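/- For all d ≥ 3, h̃(d) ≤ h̄(d). -/

import Mathlib

open MeasureTheory ProbabilityTheory Filter Set

namespace GFFperc

noncomputable section

/-- The lattice `ℤ^d`. -/
abbrev V (d : ℕ) := Fin d → ℤ

/-- Nearest-neighbour adjacency on `ℤ^d`. -/
def adj {d : ℕ} (x y : V d) : Prop := (∑ i, (x i - y i).natAbs) = 1

/-- `ℓ∞` distance between two points. -/
def dinf {d : ℕ} (x y : V d) : ℕ := Finset.univ.sup fun i => (x i - y i).natAbs

/-- `A` and `B` are joined by a nearest-neighbour path contained in `S`. -/
def ConnIn {d : ℕ} (S A B : Set (V d)) : Prop :=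
  ∃ (n : ℕ) (γ : ℕ → V d), γ 0 ∈ A ∧ γ n ∈ B ∧ (∀ k, k ≤ n → γ k ∈ S) ∧
    ∀ k, k < n → adj (γ k) (γ (k + 1))

/-- A set is connected: any two of its points are joined inside it. -/
def IsConnSet {d : ℕ} (S : Set (V d)) : Prop := ∀ x ∈ S, ∀ y ∈ S, ConnIn S {x} {y}

/-- The connected component of `x` in `S`. -/
def comp {d : ℕ} (S : Set (V d)) (x : V d) : Set (V d) := {y | ConnIn S {x} {y}}

/-- Box of (real) radius `r` centered at `x`. -/
def boxAt {d : ℕ} (x : V d) (r : ℝ) : Set (V d) := {y | ∀ i, |(y i : ℝ) - (x i : ℝ)| ≤ r}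

def box (d : ℕ) (r : ℝ) : Set (V d) := boxAt (0 : V d) r

/-- Inner vertex boundary of the box of radius `r` centered at `x`. -/
def bdryAt {d : ℕ} (x : V d) (r : ℝ) : Set (V d) :=
  {y | y ∈ boxAt x r ∧ ∃ z, z ∉ boxAt x r ∧ adj y z}

def bdry (d : ℕ) (r : ℝ) : Set (V d) := bdryAt (0 : V d) r

/-- `A` is connected to infinity within `S`. -/
def ConnToInf {d : ℕ} (S A : Set (V d)) : Prop := ∀ R : ℕ, 1 ≤ R → ConnIn S A (bdry d R)

/-- The `ℓ∞`-diameter of `S` is at least `r`. -/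
def diamGE {d : ℕ} (S : Set (V d)) (r : ℝ) : Prop := ∃ x ∈ S, ∃ y ∈ S, r ≤ (dinf x y : ℝ)

def unitV (d : ℕ) (i : Fin d) : V d := fun j => if j = i then 1 else 0

/-- `k`-step transition probabilities of simple random walk on `ℤ^d`. -/
def srwP (d : ℕ) : ℕ → V d → V d → ℝ
  | 0, x, y => if x = y then 1 else 0
  | (k + 1), x, y =>
      (1 / (2 * d)) * ∑ i : Fin d, (srwP d k (x + unitV d i) y + srwP d k (x - unitV d i) y)

/-- Green function of simple random walk on `ℤ^d`. -/
def green (d : ℕ) (x y : V d) : ℝ := ∑' k : ℕ, srwP d k x y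

/-- `ℓ`-step transition kernel of the lazy simple random walk on `ℤ^d`. -/
def lazyP (d : ℕ) : ℕ → V d → V d → ℝ
  | 0, x, y => if x = y then 1 else 0
  | (k + 1), x, y =>
      (1 / 2) * lazyP d k x y +
        (1 / (4 * d)) * ∑ i : Fin d, (lazyP d k (x + unitV d i) y + lazyP d k (x - unitV d i) y)

/-- `φ` is a centered Gaussian field with covariance function `C`: every finite linear
combination is a centered Gaussian variable with the corresponding variance. -/
def IsCGF {Ω : Type*} [MeasurableSpace Ω] {d : ℕ} (P : Measure Ω)
    (φ : V d → Ω → ℝ) (C : V d → V d → ℝ) : Prop :=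
  (∀ x, Measurable (φ x)) ∧
    ∀ (s : Finset (V d)) (a : V d → ℝ),
      Measure.map (fun ω => ∑ x ∈ s, a x * φ x ω) P =
        gaussianReal 0 (Real.toNNReal (∑ x ∈ s, ∑ y ∈ s, a x * a y * C x y))

/-- `φ` is a Gaussian free field on `ℤ^d`. -/
def IsGFF {Ω : Type*} [MeasurableSpace Ω] {d : ℕ} (P : Measure Ω) (φ : V d → Ω → ℝ) : Prop :=
  IsCGF P φ (green d)

/-- The level set `{φ ≥ h}`. -/
def lvl {d : ℕ} {Ω : Type*} (φ : V d → Ω → ℝ) (h : ℝ) (ω : Ω) : Set (V d) := {x | h ≤ φ x ω}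

/-- The whole field, as one random variable with values in `V d → ℝ`. -/
def proc {Ω : Type*} {d : ℕ} (φ : V d → Ω → ℝ) : Ω → V d → ℝ := fun ω x => φ x ω

/-- The critical parameter `h_*`. -/
def hStar (d : ℕ) {Ω : Type*} [MeasurableSpace Ω] (P : Measure Ω) (φ : V d → Ω → ℝ) : ℝ :=
  sInf {h : ℝ | P {ω | ConnToInf (lvl φ h ω) {(0 : V d)}} = 0}

/-- The critical parameter `h_{**}`. -/
def hStarStar (d : ℕ) {Ω : Type*} [MeasurableSpace Ω] (P : Measure Ω) (φ : V d → Ω → ℝ) : ℝ :=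
  sInf {h : ℝ |
    (⨅ R : ℕ, P {ω | ConnIn (lvl φ h ω) (box d ((R : ℝ) + 1)) (bdry d (2 * ((R : ℝ) + 1)))}) = 0}

/-- `u(R) = exp((log R)^{1/3})`. -/
def ufn (R : ℝ) : ℝ := Real.exp (Real.log R ^ ((1 : ℝ) / 3))

def tildeSet (d : ℕ) {Ω : Type*} [MeasurableSpace Ω] (P : Measure Ω) (φ : V d → Ω → ℝ) :
    Set ℝ :=
  {h : ℝ |
    (⨅ R : ℕ, ENNReal.ofReal (((R : ℝ) + 1) ^ d) *
        P {ω | ¬ ConnIn (lvl φ h ω) (box d (ufn ((R : ℝ) + 1))) (bdry d ((R : ℝ) + 1))}) = 0}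

/-- The critical parameter `h̃`. -/
def hTilde (d : ℕ) {Ω : Type*} [MeasurableSpace Ω] (P : Measure Ω) (φ : V d → Ω → ℝ) : ℝ :=
  sSup (tildeSet d P φ)

/-- The event `Exist(R,α)`. -/
def ExistEv (d : ℕ) {Ω : Type*} (φ : V d → Ω → ℝ) (R : ℕ) (α : ℝ) : Set Ω :=
  {ω | ∃ x ∈ lvl φ α ω ∩ box d (R : ℝ),
    diamGE (comp (lvl φ α ω ∩ box d (R : ℝ)) x) ((R : ℝ) / 5)}

/-- The event `Unique(R,α)`. -/
def UniqueEv (d : ℕ) {Ω : Type*} (φ : V d → Ω → ℝ) (R : ℕ) (α : ℝ) : Set Ω :=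
  {ω | ∀ x ∈ lvl φ α ω ∩ box d (R : ℝ), ∀ y ∈ lvl φ α ω ∩ box d (R : ℝ),
    diamGE (comp (lvl φ α ω ∩ box d (R : ℝ)) x) ((R : ℝ) / 10) →
    diamGE (comp (lvl φ α ω ∩ box d (R : ℝ)) y) ((R : ℝ) / 10) →
    ConnIn (lvl φ α ω ∩ box d (2 * (R : ℝ))) {x} {y}}

/-- `φ` strongly percolates up to level `h`. -/
def StronglyPerc (d : ℕ) {Ω : Type*} [MeasurableSpace Ω] (P : Measure Ω)
    (φ : V d → Ω → ℝ) (h : ℝ) : Prop :=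
  ∃ c : ℝ, 0 < c ∧ ∃ ρ : ℝ, ρ ∈ Set.Ioc (0 : ℝ) 1 ∧
    ∀ α : ℝ, α ≤ h → ∀ R : ℕ, 1 ≤ R →
      ENNReal.ofReal (1 - Real.exp (-c * (R : ℝ) ^ ρ)) ≤ P (ExistEv d φ R α) ∧
      ENNReal.ofReal (1 - Real.exp (-c * (R : ℝ) ^ ρ)) ≤ P (UniqueEv d φ R α)

/-- The critical parameter `h̄`. -/
def hBar (d : ℕ) {Ω : Type*} [MeasurableSpace Ω] (P : Measure Ω) (φ : V d → Ω → ℝ) : ℝ :=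
  sSup {h : ℝ | StronglyPerc d P φ h}

section
local notation:max "𝕊" x:max => Set (V x)
local notation:max "𝔽" x:max => Finset (V x)
local notation:max "𝕆" x:max => (0 : V x)
local notation:max "ℜ" x:max => (x : ℝ)
local notation:max "♠" => (by positivity)
local notation:max "♣" => (by norm_num)
local notation:max "♥" => (by omega)
open Real (exp log rpow_neg rpow_le_rpow mul_rpow rpow_le_rpow_of_nonpos mul_self_sqrt exp_add coe_toNNReal exp_nat_mul exp_pos rpow_mul rpow_natCast exp_one_gt_d9 le_log_iff_exp_le log_pos one_le_exp add_one_le_exp exp_log sqrt exp_neg exp_le_exp exp_eq_one_iff exp_one_lt_d9 sq_sqrt)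
open ENNReal (ofReal ofReal_toReal ofReal_le_ofReal ofReal_mul ofReal_pow ofReal_natCast ofReal_add toReal_nonneg ofReal_sub ofReal_div_of_pos tendsto_ofReal mul_ne_top ofReal_inv_of_pos div_le_of_le_mul one_lt_top pow_ne_top toReal_pos)
open Finset (sum_congr add_sum_erase single_le_sum sum_eq_zero ne_of_mem_erase induction_on mem_filter mem_product prod_congr sum_le_sum_of_subset sum_le_sum card_product sum_mul sum_le_card_nsmul sum_add_distrib mul_sum sum_comm sum_nonneg sum_div sum_const card_univ sum_ite_eq sum_sub_distrib sum_coe_sort mem_insert_self measurable_sum sum_attach sum_ite_eq' mem_coe measurableSet_biInter card_insert_of_notMem card_filter_le card_image_le le_sup prod_mul_distrib prod_filter prod_const finite_toSet sum_eq_single)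
open Int (ediv_mul_add_emod emod_nonneg emod_lt_of_pos card_Icc cast_abs cast_zero natAbs_mul natAbs_natCast)
open Nat (one_le_pow le_mul_of_pos_right cast_natAbs le_ceil pow_le_pow_left lt_pow_self pow_le_pow_right succ_le_of_lt div_mul_le_self lt_div_mul_add)
open LinearMap (funLeft fst snd proj mul_apply')
section
section conn
variable {d : ℕ}
def Cn (S : 𝕊 d) (x y : V d) : Prop :=
  x ∈ S ∧ Relation.ReflTransGen (fun a b => adj a b ∧ b ∈ S) x y
lemma aA {x y : V d} (h : adj x y) : adj y x := by
  unfold adj at *; rw [← h]; exact sum_congr rfl fun i _ => by omega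
lemma Cn.refl {S : 𝕊 d} {x : V d} (h : x ∈ S) : Cn S x x := ⟨h, .refl⟩
lemma Cn.left {S : 𝕊 d} {x y : V d} (h : Cn S x y) : x ∈ S := h.1
lemma Cn.right {S : 𝕊 d} {x y : V d} (h : Cn S x y) : y ∈ S := by
  rcases h.2.cases_tail with e | ⟨c, _, hc⟩
  · exact e ▸ h.1
  · exact hc.2
lemma Cn.trans {S : 𝕊 d} {x y z : V d} (h : Cn S x y) (h' : Cn S y z) : Cn S x z :=
  ⟨h.1, h.2.trans h'.2⟩
lemma Cn.mono {S T : 𝕊 d} (hST : S ⊆ T) {x y : V d} (h : Cn S x y) : Cn T x y :=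
  ⟨hST h.1, Relation.ReflTransGen.mono (fun _ _ hab => ⟨hab.1, hST hab.2⟩) _ _ h.2⟩
lemma Cn.step {S : 𝕊 d} {x y : V d} (hx : x ∈ S) (hy : y ∈ S) (h : adj x y) : Cn S x y :=
  ⟨hx, .single ⟨h, hy⟩⟩
lemma Cn.symm {S : 𝕊 d} {x y : V d} (h : Cn S x y) : Cn S y x := by
  obtain ⟨hx, h⟩ := h
  induction h with
  | refl => exact Cn.refl hx
  | @tail b c hb hc ih => exact (Cn.step hc.2 ih.left (aA hc.1)).trans ih
lemma Cn.ind {S : 𝕊 d} {x y : V d} (h : Cn S x y) (p : V d → Prop) (h0 : p x)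
    (hs : ∀ a b, a ∈ S → b ∈ S → adj a b → p a → p b) : p y := by
  obtain ⟨hx, h⟩ := h
  have : y ∈ S ∧ p y := by
    induction h with
    | refl => exact ⟨hx, h0⟩
    | tail _ hc ih => exact ⟨hc.2, hs _ _ ih.1 hc.2 hc.1 ih.2⟩
  exact this.2
lemma Cn.first {S : 𝕊 d} {x y : V d} (h : Cn S x y) (p : V d → Prop) (h0 : ¬ p x)
    (h1 : p y) : ∃ a b, Cn (S ∩ {z | ¬ p z}) x a ∧ adj a b ∧ b ∈ S ∧ p b ∧ Cn S b y := by
  refine (h.ind (fun b => (∃ a' b', Cn (S ∩ {z | ¬ p z}) x a' ∧ adj a' b' ∧ b' ∈ S ∧ p b' ∧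
      Cn S b' b) ∨ Cn (S ∩ {z | ¬ p z}) x b) (Or.inr (Cn.refl ⟨h.left, h0⟩)) ?_).resolve_right
      fun hc => hc.right.2 h1
  rintro e f he hf hef (⟨a', b', h1, h2, h3, h4, h5⟩ | h)
  · exact Or.inl ⟨a', b', h1, h2, h3, h4, h5.trans (Cn.step h5.right hf hef)⟩
  · by_cases hpf : p f
    · exact Or.inl ⟨e, f, h, hef, hf, hpf, Cn.refl hf⟩
    · exact Or.inr (h.trans (Cn.step h.right ⟨hf, hpf⟩ hef))
lemma aAx {S A B : 𝕊 d} : ConnIn S A B ↔ ∃ x ∈ A, ∃ y ∈ B, Cn S x y := by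
  constructor
  · rintro ⟨n, γ, h0, hn, hS, ha⟩
    refine ⟨_, h0, _, hn, ?_⟩
    clear hn
    induction n with
    | zero => exact Cn.refl (hS 0 le_rfl)
    | succ n ih =>
      exact (ih (fun k hk => hS k ♥) (fun k hk => ha k ♥)).trans
        (Cn.step (hS n ♥) (hS _ le_rfl) (ha n ♥))
  · rintro ⟨x, hx, y, hy, hS, h⟩
    have : ∃ (n : ℕ) (γ : ℕ → V d), γ 0 = x ∧ γ n = y ∧ (∀ k, k ≤ n → γ k ∈ S) ∧
        ∀ k, k < n → adj (γ k) (γ (k + 1)) := by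
      clear hy
      induction h with
      | refl => exact ⟨0, fun _ => x, rfl, rfl, fun _ _ => hS, fun k hk => by omega⟩
      | @tail b c _ hc ih =>
        obtain ⟨n, γ, h0, hn, h1, h2⟩ := ih
        refine ⟨n + 1, fun k => if k ≤ n then γ k else c, by simp [h0], by simp, ?_, ?_⟩
        · intro k hk
          by_cases h : k ≤ n
          · simpa [h] using h1 k h
          · simpa [h] using hc.2
        · intro k hk
          by_cases h : k + 1 ≤ n
          · simpa [h, (by omega : k ≤ n)] using h2 k ♥
          · obtain rfl : k = n := by omega
            simpa [hn] using hc.1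
    obtain ⟨n, γ, h0, hn, h1, h2⟩ := this
    exact ⟨n, γ, h0 ▸ hx, hn ▸ hy, h1, h2⟩
def Cd (S : 𝕊 d) : Prop := ∀ x ∈ S, ∀ y ∈ S, Cn S x y
lemma Cd.union {S T : 𝕊 d} (hS : Cd S) (hT : Cd T) (h : (S ∩ T).Nonempty) :
    Cd (S ∪ T) := by
  obtain ⟨p, hpS, hpT⟩ := h
  have key : ∀ x ∈ S ∪ T, Cn (S ∪ T) x p := by
    rintro x (hx | hx)
    · exact (hS x hx p hpS).mono subset_union_left
    · exact (hT x hx p hpT).mono subset_union_right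
  exact fun x hx y hy => (key x hx).trans (key y hy).symm
lemma Cd.biUnion {I : 𝕊 d} (hI : Cd I) (F : V d → 𝕊 d)
    (hne : ∀ x ∈ I, (F x).Nonempty) (hF : ∀ x ∈ I, Cd (F x))
    (hFF : ∀ x ∈ I, ∀ y ∈ I, adj x y → Cd (F x ∪ F y)) : Cd (⋃ x ∈ I, F x) := by
  intro a ha b hb
  simp only [mem_iUnion] at ha hb
  obtain ⟨x, hx, ha⟩ := ha
  obtain ⟨y, hy, hb⟩ := hb
  refine (hI x hx y hy).ind (fun z => ∀ b ∈ F z, Cn (⋃ x ∈ I, F x) a b) ?_ ?_ b hb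
  · exact fun b hb => (hF x hx a ha b hb).mono (subset_biUnion_of_mem (u := F) hx)
  · intro e f he hf hef hc b hb
    obtain ⟨p, hp⟩ := hne e he
    exact (hc p hp).trans ((hFF e he f hf hef p (Or.inl hp) b (Or.inr hb)).mono
      (union_subset (subset_biUnion_of_mem (u := F) he) (subset_biUnion_of_mem (u := F) hf)))
lemma aAy {x y : V d} {r : ℕ} : dinf x y ≤ r ↔ ∀ i, (x i - y i).natAbs ≤ r := by
  simp only [dinf, Finset.sup_le_iff, Finset.mem_univ, true_implies]
lemma aAz {x y : V d} {r : ℕ} : r < dinf x y ↔ ∃ i, r < (x i - y i).natAbs := by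
  rw [← not_le, aAy]; push Not; rfl
lemma aB (x y : V d) : dinf x y = dinf y x := by
  unfold dinf; congr 1; ext i; omega
lemma aBx (x y z : V d) : dinf x z ≤ dinf x y + dinf y z := by
  have h1 := (aAy (x := x) (y := y)).1 le_rfl
  have h2 := (aAy (x := y) (y := z)).1 le_rfl
  refine aAy.2 fun i => ?_
  have := h1 i; have := h2 i; omega
lemma aBy {x y : V d} (h : adj x y) : ∃ i, (x i - y i).natAbs = 1 ∧ ∀ j, j ≠ i → x j = y j := by
  have hex : ∃ i, (x i - y i).natAbs ≠ 0 := by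
    by_contra! hc
    simp [adj, hc] at h
  obtain ⟨i, hi⟩ := hex
  have h' := h
  rw [adj, ← add_sum_erase _ _ (Finset.mem_univ i)] at h'
  refine ⟨i, by omega, fun j hj => ?_⟩
  have : (x j - y j).natAbs ≤ ∑ j ∈ Finset.univ.erase i, (x j - y j).natAbs :=
    single_le_sum (f := fun j => (x j - y j).natAbs) (fun _ _ => Nat.zero_le _)
      (Finset.mem_erase.2 ⟨hj, Finset.mem_univ _⟩)
  omega
lemma aBz {x y : V d} (i : Fin d) (h : (x i - y i).natAbs = 1) (h' : ∀ j, j ≠ i → x j = y j) :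
    adj x y := by
  rw [adj, ← add_sum_erase _ _ (Finset.mem_univ i), sum_eq_zero]
  · omega
  · intro j hj; rw [h' j (ne_of_mem_erase hj)]; simp
lemma aC {x y : V d} (h : adj x y) : dinf x y ≤ 1 := by
  obtain ⟨i, h1, h2⟩ := aBy h
  refine aAy.2 fun j => ?_
  by_cases hj : j = i
  · subst hj; simp [h1]
  · simp [h2 j hj]
def idx (m : ℕ) (x : V d) : V d := fun i => x i / m
lemma aCx {m : ℕ} (hm : 0 < m) {x y : V d} (h : adj x y) :
    idx m x = idx m y ∨ adj (idx m x) (idx m y) := by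
  obtain ⟨i, h1, h2⟩ := aBy h
  have hm' : (0 : ℤ) < m := by exact_mod_cast hm
  by_cases he : x i / m = y i / m
  · left; ext j; by_cases hj : j = i
    · subst hj; exact he
    · simp [idx, h2 j hj]
  · right
    refine aBz i ?_ fun j hj => by simp [idx, h2 j hj]
    have a1 := ediv_mul_add_emod (x i) m
    have a2 := ediv_mul_add_emod (y i) m
    have b1 := emod_nonneg (x i) hm'.ne'
    have b2 := emod_nonneg (y i) hm'.ne'
    have c1 := emod_lt_of_pos (x i) hm'
    have c2 := emod_lt_of_pos (y i) hm'
    simp only [idx]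
    have h1 : x i - y i = 1 ∨ x i - y i = -1 := by omega
    suffices x i / (m : ℤ) - y i / m = 1 ∨ x i / (m : ℤ) - y i / m = -1 by omega
    rcases lt_or_gt_of_ne he with hlt | hlt
    · right
      by_contra hc
      have : x i / m + 2 ≤ y i / m := by omega
      rcases h1 with h1 | h1 <;> nlinarith
    · left
      by_contra hc
      have : y i / m + 2 ≤ x i / m := by omega
      rcases h1 with h1 | h1 <;> nlinarith
lemma Cn.idx {m : ℕ} (hm : 0 < m) {S : 𝕊 d} {x y : V d} (h : Cn S x y) :
    Cn (GFFperc.idx m '' S) (GFFperc.idx m x) (GFFperc.idx m y) := by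
  refine h.ind (fun z => Cn (GFFperc.idx m '' S) (GFFperc.idx m x) (GFFperc.idx m z))
    (Cn.refl ⟨x, h.left, rfl⟩) fun a b ha hb hab hc => ?_
  rcases aCx hm hab with e | e
  · rwa [← e]
  · exact hc.trans (Cn.step ⟨a, ha, rfl⟩ ⟨b, hb, rfl⟩ e)
lemma Cn.ivt {S : 𝕊 d} {x y : V d} (h : Cn S x y) (r : ℕ) (hr : r ≤ dinf x y) :
    ∃ z, Cn S x z ∧ dinf x z = r := by
  by_contra! hc
  have hx : dinf x x = 0 := by simp [dinf]
  have : Cn S x y ∧ dinf x y < r := by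
    refine h.ind (fun z => Cn S x z ∧ dinf x z < r) ⟨Cn.refl h.left, ?_⟩ ?_
    · rcases Nat.eq_zero_or_pos r with h0 | h0
      · exact absurd (by rw [hx, h0]) (hc x (Cn.refl h.left))
      · omega
    · rintro a b ha hb hab ⟨h1, h2⟩
      have h3 := h1.trans (Cn.step ha hb hab)
      have := hc b h3
      have := aBx x a b
      have := aC hab
      exact ⟨h3, by omega⟩
  omega
lemma aCy {S : 𝕊 d} (y : V d) (j : Fin d) (a b : ℤ)
    (h : ∀ s, min a b ≤ s → s ≤ max a b → Function.update y j s ∈ S) :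
    Cn S (Function.update y j a) (Function.update y j b) := by
  wlog hab : a ≤ b generalizing a b
  · exact (this b a (by simpa [min_comm, max_comm] using h) ♥).symm
  rw [min_eq_left hab, max_eq_right hab] at h
  obtain ⟨n, rfl⟩ := Int.le.dest hab
  clear hab
  induction n with
  | zero => simpa using Cn.refl (h a le_rfl (by simp))
  | succ n ih =>
    refine (ih fun s h1 h2 => h s h1 (by push_cast; omega)).trans (Cn.step ?_ ?_ ?_)
    · exact h _ ♥ (by push_cast; omega)
    · exact h _ ♥ (by push_cast; omega)
    · refine aBz j ?_ fun i hi => ?_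
      · simp
      · simp [Function.update_of_ne hi]
lemma aCz (hd : 2 ≤ d) (lo hi t : V d) (Q : Fin d → ℤ → Prop)
    (ht : ∀ j, lo j ≤ t j ∧ t j ≤ hi j ∧ Q j (t j)) :
    Cd {y : V d | (∀ j, lo j ≤ y j ∧ y j ≤ hi j) ∧ ∃ i, Q i (y i)} := by
  set S := {y : V d | (∀ j, lo j ≤ y j ∧ y j ≤ hi j) ∧ ∃ i, Q i (y i)} with hS
  have key : ∀ y ∈ S, Cn S y t := by
    rintro y ⟨hy, i, hi'⟩
    have step : ∀ z : V d, (∀ j, lo j ≤ z j ∧ z j ≤ hi j) → ∀ k l, k ≠ l → Q k (z k) →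
        Cn S z (Function.update z l (t l)) := by
      intro z hz k l hkl hQ
      have := aCy (S := S) z l (z l) (t l) (fun s h1 h2 => by
        refine ⟨fun j => ?_, k, by simpa [Function.update_of_ne hkl] using hQ⟩
        by_cases hj : j = l
        · subst hj; simp only [Function.update_self]; have := hz j; have := ht j; omega
        · simpa [Function.update_of_ne hj] using hz j)
      simpa using this
    have main : ∀ T : Finset (Fin d), i ∉ T →
        Cn S y (fun j => if j ∈ T then t j else y j) := by
      intro T
      induction T using induction_on with
      | empty => intro _; simpa using Cn.refl (S := S) ⟨hy, i, hi'⟩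
      | insert a T ha ih =>
        intro hi2
        simp only [Finset.mem_insert, not_or] at hi2
        refine (ih hi2.2).trans ?_
        have := step (fun j => if j ∈ T then t j else y j)
          (fun j => by by_cases hj : j ∈ T <;> simp [hj, (ht j).1, (ht j).2.1, hy j])
          i a hi2.1 (by simpa [hi2.2] using hi')
        convert this using 1
        ext j
        by_cases hj : j = a
        · subst hj; simp
        · simp [hj]
    refine (main (Finset.univ.erase i) (by simp)).trans ?_
    obtain ⟨k, hk⟩ : ∃ k : Fin d, k ≠ i := by
      have : Nontrivial (Fin d) := Fin.nontrivial_iff_two_le.2 hd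
      exact exists_ne i
    have := step (fun j => if j ∈ Finset.univ.erase i then t j else y j)
      (fun j => by by_cases hj : j = i <;> simp [hj, (ht j).1, (ht j).2.1, hy i])
      k i hk (by simpa [hk] using (ht k).2.2)
    convert this using 1
    ext j
    by_cases hj : j = i
    · subst hj; simp
    · simp [hj]
  exact fun x hx y hy => (key x hx).trans (key y hy).symm
end conn
end
section
section hier
variable {d : ℕ}
def Yc (x : V d) : 𝔽 d :=
  Fintype.piFinset fun i => Finset.Icc (1000000 * x i - 1000000) (1000000 * x i + 1999999)
lemma aD {x y : V d} : y ∈ Yc x ↔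
    ∀ i, 1000000 * x i - 1000000 ≤ y i ∧ y i ≤ 1000000 * x i + 1999999 := by
  simp [Yc]
def Bad (b : 𝕊 d) : ℕ → V d → Prop
  | 0, x => x ∈ b
  | n + 1, x => ∃ y ∈ Yc x, ∃ y' ∈ Yc x, 10000 ≤ dinf y y' ∧ Bad b n y ∧ Bad b n y'
def aDx (b : 𝕊 d) (n : ℕ) (x : V d) : V d :=
  Classical.epsilon fun y => y ∈ Yc x ∧ Bad b n y
def Ych (b : 𝕊 d) (n : ℕ) (x : V d) : 𝕊 d :=
  {y | y ∈ Yc x ∧ 10000 ≤ dinf y (aDx b n x)}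
def CC (b : 𝕊 d) : ℕ → V d → 𝕊 d
  | 0, x => {x}
  | n + 1, x => ⋃ y ∈ Ych b n x, CC b n y
lemma aDy {b : 𝕊 d} {n : ℕ} {x y : V d} (hx : ¬ Bad b (n + 1) x)
    (hy : y ∈ Ych b n x) : ¬ Bad b n y := by
  intro hb
  have h : aDx b n x ∈ Yc x ∧ Bad b n (aDx b n x) :=
    Classical.epsilon_spec (p := fun y => y ∈ Yc x ∧ Bad b n y) ⟨y, hy.1, hb⟩
  exact hx ⟨y, hy.1, _, h.1, hy.2, hb, h.2⟩
lemma aDz {x y : V d} {r : ℕ} (hr : 0 < r) : r ≤ dinf x y ↔ ∃ i, r ≤ (x i - y i).natAbs := by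
  obtain ⟨r, rfl⟩ := Nat.exists_eq_succ_of_ne_zero hr.ne'
  exact aAz
lemma aE {b : 𝕊 d} {n : ℕ} {x y₀ y₁ y₂ : V d} (h0 : y₀ ∈ Yc x) (h1 : y₁ ∈ Yc x)
    (h2 : y₂ ∈ Yc x) (h01 : 20000 ≤ dinf y₀ y₁) (h02 : 20000 ≤ dinf y₀ y₂)
    (h12 : 20000 ≤ dinf y₁ y₂) :
    ∃ a ∈ ({y₀, y₁, y₂} : 𝕊 d), ∃ c ∈ ({y₀, y₁, y₂} : 𝕊 d), a ∈ Ych b n x ∧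
      c ∈ Ych b n x ∧ 20000 ≤ dinf a c := by
  have t01 := aBx y₀ (aDx b n x) y₁
  have t02 := aBx y₀ (aDx b n x) y₂
  have t12 := aBx y₁ (aDx b n x) y₂
  rw [aB (aDx b n x)] at t01 t02 t12
  by_cases a0 : 10000 ≤ dinf y₀ (aDx b n x)
  · by_cases a1 : 10000 ≤ dinf y₁ (aDx b n x)
    · exact ⟨y₀, by simp, y₁, by simp, ⟨h0, a0⟩, ⟨h1, a1⟩, h01⟩
    · exact ⟨y₀, by simp, y₂, by simp, ⟨h0, a0⟩, ⟨h2, by omega⟩, h02⟩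
  · exact ⟨y₁, by simp, y₂, by simp, ⟨h1, by omega⟩, ⟨h2, by omega⟩, h12⟩
lemma aEx (hd : 2 ≤ d) (b : 𝕊 d) (n : ℕ) (x : V d) : Cd (Ych b n x) := by
  have := aCz hd (fun i => 1000000 * x i - 1000000) (fun i => 1000000 * x i + 1999999)
    (fun i => if 1000000 * x i + 500000 ≤ aDx b n x i then 1000000 * x i - 1000000 else
      1000000 * x i + 1999999) (fun i s => 10000 ≤ (s - aDx b n x i).natAbs)
    (fun j => by split_ifs <;> omega)
  convert this using 1
  ext y
  simp only [Ych, mem_ofPred_eq, aD]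
  rw [aDz ♣]
lemma aEy (b : 𝕊 d) (n : ℕ) (x c : V d) (hc : c ∈ CC b n x) (i : Fin d) :
    1000000 ^ n * x i - 2 * 1000000 ^ n ≤ c i ∧ c i < 1000000 ^ n * x i + 3 * 1000000 ^ n := by
  induction n generalizing x with
  | zero => simp only [CC, mem_singleton_iff] at hc; subst hc; simp
  | succ n ih =>
    simp only [CC, mem_iUnion] at hc
    obtain ⟨y, hy, hc⟩ := hc
    have h1 := ih y hc
    have h2 := aD.1 hy.1 i
    have : (0 : ℤ) < 1000000 ^ n := by positivity
    rw [pow_succ]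
    constructor <;> nlinarith
lemma aEz {b : 𝕊 d} {n : ℕ} {x : V d} (hx : ¬ Bad b n x) : CC b n x ⊆ bᶜ := by
  induction n generalizing x with
  | zero => simpa [CC, Bad] using hx
  | succ n ih =>
    simp only [CC, iUnion_subset_iff]
    exact fun y hy => ih (aDy hx hy)
lemma aF (hd : 2 ≤ d) (b : 𝕊 d) (n : ℕ) {x x' : V d} (h : dinf x x' ≤ 1) :
    ∃ y, y ∈ Ych b n x ∧ y ∈ Ych b n x' := by
  have h := aAy.1 h
  let p : ℤ → V d := fun t i => 1000000 * max (x i) (x' i) - 500000 + t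
  have hp : ∀ t, 0 ≤ t → t ≤ 100000 → p t ∈ Yc x ∧ p t ∈ Yc x' := fun t h1 h2 =>
    ⟨aD.2 fun i => by have := h i; simp only [p]; omega,
     aD.2 fun i => by have := h i; simp only [p]; omega⟩
  have hpp : ∀ s t : ℤ, (s - t).natAbs ≤ dinf (p s) (p t) := fun s t => by
    have := (aAy (x := p s) (y := p t)).1 le_rfl ⟨0, by omega⟩
    simpa [p] using this
  have key : ∀ s t : ℤ, 20000 ≤ (s - t).natAbs → ∀ z, 10000 ≤ dinf (p s) z ∨ 10000 ≤ dinf (p t) z := by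
    intro s t hst z
    have := aBx (p s) z (p t)
    rw [aB z] at this
    have := hpp s t
    omega
  have a := hp 0 ♣ ♣
  have b' := hp 20000 ♣ ♣
  have c := hp 40000 ♣ ♣
  have k1 := key 0 20000 ♣ (aDx b n x)
  have k2 := key 0 40000 ♣ (aDx b n x)
  have k3 := key 20000 40000 ♣ (aDx b n x)
  have l1 := key 0 20000 ♣ (aDx b n x')
  have l2 := key 0 40000 ♣ (aDx b n x')
  have l3 := key 20000 40000 ♣ (aDx b n x')
  by_cases u0 : 10000 ≤ dinf (p 0) (aDx b n x) ∧ 10000 ≤ dinf (p 0) (aDx b n x')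
  · exact ⟨p 0, ⟨a.1, u0.1⟩, ⟨a.2, u0.2⟩⟩
  by_cases u1 : 10000 ≤ dinf (p 20000) (aDx b n x) ∧ 10000 ≤ dinf (p 20000) (aDx b n x')
  · exact ⟨p 20000, ⟨b'.1, u1.1⟩, ⟨b'.2, u1.2⟩⟩
  exact ⟨p 40000, ⟨c.1, by omega⟩, ⟨c.2, by omega⟩⟩
lemma aFx (hd : 2 ≤ d) (b : 𝕊 d) (n : ℕ) :
    (∀ x : V d, (CC b n x).Nonempty) ∧ (∀ x : V d, Cd (CC b n x)) ∧
    (∀ x x' : V d, adj x x' → Cd (CC b n x ∪ CC b n x')) := by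
  induction n with
  | zero =>
    refine ⟨fun x => ⟨x, rfl⟩, fun x a ha c hc => ?_, fun x x' h => ?_⟩
    · rw [show a = x from ha, show c = x from hc]; exact Cn.refl rfl
    · rintro a (ha | ha) c (hc | hc) <;> rw [show a = _ from ha, show c = _ from hc]
      · exact Cn.refl (Or.inl rfl)
      · exact Cn.step (Or.inl rfl) (Or.inr rfl) h
      · exact Cn.step (Or.inr rfl) (Or.inl rfl) (aA h)
      · exact Cn.refl (Or.inr rfl)
  | succ n ih =>
    have c1 : ∀ x : V d, Cd (CC b (n + 1) x) := fun x =>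
      Cd.biUnion (aEx hd b n x) _ (fun y _ => ih.1 y) (fun y _ => ih.2.1 y)
        (fun y _ z _ h => ih.2.2 y z h)
    have c2 : ∀ x x' : V d, dinf x x' ≤ 1 → (CC b (n + 1) x ∩ CC b (n + 1) x').Nonempty := by
      intro x x' h
      obtain ⟨y, h1, h2⟩ := aF hd b n h
      obtain ⟨p, hp⟩ := ih.1 y
      exact ⟨p, mem_biUnion h1 hp, mem_biUnion h2 hp⟩
    exact ⟨fun x => by simpa using c2 x x (by simp [dinf]), c1,
      fun x x' h => (c1 x).union (c1 x') (c2 x x' (aC h))⟩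
lemma aFy (n : ℕ) (p : V d) (i : Fin d) :
    1000000 ^ n * idx (1000000 ^ n) p i ≤ p i ∧ p i < 1000000 ^ n * idx (1000000 ^ n) p i + 1000000 ^ n := by
  have h : (0 : ℤ) < 1000000 ^ n := by positivity
  have a1 := Int.mul_ediv_add_emod (p i) (1000000 ^ n)
  have a2 := emod_nonneg (p i) h.ne'
  have a3 := emod_lt_of_pos (p i) h
  simp only [idx]; push_cast
  constructor <;> linarith
lemma aFz (b : 𝕊 d) (n : ℕ) (A : 𝕊 d) (hA : Cd A) (p q : V d) (hp : p ∈ A)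
    (hq : q ∈ A) (hpq : 1000000 ^ n ≤ dinf p q) :
    (2 ^ n : ℕ∞) ≤ (A ∩ CC b n (idx (1000000 ^ n) p)).encard := by
  induction n generalizing p q with
  | zero =>
    have : idx (1000000 ^ 0) p = p := by ext i; simp [idx]
    rw [this]
    simp only [pow_zero]
    exact one_le_encard_iff_nonempty.2 ⟨p, hp, rfl⟩
  | succ n ih =>
    have hL : 0 < 1000000 ^ n := by positivity
    set L := 1000000 ^ n with hLd
    have hLz : (1000000 : ℤ) ^ n = L := by simp [hLd]
    rw [pow_succ, ← hLd] at hpq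
    have hid := fun p i => aFy n (d := d) p i
    have hid1 := fun p i => aFy (n + 1) (d := d) p i
    rw [pow_succ] at hid1
    rw [← hLd, hLz] at hid
    rw [pow_succ, ← hLd, hLz] at hid1
    have sep : ∀ a c : V d, 20000 * L ≤ dinf a c → 20000 ≤ dinf (idx L a) (idx L c) := by
      intro a c hac
      obtain ⟨i, hi⟩ := (aDz ♠).1 hac
      refine (aDz ♣).2 ⟨i, ?_⟩
      have h1 := hid a i
      have h2 := hid c i
      by_contra hcon
      have : (idx L a i - idx L c i).natAbs ≤ 19999 := by omega
      have h3 : idx L a i - idx L c i ≤ 19999 := by omega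
      have h4 : -19999 ≤ idx L a i - idx L c i := by omega
      have h5 : (L : ℤ) * (idx L a i - idx L c i) ≤ L * 19999 :=
        mul_le_mul_of_nonneg_left h3 ♠
      have h6 : (L : ℤ) * (-19999) ≤ L * (idx L a i - idx L c i) :=
        mul_le_mul_of_nonneg_left h4 ♠
      rw [mul_sub] at h5 h6
      omega
    have child : ∀ a : V d, dinf p a ≤ L * 1000000 → idx L a ∈ Yc (idx (L * 1000000) p) := by
      intro a ha
      refine aD.2 fun i => ?_
      have h0 := aAy.1 ha i
      have h1 := hid a i
      have h2 := hid1 p i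
      have hL' : (0 : ℤ) < L := by exact_mod_cast hL
      have h0' : (p i - a i) ≤ L * 1000000 ∧ -(L * 1000000 : ℤ) ≤ p i - a i := by omega
      constructor
      · have : (L : ℤ) * (1000000 * idx (L * 1000000) p i - 1000000) < L * (idx L a i + 1) := by
          linarith
        have := lt_of_mul_lt_mul_left this hL'.le
        omega
      · have : (L : ℤ) * (idx L a i) < L * (1000000 * idx (L * 1000000) p i + 2000000) := by
          linarith
        have := lt_of_mul_lt_mul_left this hL'.le
        omega
    have hpp : dinf p p = 0 := by simp [dinf]
    obtain ⟨p1, hp1, e1⟩ := (hA p hp q hq).ivt (20000 * L) ♥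
    obtain ⟨p2, hp2, e2⟩ := (hA p hp q hq).ivt (40000 * L) ♥
    have t12 := aBx p p1 p2
    obtain ⟨a, ha, c, hc, ha1, hc1, hac⟩ := aE (b := b) (n := n) (child p ♥)
      (child p1 ♥) (child p2 ♥) (sep _ _ ♥) (sep _ _ ♥)
      (sep p1 p2 ♥)
    have fin : ∀ a ∈ ({idx L p, idx L p1, idx L p2} : 𝕊 d), (2 ^ n : ℕ∞) ≤
        (A ∩ CC b n a).encard := by
      rintro a (rfl | rfl | rfl)
      · exact ih p q hp hq ♥
      · exact ih p1 p hp1.right hp (by rw [aB]; omega)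
      · exact ih p2 p hp2.right hp (by rw [aB]; omega)
    have hdis : Disjoint (A ∩ CC b n a) (A ∩ CC b n c) := by
      rw [Set.disjoint_left]
      rintro z ⟨_, hz⟩ ⟨_, hz'⟩
      obtain ⟨i, hi⟩ := (aDz ♣).1 hac
      have h1 := aEy b n a z hz i
      have h2 := aEy b n c z hz' i
      rw [hLz] at h1 h2
      have hL' : (0 : ℤ) < L := by exact_mod_cast hL
      rcases le_total (a i) (c i) with h | h
      · have : (L : ℤ) * (a i + 20000) ≤ L * c i := mul_le_mul_of_nonneg_left ♥ hL'.le
        linarith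
      · have : (L : ℤ) * (c i + 20000) ≤ L * a i := mul_le_mul_of_nonneg_left ♥ hL'.le
        linarith
    calc (2 ^ (n + 1) : ℕ∞) = 2 ^ n + 2 ^ n := by ring
      _ ≤ (A ∩ CC b n a).encard + (A ∩ CC b n c).encard := add_le_add (fin a ha) (fin c hc)
      _ = ((A ∩ CC b n a) ∪ (A ∩ CC b n c)).encard := (encard_union_eq hdis).symm
      _ ≤ _ := by
        refine encard_le_encard ?_
        rw [← inter_union_distrib_left, pow_succ]
        refine inter_subset_inter_right _ (union_subset ?_ ?_)
        · exact fun z hz => mem_biUnion ha1 hz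
        · exact fun z hz => mem_biUnion hc1 hz
def Tr : ℕ → V d → Finset (𝔽 d)
  | 0, x => {{x}}
  | n + 1, x => ((Yc x ×ˢ Yc x).filter fun y => 10000 ≤ dinf y.1 y.2).biUnion fun y =>
      (Tr n y.1 ×ˢ Tr n y.2).image fun T => T.1 ∪ T.2
lemma aG {b : 𝕊 d} {n : ℕ} {x : V d} (h : Bad b n x) :
    ∃ T ∈ Tr n x, ∀ y ∈ T, y ∈ b := by
  induction n generalizing x with
  | zero => exact ⟨{x}, by simp [Tr], by simpa [Bad] using h⟩
  | succ n ih =>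
    obtain ⟨y, hy, y', hy', h1, h2, h3⟩ := h
    obtain ⟨T, hT, hb⟩ := ih h2
    obtain ⟨T', hT', hb'⟩ := ih h3
    refine ⟨T ∪ T', ?_, fun z hz => (Finset.mem_union.1 hz).elim (hb z) (hb' z)⟩
    simp only [Tr, Finset.mem_biUnion, mem_filter, mem_product, Finset.mem_image]
    exact ⟨(y, y'), ⟨⟨hy, hy'⟩, h1⟩, (T, T'), ⟨hT, hT'⟩, rfl⟩
lemma aGx (n : ℕ) (x : V d) : (Tr n x).card ≤ (3000000 ^ (2 * d)) ^ (2 ^ n) := by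
  have hY : ∀ x : V d, (Yc x).card = 3000000 ^ d := fun x => by
    simp only [Yc, Fintype.card_piFinset, card_Icc]
    rw [prod_congr rfl (fun i _ => by
      rw [show (1000000 * x i + 1999999 + 1 - (1000000 * x i - 1000000)).toNat = 3000000 by omega])]
    simp
  have h1 : 1 ≤ 3000000 ^ (2 * d) := one_le_pow _ _ ♣
  suffices h : (Tr n x).card * 3000000 ^ (2 * d) ≤ (3000000 ^ (2 * d)) ^ (2 ^ n) from
    le_trans (le_mul_of_pos_right _ h1) h
  induction n generalizing x with
  | zero => simp [Tr]
  | succ n ih =>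
    set M := 3000000 ^ (2 * d) with hM
    have hb : (Tr (n + 1) x).card ≤ ∑ y ∈ Yc x ×ˢ Yc x, (Tr n y.1).card * (Tr n y.2).card := by
      refine Finset.card_biUnion_le.trans ((sum_le_sum_of_subset
        (Finset.filter_subset _ _)).trans (sum_le_sum fun y _ => ?_))
      exact Finset.card_image_le.trans (card_product _ _).le
    calc (Tr (n + 1) x).card * M
        ≤ (∑ y ∈ Yc x ×ˢ Yc x, (Tr n y.1).card * (Tr n y.2).card) * M := by gcongr
      _ ≤ (M ^ 2 ^ n) * (M ^ 2 ^ n) := by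
        have hcard : (Yc x ×ˢ Yc x).card = M := by
          rw [card_product, hY, hM, two_mul, pow_add]
        have : (∑ y ∈ Yc x ×ˢ Yc x, (Tr n y.1).card * (Tr n y.2).card) * M * M
            ≤ M * ((M ^ 2 ^ n) * (M ^ 2 ^ n)) := by
          rw [mul_assoc, sum_mul]
          refine (sum_le_card_nsmul _ _ ((M ^ 2 ^ n) * (M ^ 2 ^ n)) fun y _ => ?_).trans ?_
          · rw [mul_mul_mul_comm]
            exact Nat.mul_le_mul (ih _) (ih _)
          · rw [hcard, smul_eq_mul]
        rw [mul_comm] at this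
        exact Nat.le_of_mul_le_mul_left this h1
      _ = M ^ 2 ^ (n + 1) := by ring
lemma aGy {n : ℕ} {x : V d} {T : 𝔽 d} (hT : T ∈ Tr n x) {c : V d} (hc : c ∈ T)
    (i : Fin d) :
    1000000 ^ n * x i - 2 * 1000000 ^ n ≤ c i ∧ c i < 1000000 ^ n * x i + 3 * 1000000 ^ n := by
  induction n generalizing x T with
  | zero => simp only [Tr, Finset.mem_singleton] at hT; subst hT; simp at hc; subst hc; simp
  | succ n ih =>
    simp only [Tr, Finset.mem_biUnion, mem_filter, mem_product,
      Finset.mem_image] at hT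
    obtain ⟨⟨y, y'⟩, ⟨⟨hy, hy'⟩, -⟩, ⟨T1, T2⟩, ⟨h1, h2⟩, rfl⟩ := hT
    have : (0 : ℤ) < 1000000 ^ n := by positivity
    rw [pow_succ]
    rcases Finset.mem_union.1 hc with hc | hc
    · have a1 := ih h1 hc
      have a2 := aD.1 hy i
      constructor <;> nlinarith
    · have a1 := ih h2 hc
      have a2 := aD.1 hy' i
      constructor <;> nlinarith
lemma aGz (κ : ℕ → ℝ) (hκ : Antitone κ) {n : ℕ} {x : V d}
    {T : 𝔽 d} (hT : T ∈ Tr n x) : T.card = 2 ^ n ∧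
    (∀ p ∈ T, ∀ q ∈ T, p ≠ q → 9000 ≤ dinf p q) ∧
    ∀ p ∈ T, ∑ q ∈ T.erase p, κ (dinf p q) ≤ ∑ m ∈ Finset.range n, 2 ^ m * κ (9000 * 1000000 ^ m) := by
  induction n generalizing x T with
  | zero => simp only [Tr, Finset.mem_singleton] at hT; subst hT; simp
  | succ n ih =>
    simp only [Tr, Finset.mem_biUnion, mem_filter, mem_product,
      Finset.mem_image] at hT
    obtain ⟨⟨y, y'⟩, ⟨⟨hy, hy'⟩, hyy⟩, ⟨T1, T2⟩, ⟨h1, h2⟩, rfl⟩ := hT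
    simp only at h1 h2 hyy
    have hL : 0 < 1000000 ^ n := by positivity
    have far : ∀ p ∈ T1, ∀ q ∈ T2, 9000 * 1000000 ^ n ≤ dinf p q := by
      intro p hp q hq
      obtain ⟨i, hi⟩ := (aDz ♣).1 hyy
      refine (aDz ♠).2 ⟨i, ?_⟩
      have a1 := aGy h1 hp i
      have a2 := aGy h2 hq i
      set L : ℕ := 1000000 ^ n with hLd
      have hLz : (1000000 : ℤ) ^ n = L := by simp [hLd]
      rw [hLz] at a1 a2
      have hL' : (0 : ℤ) < L := by exact_mod_cast hL
      rcases le_total (y i) (y' i) with h | h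
      · have : (L : ℤ) * (y i + 10000) ≤ L * y' i := mul_le_mul_of_nonneg_left ♥ hL'.le
        have : (9000 * L : ℤ) ≤ q i - p i := by linarith
        omega
      · have : (L : ℤ) * (y' i + 10000) ≤ L * y i := mul_le_mul_of_nonneg_left ♥ hL'.le
        have : (9000 * L : ℤ) ≤ p i - q i := by linarith
        omega
    have far' : ∀ p ∈ T1, ∀ q ∈ T2, 9000 ≤ dinf p q := fun p hp q hq =>
      le_trans ♥ (far p hp q hq)
    have hdis : Disjoint T1 T2 := Finset.disjoint_left.2 fun p hp hq => by
      have := far' p hp p hq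
      simp [dinf] at this
    obtain ⟨c1, s1, k1⟩ := ih h1
    obtain ⟨c2, s2, k2⟩ := ih h2
    have main : ∀ S S' : 𝔽 d, Disjoint S S' → S'.card = 2 ^ n →
        (∀ p ∈ S, ∀ q ∈ S', 9000 * 1000000 ^ n ≤ dinf p q) → (∀ p ∈ S, ∑ q ∈ S.erase p, κ (dinf p q) ≤
          ∑ m ∈ Finset.range n, 2 ^ m * κ (9000 * 1000000 ^ m)) → ∀ p ∈ S, ∑ q ∈ (S ∪ S').erase p,
          κ (dinf p q) ≤ ∑ m ∈ Finset.range (n + 1), 2 ^ m * κ (9000 * 1000000 ^ m) := by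
      intro S S' hd hc hf hk p hp
      have hpS' : p ∉ S' := Finset.disjoint_left.1 hd hp
      rw [Finset.erase_union_distrib, Finset.erase_eq_of_notMem hpS', Finset.sum_union
        (hd.mono_left (Finset.erase_subset _ _)), Finset.sum_range_succ]
      refine add_le_add (hk p hp) ?_
      refine (sum_le_card_nsmul _ _ _ fun q hq => hκ (hf p hp q hq)).trans ?_
      rw [hc, nsmul_eq_mul]; push_cast; rfl
    refine ⟨by rw [Finset.card_union_of_disjoint hdis, c1, c2]; ring, ?_, ?_⟩
    · intro p hp q hq hpq
      rcases Finset.mem_union.1 hp with hp | hp <;> rcases Finset.mem_union.1 hq with hq | hq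
      · exact s1 p hp q hq hpq
      · exact far' p hp q hq
      · rw [aB]; exact far' q hq p hp
      · exact s2 p hp q hq hpq
    · intro p hp
      rcases Finset.mem_union.1 hp with hp | hp
      · exact main T1 T2 hdis c2 far k1 p hp
      · rw [Finset.union_comm]
        exact main T2 T1 hdis.symm c1 (fun p hp q hq => by rw [aB]; exact far q hq p hp)
          k2 p hp
end hier
end
section
section green
variable {d : ℕ}
def Pav (f : V d → ℝ) (x : V d) : ℝ :=
  (1 / (2 * d)) * ∑ i : Fin d, (f (x + unitV d i) + f (x - unitV d i))
lemma aH {f g : V d → ℝ} (h : ∀ x, f x ≤ g x) (x : V d) : Pav f x ≤ Pav g x :=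
  mul_le_mul_of_nonneg_left (sum_le_sum fun i _ => add_le_add (h _) (h _)) ♠
lemma aHx (f g : V d → ℝ) (a b : ℝ) (x : V d) :
    Pav (fun x => a * f x + b * g x) x = a * Pav f x + b * Pav g x := by
  simp only [Pav, sum_add_distrib, ← mul_sum]; ring
lemma aHy {ι : Type*} (s : Finset ι) (F : ι → V d → ℝ) (x : V d) :
    Pav (fun x => ∑ j ∈ s, F j x) x = ∑ j ∈ s, Pav (F j) x := by
  simp only [Pav, ← mul_sum]
  congr 1
  rw [sum_comm]
  exact sum_congr rfl fun i _ => by rw [sum_add_distrib]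
def Fs (x : V d) : ℝ := ((∑ i, (x i : ℝ) ^ 2) + (2000 + d)) ^ (-(1 / 3) : ℝ)
lemma aHz {z : ℝ} (h : |z| ≤ 1 / 20) : (1 + z) ^ (-(1 / 3) : ℝ) ≤ 1 - z / 3 + 0.24 * z ^ 2 := by
  rw [abs_le] at h
  have hz : 0 < 1 + z := by linarith
  have hp : 0 < 1 - z / 3 + 0.24 * z ^ 2 := by nlinarith
  have key : 1 ≤ (1 - z / 3 + 0.24 * z ^ 2) ^ 3 * (1 + z) := by
    have e : (1 - z / 3 + 0.24 * z ^ 2) ^ 3 * (1 + z) - 1 =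
      z ^ 2 * ((3 * 0.24 - 2 / 3) + z * ((0.24 + 1 / 3 - 1 / 27) + z * (
       (3 * 0.24 ^ 2 + 0.24 / 3 - (2 * 0.24 + 1 / 27)) + z * ((3 * 0.24 ^ 2 + 0.24 / 3 - 0.24 ^ 2) + z * ((0.24 ^ 3 - 0.24 ^ 2) + z * 0.24 ^ 3))))) := by ring
    have b0 : |z * 0.24 ^ 3| ≤ 1 := by rw [abs_le]; constructor <;> linarith
    have step : ∀ c w : ℝ, |c| ≤ 1 → |w| ≤ 1 → |z * (c + w)| ≤ 1 := by
      intro c w hc hw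
      rw [abs_le] at hc hw ⊢
      constructor <;> nlinarith
    have b1 := step (0.24 ^ 3 - 0.24 ^ 2) _ (by rw [abs_le]; norm_num) b0
    have b2 := step (3 * 0.24 ^ 2 + 0.24 / 3 - 0.24 ^ 2) _ (by rw [abs_le]; norm_num) b1
    set w := z * ((3 * 0.24 ^ 2 + 0.24 / 3 - 0.24 ^ 2) + z * ((0.24 ^ 3 - 0.24 ^ 2) + z * 0.24 ^ 3))
    have : 0 ≤ (3 * 0.24 - 2 / 3) + z * ((0.24 + 1 / 3 - 1 / 27) + z * (
       (3 * 0.24 ^ 2 + 0.24 / 3 - (2 * 0.24 + 1 / 27)) + w)) := by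
      rw [abs_le] at b2
      have b3 : |z * ((3 * 0.24 ^ 2 + 0.24 / 3 - (2 * 0.24 + 1 / 27)) + w)| ≤ 0.1 := by
        rw [abs_le]; constructor <;> nlinarith
      rw [abs_le] at b3
      nlinarith
    nlinarith [mul_nonneg (sq_nonneg z) this]
  rw [rpow_neg hz.le, inv_le_comm₀ ♠ hp, one_div]
  have : ((1 - z / 3 + 0.24 * z ^ 2)⁻¹) = (((1 - z / 3 + 0.24 * z ^ 2)⁻¹) ^ (3 : ℕ)) ^ ((3 : ℕ) : ℝ)⁻¹ :=
    (Real.pow_rpow_inv_natCast ♠ ♣).symm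
  rw [this]
  refine rpow_le_rpow ♠ ?_ ♣
  rw [inv_pow, inv_le_iff_one_le_mul₀ ♠, mul_comm]
  exact key
lemma aI (x : V d) (i : Fin d) (σ : ℤ) (hσ : σ ^ 2 = 1) :
    ∑ j, (((x + σ • unitV d i) j : ℤ) : ℝ) ^ 2 = ∑ j, (x j : ℝ) ^ 2 + (1 + 2 * σ * x i) := by
  have hσ' : (σ : ℝ) ^ 2 = 1 := by exact_mod_cast hσ
  rw [← add_sum_erase _ _ (Finset.mem_univ i),
    ← add_sum_erase _ (fun j => (x j : ℝ) ^ 2) (Finset.mem_univ i)]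
  have : ∀ j ∈ Finset.univ.erase i, (((x + σ • unitV d i) j : ℤ) : ℝ) ^ 2 = (x j : ℝ) ^ 2 := by
    intro j hj
    simp [unitV, ne_of_mem_erase hj]
  rw [sum_congr rfl this]
  simp only [Pi.add_apply, Pi.smul_apply, unitV, if_true, smul_eq_mul, mul_one]
  push_cast
  linear_combination hσ'
lemma aIx (hd : 3 ≤ d) (x : V d) : Pav Fs x < Fs x := by
  set s : ℝ := (∑ i, (x i : ℝ) ^ 2) + (2000 + d) with hs
  have hd' : ℜ 3 ≤ d := by exact_mod_cast hd
  have hsum : 0 ≤ ∑ i, (x i : ℝ) ^ 2 := sum_nonneg fun i _ => sq_nonneg _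
  have hs0 : 2000 ≤ s := by linarith
  have hxi : ∀ i, (x i : ℝ) ^ 2 ≤ s - 2000 := fun i => by
    have := single_le_sum (f := fun i => (x i : ℝ) ^ 2) (fun i _ => sq_nonneg _) (Finset.mem_univ i)
    linarith
  have hone : ∀ i (σ : ℤ), σ ^ 2 = 1 → Fs (x + σ • unitV d i) ≤
      s ^ (-(1 / 3) : ℝ) * (1 - (1 + 2 * σ * x i) / s / 3 + 0.24 * ((1 + 2 * σ * x i) / s) ^ 2) := by
    intro i σ hσ
    have hσ' : (σ : ℝ) ^ 2 = 1 := by exact_mod_cast hσ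
    have hz : |(1 + 2 * σ * x i) / s| ≤ 1 / 20 := by
      rw [abs_div, abs_of_pos (by linarith : 0 < s), div_le_iff₀ (by linarith), abs_le]
      have h1 : (σ * x i : ℝ) ^ 2 ≤ s - 2000 := by rw [mul_pow, hσ', one_mul]; exact hxi i
      constructor <;> nlinarith [sq_nonneg ((σ * x i : ℝ) - 40), sq_nonneg ((σ * x i : ℝ) + 40)]
    have h2 := aHz hz
    have h3 : (1 + (1 + 2 * σ * x i) / s) * s = s + (1 + 2 * σ * x i) := by field_simp
    have h4 : 0 < 1 + (1 + 2 * σ * x i) / s := by rw [abs_le] at hz; linarith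
    rw [Fs, aI x i σ hσ, show ∑ j, (x j : ℝ) ^ 2 + (1 + 2 * σ * x i) + (2000 + d)
      = s * (1 + (1 + 2 * σ * x i) / s) by rw [mul_comm s, h3, hs]; ring,
      mul_rpow (by linarith) h4.le]
    exact mul_le_mul_of_nonneg_left h2 ♠
  have hsp : 0 < s ^ (-(1 / 3) : ℝ) := by positivity
  have hb : ∑ i : Fin d, (Fs (x + unitV d i) + Fs (x - unitV d i)) ≤
      s ^ (-(1 / 3) : ℝ) * ∑ i, (2 - 2 / (3 * s) + 0.24 * ((2 + 8 * (x i : ℝ) ^ 2) / s ^ 2)) := by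
    rw [mul_sum]
    refine sum_le_sum fun i _ => ?_
    have a1 := hone i 1 ♣
    have a2 := hone i (-1) ♣
    simp only [one_smul, neg_smul, ← sub_eq_add_neg] at a1 a2
    refine (add_le_add a1 a2).trans (le_of_eq ?_)
    rw [← mul_add]
    congr 1
    push_cast
    field_simp
    ring
  have hsum2 : (∑ i, (2 - 2 / (3 * s) + 0.24 * ((2 + 8 * (x i : ℝ) ^ 2) / s ^ 2)) : ℝ) < 2 * (d : ℝ) := by
    rw [sum_add_distrib, ← mul_sum, ← sum_div, sum_add_distrib,
      ← mul_sum]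
    simp only [sum_const, card_univ, Fintype.card_fin, nsmul_eq_mul]
    have e : ∑ i, (x i : ℝ) ^ 2 = s - (2000 + d) := by rw [hs]; ring
    rw [e]
    have : 0.24 * ((d * 2 + 8 * (s - (2000 + d))) / s ^ 2) < d * (2 / (3 * s)) := by
      rw [← mul_div_assoc, ← mul_div_assoc, div_lt_div_iff₀ ♠ ♠]
      have : 0.24 * (d * 2 + 8 * (s - (2000 + d))) * 3 < d * 2 * s := by nlinarith
      nlinarith
    linarith
  calc Pav Fs x ≤ (1 / (2 * d)) * (s ^ (-(1 / 3) : ℝ) * _) :=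
        mul_le_mul_of_nonneg_left hb ♠
    _ < (1 / (2 * d)) * (s ^ (-(1 / 3) : ℝ) * (2 * d)) := by gcongr
    _ = Fs x := by rw [Fs, ← hs]; field_simp
lemma aIy (k : ℕ) (x y : V d) : srwP d (k + 1) x y = Pav (fun x => srwP d k x y) x := rfl
lemma aIz (k : ℕ) (x y : V d) : 0 ≤ srwP d k x y := by
  induction k generalizing x with
  | zero => simp only [srwP]; split_ifs <;> norm_num
  | succ k ih =>
    exact mul_nonneg ♠ (sum_nonneg fun i _ => add_nonneg (ih _) (ih _))
lemma aJ (hd : 3 ≤ d) (n : ℕ) (x y : V d) :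
    ∑ k ∈ Finset.range n, srwP d k x y ≤ (Fs 𝕆 d - Pav Fs 𝕆 d)⁻¹ * Fs (x - y) := by
  have hc : 0 < Fs 𝕆 d - Pav Fs 𝕆 d := sub_pos.2 (aIx hd 0)
  set c := Fs 𝕆 d - Pav Fs 𝕆 d with hcd
  have hF : ∀ x : V d, 0 ≤ Fs x := fun x => by unfold Fs; positivity
  induction n generalizing x with
  | zero => simpa using mul_nonneg (inv_nonneg.2 hc.le) (hF _)
  | succ n ih =>
    rw [Finset.sum_range_succ']
    simp only [aIy]
    rw [← aHy]
    have h1 := aH ih x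
    have h2 : Pav (fun x => c⁻¹ * Fs (x - y)) x = c⁻¹ * Pav Fs (x - y) := by
      simp only [Pav, mul_sum]
      refine sum_congr rfl fun i _ => ?_
      rw [sub_right_comm, add_sub_right_comm]; ring
    rw [h2] at h1
    by_cases hxy : x = y
    · subst hxy
      rw [sub_self] at h1 ⊢
      simp only [srwP, if_true]
      have : c⁻¹ * Fs 𝕆 d = c⁻¹ * Pav Fs 𝕆 d + 1 := by
        rw [show Fs 𝕆 d = Pav Fs 𝕆 d + c by rw [hcd]; ring, mul_add,
          inv_mul_cancel₀ hc.ne']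
      linarith
    · simp only [srwP, if_neg hxy, add_zero]
      exact h1.trans (mul_le_mul_of_nonneg_left (aIx hd _).le (inv_nonneg.2 hc.le))
lemma aJx (hd : 3 ≤ d) (x y : V d) : Summable fun k => srwP d k x y :=
  summable_of_sum_range_le (fun k => aIz k x y) fun n => aJ hd n x y
def kap (d : ℕ) (r : ℕ) : ℝ :=
  (Fs 𝕆 d - Pav Fs 𝕆 d)⁻¹ * (ℜ r ^ 2 + 1) ^ (-(1 / 3) : ℝ)
lemma aJy (hd : 3 ≤ d) : Antitone (kap d) := by
  intro r s hrs
  have hc : 0 < Fs 𝕆 d - Pav Fs 𝕆 d := sub_pos.2 (aIx hd 0)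
  refine mul_le_mul_of_nonneg_left ?_ (inv_nonneg.2 hc.le)
  exact rpow_le_rpow_of_nonpos ♠ (by gcongr) ♣
lemma aJz (hd : 3 ≤ d) (r : ℕ) : 0 < kap d r :=
  mul_pos (inv_pos.2 (sub_pos.2 (aIx hd 0))) ♠
lemma aK (x y : V d) : 0 ≤ green d x y := tsum_nonneg fun k => aIz k x y
lemma aKx (hd : 3 ≤ d) (x y : V d) : green d x y ≤ kap d (dinf x y) := by
  have hc : 0 < Fs 𝕆 d - Pav Fs 𝕆 d := sub_pos.2 (aIx hd 0)
  refine ((aJx hd x y).tsum_le_of_sum_range_le fun n => aJ hd n x y).trans ?_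
  refine mul_le_mul_of_nonneg_left ?_ (inv_nonneg.2 hc.le)
  refine rpow_le_rpow_of_nonpos ♠ ?_ ♣
  have : ((dinf x y : ℝ)) ^ 2 ≤ ∑ i, (((x - y) i : ℤ) : ℝ) ^ 2 := by
    haveI : NeZero d := ⟨by omega⟩
    obtain ⟨i, _, hi⟩ := Finset.exists_mem_eq_sup Finset.univ Finset.univ_nonempty
      (fun i => (x i - y i).natAbs)
    rw [dinf, hi]
    have := single_le_sum (f := fun i => (((x - y) i : ℤ) : ℝ) ^ 2) (fun i _ => sq_nonneg _) (Finset.mem_univ i)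
    refine le_trans (le_of_eq ?_) this
    simp only [cast_natAbs, Pi.sub_apply, cast_abs, sq_abs]
  have : ℜ 0 ≤ d := by positivity
  linarith
lemma aKy (hd : 3 ≤ d) (x y : V d) :
    green d x y = (if x = y then 1 else 0) + Pav (fun x => green d x y) x := by
  rw [green, (aJx hd x y).tsum_eq_zero_add]
  congr 1
  simp only [srwP, Pav]
  rw [tsum_mul_left, Summable.tsum_finsetSum fun i _ =>
    (aJx hd _ _).add (aJx hd _ _)]
  congr 1
  exact sum_congr rfl fun i _ =>
    (aJx hd _ _).tsum_add (aJx hd _ _)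
def iso (π : Equiv.Perm (Fin d)) (σ : Fin d → ℤˣ) (z x : V d) : V d := fun i => σ i * x (π i) + z i
lemma aKz (π : Equiv.Perm (Fin d)) (σ : Fin d → ℤˣ) (z : V d) (k : ℕ) (x y : V d) :
    srwP d k (iso π σ z x) (iso π σ z y) = srwP d k x y := by
  have hinj : ∀ x y : V d, iso π σ z x = iso π σ z y ↔ x = y := by
    intro x y
    refine ⟨fun h => ?_, fun h => h ▸ rfl⟩
    ext i
    have := congrFun h (π.symm i)
    simpa [iso] using this
  induction k generalizing x with
  | zero => simp [srwP, hinj]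
  | succ k ih =>
    simp only [srwP]
    congr 1
    rw [← Equiv.sum_comp π (fun i => srwP d k (x + unitV d i) y + srwP d k (x - unitV d i) y)]
    refine sum_congr rfl fun i _ => ?_
    have e1 : ∀ s : ℤ, iso π σ z x + s • unitV d i = iso π σ z (x + (σ i * s) • unitV d (π i)) := by
      intro s
      ext j
      simp only [iso, unitV, Pi.add_apply, Pi.smul_apply, smul_eq_mul]
      by_cases hj : j = i
      · subst hj
        have : ((σ j : ℤ)) * (σ j : ℤ) = 1 := Int.units_coe_mul_self (σ j)
        simp; linear_combination (-s) * this
      · simp [hj]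
    have f1 := e1 1
    have f2 := e1 (-1)
    simp only [one_smul, neg_smul, ← sub_eq_add_neg] at f1 f2
    rw [f1, f2, ih, ih]
    rcases Int.units_eq_one_or (σ i) with h | h
    · simp [h, ← sub_eq_add_neg]
    · simp [h, ← sub_eq_add_neg, add_comm]
lemma aL (π : Equiv.Perm (Fin d)) (σ : Fin d → ℤˣ) (z x y : V d) :
    green d (iso π σ z x) (iso π σ z y) = green d x y := by
  simp only [green, aKz]
lemma aLx (x y : V d) : green d x y = green d y x := by
  have := aL 1 (fun _ => -1) (x + y) x y
  rw [← this]
  congr 1 <;> ext i <;> simp [iso]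
end green
end
section
section pot
variable {d : ℕ}
lemma aLy (x : V d) (i : Fin d) : adj x (x + unitV d i) ∧ adj x (x - unitV d i) := by
  constructor <;> refine aBz i ?_ fun j hj => ?_ <;> simp_all [unitV]
lemma aLz (hd : 1 ≤ d) (D : 𝔽 d) (u : V d → ℝ) (h1 : ∀ x ∈ D, u x ≤ Pav u x)
    (h2 : ∀ x, x ∉ D → (∃ y ∈ D, adj x y) → u x ≤ 0) : ∀ x ∈ D, u x ≤ 0 := by
  by_contra! hc
  obtain ⟨x0, hx0, hp⟩ := hc
  obtain ⟨m, hm, hmax⟩ := Finset.exists_max_image D u ⟨x0, hx0⟩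
  have hM : 0 < u m := hp.trans_le (hmax _ hx0)
  let i0 : Fin d := ⟨0, hd⟩
  obtain ⟨x, hx, hxm⟩ := Finset.exists_max_image (D.filter fun x => u x = u m) (fun x => x i0)
    ⟨m, by simp [hm]⟩
  rw [mem_filter] at hx
  have hle : ∀ y, adj y x → u y ≤ u m := fun y hy => by
    by_cases hyD : y ∈ D
    · exact hmax _ hyD
    · exact (h2 y hyD ⟨x, hx.1, hy⟩).trans hM.le
  have hall : ∀ i, u (x + unitV d i) + u (x - unitV d i) ≤ 2 * u m := fun i => by
    linarith [hle _ (aA (aLy x i).1), hle _ (aA (aLy x i).2)]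
  by_cases hy : u (x + unitV d i0) < u m
  · have hs : ∑ i, (u (x + unitV d i) + u (x - unitV d i)) < ∑ i : Fin d, 2 * u m :=
      Finset.sum_lt_sum (fun i _ => hall i) ⟨i0, Finset.mem_univ _, by
        linarith [hle _ (aA (aLy x i0).2)]⟩
    have hd0 : ℜ 0 < d := by exact_mod_cast hd
    have : Pav u x < u m := by
      rw [Pav]
      calc _ < 1 / (2 * ℜ d) * ∑ i : Fin d, 2 * u m := by gcongr
        _ = u m := by simp; field_simp
    have := h1 x hx.1
    rw [hx.2] at this; linarith
  · have he : u (x + unitV d i0) = u m := le_antisymm (hle _ (aA (aLy x i0).1)) (not_lt.1 hy)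
    have hD : x + unitV d i0 ∈ D := by
      by_contra hD
      have := h2 _ hD ⟨x, hx.1, aA (aLy x i0).1⟩
      linarith
    have := hxm _ (Finset.mem_filter.2 ⟨hD, he⟩)
    simp [unitV] at this
lemma aM (f g : V d → ℝ) (x : V d) : Pav (fun x => f x - g x) x = Pav f x - Pav g x := by
  simpa [sub_eq_add_neg] using aHx f g 1 (-1) x
lemma aMx (hd : 1 ≤ d) (c : ℝ) (x : V d) : Pav (fun _ => c) x = c := by
  have hd0 : ℜ d ≠ 0 := by exact_mod_cast (by omega : d ≠ 0)
  simp [Pav]; field_simp; ring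
lemma aMy (hd : 1 ≤ d) (D : 𝔽 d) (u v : V d → ℝ)
    (h1 : ∀ x ∈ D, u x - Pav u x = v x - Pav v x)
    (h2 : ∀ x, x ∉ D → u x = v x) : u = v := by
  ext x
  by_cases hx : x ∈ D
  · have a := aLz hd D (fun x => u x - v x) (fun x hx => by rw [aM]; linarith [h1 x hx])
      (fun x hx _ => by rw [h2 x hx]; simp) x hx
    have b := aLz hd D (fun x => v x - u x) (fun x hx => by rw [aM]; linarith [h1 x hx])
      (fun x hx _ => by rw [h2 x hx]; simp) x hx
    linarith
  · exact h2 x hx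
def Lk (x y : V d) : ℝ := (if x = y then 1 else 0) - Pav (fun z => if z = y then 1 else 0) x
lemma aMz (x y : V d) : Lk x y = Lk y x := by
  simp only [Lk, Pav, eq_comm (a := x) (b := y)]
  congr 2
  refine sum_congr rfl fun i _ => ?_
  rw [add_comm]
  congr 2 <;> apply propext <;> constructor <;> intro h <;> rw [← h] <;> simp
lemma aN (D : 𝔽 d) (f : V d → ℝ) (hf : ∀ x, x ∉ D → f x = 0) (x : V d) :
    ∑ y ∈ D, Lk x y * f y = f x - Pav f x := by
  have e : ∀ z, f z = ∑ y ∈ D, f y * (if z = y then 1 else 0) := fun z => by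
    simp only [mul_ite, mul_one, mul_zero, sum_ite_eq]
    split_ifs with h
    · rfl
    · exact hf z h
  have e2 : Pav f x = ∑ y ∈ D, f y * Pav (fun z => if z = y then 1 else 0) x := by
    conv_lhs => rw [show f = fun z => ∑ y ∈ D, f y * (if z = y then 1 else 0) from funext e]
    rw [aHy]
    refine sum_congr rfl fun y _ => ?_
    simpa using aHx (fun z => if z = y then 1 else 0) (fun _ => 0) (f y) 0 x
  rw [e2]
  conv_rhs => rw [e x]
  rw [← sum_sub_distrib]
  exact sum_congr rfl fun y _ => by rw [Lk]; ring
def LM (D : 𝔽 d) : Matrix D D ℝ := fun x y => Lk x.1 y.1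
def GD (D : 𝔽 d) (x y : V d) : ℝ :=
  if h : x ∈ D ∧ y ∈ D then (LM D)⁻¹ ⟨x, h.1⟩ ⟨y, h.2⟩ else 0
lemma aNx (hd : 1 ≤ d) (D : 𝔽 d) : IsUnit (LM D) := by
  rw [← Matrix.mulVec_injective_iff_isUnit, ← Matrix.coe_mulVecLin,
    ← LinearMap.ker_eq_bot, LinearMap.ker_eq_bot']
  intro f hf
  let F : V d → ℝ := fun x => if h : x ∈ D then f ⟨x, h⟩ else 0
  have hF : F = fun _ => 0 := by
    refine aMy hd D _ _ (fun x hx => ?_) (fun x hx => by simp [F, hx])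
    rw [← aN D F (fun x hx => by simp [F, hx]), aMx hd]
    have := congrFun hf ⟨x, hx⟩
    rw [Matrix.mulVecLin_apply, Matrix.mulVec, dotProduct] at this
    rw [← sum_coe_sort D (fun y => Lk x y * F y)]
    simpa [LM, F] using this
  ext x
  have := congrFun hF x.1
  simpa [F] using this
lemma aNy (D : 𝔽 d) (x y : V d) : GD D x y = GD D y x := by
  unfold GD
  have : ((LM D)⁻¹).transpose = (LM D)⁻¹ := by
    rw [Matrix.transpose_nonsing_inv]
    congr 1
    ext a b
    exact aMz _ _
  by_cases h : x ∈ D ∧ y ∈ D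
  · rw [dif_pos h, dif_pos h.symm]
    conv_lhs => rw [← this]
    rfl
  · rw [dif_neg h, dif_neg fun h' => h h'.symm]
lemma aNz {D : 𝔽 d} {x y : V d} (h : x ∉ D) : GD D x y = 0 :=
  dif_neg fun h' => h h'.1
lemma aO {D : 𝔽 d} {x y : V d} (h : y ∉ D) : GD D x y = 0 :=
  dif_neg fun h' => h h'.2
lemma aOx (hd : 1 ≤ d) {D : 𝔽 d} {x : V d} (hx : x ∈ D) {y : V d} (hy : y ∈ D) :
    GD D x y - Pav (fun x => GD D x y) x = if x = y then 1 else 0 := by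
  rw [← aN D (fun x => GD D x y) (fun x hx => aNz hx)]
  have := Matrix.mul_nonsing_inv (LM D) ((Matrix.isUnit_iff_isUnit_det _).1 (aNx hd D))
  have := congrFun (congrFun this ⟨x, hx⟩) ⟨y, hy⟩
  rw [Matrix.mul_apply, Matrix.one_apply] at this
  simp only [Subtype.mk.injEq] at this
  rw [← this, ← sum_coe_sort D (fun z => Lk x z * GD D z y)]
  refine sum_congr rfl fun z _ => ?_
  rw [GD, dif_pos ⟨z.2, hy⟩]; rfl
lemma aOy (hd : 1 ≤ d) (D : 𝔽 d) (x y : V d) : 0 ≤ GD D x y := by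
  by_cases hx : x ∈ D
  swap
  · rw [aNz hx]
  by_cases hy : y ∈ D
  swap
  · rw [aO hy]
  have := aLz hd D (fun x => 0 - GD D x y) (fun z hz => by
    rw [aM, aMx hd]
    have := aOx hd hz hy
    split_ifs at this <;> linarith) (fun z hz _ => by rw [aNz hz]; simp) x hx
  linarith
def ED (D : 𝔽 d) (x y : V d) : ℝ := green d x y - GD D x y
lemma aOz (hd : 3 ≤ d) {D : 𝔽 d} {x : V d} (hx : x ∈ D) (y : V d) :
    ED D x y = Pav (fun x => ED D x y) x := by
  simp only [ED, aM]
  have h1 := aKy hd x y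
  by_cases hy : y ∈ D
  · have h2 := aOx ♥ hx hy
    linarith
  · have hxy : x ≠ y := fun h => hy (h ▸ hx)
    have : Pav (fun x => GD D x y) x = 0 := by
      simp only [aO hy]; exact aMx ♥ 0 x
    rw [if_neg hxy] at h1
    rw [this, aO hy]; linarith
lemma aP (hd : 1 ≤ d) {D : 𝔽 d} {u : V d → ℝ} {M : ℝ} (h1 : ∀ x ∈ D, u x = Pav u x)
    (h2 : ∀ x, x ∉ D → (∃ y ∈ D, adj x y) → u x ≤ M) : ∀ x ∈ D, u x ≤ M := by
  intro x hx
  have := aLz hd D (fun x => u x - M) (fun x hx => by rw [aM, aMx hd, h1 x hx])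
    (fun x hx h => by have := h2 x hx h; linarith) x hx
  linarith
lemma aPx (hd : 3 ≤ d) (D : 𝔽 d) (x y : V d) : 0 ≤ ED D x y := by
  by_cases hx : x ∈ D
  · have := aLz ♥ D (fun x => 0 - ED D x y) (fun z hz => by
      rw [aM, aMx ♥, ← aOz hd hz]) (fun z hz _ => by
        simp only [ED, aNz hz]; linarith [aK z y]) x hx
    linarith
  · simp only [ED, aNz hx]; linarith [aK x y]
lemma aPy (hd : 1 ≤ d) {D : 𝔽 d} {x : V d} (hx : x ∈ D) : 1 ≤ GD D x x := by
  have h := aOx hd hx hx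
  rw [if_pos rfl] at h
  have : 0 ≤ Pav (fun z => GD D z x) x :=
    mul_nonneg ♠ (sum_nonneg fun i _ => add_nonneg (aOy hd _ _ _) (aOy hd _ _ _))
  linarith
lemma aPz (hd : 1 ≤ d) (D : 𝔽 d) : ∃ a : V d → V d → ℝ, (∀ w x, 0 ≤ a w x) ∧
    (∀ w x, x ∉ D → a w x = 0) ∧ ∀ x y, GD D x y = ∑ w ∈ D, a w x * a w y := by
  induction D using induction_on with
  | empty => exact ⟨fun _ _ => 0, by simp, by simp, fun x y => by simp [GD]⟩
  | @insert w D hw ih =>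
    obtain ⟨a, h0, hs, hG⟩ := ih
    set D' := insert w D with hD'
    have hwD : w ∈ D' := mem_insert_self _ _
    have hDD : ∀ {x}, x ∈ D → x ∈ D' := fun h => Finset.mem_insert_of_mem h
    have hpos : 0 < GD D' w w := lt_of_lt_of_le one_pos (aPy hd hwD)
    let b : V d → ℝ := fun x => GD D' x w / √(GD D' w w)
    have hb : ∀ x y, b x * b y = GD D' x w * GD D' y w / GD D' w w := fun x y => by
      simp only [b]
      rw [div_mul_div_comm, mul_self_sqrt hpos.le]
    refine ⟨fun v => if v = w then b else a v, fun v x => ?_, fun v x hx => ?_, fun x y => ?_⟩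
    · simp only; split_ifs
      · exact div_nonneg (aOy hd _ _ _) (Real.sqrt_nonneg _)
      · exact h0 _ _
    · simp only; split_ifs
      · simp only [b, aNz hx, zero_div]
      · exact hs _ _ fun h => hx (hDD h)
    · have e : GD D' x y = b x * b y + GD D x y := by
        by_cases hy : y ∈ D
        · have := aMy hd D (fun x => GD D' x y - b x * b y) (fun x => GD D x y) (fun z hz => ?_)
            (fun z hz => ?_)
          · have := congrFun this x; linarith
          · rw [aOx hd hz hy, aM]
            have h1 := aOx hd (hDD hz) (hDD hy)
            have h2 := aOx hd (hDD hz) hwD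
            rw [if_neg (ne_of_mem_of_not_mem hz hw)] at h2
            have h3 : Pav (fun x => b x * b y) z = Pav (fun x => GD D' x w) z * (GD D' y w / GD D' w w) := by
              have := aHx (fun x => GD D' x w) (fun _ => 0) (GD D' y w / GD D' w w) 0 z
              simp only [mul_zero, add_zero, zero_mul] at this
              rw [mul_comm, ← this]
              congr 1; ext x; rw [hb]; ring
            rw [h3, hb, ← h1, show Pav (fun x => GD D' x w) z = GD D' z w by linarith]
            ring
          · simp only [hb, aNz hz]
            by_cases hzw : z = w
            · subst hzw
              rw [aNy D' z y]; field_simp; ring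
            · have : z ∉ D' := fun h => (Finset.mem_insert.1 h).elim hzw hz
              simp [aNz this]
        · rw [aO hy, hb, add_zero]
          by_cases hyw : y = w
          · subst hyw; field_simp
          · have : y ∉ D' := fun h => (Finset.mem_insert.1 h).elim hyw hy
            simp [aNz this, aO this]
      rw [e, hG, Finset.sum_insert hw]
      simp only [if_true]
      congr 1
      refine sum_congr rfl fun v hv => ?_
      rw [if_neg (ne_of_mem_of_not_mem hv hw)]
end pot
end
section
section gauss
variable {d : ℕ} {Ω Ω' : Type*} [MeasurableSpace Ω] [MeasurableSpace Ω']
  {E E' : Type*} [AddCommGroup E] [Module ℝ E] [AddCommGroup E'] [Module ℝ E']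
structure IsoG (P : Measure Ω) (W : E →ₗ[ℝ] (Ω → ℝ)) (Q : E →ₗ[ℝ] E →ₗ[ℝ] ℝ) : Prop where
  meas : ∀ e, Measurable (W e)
  nn : ∀ e, 0 ≤ Q e e
  law : ∀ e, P.map (W e) = gaussianReal 0 (Q e e).toNNReal
variable {P : Measure Ω} [IsProbabilityMeasure P] {W : E →ₗ[ℝ] (Ω → ℝ)} {Q : E →ₗ[ℝ] E →ₗ[ℝ] ℝ}
  {P' : Measure Ω'} [IsProbabilityMeasure P'] {W' : E' →ₗ[ℝ] (Ω' → ℝ)} {Q' : E' →ₗ[ℝ] E' →ₗ[ℝ] ℝ}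
lemma IsoG.tail (h : IsoG P W Q) {e : E} {q t : ℝ} (hq : Q e e ≤ q) (hq0 : 0 < q) (ht : 0 ≤ t) :
    P {ω | t ≤ W e ω} ≤ ofReal (exp (-t ^ 2 / (2 * q))) := by
  have hm := mgf_gaussianReal (h.law e) (t / q)
  have hi : Integrable (fun ω => exp (t / q * W e ω)) P := by
    have := (integrable_exp_mul_gaussianReal (μ := 0) (v := (Q e e).toNNReal) (t / q))
    rw [← h.law e] at this
    exact (integrable_map_measure (by fun_prop) (h.meas e).aemeasurable).1 this
  have := measure_ge_le_exp_mul_mgf (μ := P) (X := W e) t (div_nonneg ht hq0.le) hi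
  rw [hm, ← exp_add, coe_toNNReal _ (h.nn e)] at this
  rw [← ofReal_toReal (measure_ne_top P _)]
  refine ofReal_le_ofReal (this.trans (Real.exp_le_exp.2 ?_))
  have h1 : Q e e * (t / q) ^ 2 / 2 ≤ q * (t / q) ^ 2 / 2 := by gcongr
  have h2 : -(t / q) * t + (0 * (t / q) + q * (t / q) ^ 2 / 2) = -t ^ 2 / (2 * q) := by
    field_simp; ring
  linarith
lemma IsoG.law_fin {J : Type*} [Fintype J] (h : IsoG P W Q) (h' : IsoG P' W' Q') (e : J → E)
    (e' : J → E') (he : ∀ i j, Q (e i) (e j) = Q' (e' i) (e' j)) :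
    P.map (fun ω j => W (e j) ω) = P'.map (fun ω j => W' (e' j) ω) := by
  have m1 : Measurable (fun ω j => W (e j) ω) := measurable_pi_lambda _ fun j => h.meas _
  have m2 : Measurable (fun ω j => W' (e' j) ω) := measurable_pi_lambda _ fun j => h'.meas _
  have := Measure.isProbabilityMeasure_map (μ := P) m1.aemeasurable
  have := Measure.isProbabilityMeasure_map (μ := P') m2.aemeasurable
  refine Measure.ext_of_charFunDual ?_
  ext L
  classical
  have hL : ∀ v : J → ℝ, L v = ∑ j, L (Pi.single j 1) * v j := fun v => by
    conv_lhs => rw [← Finset.univ_sum_single v]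
    rw [map_sum]
    refine sum_congr rfl fun j _ => ?_
    rw [show Pi.single j (v j) = v j • (Pi.single j 1 : J → ℝ) by
      rw [← Pi.single_smul, smul_eq_mul, mul_one], map_smul, smul_eq_mul, mul_comm]
  rw [charFunDual_eq_charFun_map_one, charFunDual_eq_charFun_map_one,
    Measure.map_map (by fun_prop) m1, Measure.map_map (by fun_prop) m2]
  have e1 : (L ∘ fun ω j => W (e j) ω) = W (∑ j, L (Pi.single j 1) • e j) := by
    ext ω; rw [Function.comp, hL]; simp
  have e2 : (L ∘ fun ω j => W' (e' j) ω) = W' (∑ j, L (Pi.single j 1) • e' j) := by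
    ext ω; rw [Function.comp, hL]; simp
  rw [e1, e2, h.law, h'.law]
  simp only [map_sum, map_smul, LinearMap.sum_apply, LinearMap.smul_apply, he]
lemma IsoG.law_eq {J : Type*} (h : IsoG P W Q) (h' : IsoG P' W' Q') (e : J → E)
    (e' : J → E') (he : ∀ i j, Q (e i) (e j) = Q' (e' i) (e' j)) :
    P.map (fun ω j => W (e j) ω) = P'.map (fun ω j => W' (e' j) ω) := by
  have m1 : Measurable (fun ω j => W (e j) ω) := measurable_pi_lambda _ fun j => h.meas _
  have m2 : Measurable (fun ω j => W' (e' j) ω) := measurable_pi_lambda _ fun j => h'.meas _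
  have := Measure.isProbabilityMeasure_map (μ := P) m1.aemeasurable
  have (I : Finset J) : IsFiniteMeasure (Measure.map I.restrict (P.map fun ω j => W (e j) ω)) :=
    inferInstance
  refine IsProjectiveLimit.unique (P := fun I => (P.map fun ω j => W (e j) ω).map I.restrict)
    (fun I => rfl) (fun I => ?_)
  simp only []
  rw [Measure.map_map (by fun_prop) m1, Measure.map_map (by fun_prop) m2]
  exact (h.law_fin h' (fun i : I => e i) (fun i : I => e' i) (fun i j => he i j)).symm
lemma IsoG.prob_eq {J : Type*} (h : IsoG P W Q) (h' : IsoG P' W' Q') (e : J → E)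
    (e' : J → E') (he : ∀ i j, Q (e i) (e j) = Q' (e' i) (e' j)) {A : Set (J → ℝ)} (hA : MeasurableSet A) :
    P {ω | (fun j => W (e j) ω) ∈ A} = P' {ω | (fun j => W' (e' j) ω) ∈ A} := by
  have := congrArg (fun μ => μ A) (h.law_eq h' e e' he)
  rwa [Measure.map_apply (measurable_pi_lambda _ fun j => h.meas _) hA,
    Measure.map_apply (measurable_pi_lambda _ fun j => h'.meas _) hA] at this
variable (W W') in
def aQ : (E × E') →ₗ[ℝ] (Ω × Ω' → ℝ) :=
  (funLeft ℝ ℝ Prod.fst).comp (W.comp (fst ℝ E E')) +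
    (funLeft ℝ ℝ Prod.snd).comp (W'.comp (snd ℝ E E'))
variable (Q Q') in
def aQx : (E × E') →ₗ[ℝ] (E × E') →ₗ[ℝ] ℝ :=
  Q.compl₁₂ (fst ℝ E E') (fst ℝ E E') +
    Q'.compl₁₂ (snd ℝ E E') (snd ℝ E E')
lemma aQy (e : E × E') (ω : Ω × Ω') : aQ W W' e ω = W e.1 ω.1 + W' e.2 ω.2 := rfl
lemma aQz (e f : E × E') : aQx Q Q' e f = Q e.1 f.1 + Q' e.2 f.2 := rfl
lemma IsoG.prod (h : IsoG P W Q) (h' : IsoG P' W' Q') :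
    IsoG (P.prod P') (aQ W W') (aQx Q Q') where
  meas e := ((h.meas _).comp measurable_fst).add ((h'.meas _).comp measurable_snd)
  nn e := add_nonneg (h.nn _) (h'.nn _)
  law e := by
    have hi := indepFun_prod (μ := P) (ν := P') (h.meas e.1) (h'.meas e.2)
    have h1 : (P.prod P').map (fun ω => W e.1 ω.1) = gaussianReal 0 (Q e.1 e.1).toNNReal := by
      have := Measure.map_map (μ := P.prod P') (h.meas e.1) measurable_fst
      rw [(measurePreserving_fst (μ := P) (ν := P')).map_eq, h.law] at this; exact this.symm
    have h2 : (P.prod P').map (fun ω => W' e.2 ω.2) = gaussianReal 0 (Q' e.2 e.2).toNNReal := by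
      have := Measure.map_map (μ := P.prod P') (h'.meas e.2) measurable_snd
      rw [(measurePreserving_snd (μ := P) (ν := P')).map_eq, h'.law] at this; exact this.symm
    have := gaussianReal_add_gaussianReal_of_indepFun hi h1 h2
    rw [aQz, Real.toNNReal_add (h.nn _) (h'.nn _), ← zero_add (0 : ℝ), ← this]
    rfl
variable {ι : Type*} [Fintype ι]
variable (ι W) in
def piW : (ι → E) →ₗ[ℝ] ((ι → Ω) → ℝ) :=
  ∑ i, (funLeft ℝ ℝ (fun ω : ι → Ω => ω i)).comp (W.comp (proj i))
variable (ι Q) in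
def piQ : (ι → E) →ₗ[ℝ] (ι → E) →ₗ[ℝ] ℝ :=
  ∑ i, Q.compl₁₂ (proj i) (proj i)
lemma aR (e : ι → E) (ω : ι → Ω) : piW W ι e ω = ∑ i, W (e i) (ω i) := by
  simp [piW, funLeft]
lemma aRx (e f : ι → E) : piQ Q ι e f = ∑ i, Q (e i) (f i) := by
  simp [piQ, LinearMap.sum_apply]
lemma IsoG.pi (h : IsoG P W Q) : IsoG (Measure.pi fun _ : ι => P) (piW W ι) (piQ Q ι) where
  meas e := by
    have : piW W ι e = fun ω => ∑ i, W (e i) (ω i) := funext fun ω => aR e ω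
    rw [this]
    exact measurable_sum _ fun i _ => (h.meas _).comp (measurable_pi_apply i)
  nn e := by rw [aRx]; exact sum_nonneg fun i _ => h.nn _
  law e := by
    have hW : piW W ι e = fun ω => ∑ i, W (e i) (ω i) := funext fun ω => aR e ω
    have m : ∀ i, Measurable fun ω : ι → Ω => W (e i) (ω i) :=
      fun i => (h.meas _).comp (measurable_pi_apply i)
    have hi := iIndepFun_pi (μ := fun _ : ι => P) (X := fun i => W (e i)) fun i => (h.meas _).aemeasurable
    have := Measure.isProbabilityMeasure_map (μ := Measure.pi fun _ : ι => P) (f := piW W ι e)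
      (by rw [hW]; exact (measurable_sum _ fun i _ => m i).aemeasurable)
    refine Measure.ext_of_charFun ?_
    rw [hW, hi.charFun_map_fun_sum_eq_prod fun i => (m i).aemeasurable]
    ext t
    have hm : ∀ i, (Measure.pi fun _ : ι => P).map (fun ω => W (e i) (ω i)) = gaussianReal 0 (Q (e i) (e i)).toNNReal := fun i => by
      have := Measure.map_map (μ := Measure.pi fun _ : ι => P) (h.meas (e i)) (measurable_pi_apply i)
      rw [(measurePreserving_eval (fun _ : ι => P) i).map_eq, h.law] at this; exact this.symm
    simp only [Finset.prod_apply, hm, charFun_gaussianReal]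
    rw [← Complex.exp_sum, aRx]
    congr 1
    simp only [Complex.ofReal_zero, mul_zero, zero_mul, zero_sub, Finset.sum_neg_distrib, ← sum_div, ← sum_mul]
    congr 3
    rw [coe_toNNReal _ (sum_nonneg fun i _ => h.nn _)]
    push_cast
    exact sum_congr rfl fun i _ => by rw [coe_toNNReal _ (h.nn _)]
def aRy : ℝ →ₗ[ℝ] (ℝ → ℝ) := LinearMap.toSpanSingleton ℝ _ id
def aRz (v : ℝ) : ℝ →ₗ[ℝ] ℝ →ₗ[ℝ] ℝ := v • LinearMap.mul ℝ ℝ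
lemma IsoG.one {v : ℝ} (hv : 0 ≤ v) : IsoG (gaussianReal 0 v.toNNReal) aRy (aRz v) where
  meas e := by
    have : aRy e = fun x => e * x := by ext; simp [aRy]
    rw [this]; fun_prop
  nn e := by simp only [aRz, LinearMap.smul_apply, mul_apply', smul_eq_mul]; nlinarith [mul_self_nonneg e]
  law e := by
    have : aRy e = fun x => e * x := by ext; simp [aRy]
    rw [this, gaussianReal_map_const_mul]
    simp only [aRz, LinearMap.smul_apply, mul_apply', smul_eq_mul, mul_zero]
    congr 1
    ext
    rw [coe_toNNReal _ (by nlinarith [mul_self_nonneg e])]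
    simp [hv]; ring
lemma IsoG.tree (h : IsoG P W Q) {ι α : Type*} (T : Finset ι) (A : ι → Finset α)
    (e : ι → α → E) (c : ι → ι → ℝ) (q t : ℝ) (m : ℕ) (hq : 0 < q) (ht : 0 ≤ t)
    (hc : ∀ i ∈ T, ∀ j ∈ T, ∀ a ∈ A i, ∀ b ∈ A j, Q (e i a) (e j b) ≤ c i j)
    (hr : ∀ i ∈ T, ∑ j ∈ T, c i j ≤ q) (hm : ∀ i ∈ T, (A i).card ≤ m) :
    P {ω | ∀ i ∈ T, ∃ a ∈ A i, t ≤ W (e i a) ω} ≤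
      (ofReal (m * exp (-t ^ 2 / (2 * q)))) ^ T.card := by
  classical
  rcases T.eq_empty_or_nonempty with rfl | hne
  · simp
  have hk : ℜ 0 < T.card := by exact_mod_cast hne.card_pos
  have hsub : {ω | ∀ i ∈ T, ∃ a ∈ A i, t ≤ W (e i a) ω} ⊆
      ⋃ s ∈ T.pi A, {ω | T.card * t ≤ W (∑ i ∈ T.attach, e i.1 (s i.1 i.2)) ω} := by
    intro ω hω
    simp only [mem_ofPred_eq] at hω
    choose s hs1 hs2 using hω
    refine mem_biUnion (Finset.mem_coe.2 (Finset.mem_pi.2 hs1)) ?_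
    simp only [mem_ofPred_eq, map_sum, Finset.sum_apply]
    calc T.card * t = ∑ i ∈ T.attach, t := by simp
      _ ≤ _ := sum_le_sum fun i _ => hs2 _ _
  refine (measure_mono hsub).trans ((measure_biUnion_finset_le _ _).trans ?_)
  have hb : ∀ s ∈ T.pi A, P {ω | T.card * t ≤ W (∑ i ∈ T.attach, e i.1 (s i.1 i.2)) ω} ≤
      ofReal (exp (-t ^ 2 / (2 * q)) ^ T.card) := fun s hs => by
    have hs := Finset.mem_pi.1 hs
    refine (h.tail (q := T.card * q) ?_ ♠ ♠).trans ?_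
    · simp only [map_sum, LinearMap.sum_apply]
      calc _ ≤ ∑ i ∈ T.attach, ∑ j ∈ T.attach, c i.1 j.1 := by
            rw [sum_comm]
            exact sum_le_sum fun i _ => sum_le_sum fun j _ =>
              hc _ i.2 _ j.2 _ (hs _ _) _ (hs _ _)
        _ = ∑ i ∈ T, ∑ j ∈ T, c i j := by
            rw [← sum_attach T]
            exact sum_congr rfl fun i _ => sum_attach T fun j => c i.1 j
        _ ≤ ∑ i ∈ T, q := sum_le_sum hr
        _ = _ := by simp
    · rw [← exp_nat_mul]
      refine le_of_eq ?_
      congr 2; field_simp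
  refine (sum_le_sum hb).trans ?_
  rw [sum_const, Finset.card_pi, nsmul_eq_mul, ofReal_mul ♠, mul_pow,
    ofReal_pow ♠, ofReal_natCast]
  gcongr
  exact_mod_cast Finset.prod_le_pow_card _ _ _ hm
lemma aS {Λ : 𝕊 d} (hΛ : Λ.Finite) (f : V d → Ω → ℝ) (hf : ∀ x, Measurable (f x)) (a : V d → ℝ)
    (p : 𝕊 d → Prop) : MeasurableSet {ω | p ({x | a x ≤ f x ω} ∩ Λ)} := by
  have : {ω | p ({x | a x ≤ f x ω} ∩ Λ)} =
      ⋃ S ∈ {S | S ⊆ Λ ∧ p S}, {ω | {x | a x ≤ f x ω} ∩ Λ = S} := by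
    ext ω; simp
  rw [this]
  refine MeasurableSet.biUnion ((hΛ.finite_subsets.subset fun S h => h.1).countable) fun S hS => ?_
  have : {ω | {x | a x ≤ f x ω} ∩ Λ = S} = ⋂ x ∈ Λ, {ω | a x ≤ f x ω ↔ x ∈ S} := by
    ext ω
    simp only [mem_ofPred_eq, mem_iInter, Set.ext_iff, mem_inter_iff]
    exact ⟨fun h x hx => ⟨fun h' => (h x).1 ⟨h', hx⟩, fun h' => ((h x).2 h').1⟩,
      fun h x => ⟨fun h' => (h x h'.2).1 h'.1, fun h' => ⟨(h x (hS.1 h')).2 h', hS.1 h'⟩⟩⟩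
  rw [this]
  refine hΛ.measurableSet_biInter fun x _ => ?_
  by_cases hx : x ∈ S
  · simpa [hx] using measurableSet_le measurable_const (hf x)
  · simpa [hx] using measurableSet_lt (hf x) measurable_const
end gauss
end
section
section gff
variable {d : ℕ} {Ω : Type*} [MeasurableSpace Ω] {P : Measure Ω} [IsProbabilityMeasure P]
  {φ : V d → Ω → ℝ}
abbrev Es (d : ℕ) := V d →₀ ℝ
abbrev Wg (φ : V d → Ω → ℝ) : Es d →ₗ[ℝ] (Ω → ℝ) := Finsupp.linearCombination ℝ φ
def Qg (d : ℕ) : Es d →ₗ[ℝ] Es d →ₗ[ℝ] ℝ :=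
  Finsupp.linearCombination ℝ fun x => Finsupp.linearCombination ℝ (green d x)
abbrev ev (x : V d) : Es d := Finsupp.single x 1
lemma aSx (x y : V d) : Qg d (ev x) (ev y) = green d x y := by simp [Qg]
lemma aSy (x : V d) : Wg φ (ev x) = φ x := by simp
lemma aSz (e f : Es d) : Qg d e f = Qg d f e := by
  have : Qg d = (Qg d).flip := by
    ext x y
    simp [Qg, aLx x y]
  conv_lhs => rw [this]
  rfl
lemma aT (hd : 3 ≤ d) (x : V d) : 1 ≤ green d x x := by
  rw [aKy hd, if_pos rfl]
  have : Pav (fun _ => ℜ 0) x ≤ Pav (fun z => green d z x) x := aH (fun z => aK z x) x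
  rw [aMx ♥] at this
  linarith
lemma aTx (hd : 3 ≤ d) (hφ : IsGFF P φ) : IsoG P (Wg φ) (Qg d) := by
  have hlaw : ∀ e, P.map (Wg φ e) = gaussianReal 0 (Qg d e e).toNNReal := fun e => by
    have := hφ.2 e.support e
    convert this using 2
    · ext ω; simp [Finsupp.linearCombination_apply, Finsupp.sum]
    · congr 1
      simp only [Qg, Finsupp.linearCombination_apply, Finsupp.sum, LinearMap.sum_apply,
        LinearMap.smul_apply, smul_eq_mul, mul_sum]
      exact sum_congr rfl fun x _ => sum_congr rfl fun y _ => by ring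
  have hm : ∀ e, Measurable (Wg φ e) := fun e => by
    have : Wg φ e = fun ω => ∑ x ∈ e.support, e x * φ x ω := by
      ext ω; simp [Finsupp.linearCombination_apply, Finsupp.sum]
    rw [this]
    exact measurable_sum _ fun x _ => (hφ.1 x).const_mul _
  refine ⟨hm, fun e => ?_, hlaw⟩
  by_contra! hneg
  have h0 : Wg φ e =ᵐ[P] 0 := by
    have h1 := hlaw e
    rw [Real.toNNReal_of_nonpos hneg.le, gaussianReal_zero_var] at h1
    have : ∀ᵐ x ∂(P.map (Wg φ e)), x = 0 := by rw [h1]; simp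
    exact ae_of_ae_map (hm e).aemeasurable this
  set f := ev 𝕆 d
  have hf : 1 ≤ Qg d f f := by rw [aSx]; exact aT hd 0
  have key : ∀ t : ℝ, (Qg d (f + t • e) (f + t • e)).toNNReal = (Qg d f f).toNNReal := fun t => by
    have h1 := hlaw (f + t • e)
    have h2 : P.map (Wg φ (f + t • e)) = P.map (Wg φ f) := by
      refine Measure.map_congr ?_
      filter_upwards [h0] with ω hω
      simp only [map_add, map_smul, Pi.add_apply, Pi.smul_apply, hω, Pi.zero_apply, smul_zero, add_zero]
    rw [h2, hlaw f, gaussianReal_ext_iff] at h1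
    exact h1.2.symm
  have hpos : ∀ t : ℝ, Qg d (f + t • e) (f + t • e) = Qg d f f := fun t => by
    have := key t
    have h1 : 0 < (Qg d (f + t • e) (f + t • e)).toNNReal := by
      rw [this]; exact Real.toNNReal_pos.2 (by linarith)
    have h2 := Real.toNNReal_pos.1 h1
    exact (Real.toNNReal_eq_toNNReal_iff h2.le (by linarith)).1 this
  have a := hpos 1
  have b := hpos (-1)
  simp only [map_add, map_smul, LinearMap.add_apply, LinearMap.smul_apply, smul_eq_mul] at a b
  linarith
def aTy (f : V d → Es d) (x : V d) : Es d :=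
  (1 / (2 * d) : ℝ) • ∑ i : Fin d, (f (x + unitV d i) + f (x - unitV d i))
lemma aTz (l : Es d →ₗ[ℝ] ℝ) (f : V d → Es d) (x : V d) :
    l (aTy f x) = Pav (fun y => l (f y)) x := by
  simp [aTy, Pav, map_sum]
def yv (x : V d) : Es d := ev x - aTy ev x
lemma aU (hd : 3 ≤ d) (x y : V d) : Qg d (ev y) (yv x) = if x = y then 1 else 0 := by
  rw [yv, map_sub, aTz]
  simp only [aSx]
  rw [aLx, aKy hd x y]
  simp only [aLx y]; ring
def psi (D : 𝔽 d) (x : V d) : Es d := ∑ w ∈ D, GD D x w • yv w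
def eta (D : 𝔽 d) (x : V d) : Es d := ev x - psi D x
lemma aUx (hd : 3 ≤ d) (D : 𝔽 d) (x y : V d) : Qg d (psi D x) (ev y) = GD D x y := by
  rw [aSz, psi, map_sum]
  simp only [map_smul, aU hd, smul_eq_mul, mul_ite, mul_one, mul_zero, sum_ite_eq']
  split_ifs with h
  · rfl
  · rw [aO h]
lemma aUy (hd : 3 ≤ d) (D : 𝔽 d) (x y : V d) : Qg d (psi D x) (psi D y) = GD D x y := by
  conv_lhs => rw [psi.eq_1 D y]
  rw [map_sum, aNy]
  have : ∀ w ∈ D, Qg d (psi D x) (GD D y w • yv w) = if w = x then GD D y w else 0 := fun w hw => by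
    rw [map_smul, yv, map_sub, aTz]
    simp only [aUx hd, smul_eq_mul]
    by_cases hx : x ∈ D
    · have := aOx ♥ hw hx
      simp only [aNy D x]
      rw [this]; simp
    · simp only [aNz hx, aMx (show 1 ≤ d by omega)]
      rw [if_neg (ne_of_mem_of_not_mem hw hx)]; simp
  rw [sum_congr rfl this, sum_ite_eq']
  split_ifs with h
  · rfl
  · rw [aO h]
lemma aUz (hd : 3 ≤ d) (D D' : 𝔽 d) (hD : ∀ x ∈ D, ∀ y ∈ D', 1 < dinf x y) (x y : V d) :
    Qg d (psi D x) (psi D' y) = 0 := by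
  rw [psi.eq_1 D' y, map_sum]
  refine sum_eq_zero fun w hw => ?_
  rw [map_smul, yv, map_sub, aTz]
  simp only [aUx hd]
  have h0 : ∀ v, dinf v w ≤ 1 → GD D x v = 0 := fun v hv => aO fun h => by
    have := hD v h w hw; omega
  have h1 : ∀ v, adj w v → GD D x v = 0 := fun v hv => h0 v (by
    rw [aB]; exact aC hv)
  rw [h0 w (by simp [dinf])]
  simp [Pav, h1 _ (aLy w _).1, h1 _ (aLy w _).2]
lemma aV (hd : 3 ≤ d) (D : 𝔽 d) (x y : V d) : Qg d (eta D x) (ev y) = ED D x y := by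
  rw [eta, map_sub, LinearMap.sub_apply, aSx, aUx hd, ED]
lemma aVx (hd : 3 ≤ d) (D : 𝔽 d) (x y : V d) : Qg d (eta D x) (eta D y) = ED D x y := by
  rw [eta.eq_1 D y, map_sub, aV hd, eta, map_sub, LinearMap.sub_apply, aUy hd,
    aSz, aUx hd, aNy D y x]; ring
lemma aVy {D : 𝔽 d} {x : V d} (h : x ∉ D) : eta D x = ev x := by
  simp [eta, psi, aNz h]
lemma aVz (hd : 3 ≤ d) {D : 𝔽 d} {y : V d} (hy : y ∈ D) (e : Es d) :
    Qg d e (eta D y) = Pav (fun y => Qg d e (eta D y)) y := by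
  simp only [eta, psi, map_sub, aM, map_sum, map_smul, smul_eq_mul]
  rw [aHy]
  have h1 : ∀ w ∈ D, GD D y w * Qg d e (yv w) - Pav (fun y => GD D y w * Qg d e (yv w)) y =
      if y = w then Qg d e (yv w) else 0 := fun w hw => by
    have := aOx ♥ hy hw
    have h2 := aHx (fun y => GD D y w) (fun _ => 0) (Qg d e (yv w)) 0 y
    simp only [mul_zero, add_zero, zero_mul] at h2
    simp only [mul_comm _ (Qg d e (yv w))]
    rw [h2, ← mul_sub, this]; simp
  have h3 := sum_congr rfl h1
  rw [sum_sub_distrib, sum_ite_eq, if_pos hy, yv, map_sub, aTz] at h3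
  linarith
lemma aW (hd : 3 ≤ d) {D D' : 𝔽 d} {x y : V d} {M : ℝ} (hx : x ∈ D) (hy : y ∈ D')
    (h : ∀ x' ∉ D, (∃ w ∈ D, adj x' w) → ∀ y' ∉ D', (∃ w ∈ D', adj y' w) → green d x' y' ≤ M) :
    Qg d (eta D x) (eta D' y) ≤ M := by
  refine aP ♥ (fun y hy => aVz hd hy (eta D x)) (fun y' hy' hw => ?_) y hy
  rw [aVy hy', aSz]
  refine aP ♥ (fun x hx => aVz hd hx (ev y')) (fun x' hx' hw' => ?_) x hx
  rw [aVy hx', aSx, aLx]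
  exact h x' hx' hw' y' hy' hw
lemma aWx (hd : 3 ≤ d) {D : 𝔽 d} {x : V d} {r : ℕ} (hx : x ∈ D)
    (h : ∀ x' ∉ D, r ≤ dinf x' x) : Qg d (eta D x) (eta D x) ≤ kap d r := by
  rw [aVx hd, ED, ← aSx, ← aUx hd, ← LinearMap.sub_apply, ← map_sub, ← eta, aSz]
  refine aP ♥ (fun x' hx => aVz hd hx (ev x)) (fun x' hx' hw' => ?_) x hx
  rw [aVy hx', aSx, aLx]
  exact (aKx hd _ _).trans (aJy hd (h x' hx'))
lemma aWy (hd : 3 ≤ d) (D : 𝔽 d) (x : V d) : Qg d (eta D x) (eta D x) ≤ kap d 0 := by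
  rw [aVx hd, ED]
  have := aKx hd x x
  rw [show dinf x x = 0 by simp [dinf]] at this
  linarith [aOy (show 1 ≤ d by omega) D x x]
abbrev NI (n : ℕ) : Measure (Fin n → ℝ) := Measure.pi fun _ => gaussianReal 0 1
lemma aWz (hd : 3 ≤ d) (hφ : IsGFF P φ) (D : 𝔽 d) : ∃ a : Fin D.card → V d → ℝ,
    (∀ w x, 0 ≤ a w x) ∧ (∀ w x, x ∉ D → a w x = 0) ∧ (∀ x y, GD D x y = ∑ w, a w x * a w y) ∧
    ∀ A : Set ((V d → ℝ) × (V d → ℝ)), MeasurableSet A →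
      P {ω | ((fun x => Wg φ (eta D x) ω), (fun x => φ x ω)) ∈ A} =
      (P.prod (NI D.card)) {p | ((fun x => Wg φ (eta D x) p.1),
        (fun x => Wg φ (eta D x) p.1 + ∑ w, a w x * p.2 w)) ∈ A} := by
  obtain ⟨a, h0, hs, hG⟩ := aPz (show 1 ≤ d by omega) D
  have hG' : ∀ x y, GD D x y = ∑ w, a (D.equivFin.symm w) x * a (D.equivFin.symm w) y := fun x y => by
    rw [hG, ← sum_coe_sort]
    exact (Equiv.sum_comp D.equivFin.symm fun w : D => a w x * a w y).symm
  refine ⟨fun w => a (D.equivFin.symm w), fun w => h0 _, fun w => hs _, hG', fun A hA => ?_⟩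
  have h1 := aTx hd hφ
  have h2 := (IsoG.one (v := 1) zero_le_one).pi (ι := Fin D.card)
  rw [Real.toNNReal_one] at h2
  have mS : Measurable (fun f : (V d ⊕ V d) → ℝ => ((fun x => f (Sum.inl x)), (fun x => f (Sum.inr x)))) := by
    fun_prop
  have := h1.prob_eq (h1.prod h2) (J := V d ⊕ V d) (Sum.elim (eta D) ev)
    (Sum.elim (fun x => (eta D x, 0)) (fun x => (eta D x, fun w => a (D.equivFin.symm w) x)))
    (fun x y => ?_) (mS hA)
  · simp only [mem_preimage, Sum.elim_inl, Sum.elim_inr, aSy] at this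
    rw [this]
    simp only [aQy, aR]
    simp [aRy]
  · rcases x with x | x <;> rcases y with y | y <;>
      simp only [Sum.elim_inl, Sum.elim_inr, aQz, aRx, aVx hd]
    · simp
    · rw [aV hd]; simp
    · rw [aSz, aV hd, ← aVx hd, aSz, aVx hd]; simp
    · rw [aSx, ED, hG']
      simp [aRz]
end gff
end
section
section aYz
abbrev ga : Measure ℝ := gaussianReal 0 1
instance (n : ℕ) : IsProbabilityMeasure (NI n) := by unfold NI; infer_instance
lemma aX {n : ℕ} : Measurable (fun p : ℝ × (Fin n → ℝ) => (Fin.cons p.1 p.2 : Fin (n+1) → ℝ)) := by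
  rw [measurable_pi_iff]
  intro i
  refine Fin.cases ?_ (fun j => ?_) i
  · simpa using measurable_fst
  · simp only [Fin.cons_succ]
    exact (measurable_pi_apply j).comp measurable_snd
lemma aXx {n : ℕ} {A : Set (Fin (n+1) → ℝ)} (hA : MeasurableSet A) :
    NI (n+1) A = ∫⁻ x, NI n {y | (Fin.cons x y : Fin (n+1) → ℝ) ∈ A} ∂ga := by
  have h := (measurePreserving_piFinSuccAbove (fun _ : Fin (n+1) => ga) 0).symm
  have h2 := h.measure_preimage hA.nullMeasurableSet
  unfold NI
  rw [← h2, Measure.prod_apply ((MeasurableEquiv.measurable _) hA)]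
  refine lintegral_congr fun x => ?_
  congr 1; ext y
  simp [MeasurableEquiv.piFinSuccAbove, Fin.insertNthEquiv]
lemma aXy {n : ℕ} {A : Set (Fin (n+1) → ℝ)} (hA : MeasurableSet A) (x : ℝ) :
    MeasurableSet {y : Fin n → ℝ | (Fin.cons x y : Fin (n+1) → ℝ) ∈ A} :=
  (aX.comp (measurable_const.prodMk measurable_id)) hA
lemma aXz {n : ℕ} {A : Set (Fin (n+1) → ℝ)} (hA : MeasurableSet A) :
    Measurable fun x : ℝ => NI n {y : Fin n → ℝ | (Fin.cons x y : Fin (n+1) → ℝ) ∈ A} :=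
  measurable_measure_prodMk_left (ν := NI n) (aX hA)
lemma aY {n : ℕ} {x x' : ℝ} {y y' : Fin n → ℝ} (h : x ≤ x') (h' : y ≤ y') :
    (Fin.cons x y : Fin (n+1) → ℝ) ≤ Fin.cons x' y' := by
  intro i
  refine Fin.cases ?_ (fun j => ?_) i
  · simpa using h
  · simpa using h' j
lemma aYx (f g : ℝ → ENNReal) (hf : Monotone f) (hg : Monotone g) :
    (∫⁻ x, f x ∂ga) * (∫⁻ x, g x ∂ga) ≤ ∫⁻ x, f x * g x ∂ga := by
  have mf : Measurable f := hf.measurable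
  have mg : Measurable g := hg.measurable
  have hpt : ∀ x y, f x * g y + f y * g x ≤ f x * g x + f y * g y := by
    have : ∀ a b c e : ENNReal, a ≤ b → c ≤ e → a * e + b * c ≤ a * c + b * e := by
      intro a b c e h h'
      obtain ⟨s, rfl⟩ := le_iff_exists_add.1 h
      obtain ⟨t, rfl⟩ := le_iff_exists_add.1 h'
      exact le_of_le_of_eq (le_add_right le_rfl : _ ≤ _ + s * t) (by ring)
    intro x y
    rcases le_total x y with h | h
    · exact this _ _ _ _ (hf h) (hg h)
    · have := this _ _ _ _ (hf h) (hg h)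
      rwa [add_comm, add_comm (f x * g x)]
  have h1 : ∫⁻ x, ∫⁻ y, (f x * g y + f y * g x) ∂ga ∂ga ≤
      ∫⁻ x, ∫⁻ y, (f x * g x + f y * g y) ∂ga ∂ga :=
    lintegral_mono fun x => lintegral_mono fun y => hpt x y
  have e1 : ∀ x, ∫⁻ y, (f x * g y + f y * g x) ∂ga =
      f x * (∫⁻ y, g y ∂ga) + (∫⁻ y, f y ∂ga) * g x := by
    intro x
    rw [lintegral_add_left (mg.const_mul _), lintegral_const_mul _ mg, lintegral_mul_const _ mf]
  have e2 : ∀ x, ∫⁻ y, (f x * g x + f y * g y) ∂ga = f x * g x + ∫⁻ y, f y * g y ∂ga := by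
    intro x
    rw [lintegral_add_left measurable_const, lintegral_const, measure_univ, mul_one]
  simp_rw [e1, e2] at h1
  rw [lintegral_add_left (mf.mul_const _), lintegral_mul_const _ mf, lintegral_const_mul _ mg,
    lintegral_add_left (by fun_prop), lintegral_const, measure_univ, mul_one] at h1
  by_contra hc
  push Not at hc
  exact absurd h1 (not_le.2 (ENNReal.add_lt_add hc hc))
lemma aYy (A : Set (Fin 0 → ℝ)) : A = ∅ ∨ A = univ := by
  by_cases h : A.Nonempty
  · obtain ⟨x, hx⟩ := h
    right; ext y; simp [Subsingleton.elim y x, hx]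
  · left; exact not_nonempty_iff_eq_empty.1 h
theorem aYz : ∀ {n : ℕ} {A B : Set (Fin n → ℝ)} (_ : MeasurableSet A) (_ : MeasurableSet B)
    (_ : IsUpperSet A) (_ : IsUpperSet B), NI n A * NI n B ≤ NI n (A ∩ B)
  | 0, A, B, _, _, _, _ => by
    rcases aYy A with h | h <;> rcases aYy B with h' | h' <;> simp [h, h']
  | n + 1, A, B, hA, hB, uA, uB => by
    rw [aXx hA, aXx hB, aXx (hA.inter hB)]
    refine (aYx _ _ ?_ ?_).trans (lintegral_mono fun x => ?_)
    · exact fun x x' h => measure_mono fun y hy => uA (aY h le_rfl) hy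
    · exact fun x x' h => measure_mono fun y hy => uB (aY h le_rfl) hy
    · exact aYz (aXy hA x) (aXy hB x) (fun y y' h hy => uA (aY le_rfl h) hy)
        (fun y y' h hy => uB (aY le_rfl h) hy)
lemma aZ {S : Set ℝ} (hS : MeasurableSet S) (hp : ∀ x ∈ S, 0 ≤ x) {r : ℝ} (hr : 0 ≤ r) :
    ga {x | x - r ∈ S} ≤ ofReal (exp (-(r^2) / 2)) * ga S := by
  have hm : MeasurableSet {x : ℝ | x - r ∈ S} := (measurable_id.sub_const r) hS
  rw [gaussianReal_apply _ one_ne_zero, gaussianReal_apply _ one_ne_zero,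
    ← lintegral_indicator hm, ← lintegral_indicator hS,
    ← lintegral_const_mul _ ((measurable_gaussianPDF _ _).indicator hS),
    ← lintegral_add_right_eq_self _ r]
  refine lintegral_mono fun x => ?_
  by_cases hx : x ∈ S
  · rw [indicator_of_mem (by simpa using hx), indicator_of_mem hx, gaussianPDF, gaussianPDF,
      ← ofReal_mul (exp_pos _).le]
    apply ofReal_le_ofReal
    rw [gaussianPDFReal, gaussianPDFReal, mul_left_comm, ← exp_add]
    gcongr
    have := mul_nonneg (hp x hx) hr
    simp only [NNReal.coe_one]
    nlinarith
  · rw [indicator_of_notMem (by simpa using hx)]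
    exact zero_le
lemma aZx {S : Set ℝ} (hS : MeasurableSet S) : ga {x | -x ∈ S} = ga S := by
  have := gaussianReal_map_neg (μ := 0) (v := 1)
  rw [neg_zero] at this
  conv_rhs => rw [ga, ← this, Measure.map_apply measurable_neg hS]
  rfl
def kp (δ : ℝ) : ℝ := 1 - exp (-(δ^2) / 8)
lemma aZy (δ : ℝ) : ofReal (kp δ) + ofReal (exp (-(δ^2) / 8)) = 1 := by
  have : exp (-(δ^2) / 8) ≤ 1 := Real.exp_le_one_iff.2 (by nlinarith [sq_nonneg δ])
  rw [← ofReal_add (by unfold kp; linarith) (exp_pos _).le, kp]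
  simp
lemma aZz {A : Set ℝ} (hA : IsUpperSet A) : MeasurableSet A :=
  hA.ordConnected.measurableSet
lemma bA {A : Set ℝ} (hA : IsUpperSet A) {δ : ℝ} (hδ : 0 < δ) :
    ofReal (kp δ) * (ga Aᶜ * ga {x | x + δ ∈ A}) + ga A ≤ ga {x | x + δ ∈ A} := by
  have mA := aZz hA
  have m1 : MeasurableSet {x | x + δ ∈ A} := (measurable_id.add_const δ) mA
  have m2 : MeasurableSet {x | x + δ / 2 ∈ A} := (measurable_id.add_const _) mA
  have he : -((δ/2)^2)/2 = -(δ^2)/8 := by ring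
  have hk := aZy δ
  set k := ofReal (kp δ)
  set e := ofReal (exp (-(δ^2) / 8))
  by_cases h0 : 0 + δ / 2 ∈ A
  · have hs := aZ (S := {x | -x + δ / 2 ∉ A}) (r := δ / 2)
      ((measurable_neg.add_const _) mA.compl)
      (fun x hx => by
        by_contra hc
        exact hx (hA (by linarith [not_le.1 hc]) h0)) ♠
    rw [he] at hs
    have a1 : ga {x | x - δ/2 ∈ {x | -x + δ / 2 ∉ A}} = ga {x | x + δ ∈ A}ᶜ := by
      rw [← aZx m1.compl]
      congr 1; ext x
      simp only [mem_ofPred_eq, mem_compl_iff]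
      rw [show -(x - δ/2) + δ/2 = -x + δ by ring]
    have a2 : ga {x | -x + δ / 2 ∉ A} ≤ ga Aᶜ := by
      rw [← aZx mA.compl]
      exact measure_mono fun x hx hc => hx (hA (by linarith) hc)
    rw [a1] at hs
    have hs' : ga {x | x + δ ∈ A}ᶜ ≤ e * ga Aᶜ := hs.trans (by gcongr)
    have t1 := measure_add_measure_compl (μ := ga) mA
    have t2 := measure_add_measure_compl (μ := ga) m1
    rw [measure_univ] at t1 t2
    have : k * ga Aᶜ + ga A + ga {x | x + δ ∈ A}ᶜ ≤ ga {x | x + δ ∈ A} + ga {x | x + δ ∈ A}ᶜ := by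
      rw [t2, ← t1]
      calc _ ≤ k * ga Aᶜ + ga A + e * ga Aᶜ := by gcongr
        _ = ga A + (k + e) * ga Aᶜ := by ring
        _ ≤ _ := by rw [hk, one_mul]
    have := (ENNReal.add_le_add_iff_right (measure_ne_top _ _)).1 this
    refine le_trans ?_ this
    gcongr
    exact mul_le_of_le_one_right' prob_le_one
  · have hs := aZ (S := {x | x + δ / 2 ∈ A}) (r := δ / 2) m2
      (fun x hx => by
        by_contra hc
        exact h0 (hA (by linarith [not_le.1 hc]) hx)) ♠
    rw [he] at hs
    have a1 : {x | x - δ/2 ∈ {x | x + δ / 2 ∈ A}} = A := by ext x; simp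
    rw [a1] at hs
    have a2 : ga {x | x + δ / 2 ∈ A} ≤ ga {x | x + δ ∈ A} :=
      measure_mono fun x hx => hA (by linarith) hx
    calc _ ≤ k * ga {x | x + δ ∈ A} + e * ga {x | x + δ ∈ A} := by
          gcongr
          · exact mul_le_of_le_one_left' prob_le_one
          · exact hs.trans (by gcongr)
      _ = _ := by rw [← add_mul, hk, one_mul]
lemma bAx (q : ℝ → ℝ) (hq : Monotone q) (h0 : ∀ x, 0 ≤ q x) {δ : ℝ} (hδ : 0 < δ) :
    ofReal (kp δ) * (∫⁻ x, ∫⁻ y, ofReal (q (y + δ) - q x) ∂ga ∂ga)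
      + ∫⁻ x, ofReal (q x) ∂ga ≤ ∫⁻ x, ofReal (q (x + δ)) ∂ga := by
  have mq : Measurable q := hq.measurable
  have mqd : Measurable fun x => q (x + δ) := mq.comp (measurable_id.add_const δ)
  rw [lintegral_eq_lintegral_meas_lt _ (ae_of_all _ h0) mq.aemeasurable,
    lintegral_eq_lintegral_meas_lt _ (ae_of_all _ fun x => h0 _) mqd.aemeasurable]
  have key : ∫⁻ x, ∫⁻ y, ofReal (q (y + δ) - q x) ∂ga ∂ga
      = ∫⁻ t in Ioi 0, ga {x | t < q x}ᶜ * ga {x | x + δ ∈ {x | t < q x}} := by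
    have e1 : ∀ t, ga {x | t < q x}ᶜ * ga {x | x + δ ∈ {x | t < q x}} =
        (ga.prod ga) {p | q p.1 ≤ t ∧ t < q (p.2 + δ)} := by
      intro t
      rw [← Measure.prod_prod]
      congr 1; ext p; simp
    simp_rw [e1]
    have mS : MeasurableSet {r : ℝ × (ℝ × ℝ) | q r.2.1 ≤ r.1 ∧ r.1 < q (r.2.2 + δ)} := by
      apply MeasurableSet.inter
      · exact measurableSet_le (mq.comp (measurable_fst.comp measurable_snd)) measurable_fst
      · exact measurableSet_lt measurable_fst (mqd.comp (measurable_snd.comp measurable_snd))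
    have l1 := Measure.prod_apply (μ := volume.restrict (Ioi (0:ℝ))) (ν := ga.prod ga) mS
    have l2 := Measure.prod_apply_symm (μ := volume.restrict (Ioi (0:ℝ))) (ν := ga.prod ga) mS
    have l3 := l2.symm.trans l1
    simp only [preimage_ofPred_eq] at l3
    rw [← l3]
    have e2 : ∀ p : ℝ × ℝ, (volume.restrict (Ioi (0:ℝ))) {t | q p.1 ≤ t ∧ t < q (p.2 + δ)} =
        ofReal (q (p.2 + δ) - q p.1) := by
      intro p
      rw [← Real.volume_Ico, Measure.restrict_congr_set Ioi_ae_eq_Ici,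
        Measure.restrict_apply (by exact measurableSet_Ico)]
      congr 1; ext t
      simp only [mem_inter_iff, mem_ofPred_eq, mem_Ici, mem_Ico]
      exact ⟨fun h => h.1, fun h => ⟨h, (h0 _).trans h.1⟩⟩
    simp_rw [e2]
    rw [lintegral_prod _ (by fun_prop)]
  rw [key, ← lintegral_const_mul', ← lintegral_add_right']
  · refine lintegral_mono fun t => ?_
    exact bA (A := {x | t < q x}) (fun x y h hx => lt_of_lt_of_le hx (hq h)) hδ
  · apply Measurable.aemeasurable
    apply Antitone.measurable
    exact fun s t h => measure_mono fun x (hx : t < q x) => lt_of_le_of_lt h hx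
  · exact ENNReal.ofReal_ne_top
theorem bAy {δ : ℝ} (hδ : 0 < δ) : ∀ {n : ℕ} {A : Set (Fin n → ℝ)} (_ : MeasurableSet A)
    (_ : IsUpperSet A),
    ofReal (kp δ) * (NI n Aᶜ * NI n {y | (fun i => y i + δ) ∈ A}) + NI n A
      ≤ NI n {y | (fun i => y i + δ) ∈ A}
  | 0, A, _, _ => by
    rcases aYy A with h | h <;> simp [h]
  | n + 1, A, hA, uA => by
    have msh : ∀ n, Measurable fun (y : Fin n → ℝ) => fun i => y i + δ := fun n => by fun_prop
    have mAd : MeasurableSet {y : Fin (n+1) → ℝ | (fun i => y i + δ) ∈ A} := msh _ hA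
    set p : ℝ → ENNReal := fun x => NI n {y | (Fin.cons x y : Fin (n+1) → ℝ) ∈ A} with hp
    set q : ℝ → ENNReal :=
      fun x => NI n {y | (Fin.cons x (fun i => y i + δ) : Fin (n+1) → ℝ) ∈ A} with hq
    have hqm : Monotone q := fun x x' h => measure_mono fun y hy => uA (aY h le_rfl) hy
    have mp : Measurable p := aXz hA
    have eq1 : NI (n+1) {y : Fin (n+1) → ℝ | (fun i => y i + δ) ∈ A} = ∫⁻ x, q (x + δ) ∂ga := by
      rw [aXx mAd]
      refine lintegral_congr fun x => ?_
      congr 1; ext y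
      simp only [mem_ofPred_eq]
      have : (fun i => (Fin.cons x y : Fin (n+1) → ℝ) i + δ) =
          Fin.cons (x + δ) (fun i => y i + δ) := by
        ext i; refine Fin.cases ?_ (fun j => ?_) i <;> simp
      rw [this]
    have eq2 : NI (n+1) A = ∫⁻ x, p x ∂ga := aXx hA
    have eq3 : NI (n+1) Aᶜ = ∫⁻ x, (1 - p x) ∂ga := by
      rw [aXx hA.compl]
      refine lintegral_congr fun x => ?_
      rw [← prob_compl_eq_one_sub (aXy hA x)]
      rfl
    have ih : ∀ x, ofReal (kp δ) * ((1 - p x) * q x) + p x ≤ q x := by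
      intro x
      have := bAy hδ (aXy hA x) (fun y y' h hy => uA (aY le_rfl h) hy)
      rwa [prob_compl_eq_one_sub (aXy hA x)] at this
    have hfin : ∀ x, q x ≠ ⊤ := fun x => measure_ne_top _ _
    have h1 := bAx (fun x => (q x).toReal)
      (fun x x' h => ENNReal.toReal_mono (hfin _) (hqm h)) (fun x => toReal_nonneg) hδ
    have h2 : ∀ x y, ofReal ((q (y + δ)).toReal - (q x).toReal) = q (y + δ) - q x := by
      intro x y
      rw [ofReal_sub _ toReal_nonneg, ofReal_toReal (hfin _),
        ofReal_toReal (hfin _)]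
    simp_rw [h2, ofReal_toReal (hfin _)] at h1
    rw [eq1, eq2, eq3]
    refine le_trans ?_ h1
    set k := ofReal (kp δ)
    have mqd : Measurable fun y => q (y + δ) := hqm.measurable.comp (measurable_id.add_const δ)
    have m3 : Measurable fun x => ∫⁻ y, (q (y + δ) - q x) ∂ga := by
      apply Antitone.measurable
      exact fun x x' h => lintegral_mono fun y => tsub_le_tsub_left (hqm h) _
    rw [← lintegral_mul_const _ (by fun_prop), ← lintegral_const_mul _ (by fun_prop), ← lintegral_add_right _ mp,
      ← lintegral_const_mul _ m3, ← lintegral_add_left (m3.const_mul _)]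
    refine lintegral_mono fun x => ?_
    refine le_trans ?_ (add_le_add_right (ih x) _)
    rw [← add_assoc, ← mul_add]
    gcongr
    calc (1 - p x) * ∫⁻ y, q (y + δ) ∂ga
        ≤ (1 - p x) * ((∫⁻ y, (q (y + δ) - q x) ∂ga) + q x) := by
          gcongr
          calc ∫⁻ y, q (y + δ) ∂ga ≤ ∫⁻ y, ((q (y + δ) - q x) + q x) ∂ga :=
                lintegral_mono fun y => le_tsub_add
            _ = _ := by rw [lintegral_add_right _ measurable_const]; simp
      _ ≤ _ := by
          rw [mul_add]
          gcongr
          exact mul_le_of_le_one_left' tsub_le_self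
end aYz
end
section
section five
variable {d : ℕ} {Ω : Type*} [MeasurableSpace Ω] {P : Measure Ω} [IsProbabilityMeasure P]
  {φ : V d → Ω → ℝ}
lemma bAz {Ω : Type*} [MeasurableSpace Ω] {P : Measure Ω} (b : Ω → 𝕊 d) (n : ℕ) (x : V d)
    (q : ENNReal) (h : ∀ T ∈ Tr n x, P {ω | ∀ y ∈ T, y ∈ b ω} ≤ q ^ (2 ^ n)) :
    P {ω | Bad (b ω) n x} ≤ (3000000 ^ (2 * d) * q) ^ (2 ^ n) := by
  calc P {ω | Bad (b ω) n x} ≤ P (⋃ T ∈ Tr n x, {ω | ∀ y ∈ T, y ∈ b ω}) := by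
        refine measure_mono fun ω hω => ?_
        obtain ⟨T, hT, hb⟩ := aG hω
        exact mem_biUnion hT hb
    _ ≤ ∑ T ∈ Tr n x, P {ω | ∀ y ∈ T, y ∈ b ω} := measure_biUnion_finset_le _ _
    _ ≤ ∑ T ∈ Tr n x, q ^ (2 ^ n) := sum_le_sum h
    _ ≤ _ := by
        rw [sum_const, nsmul_eq_mul, mul_pow]
        gcongr
        exact_mod_cast aGx n x
lemma bB (hd : 3 ≤ d) (s j : ℕ) (hs : 1 ≤ s) :
    kap d (s * 1000000 ^ j) ≤ 2 * (1 / 10000) ^ j * kap d s := by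
  have hc := aJz hd 0
  unfold kap at hc ⊢
  simp only [Nat.cast_zero] at hc
  norm_num at hc
  rw [mul_left_comm]
  refine mul_le_mul_of_nonneg_left ?_ (by simpa using hc.le)
  have hs' : (1:ℝ) ≤ s := by exact_mod_cast hs
  have h1 : ((s:ℝ)^2 + 1) * ((1000000 ^ j) ^ 2) / 8 ≤ ((s * 1000000 ^ j : ℕ) : ℝ)^2 + 1 := by
    push_cast
    have : 0 ≤ ((1000000:ℝ) ^ j) ^ 2 := by positivity
    nlinarith [mul_nonneg this (sub_nonneg.2 (one_le_pow₀ hs' : 1 ≤ (s:ℝ)^2))]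
  calc _ ≤ (((s:ℝ)^2 + 1) * ((1000000 ^ j) ^ 2) / 8) ^ (-(1/3) : ℝ) :=
        rpow_le_rpow_of_nonpos ♠ h1 ♣
    _ = _ := by
        rw [Real.div_rpow ♠ ♠, mul_rpow ♠ ♠]
        have e1 : (8:ℝ) ^ (-(1/3) : ℝ) = 1 / 2 := by
          rw [show (8:ℝ) = 2 ^ (3:ℝ) by norm_num, ← rpow_mul ♣]; norm_num
        have e2 : (((1000000:ℝ) ^ j) ^ 2) ^ (-(1/3) : ℝ) = (1 / 10000) ^ j := by
          rw [← pow_mul, mul_comm, pow_mul, ← rpow_natCast, ← rpow_mul ♠,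
            mul_comm, rpow_mul ♠, rpow_natCast]
          congr 1
          rw [show ((1000000:ℝ) ^ 2) = 10000 ^ (3:ℝ) by norm_num, ← rpow_mul ♣]
          norm_num
        rw [e1, e2]; ring
lemma bBx (hd : 3 ≤ d) (s n : ℕ) (hs : 1 ≤ s) :
    ∑ j ∈ Finset.range n, 2 ^ j * kap d (s * 1000000 ^ j) ≤ 4 * kap d s := by
  have hk := (aJz hd s).le
  calc _ ≤ ∑ j ∈ Finset.range n, (1 / 2 : ℝ) ^ j * (2 * kap d s) := by
        refine sum_le_sum fun j _ => ?_
        have h1 := bB hd s j hs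
        have h2 : (2:ℝ) ^ j * (1 / 10000) ^ j ≤ (1 / 2) ^ j := by
          rw [← mul_pow]; gcongr; norm_num
        calc _ ≤ 2 ^ j * (2 * (1 / 10000) ^ j * kap d s) := by gcongr
          _ = (2 ^ j * (1 / 10000) ^ j) * (2 * kap d s) := by ring
          _ ≤ _ := by gcongr
    _ ≤ _ := by
        rw [← sum_mul]
        have h3 : ∑ j ∈ Finset.range n, (1 / 2 : ℝ) ^ j ≤ 2 := by
          have := Summable.sum_le_tsum (Finset.range n) (fun i _ => by positivity) summable_geometric_two
          rwa [tsum_geometric_two] at this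
        nlinarith
lemma bBy (hd : 3 ≤ d) (hφ : IsGFF P φ) (s : ℝ) (hs : s ^ 2 = 1) {h : ℝ} (hh : 0 ≤ h) {n : ℕ} {x : V d}
    {T : 𝔽 d} (hT : T ∈ Tr n x) :
    P {ω | ∀ y ∈ T, y ∈ {y | h ≤ s * φ y ω}} ≤
      ofReal (exp (-h ^ 2 / (2 * (5 * kap d 0)))) ^ (2 ^ n) := by
  classical
  have hk := aJz hd
  obtain ⟨h1, h2, h3⟩ := aGz (kap d) (aJy hd) hT
  have := (aTx hd hφ).tree T (fun _ => {()}) (fun y _ => s • ev y)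
    (fun x y => kap d (dinf x y)) (5 * kap d 0) h 1 (by have := hk 0; positivity) hh
    (fun i _ j _ _ _ _ _ => ?_) (fun i hi => ?_) (by simp)
  · rw [h1] at this
    refine le_trans (measure_mono fun ω hω => ?_) (this.trans (by simp))
    intro i hi
    refine ⟨(), by simp, ?_⟩
    rw [map_smul, aSy]
    exact hω i hi
  · have e : Qg d (s • ev i) (s • ev j) = s ^ 2 * green d i j := by
      simp only [map_smul, LinearMap.smul_apply, aSx, smul_eq_mul]; ring
    rw [e, hs, one_mul]
    exact aKx hd i j
  · rw [← add_sum_erase _ _ hi]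
    have e1 : dinf i i = 0 := by simp [dinf]
    have e2 : ∑ m ∈ Finset.range n, 2 ^ m * kap d (9000 * 1000000 ^ m) ≤ 4 * kap d 9000 :=
      bBx hd 9000 n ♣
    have e3 := aJy hd (Nat.zero_le 9000)
    have := h3 i hi
    rw [e1]
    linarith
lemma bBz (hd : 3 ≤ d) (hφ : IsGFF P φ) : ∃ h : ℝ, 0 ≤ h ∧ ∀ s : ℝ, s ^ 2 = 1 → ∀ n (x : V d),
    P {ω | Bad {y | h ≤ s * φ y ω} n x} ≤ (1 / 2) ^ (2 ^ n) := by
  set K : ℝ := 3000000 ^ (2 * d) with hK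
  have hK0 : 0 < K := by positivity
  have hk := aJz hd 0
  have t : Tendsto (fun h : ℝ => exp (-h ^ 2 / (2 * (5 * kap d 0)))) atTop (nhds 0) := by
    refine Real.tendsto_exp_atBot.comp ?_
    have : (fun h : ℝ => -h ^ 2 / (2 * (5 * kap d 0))) = fun h => -(h ^ 2 / (2 * (5 * kap d 0))) := by
      ext h; ring
    rw [this]
    exact tendsto_neg_atTop_atBot.comp ((tendsto_pow_atTop two_ne_zero).atTop_div_const ♠)
  have := (t.eventually (gt_mem_nhds (show (0:ℝ) < 1 / (2 * K) by positivity))).and (eventually_ge_atTop 0)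
  obtain ⟨h, h1, h2⟩ := this.exists
  refine ⟨h, h2, fun s hs n x => (bAz _ n x _ fun T hT => bBy hd hφ s hs h2 hT).trans ?_⟩
  gcongr
  calc _ ≤ ofReal K * ofReal (1 / (2 * K)) := by
        gcongr
        rw [hK, ofReal_pow ♣]; simp
    _ = ofReal (1 / 2) := by
        rw [← ofReal_mul hK0.le]; congr 1; field_simp
    _ = 1 / 2 := by
        rw [ofReal_div_of_pos ♣]; simp
lemma bC {c x : V d} {N : ℕ} : x ∈ boxAt c (N : ℝ) ↔ dinf x c ≤ N := by
  rw [aAy]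
  refine forall_congr' fun i => ?_
  rw [← Int.cast_sub, ← cast_abs, ← cast_natAbs, Nat.cast_le]
lemma bCx {S : 𝕊 d} (x : V d) : Cd (comp S x) := by
  have h : ∀ y, y ∈ comp S x ↔ Cn S x y := fun y => by
    simp [comp, aAx]
  have h2 : ∀ y, Cn S x y → Cn (comp S x) x y := by
    intro y hy
    have := hy.ind (fun y => Cn S x y ∧ Cn (comp S x) x y)
      ⟨Cn.refl hy.left, Cn.refl ((h x).2 (Cn.refl hy.left))⟩
      (fun a b ha hb hab hh => by
        have hb' := hh.1.trans (Cn.step ha hb hab)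
        exact ⟨hb', hh.2.trans (Cn.step ((h a).2 hh.1) ((h b).2 hb') hab)⟩)
    exact this.2
  intro y hy z hz
  exact (h2 y ((h y).1 hy)).symm.trans (h2 z ((h z).1 hz))
lemma bCy {S : 𝕊 d} {x y : V d} : y ∈ comp S x ↔ Cn S x y := by
  simp [comp, aAx]
lemma bCz (c : ENNReal) (hc : c ≠ ⊤) :
    Tendsto (fun n : ℕ => c * (1 / 2 : ENNReal) ^ (2 ^ n)) atTop (nhds 0) := by
  have h1 : Tendsto (fun n : ℕ => (1 / 2 : ENNReal) ^ n) atTop (nhds 0) :=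
    ENNReal.tendsto_pow_atTop_nhds_zero_of_lt_one (by rw [one_div]; exact ENNReal.inv_lt_one.2 ♣)
  have h2 := h1.comp (tendsto_pow_atTop_atTop_of_one_lt (show 1 < 2 by norm_num))
  have := ENNReal.Tendsto.const_mul (a := c) h2 (Or.inr hc)
  simpa using this
lemma bD (hd : 3 ≤ d) (hφ : IsGFF P φ) : BddAbove {h : ℝ | StronglyPerc d P φ h} := by
  obtain ⟨h0, h00, hb⟩ := bBz hd hφ
  refine ⟨h0, fun h hh => ?_⟩
  by_contra hlt
  push Not at hlt
  obtain ⟨c, hc, ρ, hρ, H⟩ := hh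
  set I : 𝔽 d := Fintype.piFinset fun _ => Finset.Icc (-6) 6
  have key : ∀ n : ℕ, ofReal (1 - exp (-c * ((5 * 1000000 ^ n : ℕ) : ℝ) ^ ρ)) ≤
      I.card * (1 / 2) ^ (2 ^ n) := by
    intro n
    refine (H h le_rfl (5 * 1000000 ^ n) (by have := one_le_pow n 1000000 ♣; omega)).1.trans ?_
    calc _ ≤ P (⋃ y ∈ I, {ω | Bad {y | h0 ≤ 1 * φ y ω} n y}) := by
          refine measure_mono ?_
          rintro ω ⟨x, hx, p, hp, q, hq, hpq⟩
          have hpq' : 1000000 ^ n ≤ dinf p q := by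
            push_cast at hpq
            rw [mul_div_cancel_left₀ _ (by norm_num : (5:ℝ) ≠ 0)] at hpq
            exact_mod_cast hpq
          have hit := aFz {y | h0 ≤ 1 * φ y ω} n _ (bCx x) p q hp hq hpq'
          have hpb := (bCy.1 hp).right.2
          rw [box, bC, aAy] at hpb
          refine mem_biUnion (x := idx (1000000 ^ n) p) ?_ ?_
          · simp only [mem_coe, I, Fintype.mem_piFinset, Finset.mem_Icc]
            intro i
            have h1 := aFy n p i
            have h2 := hpb i
            simp only [Pi.zero_apply, sub_zero] at h2
            have h3 : (0:ℤ) < 1000000 ^ n := by positivity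
            have h4 : |p i| ≤ 5 * 1000000 ^ n := by
              rw [← Int.natCast_natAbs]; exact_mod_cast h2
            rw [abs_le] at h4
            constructor <;> by_contra hcc <;> nlinarith
          · by_contra hbad
            have hg := aEz hbad
            have : comp (lvl φ h ω ∩ box d ((5 * 1000000 ^ n : ℕ) : ℝ)) x ∩
                CC {y | h0 ≤ 1 * φ y ω} n (idx (1000000 ^ n) p) = ∅ := by
              rw [eq_empty_iff_forall_notMem]
              rintro z ⟨hz1, hz2⟩
              refine hg hz2 ?_
              have h5 : h ≤ φ z ω := (bCy.1 hz1).right.1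
              rw [mem_ofPred_eq, one_mul]
              linarith
            rw [this, encard_empty] at hit
            simp at hit
      _ ≤ ∑ y ∈ I, P {ω | Bad {y | h0 ≤ 1 * φ y ω} n y} := measure_biUnion_finset_le _ _
      _ ≤ ∑ y ∈ I, (1 / 2) ^ (2 ^ n) := sum_le_sum fun y _ => hb 1 ♣ n y
      _ = _ := by rw [sum_const, nsmul_eq_mul]
  have t1 := bCz (I.card : ENNReal) (by simp)
  have t2 : Tendsto (fun n : ℕ => ofReal (1 - exp (-c * ((5 * 1000000 ^ n : ℕ) : ℝ) ^ ρ)))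
      atTop (nhds (ofReal (1 - 0))) := by
    refine tendsto_ofReal (tendsto_const_nhds.sub (Real.tendsto_exp_atBot.comp ?_))
    refine Tendsto.const_mul_atTop_of_neg (by linarith) ((tendsto_rpow_atTop hρ.1).comp ?_)
    refine tendsto_natCast_atTop_atTop.comp ?_
    exact (tendsto_pow_atTop_atTop_of_one_lt (by norm_num : 1 < 1000000)).const_mul_atTop' ♣
  have := le_of_tendsto_of_tendsto' t2 t1 key
  norm_num at this
lemma bDx {c a b : V d} {r : ℝ} (ha : a ∈ boxAt c r) (hb : b ∉ boxAt c r) (h : adj a b) :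
    a ∈ bdryAt c r := ⟨ha, b, hb, h⟩
lemma bDy (hd : 3 ≤ d) (hφ : IsGFF P φ) : (tildeSet d P φ).Nonempty := by
  obtain ⟨h0, h00, hb⟩ := bBz hd hφ
  refine ⟨-h0, ?_⟩
  have i0 : Fin d := ⟨0, by omega⟩
  set ax : ℕ → V d := fun k => Function.update 0 i0 (k : ℤ) with hax
  set Rn : ℕ → ℕ := fun n => ⌈exp ((20 * n) ^ 3)⌉₊ with hRn
  have key : ∀ n : ℕ, 1 ≤ n → P {ω | ¬ ConnIn (lvl φ (-h0) ω) (box d (ufn ((Rn n : ℝ) + 1))) (bdry d ((Rn n : ℝ) + 1))} ≤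
      ((Rn n + 5 : ℕ) : ENNReal) * (1 / 2) ^ (2 ^ n) := by
    intro n hn
    set R := Rn n
    have hRge : exp ((20 * n) ^ 3) ≤ R := le_ceil _
    have hE : (3 * 1000000 ^ n : ℝ) ≤ exp (20 * n) := by
      calc (3 * 1000000 ^ n : ℝ) ≤ 3000000 ^ n := by
            rw [show (3000000:ℝ) = 3 * 1000000 by norm_num, mul_pow]
            gcongr
            calc (3:ℝ) = 3 ^ 1 := by norm_num
              _ ≤ 3 ^ n := pow_le_pow_right₀ ♣ hn
        _ ≤ (exp 20) ^ n := by
            gcongr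
            calc (3000000:ℝ) ≤ 2.7 ^ 20 := by norm_num
              _ ≤ (exp 1) ^ 20 := by gcongr; linarith [exp_one_gt_d9]
              _ = _ := by rw [← exp_nat_mul]; norm_num
        _ = exp (20 * n) := by rw [← exp_nat_mul]; ring_nf
    have hu : (3 * 1000000 ^ n : ℝ) ≤ ufn (R + 1) := by
      refine hE.trans (Real.exp_le_exp.2 ?_)
      have : ((20 * n : ℝ) ^ 3) ≤ log (R + 1) := by
        rw [le_log_iff_exp_le ♠]; linarith
      calc (20 * n : ℝ) = ((20 * n : ℝ) ^ 3) ^ ((1:ℝ) / 3) := by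
            rw [← rpow_natCast, ← rpow_mul ♠]; norm_num
        _ ≤ _ := rpow_le_rpow ♠ this ♣
    calc _ ≤ P (⋃ k ∈ Finset.range (R + 5), {ω | Bad {y | h0 ≤ (-1) * φ y ω} n (ax k)}) := by
          refine measure_mono fun ω hω => ?_
          by_contra hcon
          simp only [mem_iUnion, not_exists] at hcon
          refine hω ?_
          set b := {y | h0 ≤ (-1) * φ y ω} with hbdef
          obtain ⟨c1, c2, c3⟩ := aFx (by omega : 2 ≤ d) b n
          set I : 𝕊 d := {y | ∃ k < R + 5, y = ax k} with hI
          have hIc : Cd I := by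
            rintro _ ⟨k, hk, rfl⟩ _ ⟨l, hl, rfl⟩
            refine aCy 0 i0 (k : ℤ) (l : ℤ) fun s hs1 hs2 => ⟨s.toNat, ?_, ?_⟩
            · have : max (k:ℤ) l < R + 5 := max_lt (by exact_mod_cast hk) (by exact_mod_cast hl)
              omega
            · have : 0 ≤ s := le_trans (le_min ♠ ♠) hs1
              simp [hax, Int.toNat_of_nonneg this]
          have hU := Cd.biUnion hIc (CC b n) (fun x _ => c1 x) (fun x _ => c2 x) (fun x _ y _ h => c3 x y h)
          have hsub : (⋃ x ∈ I, CC b n x) ⊆ lvl φ (-h0) ω := by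
            refine iUnion₂_subset ?_
            rintro _ ⟨k, hk, rfl⟩ z hz
            have := aEz (hcon k (Finset.mem_range.2 hk)) hz
            simp only [mem_compl_iff, mem_ofPred_eq] at this
            simp only [lvl, mem_ofPred_eq]; linarith
          obtain ⟨p, hp⟩ := c1 (ax 0)
          obtain ⟨q, hq⟩ := c1 (ax (R + 4))
          have hpq := (hU p (mem_biUnion ⟨0, by omega, rfl⟩ hp) q
            (mem_biUnion ⟨R + 4, by omega, rfl⟩ hq)).mono hsub
          have hpL := fun i => aEy b n _ p hp i
          have hqL := aEy b n _ q hq i0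
          have hpow : (1:ℤ) ≤ 1000000 ^ n := one_le_pow₀ ♣
          have hq2 : (R:ℤ) + 2 ≤ q i0 := by
            have := hqL.1
            simp only [hax, Function.update_self] at this
            push_cast at this
            nlinarith
          have hqout : q ∉ boxAt 𝕆 d ((R:ℝ) + 1) := by
            intro hc
            have := hc i0
            rw [Pi.zero_apply, cast_zero, sub_zero] at this
            have h2 := (abs_le.1 this).2
            have : ((R:ℝ) + 2) ≤ (q i0 : ℝ) := by exact_mod_cast hq2
            linarith
          have hpu : p ∈ box d (ufn ((R:ℝ) + 1)) := by
            intro i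
            have := hpL i
            have h0 : ax 0 i = 0 := by simp [hax]
            rw [h0, mul_zero] at this
            rw [Pi.zero_apply, cast_zero, sub_zero]
            refine le_trans ?_ hu
            rw [abs_le]
            have e1 : (0:ℤ) - 2 * 1000000 ^ n ≤ p i := this.1
            have e2 : p i < 0 + 3 * 1000000 ^ n := this.2
            have e1' : ((0:ℝ) - 2 * 1000000 ^ n) ≤ p i := by exact_mod_cast e1
            have e2' : ((p i : ℤ) : ℝ) < 0 + 3 * 1000000 ^ n := by exact_mod_cast e2
            have : (0:ℝ) < 1000000 ^ n := by positivity
            constructor <;> linarith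
          by_cases hpin : p ∈ boxAt 𝕆 d ((R:ℝ) + 1)
          · obtain ⟨a, b', h1, h2, h3, h4, -⟩ := hpq.first (fun z => z ∉ boxAt 𝕆 d ((R:ℝ) + 1))
              (by simpa using hpin) hqout
            rw [aAx]
            have ha := h1.right.2
            simp only [mem_ofPred_eq, not_not] at ha
            exact ⟨p, hpu, a, bDx ha h4 h2, h1.mono inter_subset_left⟩
          · exfalso
            apply hpin
            intro i
            have := hpL i
            have h0 : ax 0 i = 0 := by simp [hax]
            rw [h0, mul_zero] at this
            rw [Pi.zero_apply, cast_zero, sub_zero, abs_le]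
            have hR3 : (3:ℝ) * 1000000 ^ n ≤ R := by
              refine le_trans ?_ hRge
              have : (1:ℝ) ≤ n := by exact_mod_cast hn
              refine hE.trans (Real.exp_le_exp.2 ?_)
              exact le_self_pow₀ (by linarith) ♣
            have e1 : (0:ℤ) - 2 * 1000000 ^ n ≤ p i := this.1
            have e2 : p i < 0 + 3 * 1000000 ^ n := this.2
            have e1' : ((0:ℝ) - 2 * 1000000 ^ n) ≤ p i := by exact_mod_cast e1
            have e2' : ((p i : ℤ) : ℝ) < 0 + 3 * 1000000 ^ n := by exact_mod_cast e2
            have : (0:ℝ) < 1000000 ^ n := by positivity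
            constructor <;> linarith
      _ ≤ ∑ k ∈ Finset.range (R + 5), P {ω | Bad {y | h0 ≤ (-1) * φ y ω} n (ax k)} :=
          measure_biUnion_finset_le _ _
      _ ≤ ∑ k ∈ Finset.range (R + 5), (1 / 2) ^ (2 ^ n) :=
          sum_le_sum fun y _ => hb (-1) ♣ n _
      _ = _ := by rw [sum_const, nsmul_eq_mul, Finset.card_range]
  have hbound : ∀ᶠ n : ℕ in atTop, ofReal (((Rn n : ℝ) + 1) ^ d) *
      P {ω | ¬ ConnIn (lvl φ (-h0) ω) (box d (ufn ((Rn n : ℝ) + 1))) (bdry d ((Rn n : ℝ) + 1))} ≤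
      ofReal (exp (-(log 2 / 2) * 2 ^ n)) := by
    have t := tendsto_pow_const_div_const_pow_of_one_lt 3 (show (1:ℝ) < 2 by norm_num)
    have hl : 0 < log 2 := log_pos ♣
    have ev1 := t.eventually (gt_mem_nhds (show (0:ℝ) < log 2 / 2 / (d + 1) / 8006 by positivity))
    filter_upwards [ev1, eventually_ge_atTop 1] with n h1 h2
    refine (mul_le_mul_right (key n h2) _).trans ?_
    have hn1 : (1:ℝ) ≤ n := by exact_mod_cast h2
    have hR : ((Rn n : ℝ) + 5) ≤ exp (8006 * n ^ 3) := by
      have e1 : (Rn n : ℝ) < exp ((20 * n) ^ 3) + 1 := Nat.ceil_lt_add_one (exp_pos _).le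
      have e2 : (1:ℝ) ≤ exp ((20 * n) ^ 3) := one_le_exp ♠
      have e3 : (7:ℝ) ≤ exp (6 * n ^ 3) := by
        have := add_one_le_exp (6 * (n:ℝ) ^ 3)
        have : (1:ℝ) ≤ n ^ 3 := one_le_pow₀ hn1
        linarith
      calc ((Rn n : ℝ) + 5) ≤ 7 * exp ((20 * n) ^ 3) := by linarith
        _ ≤ exp (6 * n ^ 3) * exp ((20 * n) ^ 3) := by gcongr
        _ = _ := by rw [← exp_add]; congr 1; ring
    have e4 : ((Rn n + 5 : ℕ) : ENNReal) * (1 / 2) ^ (2 ^ n) = ofReal (((Rn n : ℝ) + 5) * (1 / 2) ^ (2 ^ n)) := by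
      rw [ofReal_mul ♠, ofReal_pow ♣,
        ofReal_div_of_pos ♣, ofReal_add ♠ ♣]
      simp
    rw [e4, ← ofReal_mul ♠]
    apply ofReal_le_ofReal
    have e5 : ((1:ℝ) / 2) ^ (2 ^ n) = exp (-log 2 * 2 ^ n) := by
      rw [show -log 2 * 2 ^ n = ((2 ^ n : ℕ) : ℝ) * log (1 / 2) by
        rw [one_div, Real.log_inv]; push_cast; ring, exp_nat_mul, exp_log ♣]
    rw [e5, ← mul_assoc, ← le_div_iff₀ (exp_pos _), ← Real.exp_sub]
    calc ((Rn n : ℝ) + 1) ^ d * ((Rn n : ℝ) + 5) ≤ ((Rn n : ℝ) + 5) ^ d * ((Rn n : ℝ) + 5) := by gcongr; norm_num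
      _ = ((Rn n : ℝ) + 5) ^ (d + 1) := by rw [pow_succ]
      _ ≤ exp (8006 * n ^ 3) ^ (d + 1) := by gcongr
      _ = exp ((d + 1) * (8006 * n ^ 3)) := by rw [← exp_nat_mul]; push_cast; rfl
      _ ≤ _ := by
          apply Real.exp_le_exp.2
          rw [div_div, div_lt_div_iff₀ ♠ ♠] at h1
          nlinarith
  have t2 : Tendsto (fun n : ℕ => ofReal (exp (-(log 2 / 2) * 2 ^ n))) atTop (nhds 0) := by
    rw [← ENNReal.ofReal_zero]
    refine tendsto_ofReal (Real.tendsto_exp_atBot.comp ?_)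
    have hl : 0 < log 2 := log_pos ♣
    exact Tendsto.const_mul_atTop_of_neg (by linarith) (tendsto_pow_atTop_atTop_of_one_lt ♣)
  refine le_antisymm (ge_of_tendsto t2 ?_) zero_le
  filter_upwards [hbound] with n hn
  exact (iInf_le _ (Rn n)).trans hn
end five
end
section
variable {d : ℕ} {Ω : Type*} [MeasurableSpace Ω] {P : Measure Ω} [IsProbabilityMeasure P]
  {φ : V d → Ω → ℝ}
def pf {n : ℕ} (a : Fin n → V d → ℝ) (y : Fin n → ℝ) (x : V d) : ℝ := ∑ w, a w x * y w
def bDz (φ : V d → Ω → ℝ) (D : 𝔽 d) (ω : Ω) (x : V d) : ℝ := Wg φ (eta D x) ω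
def Spl (P : Measure Ω) (φ : V d → Ω → ℝ) (D : 𝔽 d) (a : Fin D.card → V d → ℝ) : Prop :=
  (∀ w x, 0 ≤ a w x) ∧ (∀ w x, x ∉ D → a w x = 0) ∧
  (∀ x y, GD D x y = ∑ w, a w x * a w y) ∧ ∀ A : Set ((V d → ℝ) × (V d → ℝ)), MeasurableSet A →
  P {ω | (bDz φ D ω, proc φ ω) ∈ A} =
    (P.prod (NI D.card)) {p | (bDz φ D p.1, bDz φ D p.1 + pf a p.2) ∈ A}
lemma bE (hd : 3 ≤ d) (hφ : IsGFF P φ) (D : 𝔽 d) : ∃ a, Spl P φ D a := aWz hd hφ D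
lemma bEx {n : ℕ} {a : Fin n → V d → ℝ} (h : ∀ w x, 0 ≤ a w x) : Monotone (pf a) :=
  fun _ _ hy x => sum_le_sum fun w _ => mul_le_mul_of_nonneg_left (hy w) (h w x)
lemma bEy {n : ℕ} {a : Fin n → V d → ℝ} : Measurable (pf a) := by unfold pf; fun_prop
lemma bEz (hd : 3 ≤ d) (hφ : IsGFF P φ) (D : 𝔽 d) : Measurable (bDz φ D) :=
  measurable_pi_lambda _ fun _ => (aTx hd hφ).meas _
lemma bF (hd : 3 ≤ d) (hφ : IsGFF P φ) {D : 𝔽 d} {a : Fin D.card → V d → ℝ}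
    (ha : Spl P φ D a) {δ : ℝ} (hδ : 0 < δ)
    {J G : Set (V d → ℝ)} (hJ : MeasurableSet J) (uJ : IsUpperSet J) (hG : MeasurableSet G)
    (b : ENNReal) (hb : ∀ η ∈ G, b ≤ NI D.card {y | η + pf a y ∈ J}) :
    ofReal (kp δ) * b * P {ω | bDz φ D ω ∈ G ∧ proc φ ω ∉ J} ≤
      P {ω | bDz φ D ω ∈ G ∧ proc φ ω ∉ J ∧ (proc φ ω + fun x => δ * ∑ w, a w x) ∈ J} := by
  have hm : Measurable fun p : (V d → ℝ) × (V d → ℝ) => p.2 + fun x => δ * ∑ w, a w x := by fun_prop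
  have h1 := ha.2.2.2 {p | p.1 ∈ G ∧ p.2 ∉ J}
    ((measurable_fst hG).inter (measurable_snd hJ).compl)
  have h2 := ha.2.2.2 {p | p.1 ∈ G ∧ p.2 ∉ J ∧ (p.2 + fun x => δ * ∑ w, a w x) ∈ J}
    ((measurable_fst hG).inter ((measurable_snd hJ).compl.inter (hm hJ)))
  simp only [mem_ofPred_eq] at h1 h2
  have he := bEz hd hφ D
  have hp : Measurable fun p : Ω × (Fin D.card → ℝ) => bDz φ D p.1 + pf a p.2 :=
    (he.comp measurable_fst).add (bEy.comp measurable_snd)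
  have hp' : Measurable fun p : Ω × (Fin D.card → ℝ) =>
      bDz φ D p.1 + pf a p.2 + fun x => δ * ∑ w, a w x := hp.add measurable_const
  have m1 : MeasurableSet {p : Ω × (Fin D.card → ℝ) | bDz φ D p.1 ∈ G ∧ bDz φ D p.1 + pf a p.2 ∉ J} :=
    ((he.comp measurable_fst) hG).inter (hp hJ).compl
  have m2 : MeasurableSet {p : Ω × (Fin D.card → ℝ) | bDz φ D p.1 ∈ G ∧
      bDz φ D p.1 + pf a p.2 ∉ J ∧ (bDz φ D p.1 + pf a p.2 + fun x => δ * ∑ w, a w x) ∈ J} :=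
    ((he.comp measurable_fst) hG).inter ((hp hJ).compl.inter (hp' hJ))
  rw [h1, h2, Measure.prod_apply m1, Measure.prod_apply m2, ← lintegral_const_mul _
    (measurable_measure_prodMk_left m1)]
  refine lintegral_mono fun ω => ?_
  by_cases hω : bDz φ D ω ∈ G
  · set A := {y | bDz φ D ω + pf a y ∈ J}
    have mA : MeasurableSet A := (measurable_const.add bEy) hJ
    have uA : IsUpperSet A := fun y y' hy h => uJ (add_le_add_right (bEx ha.1 hy) _) h
    have hs := bAy hδ mA uA
    set A' := {y : Fin D.card → ℝ | (fun i => y i + δ) ∈ A}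
    have hAA : A ⊆ A' := fun y hy => uA (fun i => by simp [hδ.le]) hy
    have e1 : Prod.mk ω ⁻¹' {p : Ω × (Fin D.card → ℝ) | bDz φ D p.1 ∈ G ∧
        bDz φ D p.1 + pf a p.2 ∉ J} = Aᶜ := by ext y; simp [A, hω]
    have e2 : Prod.mk ω ⁻¹' {p : Ω × (Fin D.card → ℝ) | bDz φ D p.1 ∈ G ∧
        bDz φ D p.1 + pf a p.2 ∉ J ∧ (bDz φ D p.1 + pf a p.2 + fun x => δ * ∑ w, a w x) ∈ J}
        = A' \ A := by
      ext y
      have : bDz φ D ω + pf a y + (fun x => δ * ∑ w, a w x) =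
          bDz φ D ω + pf a (fun i => y i + δ) := by
        rw [add_assoc]; congr 1; ext x
        simp [pf, mul_add, sum_add_distrib, mul_sum, mul_comm]
      simp only [mem_preimage, mem_ofPred_eq, hω, true_and, this, Set.mem_sdiff, A', A]; tauto
    simp only [e1, e2]
    rw [measure_sdiff hAA mA.nullMeasurableSet (measure_ne_top _ _)]
    refine ENNReal.le_sub_of_add_le_right (measure_ne_top _ _) (le_trans ?_ hs)
    rw [mul_assoc, mul_comm b]
    gcongr
    exact (hb _ hω).trans (measure_mono hAA)
  · have e1 : Prod.mk ω ⁻¹' {p : Ω × (Fin D.card → ℝ) | bDz φ D p.1 ∈ G ∧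
        bDz φ D p.1 + pf a p.2 ∉ J} = ∅ := by ext y; simp [hω]
    simp [e1]
lemma bFx {t : ℝ} (ht : 0 ≤ t) : ofReal (exp (-(t + 2) ^ 2)) ≤ ga (Ici t) := by
  have h0 : ga (Icc t (t + 1)) ≤ ga (Ici t) := measure_mono Icc_subset_Ici_self
  refine le_trans ?_ h0
  rw [gaussianReal_apply 0 one_ne_zero]
  have : ∫⁻ x in Icc t (t + 1), ofReal (exp (-(t + 2) ^ 2)) ∂volume
      = ofReal (exp (-(t + 2) ^ 2)) := by simp
  rw [← this]
  refine setLIntegral_mono' measurableSet_Icc fun x hx => ?_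
  refine ofReal_le_ofReal ?_
  simp only [gaussianPDFReal, NNReal.coe_one, mul_one, sub_zero]
  have h2 : sqrt (2 * Real.pi) ≤ exp 1 := by
    refine Real.sqrt_le_iff.2 ⟨(exp_pos _).le, ?_⟩
    have := exp_one_gt_d9; have := Real.pi_lt_d2; nlinarith
  have h3 : exp (-1) ≤ (sqrt (2 * Real.pi))⁻¹ := by
    rw [exp_neg]; exact inv_anti₀ (Real.sqrt_pos.2 ♠) h2
  refine le_trans ?_ (mul_le_mul_of_nonneg_right h3 (exp_pos _).le)
  rw [← exp_add]
  refine Real.exp_le_exp.2 ?_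
  nlinarith [hx.1, hx.2]
lemma bFy {n : ℕ} (a : Fin n → V d → ℝ) {x : V d} (h1 : 1 ≤ ∑ w, a w x * a w x) {t : ℝ}
    (ht : 0 ≤ t) : ga (Ici t) ≤ NI n {y | t ≤ pf a y x} := by
  have i1 : IsoG ga aRy (aRz 1) := by simpa using IsoG.one (v := 1) zero_le_one
  set σ := sqrt (∑ w, a w x * a w x)
  have hσ : σ * σ = ∑ w, a w x * a w x := mul_self_sqrt (by linarith)
  have := (i1.pi (ι := Fin n)).prob_eq i1 (J := Unit) (fun _ w => a w x) (fun _ => σ)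
    (fun _ _ => by simp [aRx, aRz, hσ]) (A := {f | t ≤ f ()})
    (measurableSet_le measurable_const (measurable_pi_apply _))
  simp only [mem_ofPred_eq, aR] at this
  have h2 : NI n {y | t ≤ pf a y x} = ga {z | t ≤ aRy σ z} := by rw [← this]; rfl
  rw [h2]
  refine measure_mono fun z (hz : t ≤ z) => ?_
  have : ℜ 1 ≤ σ := Real.one_le_sqrt.2 h1
  have h3 : aRy σ z = σ * z := by simp [aRy]
  simp only [mem_ofPred_eq, h3]
  nlinarith
lemma bFz {n : ℕ} {a : Fin n → V d → ℝ} (h0 : ∀ w x, 0 ≤ a w x) (s : 𝔽 d)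
    (h1 : ∀ x ∈ s, 1 ≤ ∑ w, a w x * a w x) {t : ℝ} (ht : 0 ≤ t) :
    ga (Ici t) ^ s.card ≤ NI n {y | ∀ x ∈ s, t ≤ pf a y x} := by
  induction s using induction_on with
  | empty => simp
  | insert x s hx ih =>
    have ih := ih fun z hz => h1 z (Finset.mem_insert_of_mem hz)
    have m1 : ∀ x, MeasurableSet {y | t ≤ pf a y x} := fun x =>
      measurableSet_le measurable_const ((measurable_pi_apply x).comp bEy)
    have m2 : MeasurableSet {y | ∀ x ∈ s, t ≤ pf a y x} := by
      have : {y | ∀ x ∈ s, t ≤ pf a y x} = ⋂ x ∈ s, {y | t ≤ pf a y x} := by ext; simp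
      rw [this]; exact measurableSet_biInter _ fun x _ => m1 x
    have := aYz (m1 x) m2 (fun y y' hy (h : _ ≤ _) => h.trans (bEx h0 hy x))
      (fun y y' hy h z hz => (h z hz).trans (bEx h0 hy z))
    rw [card_insert_of_notMem hx, pow_succ, mul_comm]
    refine (mul_le_mul' (bFy a (h1 x (mem_insert_self _ _)) ht) ih).trans (this.trans ?_)
    refine measure_mono fun y hy z hz => ?_
    rcases Finset.mem_insert.1 hz with rfl | hz
    exacts [hy.1, hy.2 z hz]
lemma bG (hd : 3 ≤ d) {D : 𝔽 d} {a : Fin D.card → V d → ℝ} (ha : Spl P φ D a) {x : V d}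
    (hx : x ∈ D) : 1 ≤ ∑ w, a w x * a w x := by
  rw [← ha.2.2.1]; exact aPy ♥ hx
lemma bGx (hd : 3 ≤ d) (hφ : IsGFF P φ) (D : 𝔽 d) (M : ℝ) :
    0 < P {ω | ∀ x ∈ D, M ≤ φ x ω} := by
  obtain ⟨a, ha⟩ := bE hd hφ D
  have mA : MeasurableSet {f : V d → ℝ | ∀ x ∈ D, M ≤ f x} := by
    have : {f : V d → ℝ | ∀ x ∈ D, M ≤ f x} = ⋂ x ∈ D, {f | M ≤ f x} := by ext; simp
    rw [this]
    exact measurableSet_biInter _ fun x _ =>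
      measurableSet_le measurable_const (measurable_pi_apply x)
  have h := ha.2.2.2 {p | ∀ x ∈ D, M ≤ p.2 x} (measurable_snd mA)
  simp only [mem_ofPred_eq] at h
  have hp : Measurable fun p : Ω × (Fin D.card → ℝ) => bDz φ D p.1 + pf a p.2 :=
    ((bEz hd hφ D).comp measurable_fst).add (bEy.comp measurable_snd)
  have h2 := hp mA
  change 0 < P {ω | ∀ x ∈ D, M ≤ proc φ ω x}
  rw [h, pos_iff_ne_zero]
  intro h0
  have h3 := (Measure.measure_prod_null h2).1 h0
  have h4 : ∀ ω, NI D.card (Prod.mk ω ⁻¹' {p : Ω × (Fin D.card → ℝ) | ∀ x ∈ D, M ≤ (bDz φ D p.1 + pf a p.2) x}) ≠ 0 := by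
    intro ω
    set t := ∑ x ∈ D, |M - bDz φ D ω x|
    have := bFz ha.1 D (fun x hx => bG hd ha hx) (t := t) ♠
    refine (lt_of_lt_of_le (ENNReal.pow_pos (lt_of_lt_of_le (ENNReal.ofReal_pos.2 (exp_pos _))
      (bFx (t := t) ♠)) _) (this.trans (measure_mono ?_))).ne'
    intro y hy x hx
    have h5 := hy x hx
    have h6 := single_le_sum (f := fun x => |M - bDz φ D ω x|) (fun _ _ => abs_nonneg _) hx
    have h7 := le_abs_self (M - bDz φ D ω x)
    simp only [Pi.add_apply]
    simp only [t] at h5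
    linarith
  have h5 := h3.exists
  obtain ⟨ω, hω⟩ := h5
  exact h4 ω hω
lemma bGy (hφ : IsGFF P φ) : IsGFF P (fun x ω => -φ x ω) := by
  refine ⟨fun x => (hφ.1 x).neg, fun s a => ?_⟩
  have := hφ.2 s (fun x => -a x)
  simpa using this
lemma bGz (hd : 3 ≤ d) (hφ : IsGFF P φ) (π : Equiv.Perm (Fin d)) (σ : Fin d → ℤˣ) (z : V d)
    {A : Set (V d → ℝ)} (hA : MeasurableSet A) :
    P {ω | (fun x => φ (iso π σ z x) ω) ∈ A} = P {ω | proc φ ω ∈ A} := by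
  have := (aTx hd hφ).prob_eq (aTx hd hφ) (fun x => ev (iso π σ z x)) ev
    (fun x y => by rw [aSx, aSx, aL]) hA
  simp only [aSy] at this
  exact this
lemma bH (π : Equiv.Perm (Fin d)) (σ : Fin d → ℤˣ) (z x y : V d) :
    dinf (iso π σ z x) (iso π σ z y) = dinf x y := by
  have h : ∀ i, (iso π σ z x i - iso π σ z y i).natAbs = (x (π i) - y (π i)).natAbs := by
    intro i
    simp only [iso, add_sub_add_right_eq_sub, ← mul_sub, natAbs_mul]
    simp
  refine le_antisymm (aAy.2 fun i => (h i).le.trans (aAy.1 le_rfl (π i)))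
    (aAy.2 fun i => ?_)
  have := h (π.symm i)
  rw [Equiv.apply_symm_apply] at this
  exact this.symm.le.trans (aAy.1 le_rfl (π.symm i))
lemma bHx (π : Equiv.Perm (Fin d)) (σ : Fin d → ℤˣ) (z : V d) {x y : V d} (h : adj x y) :
    adj (iso π σ z x) (iso π σ z y) := by
  unfold adj at *
  rw [← h, ← Equiv.sum_comp π fun i => (x i - y i).natAbs]
  refine sum_congr rfl fun i _ => ?_
  simp only [iso, add_sub_add_right_eq_sub, ← mul_sub, natAbs_mul]
  simp
lemma Cn.map_iso (π : Equiv.Perm (Fin d)) (σ : Fin d → ℤˣ) (z : V d) {S T : 𝕊 d} {x y : V d}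
    (h : Cn S x y) (hT : ∀ v ∈ S, iso π σ z v ∈ T) : Cn T (iso π σ z x) (iso π σ z y) := by
  refine h.ind (fun v => Cn T (iso π σ z x) (iso π σ z v)) (Cn.refl (hT _ h.left)) ?_
  intro a b ha hb hab hc
  exact hc.trans (.step (hT a ha) (hT b hb) (bHx π σ z hab))
def bx (c : V d) (N : ℕ) : 𝔽 d := Fintype.piFinset fun i => Finset.Icc (c i - N) (c i + N)
lemma bHy {c x : V d} {N : ℕ} : x ∈ bx c N ↔ dinf x c ≤ N := by
  simp only [bx, Fintype.mem_piFinset, Finset.mem_Icc, aAy]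
  exact forall_congr' fun i => by omega
lemma bHz {c x : V d} {N : ℕ} : x ∈ bx c N ↔ ∀ i, (x i - c i).natAbs ≤ N := by
  rw [bHy, aAy]
lemma bI (c : V d) (N : ℕ) : (bx c N).card = (2 * N + 1) ^ d := by
  simp only [bx, Fintype.card_piFinset, card_Icc]
  rw [prod_congr rfl (g := fun _ => 2 * N + 1) fun i _ => by omega]; simp
def Ev (Λ : 𝔽 d) (h : ℝ) (w q : V d) : Set (V d → ℝ) := {f | Cn ({x | h ≤ f x} ∩ Λ) w q}
lemma bIx (Λ : 𝔽 d) (h : ℝ) (w q : V d) : MeasurableSet (Ev Λ h w q) :=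
  aS (Ω := V d → ℝ) Λ.finite_toSet (fun x f => f x) (fun x => measurable_pi_apply x)
    (fun _ => h) (fun S => Cn S w q)
lemma bIy {f g : V d → ℝ} {Λ Λ' : 𝔽 d} {h h' : ℝ} {w q : V d} (hf : f ∈ Ev Λ h w q)
    (H : ∀ x ∈ Λ, h ≤ f x → x ∈ Λ' ∧ h' ≤ g x) : g ∈ Ev Λ' h' w q :=
  Cn.mono (S := {x | h ≤ f x} ∩ Λ) (T := {x | h' ≤ g x} ∩ Λ') (fun x hx => ⟨(H x hx.2 hx.1).2, (H x hx.2 hx.1).1⟩) hf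
lemma bIz (hd : 3 ≤ d) (hφ : IsGFF P φ) (π : Equiv.Perm (Fin d)) (σ : Fin d → ℤˣ) (z p : V d)
    (N : ℕ) (h : ℝ) : P {ω | proc φ ω ∈ Ev (bx 0 N) h 0 p} ≤
      P {ω | proc φ ω ∈ Ev (bx z N) h z (iso π σ z p)} := by
  have hz : iso π σ z 0 = z := by ext i; simp [iso]
  rw [← bGz hd hφ π σ z (bIx _ _ _ _)]
  refine measure_mono fun ω hω => ?_
  have := Cn.map_iso π σ z hω (T := {x | h ≤ φ x ω} ∩ bx z N) fun v hv => ⟨hv.1, by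
    have := hv.2
    simp only [mem_coe, bHy] at this ⊢
    have h2 := bH π σ z v 0
    rw [hz] at h2; omega⟩
  rw [hz] at this; exact this
def b1 (d U L : ℕ) : ENNReal := (2 * ((2 * U + 1) ^ d * (2 * L + 1) ^ d) : ENNReal)⁻¹
lemma bJ (hd : 3 ≤ d) (hφ : IsGFF P φ) {h u : ℝ} {U N L R : ℕ} (hu : u ≤ U) (hN : N ≤ L)
    (hR : L + U < R) (hP : 1 / 2 < P {ω | ConnIn (lvl φ h ω) (box d u) (bdry d R)}) :
    ∃ p : V d, dinf p 0 = N ∧ b1 d U L ≤ P {ω | proc φ ω ∈ Ev (bx 0 N) h 0 p} := by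
  by_contra! hc
  refine hP.not_ge ?_
  have hsub : {ω | ConnIn (lvl φ h ω) (box d u) (bdry d R)} ⊆
      ⋃ v ∈ bx 𝕆 d U, ⋃ p ∈ (bx 𝕆 d L).filter (dinf · 0 = N),
        {ω | proc φ ω ∈ Ev (bx v N) h v (iso 1 1 v p)} := by
    intro ω hω
    obtain ⟨v, hv, y, ⟨hy, z, hz, hyz⟩, hvy⟩ := aAx.1 hω
    have hv' : dinf v 0 ≤ U := bC.1 fun i => (hv i).trans hu
    have hz' : R < dinf z 0 := by by_contra! h; exact hz (bC.2 h)
    have h1 := aBx z y 0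
    have h2 := aC hyz
    have h3 := aBx y v 0
    rw [aB z y] at h1
    obtain ⟨a, b, ha, hab, hb, hpb, -⟩ := hvy.first (fun x => N < dinf x v)
      (by simp [dinf]) ♥
    have h4 := ha.right.2
    have h5 := aBx b a v
    have h6 := aC hab
    rw [aB a b] at h6
    simp only [mem_ofPred_eq, not_lt] at h4
    have e : iso 1 1 v (a - v) = a := by ext i; simp [iso]
    have e2 : dinf (a - v) 0 = dinf a v := by simp [dinf]
    simp only [mem_iUnion]
    refine ⟨v, bHy.2 hv', a - v, ?_, ?_⟩
    · rw [mem_filter, bHy, e2]; omega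
    · rw [e]
      exact Cn.mono (T := {x | h ≤ φ x ω} ∩ bx v N) (fun x hx => ⟨hx.1, by simpa [bHy] using hx.2⟩) ha
  refine (measure_mono hsub).trans ?_
  refine (measure_biUnion_finset_le _ _).trans ?_
  have h1 : ∀ v ∈ bx 𝕆 d U, P (⋃ p ∈ (bx 𝕆 d L).filter (dinf · 0 = N),
      {ω | proc φ ω ∈ Ev (bx v N) h v (iso 1 1 v p)}) ≤ (2 * L + 1 : ENNReal) ^ d * b1 d U L := by
    intro v _
    refine (measure_biUnion_finset_le _ _).trans ?_
    have h2 : ∀ p ∈ (bx 𝕆 d L).filter (dinf · 0 = N),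
        P {ω | proc φ ω ∈ Ev (bx v N) h v (iso 1 1 v p)} ≤ b1 d U L := by
      intro p hp
      have e0 : iso 1 1 (-v) v = 0 := by ext i; simp [iso]
      have := bGz hd hφ 1 1 v (bIx (bx 0 N) h 0 p)
      refine le_trans (measure_mono fun ω hω => ?_) (this.le.trans (hc p (Finset.mem_filter.1 hp).2).le)
      have := Cn.map_iso 1 1 (-v) hω (T := {x | h ≤ φ (iso 1 1 v x) ω} ∩ bx 𝕆 d N) fun x hx => ⟨by
        have := hx.1
        have e : iso 1 1 v (iso 1 1 (-v) x) = x := by ext i; simp [iso]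
        simpa [e, proc] using this, by
        have := hx.2
        simp only [mem_coe, bHy] at this ⊢
        have h2 := bH 1 1 (-v) x v
        rw [e0] at h2; exact h2.le.trans this⟩
      have e : iso 1 1 (-v) (iso 1 1 v p) = p := by ext i; simp [iso]
      rw [e, e0] at this
      exact this
    refine (sum_le_sum h2).trans ?_
    rw [sum_const, nsmul_eq_mul]
    gcongr
    refine (Nat.cast_le.2 (card_filter_le _ _)).trans ?_
    rw [bI]; push_cast; rfl
  refine (sum_le_sum h1).trans ?_
  rw [sum_const, nsmul_eq_mul, bI, b1, ENNReal.mul_inv (by simp) (by simp)]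
  push_cast
  rw [← mul_assoc, mul_comm (2⁻¹ : ENNReal), ← mul_assoc, ENNReal.mul_inv_cancel (by simp)
    (mul_ne_top (by finiteness) (by finiteness))]
  simp
lemma p2p (hd : 3 ≤ d) (hφ : IsGFF P φ) {h u : ℝ} {U N L R : ℕ} (hu : u ≤ U) (hN : N ≤ L)
    (hR : L + U < R) (hP : 1 / 2 < P {ω | ConnIn (lvl φ h ω) (box d u) (bdry d R)})
    (w w' : V d) (i : Fin d) (hw : ∀ j, j ≠ i → w' j = w j) (hwi : (w' i - w i).natAbs = 2 * N) :
    ∃ q : V d, b1 d U L ≤ P {ω | proc φ ω ∈ Ev (bx w N) h w q} ∧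
      b1 d U L ≤ P {ω | proc φ ω ∈ Ev (bx w' N) h w' q} := by
  obtain ⟨p, hp, hb⟩ := bJ hd hφ hu hN hR hP
  have hj : ∃ j, (p j).natAbs = N := by
    rcases Nat.eq_zero_or_pos N with h0 | h0
    · exact ⟨i, by have := aAy.1 hp.le i; simp at this; omega⟩
    · obtain ⟨j, hj⟩ := (aDz h0).1 hp.ge
      have := aAy.1 hp.le j
      exact ⟨j, by simp at this hj; omega⟩
  obtain ⟨j, hj⟩ := hj
  have hs : ∃ s : ℤˣ, w' i - w i = 2 * (s * p j) := by
    rcases (by omega : w' i - w i = 2 * p j ∨ w' i - w i = -(2 * p j)) with h | h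
    · exact ⟨1, by simp [h]⟩
    · exact ⟨-1, by simp [h]⟩
  obtain ⟨s, hs⟩ := hs
  refine ⟨iso (Equiv.swap i j) (fun k => if k = i then s else 1) w p,
    hb.trans (bIz hd hφ _ _ _ _ _ _), ?_⟩
  have : iso (Equiv.swap i j) (fun k => if k = i then s else 1) w p =
      iso (Equiv.swap i j) (fun k => if k = i then -s else 1) w' p := by
    ext k
    by_cases hk : k = i
    · subst hk; simp [iso]; linarith
    · simp [iso, hk, hw k hk]
  rw [this]
  exact hb.trans (bIz hd hφ _ _ _ _ _ _)
lemma bJx (hd : 3 ≤ d) (hφ : IsGFF P φ) (D S : 𝔽 d) {v ε : ℝ} (hε : 0 ≤ ε) (hv0 : 0 < v)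
    (hv : ∀ x ∈ S, Qg d (eta D x) (eta D x) ≤ v) :
    P {ω | ∃ x ∈ S, ε ≤ bDz φ D ω x} ≤ S.card * ofReal (exp (-ε ^ 2 / (2 * v))) := by
  have : {ω | ∃ x ∈ S, ε ≤ bDz φ D ω x} = ⋃ x ∈ S, {ω | ε ≤ Wg φ (eta D x) ω} := by ext; simp [bDz]
  rw [this]
  refine (measure_biUnion_finset_le _ _).trans ?_
  rw [← nsmul_eq_mul, ← sum_const]
  exact sum_le_sum fun x hx => (aTx hd hφ).tail (hv x hx) hv0 hε
lemma bJy {D : 𝔽 d} {a : Fin D.card → V d → ℝ}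
    (ha : Spl P φ D a) {S S' : 𝔽 d} (hS : S' ⊆ S) {h ε : ℝ} {w q : V d} {b : ENNReal}
    (hbt : b ≠ ⊤)
    (he : P {ω | ∃ x ∈ S, ε ≤ bDz φ D ω x} ≤ b / 2)
    (hb : b ≤ P {ω | proc φ ω ∈ Ev S' h w q}) :
    b / 2 ≤ NI D.card {y | pf a y ∈ Ev S (h - ε) w q} := by
  have h1 := ha.2.2.2 {p | p.2 ∈ Ev S' h w q} (measurable_snd (bIx _ _ _ _))
  simp only [mem_ofPred_eq] at h1
  have h2 : b ≤ b / 2 + NI D.card {y | pf a y ∈ Ev S (h - ε) w q} := by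
    refine (hb.trans h1.le).trans ?_
    have hsub : {p : Ω × (Fin D.card → ℝ) | bDz φ D p.1 + pf a p.2 ∈ Ev S' h w q} ⊆
        {ω | ∃ x ∈ S, ε ≤ bDz φ D ω x} ×ˢ univ ∪ univ ×ˢ {y | pf a y ∈ Ev S (h - ε) w q} := by
      rintro ⟨ω, y⟩ hp
      by_cases hx : ∃ x ∈ S, ε ≤ bDz φ D ω x
      · exact Or.inl ⟨hx, trivial⟩
      · push Not at hx
        refine Or.inr ⟨trivial, bIy hp fun x hx' h4 => ⟨hS hx', ?_⟩⟩
        have h3 := hx x (hS hx')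
        simp only [Pi.add_apply] at h4; linarith
    refine (measure_mono hsub).trans ((measure_union_le _ _).trans ?_)
    rw [Measure.prod_prod, Measure.prod_prod]; simp only [measure_univ, mul_one, one_mul]; gcongr
  have h3 : b / 2 ≠ ⊤ := (ENNReal.div_lt_top hbt (by simp)).ne
  have h4 : b / 2 + b / 2 ≤ b / 2 + NI D.card {y | pf a y ∈ Ev S (h - ε) w q} := by
    rwa [ENNReal.add_halves]
  exact (ENNReal.add_le_add_iff_left h3).1 h4
lemma bJz {n : ℕ} {a : Fin n → V d → ℝ} (h0 : ∀ w x, 0 ≤ a w x) {S : 𝔽 d} {h : ℝ}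
    (w w1 w2 : V d) : NI n {y | pf a y ∈ Ev S h w w1} * NI n {y | pf a y ∈ Ev S h w1 w2} ≤
      NI n {y | pf a y ∈ Ev S h w w2} := by
  have u : ∀ w w', IsUpperSet {y | pf a y ∈ Ev S h w w'} := fun w w' y y' hy hc =>
    bIy hc fun x hx hx' => ⟨hx, le_trans hx' (bEx h0 hy x)⟩
  have m : ∀ w w', MeasurableSet {y | pf a y ∈ Ev S h w w'} := fun w w' => bEy (bIx _ _ _ _)
  exact (aYz (m _ _) (m _ _) (u _ _) (u _ _)).trans
    (measure_mono fun y hy => Cn.trans hy.1 hy.2)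
lemma bK (E : V d → V d → ENNReal) (β : ENNReal) (c : V d) (K : ℕ) (i0 : Fin d)
    (ht : ∀ w w1 w2, E w w1 * E w1 w2 ≤ E w w2)
    (hx : ∀ (v v' : V d) (i : Fin d) (N : ℕ), (∀ j, j ≠ i → v' j = v j) → (v' i - v i).natAbs = N →
      (∀ j, 2 * (v j).natAbs + N ≤ K) → (∀ j, 2 * (v' j).natAbs + N ≤ K) →
      β ≤ E (c + 2 * v) (c + 2 * v'))
    (k n : ℕ) (v : V d) (hv : ∀ j, 2 * (v j).natAbs + n ≤ K) (hk : K ≤ n * 3 ^ k) :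
    β ^ (d * k + 1) ≤ E (c + 2 * v) c := by
  have base : β ≤ E (c + 2 * 0) (c + 2 * 0) := hx 0 0 i0 0 (by simp) (by simp) (by simp) (by simp)
  simp only [mul_zero, add_zero] at base
  induction k generalizing n v with
  | zero =>
    have : v = 0 := by ext j; have := hv j; simp at hk; simp; omega
    subst this; simpa using base
  | succ k ih =>
    set v' : V d := fun j => if (v j).natAbs ≤ n then 0 else if 0 ≤ v j then v j - n else v j + n
    have key : ∀ s : Finset (Fin d), ∀ T, β ^ s.card * E (c + 2 * fun j => if j ∈ s then v' j else v j) T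
        ≤ E (c + 2 * v) T := by
      intro s
      induction s using induction_on with
      | empty => intro T; simp
      | insert i s hi ih2 =>
        intro T
        refine le_trans ?_ (ih2 T)
        rw [card_insert_of_notMem hi, pow_succ, mul_assoc]
        gcongr
        refine le_trans ?_ (ht _ (c + 2 * fun j => if j ∈ insert i s then v' j else v j) _)
        gcongr
        refine hx _ _ i (v' i - v i).natAbs (fun j hj => by simp [hj]) (by simp [hi]) ?_ ?_ <;>
        · intro j
          have h1 := hv j
          have h2 := hv i
          simp only [v', Finset.mem_insert]
          split_ifs <;> omega
    have k1 := key Finset.univ c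
    simp only [Finset.mem_univ, if_true, card_univ, Fintype.card_fin] at k1
    have e : d * (k + 1) + 1 = d + (d * k + 1) := by ring
    rw [e, pow_add]
    refine le_trans (mul_le_mul_right ?_ _) k1
    by_cases h3 : 3 * n ≤ K
    · refine ih (3 * n) v' (fun j => ?_) (by rw [pow_succ] at hk; linarith)
      have h1 := hv j
      simp only [v']; split_ifs <;> omega
    · have : v' = 0 := by
        ext j; have h1 := hv j; simp only [v', Pi.zero_apply]; split_ifs <;> omega
      refine ih K v' (fun j => by simp [this]) (le_mul_of_pos_right _ ♠)
lemma bKx (w t : V d) (n : ℕ) (h : ∀ j, (w j - t j).natAbs ≤ n) :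
    ∃ s : 𝔽 d, s.card ≤ d * (n + 1) + 1 ∧ Cn (s : 𝕊 d) w t ∧
      ∀ x ∈ s, ∀ j, min (w j) (t j) ≤ x j ∧ x j ≤ max (w j) (t j) := by
  classical
  have key : ∀ I : Finset (Fin d), ∃ s : 𝔽 d, s.card ≤ I.card * (n + 1) + 1 ∧
      Cn (s : 𝕊 d) w (fun j => if j ∈ I then t j else w j) ∧
      ∀ x ∈ s, ∀ j, min (w j) (t j) ≤ x j ∧ x j ≤ max (w j) (t j) := by
    intro I
    induction I using induction_on with
    | empty =>
      refine ⟨{w}, by simp, ?_, by simp⟩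
      simpa using Cn.refl (S := ({w} : 𝕊 d)) rfl
    | insert i I hi ih =>
      obtain ⟨s, h1, h2, h3⟩ := ih
      set y : V d := fun j => if j ∈ I then t j else w j with hy
      refine ⟨s ∪ (Finset.Icc (min (w i) (t i)) (max (w i) (t i))).image (Function.update y i),
        ?_, ?_, ?_⟩
      · refine (Finset.card_union_le _ _).trans ?_
        have := card_image_le (s := Finset.Icc (min (w i) (t i)) (max (w i) (t i)))
          (f := Function.update y i)
        have h4 := h i
        rw [card_Icc] at this
        rw [card_insert_of_notMem hi, add_mul]
        omega
      · have l := aCy (S := (s ∪ (Finset.Icc (min (w i) (t i)) (max (w i) (t i))).image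
          (Function.update y i) : 𝔽 d)) y i (w i) (t i) (fun r hr hr' => by
            rw [mem_coe, Finset.mem_union]
            exact Or.inr (Finset.mem_image_of_mem _ (Finset.mem_Icc.2 ⟨hr, hr'⟩)))
        have e1 : Function.update y i (w i) = y := by
          ext j; by_cases hj : j = i
          · subst hj; simp [hy, hi]
          · simp [hj]
        have e2 : Function.update y i (t i) = fun j => if j ∈ insert i I then t j else w j := by
          ext j; by_cases hj : j = i
          · subst hj; simp
          · simp [hj, hy]
        rw [e1, e2] at l
        exact (h2.mono (by simp)).trans l
      · intro x hx j
        rcases Finset.mem_union.1 hx with hx | hx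
        · exact h3 x hx j
        · obtain ⟨r, hr, rfl⟩ := Finset.mem_image.1 hx
          by_cases hj : j = i
          · subst hj; simpa using hr
          · simp only [Function.update_of_ne hj, hy]; split_ifs <;> simp
  obtain ⟨s, h1, h2, h3⟩ := key Finset.univ
  exact ⟨s, by simpa using h1, by simpa using h2, h3⟩
def bKy (d U L l k : ℕ) (t : ℝ) : ENNReal :=
  ga (Ici t) ^ (d * (l + 5) + 1) * ((b1 d U L / 2) ^ 2) ^ (d * k + 1)
lemma bKz (hd : 3 ≤ d) {c : V d} {L : ℕ} {a : Fin (bx c L).card → V d → ℝ}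
    (ha : Spl P φ (bx c L) a) {K k l : ℕ} (hK : K + l = L) (hk1 : 1 ≤ K) (hk : K ≤ 3 ^ k) {h t : ℝ} (h0 : 0 ≤ t)
    {β : ENNReal}
    (hx : ∀ (v v' : V d) (i : Fin d) (N : ℕ), (∀ j, j ≠ i → v' j = v j) → (v' i - v i).natAbs = N →
      (∀ j, 2 * (v j).natAbs + N ≤ K) → (∀ j, 2 * (v' j).natAbs + N ≤ K) →
      β ≤ NI _ {y | pf a y ∈ Ev (bx c K) h (c + 2 * v) (c + 2 * v')}) {x w : V d}
      (hxw : adj x w) (hw : w ∈ bx c L) :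
    ∃ s : 𝔽 d, s ⊆ bx c L ∧
     ga (Ici t) ^ (d * (l + 5) + 1) * β ^ (d * k + 1) ≤ NI _ ({y | ∀ x ∈ s, t ≤ pf a y x} ∩
     {y | pf a y ∈ Ev (bx c K) h (c + 2 * fun j =>
        max (-((K - 1) / 2 : ℤ)) (min ((K - 1) / 2) ((w j - c j) / 2))) c}) ∧
      Cn (insert x s : 𝕊 d) x (c + 2 * fun j =>
        max (-((K - 1) / 2 : ℤ)) (min ((K - 1) / 2) ((w j - c j) / 2))) := by
  set v : V d := fun j => max (-((K - 1) / 2 : ℤ)) (min ((K - 1) / 2) ((w j - c j) / 2)) with hv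
  have hw' := bHz.1 hw
  have hvv : ∀ j, (c + 2 * v) j = c j + 2 * v j := fun j => by simp
  obtain ⟨s, h1, h2, h3⟩ := bKx w (c + 2 * v) (l + 4) (fun j => by
    have := hw' j; rw [hvv]; simp only [v]; omega)
  have hs : s ⊆ bx c L := fun x hx => bHz.2 fun j => by
    have h4 := h3 x hx j; have h5 := hw' j; rw [hvv] at h4; simp only [v] at h4; omega
  refine ⟨s, hs, ?_, ?_⟩
  · have c1 := bK (fun w w' => NI _ {y | pf a y ∈ Ev (bx c K) h w w'}) β c K ⟨0, by omega⟩
      (bJz ha.1) hx k 1 v (fun j => by simp only [v]; omega) (by simpa using hk)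
    have c2 := bFz ha.1 s (fun x hx => bG hd ha (hs hx)) h0
    refine le_trans ?_ (aYz ?_ (bEy (bIx _ _ _ _))
      (fun y y' hy h z hz => (h z hz).trans (bEx ha.1 hy z))
      (fun y y' hy h => bIy h fun x hx hx' => ⟨hx, le_trans hx' (bEx ha.1 hy x)⟩))
    · refine mul_le_mul' (le_trans ?_ c2) c1
      exact pow_le_pow_of_le_one zero_le prob_le_one (h1.trans (by ring_nf; omega))
    · have : {y | ∀ x ∈ s, t ≤ pf a y x} = ⋂ x ∈ s, {y | t ≤ pf a y x} := by ext; simp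
      rw [this]; exact measurableSet_biInter _ fun x _ =>
        measurableSet_le measurable_const ((measurable_pi_apply x).comp bEy)
  · have h4 : w ∈ (insert x s : 𝕊 d) := Or.inr h2.left
    exact (Cn.step (mem_insert _ _) h4 hxw).trans (h2.mono (subset_insert _ _))
lemma bL (hd : 3 ≤ d) (hφ : IsGFF P φ) {h u ε M : ℝ} {U L R l K k : ℕ} (hu : u ≤ U)
    (hR : L + U < R) (hP : 1 / 2 < P {ω | ConnIn (lvl φ h ω) (box d u) (bdry d R)})
    (hε : 0 ≤ ε) (hM : 0 ≤ M) (hK : K + l = L) (hk1 : 1 ≤ K) (hk : K ≤ 3 ^ k) {c : V d}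
    {a : Fin (bx c L).card → V d → ℝ} (ha : Spl P φ (bx c L) a)
    (hs : ((2 * L + 1 : ENNReal) ^ d) * ofReal (exp (-ε ^ 2 / (2 * kap d l))) ≤ b1 d U L / 2)
    {x x' w w' : V d} (hxw : adj x w) (hw : w ∈ bx c L) (hxw' : adj x' w') (hw' : w' ∈ bx c L)
    {η : V d → ℝ} (hη : ∀ z ∈ bx c K, -ε ≤ η z) (hη' : ∀ z ∈ bx c L, -M ≤ η z)
    {S : 𝕊 d} (hS : ∀ z ∈ bx c L, z ∈ S) (hxS : x ∈ S) (hxS' : x' ∈ S)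
    {F : V d → ℝ} (hF : ∀ z, 0 ≤ F z) (hxx : x ∉ bx c L ∧ x' ∉ bx c L)
    (hx : h - 2 * ε ≤ η x + F x) (hx' : h - 2 * ε ≤ η x' + F x') :
    bKy d U L l k (M + |h|) ^ 2 ≤ NI _ {y | Cn ({z | h - 2 * ε ≤ η z + pf a y z + F z} ∩ S) x x'} := by
  have hbt : b1 d U L ≠ ⊤ := by
    refine ENNReal.inv_ne_top.2 ♠
  have hax : ∀ (v v' : V d) (i : Fin d) (N : ℕ), (∀ j, j ≠ i → v' j = v j) → (v' i - v i).natAbs = N →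
      (∀ j, 2 * (v j).natAbs + N ≤ K) → (∀ j, 2 * (v' j).natAbs + N ≤ K) →
      (b1 d U L / 2) ^ 2 ≤ NI _ {y | pf a y ∈ Ev (bx c K) (h - ε) (c + 2 * v) (c + 2 * v')} := by
    intro v v' i N h1 h2 h3 h4
    have hvv : ∀ (v : V d) j, (c + 2 * v) j = c j + 2 * v j := fun v j => by simp
    have hb : ∀ v : V d, (∀ j, 2 * (v j).natAbs + N ≤ K) → bx (c + 2 * v) N ⊆ bx c K := by
      intro v h3 z hz
      refine bHz.2 fun j => ?_
      have := bHz.1 hz j; have := h3 j; rw [hvv] at *; omega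
    obtain ⟨q, q1, q2⟩ := p2p hd hφ hu (N := N) (by have := h3 i; omega) hR hP (c + 2 * v) (c + 2 * v') i
      (fun j hj => by simp [h1 j hj]) (by rw [hvv, hvv]; omega)
    have hsup : P {ω | ∃ x ∈ bx c K, ε ≤ bDz φ (bx c L) ω x} ≤ b1 d U L / 2 := by
      refine (bJx hd hφ _ _ hε (aJz hd l) fun x hx => ?_).trans (le_trans ?_ hs)
      · refine aWx hd (bHy.2 ((bHy.1 hx).trans ♥)) fun z hz => ?_
        have := aBx z x c; rw [bHy] at hx hz; omega
      · gcongr; rw [bI]; push_cast; gcongr; omega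
    have t1 := bJy ha (hb v h3) hbt hsup q1
    have t2 := bJy ha (hb v' h4) hbt hsup q2
    rw [pow_two]
    refine (mul_le_mul' t1 t2).trans (le_trans (le_of_eq ?_) (bJz ha.1 (c + 2 * v) q (c + 2 * v')))
    congr 2; ext y; exact ⟨Cn.symm, Cn.symm⟩
  have ht0 : 0 ≤ M + |h| := by positivity
  obtain ⟨s, s1, s2, s3⟩ := bKz hd ha hK hk1 hk ht0 hax hxw hw
  obtain ⟨s', s1', s2', s3'⟩ := bKz hd ha hK hk1 hk ht0 hax hxw' hw'
  have mm : ∀ s : 𝔽 d, MeasurableSet {y | ∀ x ∈ s, M + |h| ≤ pf a y x} := by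
    intro s
    have : {y | ∀ x ∈ s, M + |h| ≤ pf a y x} = ⋂ x ∈ s, {y | M + |h| ≤ pf a y x} := by ext; simp
    rw [this]; exact measurableSet_biInter _ fun x _ =>
        measurableSet_le measurable_const ((measurable_pi_apply x).comp bEy)
  have uu : ∀ s : 𝔽 d, IsUpperSet {y | ∀ x ∈ s, M + |h| ≤ pf a y x} :=
    fun s y y' hy h z hz => (h z hz).trans (bEx ha.1 hy z)
  have me : ∀ p, MeasurableSet {y | pf a y ∈ Ev (bx c K) (h - ε) p c} :=
    fun p => bEy (bIx _ _ _ _)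
  have ue : ∀ p, IsUpperSet {y | pf a y ∈ Ev (bx c K) (h - ε) p c} :=
    fun p y y' hy h => bIy h fun x hx hx' => ⟨hx, le_trans hx' (bEx ha.1 hy x)⟩
  rw [pow_two]
  refine (mul_le_mul' s2 s2').trans ((aYz ((mm s).inter (me _)) ((mm s').inter (me _))
    ((uu s).inter (ue _)) ((uu s').inter (ue _))).trans (measure_mono ?_))
  rintro y ⟨⟨y1, y2 : Cn _ _ _⟩, y1', y2' : Cn _ _ _⟩
  have hh := neg_abs_le h
  have hh' := le_abs_self h
  have hp0 : ∀ z, z ∉ bx c L → pf a y z = 0 := fun z hz =>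
    sum_eq_zero fun w _ => by rw [ha.2.1 w z hz, zero_mul]
  have hsub : ∀ (x : V d) (s : 𝔽 d), x ∈ S → h - 2 * ε ≤ η x + F x → x ∉ bx c L → s ⊆ bx c L →
      (∀ x ∈ s, M + |h| ≤ pf a y x) →
      (insert x s : 𝕊 d) ⊆ {z | h - 2 * ε ≤ η z + pf a y z + F z} ∩ S := by
    rintro x s hx1 hx2 hx3 hs1 hs2 z (rfl | hz)
    · refine ⟨?_, hx1⟩
      simp only [mem_ofPred_eq, hp0 _ hx3]; linarith
    · refine ⟨?_, hS z (hs1 hz)⟩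
      have := hs2 z hz; have := hη' z (hs1 hz); have := hF z
      simp only [mem_ofPred_eq]; linarith
  have hsub2 : ({x | h - ε ≤ pf a y x} ∩ (bx c K : 𝕊 d)) ⊆
      {z | h - 2 * ε ≤ η z + pf a y z + F z} ∩ S := by
    rintro z ⟨hz1, hz2⟩
    have := hη z hz2; have := hF z
    refine ⟨?_, hS z (bHy.2 ((bHy.1 hz2).trans ♥))⟩
    simp only [mem_ofPred_eq] at *; linarith
  exact ((s3.mono (hsub x s hxS hx hxx.1 s1 y1)).trans (y2.mono hsub2)).trans
    ((s3'.mono (hsub x' s' hxS' hx' hxx.2 s1' y1')).trans (y2'.mono hsub2)).symm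
lemma bLx (hd : 3 ≤ d) {E : Type*} [AddCommGroup E] [Module ℝ E] {W : E →ₗ[ℝ] (Ω → ℝ)} {Q : E →ₗ[ℝ] E →ₗ[ℝ] ℝ}
    (iso : IsoG P W Q) (hs : ∀ e f, Q e f = Q f e) {m : ℕ} (hm0 : 1 ≤ m) (A : 𝔽 d) (e : V d → V d → E) {ε v : ℝ} (hε : 0 < ε)
    (hv0 : 0 ≤ v) (hv : ∀ y, ∀ a ∈ A, Q (e y a) (e y a) ≤ v)
    (ho : ∀ i j, 9000 ≤ dinf i j → ∀ a ∈ A, ∀ b ∈ A, Q (e i a) (e j b) ≤ kap d (m * dinf i j / 2) / ε ^ 2)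
    {n : ℕ} {x : V d} {T S : 𝔽 d} (hT : T ∈ Tr n x) (hS : S ⊆ T) :
    P {ω | ∀ y ∈ S, ∃ a ∈ A, 1 ≤ W (e y a) ω} ≤
     ofReal (A.card * exp (-1 / (2 * (v + 4 * kap d (4500 * m) / ε ^ 2)))) ^ S.card := by
  set κ : ℕ → ℝ := fun k => kap d (m * k / 2)
  obtain ⟨-, t2, t3⟩ := aGz κ (fun i j hij => aJy hd (Nat.div_le_div_right
    (Nat.mul_le_mul_left _ hij))) hT
  have hκ : ∑ j ∈ Finset.range n, 2 ^ j * κ (9000 * 1000000 ^ j) ≤ 4 * kap d (4500 * m) := by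
    refine le_trans (le_of_eq ?_) (bBx hd (4500 * m) n ♥)
    refine sum_congr rfl fun j _ => ?_
    simp only [κ]; congr 2
    rw [show m * (9000 * 1000000 ^ j) = 2 * (4500 * m * 1000000 ^ j) by ring]; omega
  have := iso.tree S (fun _ => A) e
    (fun i j => if i = j then v else κ (dinf i j) / ε ^ 2) (v + 4 * kap d (4500 * m) / ε ^ 2) 1 A.card
    (by have := aJz hd (4500 * m); positivity) zero_le_one ?_ ?_ (fun _ _ => le_rfl)
  · simpa using this
  · intro i hi j hj a ha b hb
    by_cases hij : i = j
    · subst hij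
      simp only [if_true]
      have h1 := iso.nn (e i a - e i b)
      simp only [map_sub, LinearMap.sub_apply] at h1
      rw [hs (e i b) (e i a)] at h1
      linarith [hv i a ha, hv i b hb]
    · simp only [hij, if_false]
      exact ho i j (t2 i (hS hi) j (hS hj) hij) a ha b hb
  · intro i hi
    rw [← add_sum_erase _ _ hi]
    simp only [if_true]
    gcongr
    rw [sum_congr rfl (g := fun j => κ (dinf i j) / ε ^ 2) fun j hj => by
      rw [if_neg (ne_of_mem_erase hj).symm], ← sum_div]
    gcongr
    exact (Finset.sum_le_sum_of_subset_of_nonneg (Finset.erase_subset_erase _ hS) fun j _ _ => (aJz hd _).le).trans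
      ((t3 i (hS hi)).trans hκ)
lemma bLy (hd : 3 ≤ d) (hφ : IsGFF P φ) {m L : ℕ} (hm : 2 * L + 2 ≤ 30 * m) (ctr : V d → V d)
    (hctr : ∀ y y', m * dinf y y' ≤ dinf (ctr y) (ctr y')) (A : 𝔽 d)
    (hA : ∀ y, ∀ a ∈ A, ctr y + a ∈ bx (ctr y) L) {g : V d → ℝ} {ε v : ℝ} (hε : 0 < ε)
    (hgg : ∀ a b, 0 ≤ g a * g b) (hg : ∀ a, |g a| ≤ 1 / ε) (hv0 : 0 ≤ v)
    (hv : ∀ y, ∀ a ∈ A, g a ^ 2 * Qg d (eta (bx (ctr y) L) (ctr y + a)) (eta (bx (ctr y) L) (ctr y + a)) ≤ v)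
    {n : ℕ} {x : V d} {T S : 𝔽 d} (hT : T ∈ Tr n x) (hS : S ⊆ T) :
    P {ω | ∀ y ∈ S, ∃ a ∈ A, 1 ≤ g a * bDz φ (bx (ctr y) L) ω (ctr y + a)} ≤
     ofReal (A.card * exp (-1 / (2 * (v + 4 * kap d (4500 * m) / ε ^ 2)))) ^ S.card := by
  have := bLx hd (aTx hd hφ) aSz (show 1 ≤ m by omega) A
    (fun y a => g a • eta (bx (ctr y) L) (ctr y + a)) hε hv0 ?_ ?_ hT hS
  · simpa [bDz] using this
  · intro y a ha
    simp only [map_smul, LinearMap.smul_apply, smul_eq_mul, ← mul_assoc, ← pow_two]; exact hv y a ha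
  · intro i j h9 a ha b hb
    simp only [map_smul, LinearMap.smul_apply, smul_eq_mul]
    have hQ : Qg d (eta (bx (ctr i) L) (ctr i + a)) (eta (bx (ctr j) L) (ctr j + b)) ≤ kap d (m * dinf i j / 2) := by
      refine aW hd (hA i a ha) (hA j b hb) fun x' _ ⟨w, hw, hxw⟩ y' _ ⟨w', hw', hyw⟩ => ?_
      refine (aKx hd _ _).trans (aJy hd ?_)
      rw [bHy] at hw hw'
      have a1 := aC hxw
      have a2 := aC hyw
      have b1 := aBx (ctr i) x' (ctr j)
      have b2 := aBx x' y' (ctr j)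
      have b3 := aBx x' w (ctr i)
      have b4 := aBx y' w' (ctr j)
      have b5 := hctr i j
      rw [aB (ctr i) x'] at b1
      have : m * 9000 ≤ m * dinf i j := Nat.mul_le_mul_left _ h9
      omega
    have hk : 0 ≤ kap d (m * dinf i j / 2) := (aJz hd _).le
    have h1 : g b * g a ≤ 1 / ε ^ 2 := by
      have h1 := abs_mul (g b) (g a)
      have h2 := le_abs_self (g b * g a)
      have h3 := mul_le_mul (hg b) (hg a) (abs_nonneg _) ♠
      rw [show 1 / ε ^ 2 = 1 / ε * (1 / ε) by field_simp]; linarith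
    calc _ = g b * g a * Qg d (eta (bx (ctr i) L) (ctr i + a)) (eta (bx (ctr j) L) (ctr j + b)) := by ring
      _ ≤ g b * g a * kap d (m * dinf i j / 2) := mul_le_mul_of_nonneg_left hQ (hgg _ _)
      _ ≤ 1 / ε ^ 2 * kap d (m * dinf i j / 2) := mul_le_mul_of_nonneg_right h1 hk
      _ = _ := by ring
def cc (U : ℕ) (y : V d) : V d := fun i => (2 * U + 1) * y i + U
def Mk (r : ℕ) (h : ℝ) (D : 𝔽 d) (f : V d → ℝ) (v : V d) : Prop :=
  ∃ p, dinf p 0 = r ∧ Cn ({x | h ≤ f x} ∩ (bx 0 r \ D : 𝔽 d)) v p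
def SF (r : ℕ) (h : ℝ) (F f : V d → ℝ) : 𝕊 d := {x | h - F x ≤ f x} ∩ (bx 𝕆 d r : 𝕊 d)
open Classical in
def Kim (r : ℕ) (h : ℝ) (s : ℕ) (F f : V d → ℝ) : Finset (𝕊 d) :=
  ((bx 0 s).filter (Mk r h ∅ f)).image (comp (SF r h F f))
def En (c : V d) (K L : ℕ) (ε M : ℝ) (η : V d → ℝ) : Prop :=
  (∀ z ∈ bx c K, -ε ≤ η z) ∧ ∀ z ∈ bx c L, -M ≤ η z
def GG (r : ℕ) (h : ℝ) (c : V d) (K L : ℕ) (ε M : ℝ) (x x' : V d) : Set (V d → ℝ) :=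
  {η | En c K L ε M η ∧ Mk r h (bx c L) η x ∧ Mk r h (bx c L) η x'}
lemma bLz {r : ℕ} {h : ℝ} {F F' f : V d → ℝ} (hF : F ≤ F') : SF r h F f ⊆ SF r h F' f :=
  fun x hx => ⟨by have := hF x; have := hx.1; simp only [mem_ofPred_eq] at *; linarith, hx.2⟩
lemma bM {S : 𝕊 d} {x y : V d} (h : Cn S x y) : comp S x = comp S y := by
  ext z; rw [bCy, bCy]; exact ⟨h.symm.trans, h.trans⟩
lemma bMx {S : 𝕊 d} {x y : V d} (h : x ∈ S) : comp S x = comp S y ↔ Cn S x y := by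
  refine ⟨fun e => ?_, bM⟩
  have : x ∈ comp S x := bCy.2 (Cn.refl h)
  rw [e] at this; exact (bCy.1 this).symm
lemma Mk.sub {r : ℕ} {h : ℝ} {D : 𝔽 d} {f : V d → ℝ} {v : V d} (hv : Mk r h D f v) :
    Mk r h ∅ f v := by
  obtain ⟨p, hp, hc⟩ := hv
  exact ⟨p, hp, hc.mono (inter_subset_inter_right _ (by simp))⟩
lemma Mk.mem {r : ℕ} {h : ℝ} {D : 𝔽 d} {f : V d → ℝ} {v : V d} (hv : Mk r h D f v)
    {F : V d → ℝ} (hF : 0 ≤ F) : v ∈ SF r h F f := by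
  obtain ⟨p, hp, hc⟩ := hv.sub
  have h1 := hc.left; have h2 := hF v
  refine ⟨?_, by simpa using h1.2⟩
  have := h1.1; simp only [mem_ofPred_eq, Pi.zero_apply] at *; linarith
lemma bMy {r : ℕ} {h : ℝ} {s : ℕ} {F F' f : V d → ℝ} (hF : F ≤ F') (h0 : 0 ≤ F) :
    (Kim r h s F' f).card ≤ (Kim r h s F f).card ∧
    ∀ x x', Mk r h ∅ f x → Mk r h ∅ f x' → x ∈ bx 0 s → x' ∈ bx 0 s → ¬ Cn (SF r h F f) x x' →
      Cn (SF r h F' f) x x' → (Kim r h s F' f).card + 1 ≤ (Kim r h s F f).card := by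
  classical
  set Φ : 𝕊 d → 𝕊 d := fun C => ⋃ v ∈ C, comp (SF r h F' f) v
  have hΦ : ∀ v, v ∈ SF r h F f → Φ (comp (SF r h F f) v) = comp (SF r h F' f) v := by
    intro v hv
    ext z
    simp only [Φ, mem_iUnion]
    constructor
    · rintro ⟨u, hu, hz⟩
      rwa [bM ((bCy.1 hu).mono (bLz hF))]
    · exact fun hz => ⟨v, bCy.2 (Cn.refl hv), hz⟩
  have hi : Kim r h s F' f = (Kim r h s F f).image Φ := by
    rw [Kim, Kim, Finset.image_image]
    refine Finset.image_congr fun v hv => ?_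
    rw [mem_coe, mem_filter] at hv
    exact (hΦ v (hv.2.mem h0)).symm
  refine ⟨hi ▸ card_image_le, fun x x' hx hx' hxs hxs' hn hc => ?_⟩
  rw [Nat.add_one_le_iff, hi]
  refine lt_of_le_of_ne card_image_le fun e => hn ?_
  have hinj := Finset.card_image_iff.1 e
  rw [← bMx (hx.mem h0)]
  refine hinj ?_ ?_ ?_
  · exact Finset.mem_coe.2 (Finset.mem_image_of_mem _ (Finset.mem_filter.2 ⟨hxs, hx⟩))
  · exact Finset.mem_coe.2 (Finset.mem_image_of_mem _ (Finset.mem_filter.2 ⟨hxs', hx'⟩))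
  · rw [hΦ _ (hx.mem h0), hΦ _ (hx'.mem h0)]; exact bM hc
lemma bMz {Λ : 𝕊 d} (hΛ : Λ.Finite) (a a' : V d → ℝ) (p : 𝕊 d → 𝕊 d → Prop) :
    MeasurableSet {f : V d → ℝ | p ({x | a x ≤ f x} ∩ Λ) ({x | a' x ≤ f x} ∩ Λ)} := by
  have : {f : V d → ℝ | p ({x | a x ≤ f x} ∩ Λ) ({x | a' x ≤ f x} ∩ Λ)} = ⋃ A ∈ 𝒫 Λ,
      {f : V d → ℝ | {x | a x ≤ f x} ∩ Λ = A} ∩ {f | p A ({x | a' x ≤ f x} ∩ Λ)} := by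
    ext f
    simp only [mem_iUnion, mem_inter_iff, mem_ofPred_eq]
    exact ⟨fun h => ⟨_, inter_subset_right, rfl, h⟩, by rintro ⟨A, _, rfl, h⟩; exact h⟩
  rw [this]
  exact Finite.measurableSet_biUnion hΛ.finite_subsets fun A _ =>
    (aS (Ω := V d → ℝ) hΛ (fun x f => f x) (fun x => measurable_pi_apply x) a (fun S => S = A)).inter
      (aS (Ω := V d → ℝ) hΛ (fun x f => f x) (fun x => measurable_pi_apply x) a' (fun S => p A S))
lemma bN (r : ℕ) (h : ℝ) (s : ℕ) (F : V d → ℝ) : Measurable fun f => (Kim r h s F f).card := by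
  classical
  refine measurable_to_countable' fun k => ?_
  have := bMz (bx 𝕆 d r).finite_toSet (fun _ => h) (fun x => h - F x) (fun A A' =>
    (((bx 𝕆 d s).filter fun v => ∃ p, dinf p 0 = r ∧ Cn A v p).image (comp A')).card = k)
  convert this using 1
  ext f
  simp only [Kim, Mk, SF, mem_preimage, mem_singleton_iff, mem_ofPred_eq, Finset.sdiff_empty]
  congr!
  rw [Mk, Finset.sdiff_empty]
lemma bNx (r : ℕ) (h : ℝ) (D : 𝔽 d) (v : V d) : MeasurableSet {f | Mk r h D f v} :=
  aS (Ω := V d → ℝ) (bx 𝕆 d r \ D).finite_toSet (fun x f => f x) (fun x => measurable_pi_apply x)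
    (fun _ => h) (fun S => ∃ p, dinf p 0 = r ∧ Cn S v p)
lemma bNy (s : 𝔽 d) (t : ℝ) : MeasurableSet {η : V d → ℝ | ∀ z ∈ s, t ≤ η z} := by
  have : {η : V d → ℝ | ∀ z ∈ s, t ≤ η z} = ⋂ z ∈ s, {η | t ≤ η z} := by ext; simp
  rw [this]; exact measurableSet_biInter _ fun x _ =>
    measurableSet_le measurable_const (measurable_pi_apply x)
lemma bNz (r : ℕ) (h : ℝ) (c : V d) (K L : ℕ) (ε M : ℝ) (x x' : V d) :
    MeasurableSet (GG r h c K L ε M x x') :=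
  ((bNy _ _).inter (bNy _ _)).inter ((bNx _ _ _ _).inter (bNx _ _ _ _))
lemma bO {r : ℕ} {h : ℝ} {D : 𝔽 d} {ω : Ω} {v : V d} :
    Mk r h D (bDz φ D ω) v ↔ Mk r h D (proc φ ω) v := by
  have : {x | h ≤ bDz φ D ω x} ∩ (bx 0 r \ D : 𝔽 d) =
      {x | h ≤ proc φ ω x} ∩ (bx 0 r \ D : 𝔽 d) := by
    ext x
    simp only [mem_inter_iff, mem_ofPred_eq, mem_coe, Finset.mem_sdiff]
    refine and_congr_left fun hx => ?_
    rw [bDz, aVy hx.2, aSy]; rfl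
  rw [Mk, Mk, this]
lemma bOx (hd : 3 ≤ d) (hφ : IsGFF P φ) {r s K L : ℕ} {h ε M δ : ℝ} (hδ : 0 < δ) {b : ENNReal}
    (a : ∀ D : 𝔽 d, Fin D.card → V d → ℝ) (ha : ∀ D, Spl P φ D (a D))
    (l : List (V d × V d × V d))
    (hl : ∀ τ ∈ l, τ.2.1 ∈ bx 0 s ∧ τ.2.2 ∈ bx 0 s ∧ ∀ η ∈ GG r h τ.1 K L ε M τ.2.1 τ.2.2,
      ∀ F : V d → ℝ, 0 ≤ F → b ≤ NI _ {y | Cn (SF r h F (η + pf (a (bx τ.1 L)) y)) τ.2.1 τ.2.2})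
    (F0 : V d → ℝ) (h0 : 0 ≤ F0) :
    let Fe := F0 + (l.map fun τ => fun x => δ * ∑ w, a (bx τ.1 L) w x).sum
    F0 ≤ Fe ∧ (∫⁻ ω, (Kim r h s Fe (proc φ ω)).card ∂P) + ofReal (kp δ) * b *
      (l.map fun τ => P {ω | bDz φ (bx τ.1 L) ω ∈ GG r h τ.1 K L ε M τ.2.1 τ.2.2 ∧
        ¬ Cn (SF r h Fe (proc φ ω)) τ.2.1 τ.2.2}).sum ≤ ∫⁻ ω, (Kim r h s F0 (proc φ ω)).card ∂P := by
  have hpm : Measurable (proc φ) := measurable_pi_lambda _ hφ.1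
  have mK : ∀ F, Measurable fun ω => ((Kim r h s F (proc φ ω)).card : ENNReal) := fun F =>
    (measurable_of_countable (fun n : ℕ => (n : ENNReal))).comp ((bN r h s F).comp hpm)
  induction l generalizing F0 with
  | nil => simp
  | cons τ l ih =>
    have hf0 : (0 : V d → ℝ) ≤ fun x => δ * ∑ w, a (bx τ.1 L) w x := fun x =>
      mul_nonneg hδ.le (sum_nonneg fun w _ => (ha _).1 w x)
    obtain ⟨i1, i2⟩ := ih (fun τ hτ => hl τ (List.mem_cons_of_mem _ hτ))
      (F0 + fun x => δ * ∑ w, a (bx τ.1 L) w x) (add_nonneg h0 hf0)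
    simp only [List.map_cons, List.sum_cons, ← add_assoc] at *
    set F1 := F0 + fun x => δ * ∑ w, a (bx τ.1 L) w x
    set Fe := F1 + (l.map fun τ => fun x => δ * ∑ w, a (bx τ.1 L) w x).sum
    have h01 : F0 ≤ F1 := le_add_of_nonneg_right hf0
    refine ⟨h01.trans i1, ?_⟩
    obtain ⟨h1, h2, h3⟩ := hl τ List.mem_cons_self
    set G := GG r h τ.1 K L ε M τ.2.1 τ.2.2
    have mJ : MeasurableSet {f | Cn (SF r h F0 f) τ.2.1 τ.2.2} :=
      aS (Ω := V d → ℝ) (bx 𝕆 d r).finite_toSet (fun x f => f x)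
        (fun x => measurable_pi_apply x) (fun x => h - F0 x) (fun S => Cn S τ.2.1 τ.2.2)
    have sp := bF hd hφ (ha (bx τ.1 L)) hδ (J := {f | Cn (SF r h F0 f) τ.2.1 τ.2.2})
      (G := G) mJ (fun f g hfg hc => Cn.mono (S := SF r h F0 f) (T := SF r h F0 g) (fun x hx => ⟨le_trans hx.1 (hfg x), hx.2⟩)
        (show Cn (SF r h F0 f) τ.2.1 τ.2.2 from hc)) (bNz _ _ _ _ _ _ _ _ _) b (fun η hη => h3 η hη F0 h0)
    simp only [mem_ofPred_eq] at sp
    set E1 := {ω | bDz φ (bx τ.1 L) ω ∈ G ∧ ¬ Cn (SF r h F0 (proc φ ω)) τ.2.1 τ.2.2 ∧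
      Cn (SF r h F0 (proc φ ω + fun x => δ * ∑ w, a (bx τ.1 L) w x)) τ.2.1 τ.2.2} with hE1
    have m1 : MeasurableSet E1 := by
      refine ((bEz hd hφ _) (bNz _ _ _ _ _ _ _ _ _)).inter ((hpm mJ).compl.inter ?_)
      exact (show Measurable fun ω => proc φ ω + fun x => δ * ∑ w, a (bx τ.1 L) w x from
        hpm.add measurable_const) mJ
    have key : (∫⁻ ω, (Kim r h s F1 (proc φ ω)).card ∂P) + P E1 ≤
        ∫⁻ ω, (Kim r h s F0 (proc φ ω)).card ∂P := by
      rw [← lintegral_indicator_one m1, ← lintegral_add_left (mK F1)]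
      refine lintegral_mono fun ω => ?_
      obtain ⟨k1, k2⟩ := bMy (r := r) (h := h) (s := s) (f := proc φ ω) h01 h0
      by_cases hω : ω ∈ E1
      · simp only [indicator_of_mem hω, Pi.one_apply]
        have e : SF r h F0 (proc φ ω + fun x => δ * ∑ w, a (bx τ.1 L) w x) = SF r h F1 (proc φ ω) := by
          ext x
          simp only [SF, F1, mem_inter_iff, mem_ofPred_eq, Pi.add_apply]
          exact and_congr_left fun _ => ⟨fun h => by linarith, fun h => by linarith⟩
        obtain ⟨⟨_, g1, g2⟩, g3, g4⟩ := hω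
        rw [e] at g4
        exact_mod_cast k2 _ _ (bO.1 g1).sub (bO.1 g2).sub h1 h2 g3 g4
      · simp only [indicator_of_notMem hω, add_zero]; exact_mod_cast k1
    refine le_trans ?_ key
    rw [mul_add, add_comm (_ * P _), ← add_assoc]
    refine add_le_add i2 (le_trans ?_ sp)
    refine mul_le_mul_right (measure_mono ?_) _
    exact fun ω hω => And.intro hω.1 fun hc => hω.2 (hc.mono (bLz (h01.trans i1)))
lemma bOy {U : ℕ} {v y : V d} : idx (2 * U + 1) v = y ↔ v ∈ bx (cc U y) U := by
  rw [bHy, aAy, funext_iff]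
  refine forall_congr' fun i => ?_
  simp only [idx, cc]
  push_cast
  rw [Int.ediv_eq_iff_of_pos ♠, mul_comm (y i)]
  constructor
  · rintro ⟨h1, h2⟩; omega
  · intro h; constructor <;> omega
lemma bOz {r : ℕ} {h : ℝ} {f : V d → ℝ} {D : 𝔽 d} {u : V d} (hu : Mk r h ∅ f u)
    (hD : ∀ z ∈ D, dinf z 0 < r) (huD : u ∈ D) :
    ∃ x w, Mk r h D f x ∧ adj x w ∧ w ∈ D ∧ x ∉ D ∧ Cn ({z | h ≤ f z} ∩ (bx 𝕆 d r : 𝕊 d)) u x := by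
  obtain ⟨p, hp, hc⟩ := hu
  rw [Finset.sdiff_empty] at hc
  obtain ⟨x, w, h1, h2, h3, h4, h5⟩ := hc.symm.first (· ∈ D)
    (fun hh => by have := hD p hh; omega) huD
  have h6 := h1.right
  refine ⟨x, w, ⟨p, hp, (h1.mono ?_).symm⟩, h2, h4, h6.2,
    h5.symm.trans (Cn.step h3 h6.1 (aA h2))⟩
  intro z hz
  exact ⟨hz.1.1, by simpa using ⟨hz.1.2, hz.2⟩⟩
lemma bP (hd : 2 ≤ d) (b : 𝕊 d) (n k : ℕ) :
    Cd (⋃ X ∈ {X : V d | dinf X 0 = k}, CC b n X) := by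
  obtain ⟨c1, c2, c3⟩ := aFx hd b n
  refine Cd.biUnion ?_ _ (fun x _ => c1 x) (fun x _ => c2 x) (fun x _ y _ h => c3 x y h)
  have := aCz hd (fun _ => -(k : ℤ)) (fun _ => k) (fun _ => k) (fun _ t => t.natAbs = k)
    (fun j => ⟨by omega, le_rfl, by simp⟩)
  convert this using 1
  ext X
  simp only [mem_ofPred_eq]
  constructor
  · intro h
    have h1 := aAy.1 h.le
    simp only [Pi.zero_apply] at h1
    refine ⟨fun j => by have := h1 j; omega, ?_⟩
    rcases Nat.eq_zero_or_pos k with rfl | hk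
    · exact ⟨⟨0, by omega⟩, by have := h1 ⟨0, by omega⟩; omega⟩
    · obtain ⟨i, hi⟩ := (aDz hk).1 h.ge
      have := h1 i
      exact ⟨i, by simp only [Pi.zero_apply] at hi; omega⟩
  · rintro ⟨h1, i, hi⟩
    refine le_antisymm (aAy.2 fun j => ?_) ?_
    · have := h1 j; simp only [Pi.zero_apply]; omega
    · rcases Nat.eq_zero_or_pos k with rfl | hk
      · simp
      · exact (aDz hk).2 ⟨i, by simp [hi]⟩
lemma bPx {U n r σ : ℕ} {h : ℝ} {f : V d → ℝ} (b : 𝕊 d) {v : V d} (hv : Mk r h ∅ f v)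
    (h1 : dinf v 0 + 2 * ((2 * U + 1) * 1000000 ^ n) ≤ 10 * σ * ((2 * U + 1) * 1000000 ^ n))
    (h2 : (10 * σ + 4) * ((2 * U + 1) * 1000000 ^ n) ≤ r) :
    ∃ z, Mk r h ∅ f z ∧ Cn ({z | h ≤ f z} ∩ (bx 𝕆 d r : 𝕊 d)) v z ∧
      idx (2 * U + 1) z ∈ ⋃ X ∈ {X : V d | dinf X 0 = 10 * σ}, CC b n X := by
  obtain ⟨p, hp, hc⟩ := hv
  rw [Finset.sdiff_empty] at hc
  set S := {z | h ≤ f z} ∩ (bx 𝕆 d r : 𝕊 d)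
  set m := 2 * U + 1 with hm
  set Mn := 1000000 ^ n with hMn
  have hMp : 0 < Mn := by positivity
  have hA : Cd (comp S v) := bCx v
  have hvA : v ∈ comp S v := bCy.2 (Cn.refl hc.left)
  have hpA : p ∈ comp S v := bCy.2 hc
  have ii : ∀ z : V d, ∀ i, (m * Mn : ℤ) * idx Mn (idx m z) i ≤ z i ∧
      z i < (m * Mn : ℤ) * idx Mn (idx m z) i + m * Mn := by
    intro z i
    have e : idx Mn (idx m z) i = z i / (m * Mn : ℤ) := by
      simp only [idx]; rw [Int.ediv_ediv_of_nonneg ♠]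
    have hpos : (0 : ℤ) < m * Mn := by positivity
    rw [e]
    exact ⟨Int.mul_ediv_self_le hpos.ne', Int.lt_mul_ediv_self_add hpos⟩
  have hW : (0 : ℤ) < m * Mn := by positivity
  have q0 : ¬ 10 * σ ≤ dinf (idx Mn (idx m v)) 0 := by
    intro hh
    have hσ : 0 < 10 * σ := by
      rcases Nat.eq_zero_or_pos σ with rfl | h
      · simp at h1; omega
      · omega
    obtain ⟨i, hi⟩ := (aDz hσ).1 hh
    have a1 := aAy.1 (le_refl (dinf v 0)) i
    obtain ⟨a2, a3⟩ := ii v i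
    simp only [Pi.zero_apply, sub_zero] at hi a1
    have h1' : (dinf v 0 : ℤ) + 2 * (m * Mn) ≤ 10 * σ * (m * Mn) := by exact_mod_cast h1
    set t := idx Mn (idx m v) i
    rcases le_total 0 t with ht | ht
    · have : (10 * σ : ℤ) ≤ t := by omega
      have := mul_le_mul_of_nonneg_left this hW.le
      have : v i ≤ dinf v 0 := by omega
      nlinarith
    · have : t ≤ (-(10 * σ) : ℤ) := by omega
      have := mul_le_mul_of_nonneg_left this hW.le
      have : -(v i) ≤ dinf v 0 := by omega
      nlinarith
  have hr0 : 0 < r := lt_of_lt_of_le ♠ h2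
  have q1 : 10 * σ + 3 ≤ dinf (idx Mn (idx m p)) 0 := by
    obtain ⟨i, hi⟩ := (aDz hr0).1 hp.ge
    obtain ⟨a2, a3⟩ := ii p i
    refine (aDz ♥).2 ⟨i, ?_⟩
    simp only [Pi.zero_apply, sub_zero] at hi ⊢
    have h2' : (10 * σ + 4 : ℤ) * (m * Mn) ≤ r := by exact_mod_cast h2
    set t := idx Mn (idx m p) i
    by_contra hlt
    have b1 : t ≤ 10 * σ + 2 := by omega
    have b2 : -(10 * σ + 2) ≤ t := by omega
    have b3 := mul_le_mul_of_nonneg_left b1 hW.le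
    have b4 := mul_le_mul_of_nonneg_left b2 hW.le
    rcases le_total 0 (p i) with ht | ht
    · have : (r : ℤ) ≤ p i := by omega
      nlinarith
    · have : (r : ℤ) ≤ - p i := by omega
      nlinarith
  have hcA : Cn (comp S v) v p := hA v hvA p hpA
  obtain ⟨a', b', g1, g2, ⟨w, ⟨z, hz, rfl⟩, rfl⟩, g4, -⟩ :=
    ((hcA.idx (m := m) ♥).idx (m := Mn) hMp).first (fun y => 10 * σ ≤ dinf y 0) q0 ♥
  have g5 : dinf (idx Mn (idx m z)) 0 = 10 * σ := by
    have := g1.right.2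
    have t1 := aBx (idx Mn (idx m z)) a' 0
    have t2 := aC (aA g2)
    simp only [mem_ofPred_eq] at this
    omega
  have hfar : 1000000 ^ n ≤ dinf (idx m z) (idx m p) := by
    by_contra hlt
    have : dinf (idx Mn (idx m p)) (idx Mn (idx m z)) ≤ 1 := by
      refine aAy.2 fun i => ?_
      have k1 := aFy n (idx m z) i
      have k2 := aFy n (idx m p) i
      have k3 := aAy.1 (not_le.1 hlt).le i
      have k4 := aAy.1 (Nat.le_sub_one_of_lt (not_le.1 hlt)) i
      rw [← hMn] at k1 k2 k4
      have hM1 : (1000000 : ℤ) ^ n = Mn := by rw [hMn]; push_cast; rfl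
      rw [hM1] at k1 k2
      set t := idx Mn (idx m p) i
      set t' := idx Mn (idx m z) i
      by_contra hh
      rcases (show t' + 2 ≤ t ∨ t + 2 ≤ t' by omega) with hh | hh
      all_goals have := mul_le_mul_of_nonneg_left hh (show (0 : ℤ) ≤ Mn by positivity)
      all_goals rw [mul_add] at this
      all_goals omega
    have t1 := aBx (idx Mn (idx m p)) (idx Mn (idx m z)) 0
    omega
  have hit := aFz b n (idx m '' comp S v) (fun x hx y hy => by
    obtain ⟨x, hx, rfl⟩ := hx; obtain ⟨y, hy, rfl⟩ := hy
    exact (hA x hx y hy).idx ♥) _ _ (mem_image_of_mem _ hz) (mem_image_of_mem _ hpA) hfar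
  have hne : (idx m '' comp S v ∩ CC b n (idx (1000000 ^ n) (idx m z))).Nonempty := by
    rw [← encard_pos]; exact lt_of_lt_of_le ♠ hit
  obtain ⟨_, ⟨z', hz', rfl⟩, hC⟩ := hne
  have hcz := bCy.1 hz'
  refine ⟨z', ⟨p, hp, ?_⟩, hcz, mem_biUnion g5 hC⟩
  rw [Finset.sdiff_empty]; exact hcz.symm.trans hc
lemma bPy {b : 𝕊 d} {n k : ℕ} {y : V d}
    (hy : y ∈ ⋃ X ∈ {X : V d | dinf X 0 = k}, CC b n X) :
    dinf y 0 ≤ (k + 3) * 1000000 ^ n ∧ k * 1000000 ^ n ≤ dinf y 0 + 3 * 1000000 ^ n := by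
  simp only [mem_iUnion] at hy
  obtain ⟨X, hX, hy⟩ := hy
  have hX : dinf X 0 = k := hX
  have h1 := fun i => aEy b n X y hy i
  have hM : (0 : ℤ) < 1000000 ^ n := by positivity
  constructor
  · refine aAy.2 fun i => ?_
    have h2 := aAy.1 hX.le i
    obtain ⟨h3, h4⟩ := h1 i
    simp only [Pi.zero_apply, sub_zero] at h2 ⊢
    zify
    rw [abs_le]
    have : X i ≤ k ∧ -k ≤ X i := by omega
    constructor <;> nlinarith
  · rcases Nat.eq_zero_or_pos k with rfl | hk
    · simp
    obtain ⟨i, hi⟩ := (aDz hk).1 hX.ge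
    obtain ⟨h3, h4⟩ := h1 i
    have h2 := aAy.1 (le_refl (dinf y 0)) i
    simp only [Pi.zero_apply, sub_zero] at h2 hi
    zify
    have a1 : y i ≤ dinf y 0 ∧ -(y i) ≤ dinf y 0 := by omega
    rcases (show (k : ℤ) ≤ X i ∨ X i ≤ -k by omega) with h | h <;> nlinarith
lemma bPz (hd : 2 ≤ d) {U L n r σ : ℕ} {h : ℝ} {f : V d → ℝ} {b : 𝕊 d} {S : 𝕊 d}
    (hS : {z | h ≤ f z} ∩ (bx 𝕆 d r : 𝕊 d) ⊆ S)
    (hL : 3 * U + 2 ≤ L) (hL' : U + L < (2 * U + 1) * 1000000 ^ n)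
    (hF : ∀ y, (∀ z ∈ bx (cc U y) U, dinf z 0 ≤ r) → ∃ v ∈ bx (cc U y) U, Mk r h ∅ f v)
    {v v' : V d} (hv : Mk r h ∅ f v) (hv' : Mk r h ∅ f v') (hvv : ¬ Cn S v v')
    (h1 : dinf v 0 + 2 * ((2 * U + 1) * 1000000 ^ n) ≤ 10 * σ * ((2 * U + 1) * 1000000 ^ n))
    (h1' : dinf v' 0 + 2 * ((2 * U + 1) * 1000000 ^ n) ≤ 10 * σ * ((2 * U + 1) * 1000000 ^ n))
    (h2 : (10 * σ + 4) * ((2 * U + 1) * 1000000 ^ n) ≤ r) :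
    ∃ y ∈ ⋃ X ∈ {X : V d | dinf X 0 = 10 * σ}, CC b n X,
      (∀ z ∈ bx (cc U y) L, dinf z 0 < (10 * σ + 4) * ((2 * U + 1) * 1000000 ^ n)) ∧
      ∃ x x' w w', Mk r h (bx (cc U y) L) f x ∧ Mk r h (bx (cc U y) L) f x' ∧
        adj x w ∧ w ∈ bx (cc U y) L ∧ x ∉ bx (cc U y) L ∧
        adj x' w' ∧ w' ∈ bx (cc U y) L ∧ x' ∉ bx (cc U y) L ∧ Cn S v x ∧ ¬ Cn S v x' := by
  set 𝒞 := ⋃ X ∈ {X : V d | dinf X 0 = 10 * σ}, CC b n X with h𝒞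
  have hin : ∀ y ∈ 𝒞, ∀ z ∈ bx (cc U y) L, dinf z 0 < (10 * σ + 4) * ((2 * U + 1) * 1000000 ^ n) := by
    intro y hy z hz
    have k1 := aAy.1 (bPy hy).1
    have k2 := bHz.1 hz
    refine Nat.lt_of_le_of_lt (aAy.2 fun i => ?_ : dinf z 0 ≤
      (10 * σ + 3) * ((2 * U + 1) * 1000000 ^ n) + (U + L)) (by linarith)
    have k1 := k1 i
    have k2 := k2 i
    simp only [Pi.zero_apply, sub_zero, cc] at *
    zify at k1 k2 ⊢
    rw [abs_le] at *
    have : (0 : ℤ) ≤ U := by positivity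
    constructor <;> nlinarith
  have hLU : ∀ y y' z : V d, dinf y y' ≤ 1 → z ∈ bx (cc U y') U → z ∈ bx (cc U y) L := by
    intro y y' z hyy hz
    rw [bHz] at *
    intro i
    have k1 := hz i
    have k2 := aAy.1 hyy i
    simp only [cc] at *
    rcases (show y' i = y i ∨ y' i = y i + 1 ∨ y' i = y i - 1 by omega) with e | e | e <;>
      rw [e] at k1 <;> ring_nf at k1 ⊢ <;> omega
  have hmk : ∀ y ∈ 𝒞, ∃ v ∈ bx (cc U y) U, Mk r h ∅ f v := fun y hy => hF y fun z hz =>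
    ((hin y hy z (hLU y y z (by simp [dinf]) hz)).trans_le h2).le
  obtain ⟨z, mz, cz, iz⟩ := bPx b hv h1 h2
  obtain ⟨z', mz', cz', iz'⟩ := bPx b hv' h1' h2
  rw [← h𝒞] at iz iz'
  have nz' : ¬ Cn S v z' := fun hc => hvv (hc.trans (cz'.mono hS).symm)
  suffices ∃ a ∈ 𝒞, ∃ u u', u ∈ bx (cc U a) L ∧ u' ∈ bx (cc U a) L ∧ Mk r h ∅ f u ∧ Mk r h ∅ f u' ∧
      Cn S v u ∧ ¬ Cn S v u' by
    obtain ⟨a, ha, u, u', hu, hu', mu, mu', cu, cu'⟩ := this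
    obtain ⟨x, w, e1, e2, e3, e4, e5⟩ := bOz mu (fun z hz => (hin a ha z hz).trans_le h2) hu
    obtain ⟨x', w', e1', e2', e3', e4', e5'⟩ := bOz mu' (fun z hz => (hin a ha z hz).trans_le h2) hu'
    exact ⟨a, ha, hin a ha, x, x', w, w', e1, e1', e2, e3, e4, e2', e3', e4', cu.trans (e5.mono hS),
      fun hc => cu' (hc.trans (e5'.mono hS).symm)⟩
  by_cases p0 : ∃ u ∈ bx (cc U (idx (2 * U + 1) z)) U, Mk r h ∅ f u ∧ ¬ Cn S v u
  · obtain ⟨u, k1, k2, k3⟩ := p0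
    exact ⟨_, iz, z, u, hLU _ _ _ (by simp [dinf]) (bOy.1 rfl), hLU _ _ _ (by simp [dinf]) k1, mz, k2,
      cz.mono hS, k3⟩
  · obtain ⟨a, c, g1, g2, g3, ⟨u', g4, g5, g6⟩, -⟩ := (bP hd b n (10 * σ) _ iz _ iz').first
      (fun y => ∃ u ∈ bx (cc U y) U, Mk r h ∅ f u ∧ ¬ Cn S v u) p0 ⟨z', bOy.1 rfl, mz', nz'⟩
    have ha := g1.right
    obtain ⟨u, q1, q2⟩ := hmk a ha.1
    refine ⟨a, ha.1, u, u', hLU _ _ _ (by simp [dinf]) q1, hLU _ _ _ (aC g2) g4, q2, g5, ?_, g6⟩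
    by_contra hh
    exact ha.2 ⟨u, q1, q2, hh⟩
def Adm (r L : ℕ) (τ : V d × V d × V d) : Prop :=
  (∀ z ∈ bx τ.1 L, dinf z 0 < r) ∧ τ.2.1 ∉ bx τ.1 L ∧ τ.2.2 ∉ bx τ.1 L ∧
    (∃ w ∈ bx τ.1 L, adj τ.2.1 w) ∧ ∃ w ∈ bx τ.1 L, adj τ.2.2 w
open Classical in
def Tp (r s L : ℕ) : Finset (V d × V d × V d) :=
  (bx 0 r ×ˢ bx 0 s ×ˢ bx 0 s).filter (Adm r L)
def Vb (d L : ℕ) : ℝ := (4 * L + 3) ^ (3 * d) * ((2 * L + 1) ^ d + kap d 0)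
def bb (U K L : ℕ) (ε M : ℝ) (φ : V d → Ω → ℝ) (ω : Ω) : 𝕊 d :=
  {y | ¬ En (cc U y) K L ε M (bDz φ (bx (cc U y) L) ω)}
lemma bQ (hd : 3 ≤ d) {r s L : ℕ} {δ : ℝ} (hδ : 0 ≤ δ)
    {a : ∀ D : 𝔽 d, Fin D.card → V d → ℝ} (ha : ∀ D, Spl P φ D (a D)) (x : V d) :
    (∑ τ ∈ Tp r s L, fun x => δ * ∑ w, a (bx τ.1 L) w x) x ≤ δ * Vb d L := by
  classical
  rw [Finset.sum_apply, ← mul_sum]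
  refine mul_le_mul_of_nonneg_left ?_ hδ
  have h1 : ∀ c : V d, ∑ w, a (bx c L) w x ≤ (2 * L + 1) ^ d + kap d 0 := by
    intro c
    have : ∀ w, a (bx c L) w x ≤ 1 + a (bx c L) w x * a (bx c L) w x := fun w => by
      nlinarith [sq_nonneg (a (bx c L) w x - 1), (ha (bx c L)).1 w x]
    refine (sum_le_sum fun w _ => this w).trans ?_
    rw [sum_add_distrib, ← (ha (bx c L)).2.2.1]
    simp only [sum_const, card_univ, Fintype.card_fin, bI, nsmul_eq_mul, mul_one]
    push_cast
    have h2 := aKx hd x x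
    rw [show dinf x x = 0 by simp [dinf]] at h2
    have h3 := aPx hd (bx c L) x x
    rw [ED] at h3
    linarith
  rw [← Finset.sum_filter_of_ne (p := fun τ => x ∈ bx τ.1 L) fun τ _ hne => by
    by_contra hx; exact hne (sum_eq_zero fun w _ => (ha _).2.1 w x hx)]
  refine (sum_le_card_nsmul _ _ _ fun τ _ => h1 τ.1).trans ?_
  rw [nsmul_eq_mul, Vb]
  refine mul_le_mul_of_nonneg_right ?_ (by have := (aJz hd 0).le; positivity)
  have hsub : (Tp r s L).filter (fun τ => x ∈ bx τ.1 L) ⊆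
      bx x (2 * L + 1) ×ˢ bx x (2 * L + 1) ×ˢ bx x (2 * L + 1) := by
    intro τ hτ
    simp only [Tp, mem_filter, Adm, bHy] at hτ
    obtain ⟨⟨-, -, -, -, ⟨w, h1, h2⟩, w', h3, h4⟩, h5⟩ := hτ
    simp only [mem_product, bHy]
    have := aC h2; have := aC h4
    have := aB x τ.1
    have := aBx τ.2.1 w τ.1; have := aBx τ.2.1 τ.1 x
    have := aBx τ.2.2 w' τ.1; have := aBx τ.2.2 τ.1 x
    omega
  refine (Nat.cast_le.2 (Finset.card_le_card hsub)).trans (le_of_eq ?_)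
  simp only [card_product, bI]
  push_cast; ring
def Loc (P : Measure Ω) (φ : V d → Ω → ℝ) (r K L : ℕ) (h ε M : ℝ) (b : ENNReal) : Prop :=
  ∀ a : ∀ D : 𝔽 d, Fin D.card → V d → ℝ, (∀ D, Spl P φ D (a D)) → ∀ τ, Adm r L τ →
    ∀ η ∈ GG r h τ.1 K L ε M τ.2.1 τ.2.2, ∀ F : V d → ℝ, 0 ≤ F →
      b ≤ NI _ {y | Cn (SF r h F (η + pf (a (bx τ.1 L)) y)) τ.2.1 τ.2.2}
def Gd (U K L n r ρ : ℕ) (h ε M : ℝ) (φ : V d → Ω → ℝ) : Set Ω :=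
  {ω | (∀ y, (∀ z ∈ bx (cc U y) U, dinf z 0 ≤ r) → ∃ v ∈ bx (cc U y) U, Mk r h ∅ (proc φ ω) v) ∧
    ∀ X, dinf X 0 ≤ ρ → ¬ Bad (bb U K L ε M φ ω) n X}
lemma bQx (hd : 2 ≤ d) {U K L n r s s' σ₀ N : ℕ} {h ε M : ℝ} {F : V d → ℝ} (hF : 0 ≤ F)
    (hL : 3 * U + 2 ≤ L) (hL' : U + L < (2 * U + 1) * 1000000 ^ n)
    (h1 : s' ≤ 10 * σ₀ * ((2 * U + 1) * 1000000 ^ n))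
    (h2 : (10 * (σ₀ + N) + 4) * ((2 * U + 1) * 1000000 ^ n) ≤ s) (hs : s ≤ r)
    {ω : Ω} (hω : ω ∈ Gd U K L n r (10 * (σ₀ + N)) h ε M φ)
    (hK : 2 ≤ (Kim r h s' F (proc φ ω)).card) :
    ∃ Q ⊆ Tp r s L, N * (Kim r h s' F (proc φ ω)).card ≤ Q.card ∧
      ∀ τ ∈ Q, bDz φ (bx τ.1 L) ω ∈ GG r h τ.1 K L ε M τ.2.1 τ.2.2 ∧
        ¬ Cn (SF r h F (proc φ ω)) τ.2.1 τ.2.2 := by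
  classical
  obtain ⟨g1, g2⟩ := hω
  set W := (2 * U + 1) * 1000000 ^ n with hW
  set f := proc φ ω
  set S := SF r h F f
  have hS : {z | h ≤ f z} ∩ (bx 𝕆 d r : 𝕊 d) ⊆ S := fun z hz =>
    ⟨by have := hz.1; have := hF z; simp only [mem_ofPred_eq, Pi.zero_apply] at *; linarith, hz.2⟩
  have key : ∀ q ∈ Kim r h s' F f ×ˢ Finset.Icc (σ₀ + 1) (σ₀ + N), ∃ τ ∈ Tp r s L,
      (bDz φ (bx τ.1 L) ω ∈ GG r h τ.1 K L ε M τ.2.1 τ.2.2 ∧ ¬ Cn S τ.2.1 τ.2.2) ∧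
      comp S τ.2.1 = q.1 ∧ ∃ y, τ.1 = cc U y ∧ dinf y 0 ≤ (10 * q.2 + 3) * 1000000 ^ n ∧
        10 * q.2 * 1000000 ^ n ≤ dinf y 0 + 3 * 1000000 ^ n := by
    rintro ⟨C, σ⟩ hq
    simp only [mem_product, Finset.mem_Icc] at hq ⊢
    obtain ⟨hC, hσ1, hσ2⟩ := hq
    obtain ⟨C', hC', hne⟩ := Finset.exists_mem_ne (show 1 < (Kim r h s' F f).card by omega) C
    obtain ⟨v, hv, rfl⟩ := Finset.mem_image.1 hC
    obtain ⟨v', hv', rfl⟩ := Finset.mem_image.1 hC'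
    rw [mem_filter, bHy] at hv hv'
    have hW2 : 10 * (σ₀ + 1) * W ≤ 10 * σ * W := by gcongr
    have hW3 : (10 * σ + 4) * W ≤ (10 * (σ₀ + N) + 4) * W := by gcongr
    have hW4 : 10 * (σ₀ + 1) * W = 10 * σ₀ * W + 10 * W := by ring
    obtain ⟨y, hy, hD, x, x', w, w', e1, e2, e3, e4, e5, e6, e7, e8, e9, e10⟩ :=
      bPz hd (b := bb U K L ε M φ ω) (σ := σ) hS hL hL' g1 hv.2 hv'.2
        (fun hc => hne (bM hc).symm) (by rw [← hW]; linarith [hv.1]) (by rw [← hW]; linarith [hv'.1]) (by rw [← hW]; linarith)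
    rw [← hW] at hD
    have hyn := bPy hy
    simp only [mem_iUnion] at hy
    obtain ⟨X, hX, hyX⟩ := hy
    have hX : dinf X 0 = 10 * σ := hX
    have hgood : y ∉ bb U K L ε M φ ω := aEz (g2 X ♥) hyX
    have hEn : En (cc U y) K L ε M (bDz φ (bx (cc U y) L) ω) := by
      by_contra hh; exact hgood hh
    have hnear : ∀ x w, adj x w → w ∈ bx (cc U y) L → x ∈ bx 𝕆 d s := fun x w h h' => by
      have q1 := hD w h'; have q2 := aBx x w 0; have q3 := aC h
      rw [bHy]; omega
    have hcr : cc U y ∈ bx 𝕆 d r := by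
      have := hD (cc U y) (bHy.2 (by simp [dinf])); rw [bHy]; omega
    refine ⟨(cc U y, x, x'), ?_, ⟨⟨hEn, bO.2 e1, bO.2 e2⟩, fun hc => e10 (e9.trans hc)⟩,
      (bM e9).symm, y, rfl, hyn.1, hyn.2⟩
    rw [Tp, mem_filter]
    simp only [mem_product]
    exact ⟨⟨hcr, hnear x w e3 e4, hnear x' w' e6 e7⟩, fun z hz => (hD z hz).trans_le ♥, e5, e8,
      ⟨w, e4, e3⟩, w', e7, e6⟩
  choose! T hT1 hT2 hT3 hT4 using key
  refine ⟨(Kim r h s' F f ×ˢ Finset.Icc (σ₀ + 1) (σ₀ + N)).image T, ?_, ?_, ?_⟩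
  · intro τ hτ; obtain ⟨q, hq, rfl⟩ := Finset.mem_image.1 hτ; exact hT1 q hq
  · rw [Finset.card_image_of_injOn]
    · rw [card_product, Nat.card_Icc, mul_comm]
      exact Nat.mul_le_mul_left _ ♥
    · intro q hq q' hq' e
      obtain ⟨y, a1, a2, a3⟩ := hT4 q hq
      obtain ⟨y', b1, b2, b3⟩ := hT4 q' hq'
      refine Prod.ext (by rw [← hT3 q hq, ← hT3 q' hq', e]) ?_
      have hyy : y = y' := by
        rw [e, b1] at a1
        ext i; have := congrFun a1 i; simp only [cc] at this
        have h3 : (2 * (U : ℤ) + 1) * y' i = (2 * U + 1) * y i := by linarith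
        exact (mul_left_cancel₀ ♠ h3).symm
      subst hyy
      have hM : 0 < 1000000 ^ n := by positivity
      by_contra hne
      rcases lt_or_gt_of_ne hne with hlt | hlt
      · have : (10 * q.2 + 10) * 1000000 ^ n ≤ 10 * q'.2 * 1000000 ^ n := by gcongr; omega
        nlinarith
      · have : (10 * q'.2 + 10) * 1000000 ^ n ≤ 10 * q.2 * 1000000 ^ n := by gcongr; omega
        nlinarith
  · intro τ hτ; obtain ⟨q, hq, rfl⟩ := Finset.mem_image.1 hτ; exact hT2 q hq
lemma bQy {r s : ℕ} {h : ℝ} {F f : V d → ℝ} : (Kim r h s F f).card ≤ (2 * s + 1) ^ d := by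
  classical
  exact Finset.card_image_le.trans ((card_filter_le _ _).trans (bI _ _).le)
lemma bQz (hd : 3 ≤ d) (hφ : IsGFF P φ) {U K L n r s s' σ₀ N : ℕ} {h ε M δ : ℝ} (hδ : 0 < δ) {b Θ : ENNReal}
    (hloc : Loc P φ r K L h ε M b) (F : V d → ℝ) (hF : 0 ≤ F)
    (hL : 3 * U + 2 ≤ L) (hL' : U + L < (2 * U + 1) * 1000000 ^ n)
    (h1 : s' ≤ 10 * σ₀ * ((2 * U + 1) * 1000000 ^ n))
    (h2 : (10 * (σ₀ + N) + 4) * ((2 * U + 1) * 1000000 ^ n) ≤ s) (hs : s ≤ r) (hN : N ≠ 0)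
    (hΘ : Θ ≤ N * (ofReal (kp δ) * b)) (hΘ0 : Θ ≠ 0) (hΘ1 : Θ ≠ ⊤) :
    ∃ F', 0 ≤ F' ∧ (∀ x, F' x ≤ F x + δ * Vb d L) ∧
      ∫⁻ ω, {ω | 2 ≤ (Kim r h s' F' (proc φ ω)).card}.indicator
        (fun ω => ((Kim r h s' F' (proc φ ω)).card : ENNReal)) ω ∂P ≤
      Θ⁻¹ * (∫⁻ ω, (Kim r h s F (proc φ ω)).card ∂P) +
        (2 * s' + 1) ^ d * P (Gd U K L n r (10 * (σ₀ + N)) h ε M φ)ᶜ := by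
  classical
  choose a ha using fun D => bE hd hφ D
  have ml := bOx hd hφ (s := s) hδ a ha (Tp r s L).toList (fun τ hτ => by
    rw [Finset.mem_toList, Tp, mem_filter] at hτ
    simp only [mem_product] at hτ
    exact ⟨hτ.1.2.1, hτ.1.2.2, hloc a ha τ hτ.2⟩) F hF
  simp only [Finset.sum_map_toList] at ml
  set F' := F + ∑ τ ∈ Tp r s L, fun x => δ * ∑ w, a (bx τ.1 L) w x with hF'
  obtain ⟨m1, m2⟩ := ml
  refine ⟨F', hF.trans m1, fun x => ?_, ?_⟩
  · rw [hF', Pi.add_apply]; gcongr; exact bQ hd hδ.le ha x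
  set E : V d × V d × V d → Set Ω := fun τ => {ω | bDz φ (bx τ.1 L) ω ∈ GG r h τ.1 K L ε M τ.2.1 τ.2.2 ∧
        ¬ Cn (SF r h F' (proc φ ω)) τ.2.1 τ.2.2}
  have hpm : Measurable (proc φ) := measurable_pi_lambda _ hφ.1
  have mE : ∀ τ, MeasurableSet (E τ) := fun τ =>
    ((bEz hd hφ _) (bNz _ _ _ _ _ _ _ _ _)).inter
      (hpm (aS (Ω := V d → ℝ) (bx 𝕆 d r).finite_toSet (fun x f => f x)
        (fun x => measurable_pi_apply x) (fun x => h - F' x) (fun S => Cn S τ.2.1 τ.2.2))).compl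
  set I := ∫⁻ ω, {ω | 2 ≤ (Kim r h s' F' (proc φ ω)).card}.indicator
        (fun ω => ((Kim r h s' F' (proc φ ω)).card : ENNReal)) ω ∂P
  set B := (Gd U K L n r (10 * (σ₀ + N)) h ε M φ)ᶜ with hB
  have step : N * I ≤ (∑ τ ∈ Tp r s L, P (E τ)) + N * ((2 * s' + 1) ^ d * P B) := by
    calc N * I = ∫⁻ ω, N * ({ω | 2 ≤ (Kim r h s' F' (proc φ ω)).card}.indicator
        (fun ω => ((Kim r h s' F' (proc φ ω)).card : ENNReal)) ω) ∂P := by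
          rw [lintegral_const_mul' _ _ (by simp)]
      _ ≤ ∫⁻ ω, (∑ τ ∈ Tp r s L, (E τ).indicator 1 ω) + N * ((2 * s' + 1) ^ d * (B.indicator 1 ω)) ∂P := by
          refine lintegral_mono fun ω => ?_
          by_cases hK : 2 ≤ (Kim r h s' F' (proc φ ω)).card
          swap
          · rw [indicator_of_notMem (by exact hK)]; simp
          rw [indicator_of_mem (by exact hK)]
          by_cases hω : ω ∈ B
          · refine le_add_left ?_
            rw [indicator_of_mem hω, Pi.one_apply, mul_one]
            gcongr
            exact_mod_cast bQy
          · obtain ⟨Q, q1, q2, q3⟩ := bQx ♥ (hF.trans m1) hL hL' h1 h2 hs (not_notMem.1 hω) hK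
            refine le_add_right ?_
            calc (N : ENNReal) * (Kim r h s' F' (proc φ ω)).card ≤ Q.card := by exact_mod_cast q2
              _ = ∑ τ ∈ Q, (E τ).indicator 1 ω := by
                rw [sum_congr rfl fun τ hτ => show (E τ).indicator 1 ω = (1 : ENNReal) from
                  indicator_of_mem (s := E τ) (q3 τ hτ) _]; simp
              _ ≤ _ := sum_le_sum_of_subset q1
      _ = (∑ τ ∈ Tp r s L, P (E τ)) + ∫⁻ ω, N * ((2 * s' + 1) ^ d * (B.indicator 1 ω)) ∂P := by
          rw [lintegral_add_left (Finset.measurable_fun_sum _ fun τ _ => measurable_one.indicator (mE τ)),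
            lintegral_finsetSum _ fun τ _ => measurable_one.indicator (mE τ)]
          simp only [lintegral_indicator_one (mE _)]
      _ ≤ _ := by
          have e1 : ((2 * s' + 1 : ENNReal) ^ d) ≠ ⊤ := by
            exact_mod_cast ENNReal.natCast_ne_top ((2 * s' + 1) ^ d)
          rw [lintegral_const_mul' _ _ (by simp), lintegral_const_mul' _ _ e1]
          gcongr
          exact lintegral_indicator_one_le _
  have hN0 : (N : ENNReal) ≠ 0 := by exact_mod_cast hN
  have hNt : (N : ENNReal) ≠ ⊤ := by simp
  set Sg := ∑ τ ∈ Tp r s L, P (E τ)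
  have m3 : ofReal (kp δ) * b * Sg ≤ ∫⁻ ω, (Kim r h s F (proc φ ω)).card ∂P := le_trans (by simp) m2
  have s1 : I ≤ (N : ENNReal)⁻¹ * Sg + (2 * s' + 1) ^ d * P B := by
    calc I = (N : ENNReal)⁻¹ * (N * I) := by rw [← mul_assoc, ENNReal.inv_mul_cancel hN0 hNt, one_mul]
      _ ≤ (N : ENNReal)⁻¹ * (Sg + N * ((2 * s' + 1) ^ d * P B)) := by gcongr
      _ = _ := by rw [mul_add, ← mul_assoc _ (N : ENNReal), ENNReal.inv_mul_cancel hN0 hNt, one_mul]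
  refine s1.trans (add_le_add ?_ le_rfl)
  rw [← ENNReal.div_eq_inv_mul, ← ENNReal.div_eq_inv_mul, ENNReal.le_div_iff_mul_le (Or.inl hΘ0) (Or.inl hΘ1)]
  calc Sg / N * Θ ≤ Sg / N * (N * (ofReal (kp δ) * b)) := by gcongr
    _ = ofReal (kp δ) * b * Sg := by
      rw [← mul_assoc, ENNReal.div_mul_cancel hN0 hNt, mul_comm]
    _ ≤ _ := m3
lemma bR {U K L n r ρ ρ' : ℕ} {h ε M : ℝ} (hρ : ρ ≤ ρ') :
    Gd U K L n r ρ' h ε M φ ⊆ Gd U K L n r ρ h ε M φ := fun _ hω => ⟨hω.1, fun X hX => hω.2 X (hX.trans hρ)⟩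
lemma bRx (hd : 3 ≤ d) (hφ : IsGFF P φ) {U K L n r N ρ : ℕ} {h ε M δ : ℝ} (hδ : 0 < δ) {b Θ : ENNReal}
    (hloc : Loc P φ r K L h ε M b)
    (hL : 3 * U + 2 ≤ L) (hL' : U + L < (2 * U + 1) * 1000000 ^ n) (hN : N ≠ 0)
    (hΘ : Θ ≤ N * (ofReal (kp δ) * b)) (hΘ2 : Θ⁻¹ ≤ 2⁻¹) (hΘ1 : Θ ≠ ⊤)
    (hG : (2 * r + 1) ^ d * P (Gd U K L n r ρ h ε M φ)ᶜ ≤ 1) (j t : ℕ)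
    (ht : 10 * (t + j * (N + 1)) * ((2 * U + 1) * 1000000 ^ n) ≤ r) (hρ : 10 * (t + j * (N + 1)) ≤ ρ) :
    (∃ F, 0 ≤ F ∧ (∀ x, F x ≤ j * (δ * Vb d L)) ∧
      ∫⁻ ω, (Kim r h (10 * t * ((2 * U + 1) * 1000000 ^ n)) F (proc φ ω)).card ∂P ≤
        4 + Θ⁻¹ ^ j * (2 * r + 1) ^ d) ∧ ∀ j', j = j' + 1 →
    ∃ F, 0 ≤ F ∧ (∀ x, F x ≤ j * (δ * Vb d L)) ∧
      P {ω | 2 ≤ (Kim r h (10 * t * ((2 * U + 1) * 1000000 ^ n)) F (proc φ ω)).card} ≤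
        Θ⁻¹ * (4 + Θ⁻¹ ^ j' * (2 * r + 1) ^ d) + (2 * r + 1) ^ d * P (Gd U K L n r ρ h ε M φ)ᶜ := by
  set W := (2 * U + 1) * 1000000 ^ n with hW
  have hΘ0 : Θ ≠ 0 := by rintro rfl; simp at hΘ2
  have hpm : Measurable (proc φ) := measurable_pi_lambda _ hφ.1
  induction j generalizing t with
  | zero =>
    refine ⟨⟨0, le_rfl, by simp, ?_⟩, by simp⟩
    simp only [zero_mul, add_zero] at ht
    calc _ ≤ ∫⁻ ω, (2 * r + 1) ^ d ∂P := by
          refine lintegral_mono fun ω => ?_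
          refine (Nat.cast_le.2 (bQy.trans (pow_le_pow_left (show _ ≤ 2 * r + 1 by omega) d))).trans ?_
          push_cast; rfl
      _ ≤ _ := by simp
  | succ j ih =>
    have e1 : t + N + 1 + j * (N + 1) = t + (j + 1) * (N + 1) := by ring
    obtain ⟨⟨F, f1, f2, f3⟩, -⟩ := ih (t + N + 1) (by rw [e1]; exact hρ) (by rw [e1]; exact ht)
    have e2 : t + N + 1 ≤ t + (j + 1) * (N + 1) := by rw [← e1]; omega
    have hsr : 10 * (t + N + 1) * W ≤ r := (Nat.mul_le_mul_right W ♥).trans ht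
    obtain ⟨F', g1, g2, g3⟩ := bQz hd hφ hδ hloc F f1 hL hL' (σ₀ := t) (s' := 10 * t * W) (s := 10 * (t + N + 1) * W)
      (N := N) le_rfl (by rw [← hW]; gcongr; omega) hsr hN hΘ hΘ0 hΘ1
    set E := {ω | 2 ≤ (Kim r h (10 * t * W) F' (proc φ ω)).card}
    have hPG : P (Gd U K L n r (10 * (t + N)) h ε M φ)ᶜ ≤ P (Gd U K L n r ρ h ε M φ)ᶜ :=
      measure_mono (compl_subset_compl.2 (bR (by
        have : t + N ≤ t + (j + 1) * (N + 1) := by rw [← e1]; omega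
        omega)))
    have hst : 2 * (10 * t * W) + 1 ≤ 2 * r + 1 := by
      have : 10 * t * W ≤ 10 * (t + N + 1) * W := by gcongr; omega
      omega
    have hst' : (2 * (10 * t * W : ℕ) + 1 : ENNReal) ≤ 2 * r + 1 := by exact_mod_cast hst
    have g4 := g3.trans (add_le_add (mul_le_mul_right f3 _) (mul_le_mul' (pow_le_pow_left' hst' d) hPG))
    have hF' : ∀ x, F' x ≤ (j + 1 : ℕ) * (δ * Vb d L) := fun x => by
      have := g2 x; have := f2 x; push_cast; linarith
    refine ⟨⟨F', g1, hF', ?_⟩, fun j' hj' => ⟨F', g1, hF', ?_⟩⟩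
    · calc _ ≤ ∫⁻ ω, 1 + E.indicator (fun ω => ((Kim r h (10 * t * W) F' (proc φ ω)).card : ENNReal)) ω ∂P := by
            refine lintegral_mono fun ω => ?_
            by_cases hω : ω ∈ E
            · rw [indicator_of_mem hω]; exact le_add_self
            · rw [indicator_of_notMem hω, add_zero]
              have : ¬ 2 ≤ (Kim r h (10 * t * W) F' (proc φ ω)).card := hω
              exact Nat.cast_le_one.2 (show (Kim r h (10 * t * W) F' (proc φ ω)).card ≤ 1 by omega)
        _ ≤ 1 + (Θ⁻¹ * (4 + Θ⁻¹ ^ j * (2 * r + 1) ^ d) + 1) := by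
            rw [lintegral_add_left measurable_const]
            refine add_le_add (by simp) (g4.trans (add_le_add le_rfl hG))
        _ ≤ 1 + (2⁻¹ * 4 + Θ⁻¹ * (Θ⁻¹ ^ j * (2 * r + 1) ^ d) + 1) := by
            rw [mul_add]; gcongr
        _ = _ := by
            rw [pow_succ', show (2⁻¹ * 4 : ENNReal) = 2 by
              rw [show (4 : ENNReal) = 2 * 2 by norm_num, ← mul_assoc, ENNReal.inv_mul_cancel (by simp) (by simp), one_mul]]
            ring
    · obtain rfl : j = j' := by omega
      refine le_trans ?_ g4
      have mE : MeasurableSet E := hpm ((bN r h (10 * t * W) F') (measurableSet_Ici (a := 2)))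
      rw [← lintegral_indicator_one mE]
      refine lintegral_mono fun ω => indicator_le_indicator' fun hω => ?_
      have : 2 ≤ (Kim r h (10 * t * W) F' (proc φ ω)).card := hω
      exact Nat.one_le_cast.2 (show 1 ≤ (Kim r h (10 * t * W) F' (proc φ ω)).card by omega)
lemma bRy (hd : 3 ≤ d) (hφ : IsGFF P φ) {h u ε M : ℝ} {U L R l K k r : ℕ} (hu : u ≤ U) (hR : L + U < R)
    (hP : 1 / 2 < P {ω | ConnIn (lvl φ h ω) (box d u) (bdry d R)}) (hε : 0 ≤ ε) (hM : 0 ≤ M)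
    (hK : K + l = L) (hk1 : 1 ≤ K) (hk : K ≤ 3 ^ k)
    (hs : ((2 * L + 1 : ENNReal) ^ d) * ofReal (exp (-ε ^ 2 / (2 * kap d l))) ≤ b1 d U L / 2) :
    Loc P φ r K L (h - 2 * ε) ε M (bKy d U L l k (M + |h|) ^ 2) := by
  rintro a ha ⟨c, x, x'⟩ ⟨hA, hx, hx', ⟨w, hw, hxw⟩, w', hw', hxw'⟩ η ⟨⟨e1, e2⟩, m1, m2⟩ F hF
  simp only at *
  have key : ∀ x, Mk r (h - 2 * ε) (bx c L) η x → x ∈ bx 𝕆 d r ∧ h - 2 * ε ≤ η x + F x := by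
    rintro x ⟨p, hp, hc⟩
    have := hc.left
    have h1 := this.1
    have h2 := hF x
    have h3 := this.2
    simp only [mem_coe, Finset.mem_sdiff, mem_ofPred_eq, Pi.zero_apply] at *
    exact ⟨h3.1, by linarith⟩
  have := bL hd hφ hu hR hP hε hM hK hk1 hk (ha (bx c L)) hs hxw hw hxw' hw' e1 e2
    (S := (bx 𝕆 d r : 𝕊 d)) (fun z hz => by
      have := hA z hz; rw [mem_coe, bHy]; omega) (key x m1).1 (key x' m2).1 hF ⟨hx, hx'⟩ (key x m1).2 (key x' m2).2
  refine this.trans (measure_mono fun y hy => ?_)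
  refine Cn.mono (S := {z | h - 2 * ε ≤ η z + pf (a (bx c L)) y z + F z} ∩ (bx 𝕆 d r : 𝕊 d)) ?_ hy
  intro z hz
  refine ⟨?_, hz.2⟩
  have := hz.1
  simp only [mem_ofPred_eq, Pi.add_apply] at *
  linarith
def MA (c : V d) (r : ℕ) (a : ℝ) (f : V d → ℝ) (v : V d) : Prop :=
  ∃ p, dinf p c = r ∧ Cn ({x | a ≤ f x} ∩ (bx c r : 𝕊 d)) v p
lemma bRz {r : ℕ} {a : ℝ} {f : V d → ℝ} {v : V d} : MA 0 r a f v ↔ Mk r a ∅ f v := by simp [MA, Mk]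
def sh (z x : V d) : V d := iso 1 (fun _ => 1) z x
lemma bS (z x : V d) : sh z x = x + z := by ext i; simp [sh, iso]
lemma bSx (z x y : V d) : dinf (x + z) (y + z) = dinf x y := by
  rw [← bS, ← bS]; exact bH _ _ _ _ _
lemma Cn.shift {S T : 𝕊 d} {x y : V d} (z : V d) (h : Cn S x y) (hT : ∀ v ∈ S, v + z ∈ T) :
    Cn T (x + z) (y + z) := by
  rw [← bS, ← bS]
  exact Cn.map_iso _ _ _ h fun v hv => by rw [← sh, bS]; exact hT v hv
lemma bSy {c z x : V d} {N : ℕ} : x + z ∈ bx (c + z) N ↔ x ∈ bx c N := by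
  rw [bHy, bHy, bSx]
lemma bSz {f : V d → ℝ} {a : ℝ} {c v w : V d} {N : ℕ} (z : V d) :
    Cn ({x | a ≤ f x} ∩ (bx (c + z) N : 𝕊 d)) (v + z) (w + z) ↔
      Cn ({x | a ≤ f (x + z)} ∩ (bx c N : 𝕊 d)) v w := by
  constructor <;> intro h
  · have := h.shift (-z) (T := {x | a ≤ f (x + z)} ∩ (bx c N : 𝕊 d)) fun x hx => by
      refine ⟨by simpa using hx.1, ?_⟩
      have := hx.2
      rw [mem_coe] at *
      rw [← bSy (z := z)]; simpa using this
    simpa using this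
  · exact h.shift z fun x hx => ⟨hx.1, by have := hx.2; rw [mem_coe] at *; rwa [bSy]⟩
lemma bT {f : V d → ℝ} {a : ℝ} {c v : V d} {r : ℕ} (z : V d) :
    MA (c + z) r a f (v + z) ↔ MA c r a (fun x => f (x + z)) v := by
  constructor
  · rintro ⟨p, hp, h⟩
    refine ⟨p - z, by rw [← bSx z]; simpa using hp, ?_⟩
    rw [← bSz]; simpa using h
  · rintro ⟨p, hp, h⟩
    exact ⟨p + z, by rw [bSx]; exact hp, (bSz z).2 h⟩
lemma bTx (hd : 3 ≤ d) (hφ : IsGFF P φ) (z : V d) {A : Set (V d → ℝ)} (hA : MeasurableSet A) :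
    P {ω | (fun x => φ (x + z) ω) ∈ A} = P {ω | proc φ ω ∈ A} := by
  rw [← bGz hd hφ 1 (fun _ => 1) z hA]
  simp_rw [← bS]; rfl
lemma bTy {S : 𝕊 d} {v p c : V d} {r : ℕ} (h : Cn S v p) (hv : dinf v c ≤ r) (hp : r ≤ dinf p c) :
    ∃ q, dinf q c = r ∧ Cn (S ∩ (bx c r : 𝕊 d)) v q := by
  rcases hv.lt_or_eq with h1 | h1
  · obtain ⟨a, b, ha, hab, hb, hpb, -⟩ := h.first (fun z => r ≤ dinf z c) ♥ hp
    have h2 := ha.right.2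
    simp only [mem_ofPred_eq, not_le] at h2
    have h3 := aBx b a c; have h4 := aC hab; rw [aB] at h4
    refine ⟨b, by omega, ?_⟩
    have e : Cn (S ∩ (bx c r : 𝕊 d)) v a := by
      refine Cn.mono ?_ ha
      intro z hz
      have := hz.2; simp only [mem_ofPred_eq, not_le] at this
      exact ⟨hz.1, by rw [mem_coe, bHy]; omega⟩
    exact e.trans (Cn.step e.right ⟨hb, by rw [mem_coe, bHy]; omega⟩ hab)
  · exact ⟨v, h1, Cn.refl ⟨h.left, by rw [mem_coe, bHy]; omega⟩⟩
lemma MA.to {c c' v : V d} {r r' : ℕ} {a a' : ℝ} {f f' : V d → ℝ} (h : MA c r a f v)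
    (hf : ∀ x ∈ bx c r, a ≤ f x → a' ≤ f' x) (hv : dinf v c' ≤ r') (hr : r' + dinf c' c ≤ r) : MA c' r' a' f' v := by
  obtain ⟨p, hp, h⟩ := h
  obtain ⟨q, hq, h'⟩ := bTy h hv (by have := aBx p c' c; omega)
  refine ⟨q, hq, Cn.mono ?_ h'⟩
  intro x hx
  exact ⟨hf x hx.1.2 hx.1.1, hx.2⟩
def GA (c : V d) (U r : ℕ) (a : ℝ) (f : V d → ℝ) : Prop := ∃ v ∈ bx c U, MA c r a f v
lemma bTz {f : V d → ℝ} {a : ℝ} {U r : ℕ} (z : V d) :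
    GA z U r a f ↔ GA 0 U r a (fun x => f (x + z)) := by
  constructor
  · rintro ⟨v, hv, h⟩
    refine ⟨v - z, by rw [← bSy (z := z)]; simpa using hv, ?_⟩
    rw [← bT]; simpa using h
  · rintro ⟨v, hv, h⟩
    exact ⟨v + z, by have := (bSy (z := z)).2 hv; simpa using this, by have := (bT z).2 h; simpa using this⟩
lemma bU (U r : ℕ) (a : ℝ) : MeasurableSet {f : V d → ℝ | GA 0 U r a f} := by
  have : {f : V d → ℝ | GA 0 U r a f} = ⋃ v ∈ bx 𝕆 d U, {f | Mk r a ∅ f v} := by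
    ext; simp [GA, bRz]
  rw [this]; exact Finset.measurableSet_biUnion _ fun v _ => bNx r a ∅ v
lemma bUx (hd : 3 ≤ d) (hφ : IsGFF P φ) (z : V d) (U r : ℕ) (a : ℝ) :
    P {ω | ¬ GA z U r a (proc φ ω)} = P {ω | ¬ GA 0 U r a (proc φ ω)} := by
  have := bTx hd hφ z (bU U r a).compl
  simp only [mem_compl_iff, mem_ofPred_eq] at this
  rw [← this]
  congr 1; ext ω; simp only [mem_ofPred_eq]; rw [bTz]; rfl
lemma bUy {h u : ℝ} {U r R : ℕ} {f : V d → ℝ} (hu : u ≤ U) (hr : r ≤ R) (hU : U ≤ r)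
    (hc : ConnIn {x | h ≤ f x} (box d u) (bdry d R)) : GA 0 U r h f := by
  obtain ⟨x, hx, y, hy, hxy⟩ := aAx.1 hc
  have hx' : dinf x 0 ≤ U := bC.1 fun i => (hx i).trans hu
  have hy' : R ≤ dinf y 0 := by
    obtain ⟨h1, z, h2, h3⟩ := hy
    have : ¬ dinf z 0 ≤ R := fun h => h2 (bC.2 h)
    have := aBx z y 0; have := aC h3; rw [aB] at this
    omega
  obtain ⟨q, hq, h'⟩ := bTy hxy (hx'.trans hU) (hr.trans hy')
  exact ⟨x, bHy.2 hx', q, hq, h'⟩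
lemma bUz (hd : 3 ≤ d) (hφ : IsGFF P φ) {h : ℝ} (hh : h ∈ tildeSet d P φ) {δ : ENNReal} (hδ : 0 < δ) (R0 : ℕ) :
    ∃ R : ℕ, R0 ≤ R ∧ (R : ENNReal) ^ d * P {ω | ¬ ConnIn (lvl φ h ω) (box d (ufn R)) (bdry d R)} ≤ δ := by
  classical
  by_contra! hc
  set t : ℕ → ENNReal := fun R => ofReal ((ℜ R + 1) ^ d) *
        P {ω | ¬ ConnIn (lvl φ h ω) (box d (ufn (ℜ R + 1))) (bdry d (ℜ R + 1))} with ht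
  have hpos : ∀ R, 0 < t R := by
    intro R
    refine ENNReal.mul_pos (ENNReal.ofReal_pos.2 ♠).ne' (ne_of_gt ?_)
    refine (bGx hd (bGy hφ) (bx 𝕆 d (R + 1)) (1 - h)).trans_le (measure_mono fun ω hω => ?_)
    rintro ⟨n, γ, -, h2, h3, -⟩
    have h4 : γ n ∈ bx 𝕆 d (R + 1) := bHy.2 (bC.1 (by
      have := h2.1; push_cast; exact this))
    have := hω _ h4
    have h5 : h ≤ φ (γ n) ω := h3 n le_rfl
    linarith
  have hge : ∀ R, R0 ≤ R → δ ≤ t R := by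
    intro R hR
    have := hc (R + 1) ♥
    push_cast at this
    refine this.le.trans (le_of_eq ?_)
    simp only [ht]; congr 1
    rw [ofReal_pow ♠]; congr 1
    rw [ofReal_add ♠ zero_le_one]; simp
  have : 0 < min δ ((Finset.range R0).inf t) := by
    refine lt_min hδ ?_
    rw [Finset.lt_inf_iff (by simp)]
    exact fun R _ => hpos R
  refine absurd hh (ne_of_gt (this.trans_le (le_iInf fun R => ?_)))
  rcases le_or_gt R0 R with h1 | h1
  · exact (min_le_left _ _).trans (hge R h1)
  · exact (min_le_right _ _).trans (Finset.inf_le (Finset.mem_range.2 h1))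
lemma bV (hd : 3 ≤ d) (hφ : IsGFF P φ) {U L K l : ℕ} {ε M : ℝ} (hε : 0 < ε) (hεM : ε ≤ M)
    (hL : 2 * L + 2 ≤ 30 * (2 * U + 1)) (hK : K + l = L)
    (hq : 3000000 ^ (2 * d) * ((2 * L + 1) ^ d * exp (-1 / (2 * ((kap d l / ε ^ 2 + kap d 0 / M ^ 2) +
      4 * kap d (4500 * (2 * U + 1)) / ε ^ 2)))) ≤ 1 / 2) (n : ℕ) (X : V d) :
    P {ω | Bad (bb U K L ε M φ ω) n X} ≤ 2⁻¹ ^ 2 ^ n := by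
  classical
  have hM : 0 < M := hε.trans_le hεM
  set q : ℝ := (2 * L + 1) ^ d * exp (-1 / (2 * ((kap d l / ε ^ 2 + kap d 0 / M ^ 2) +
      4 * kap d (4500 * (2 * U + 1)) / ε ^ 2))) with hqd
  have k0 := aJz hd 0
  have kl := aJz hd l
  refine (bAz (P := P) (fun ω => bb U K L ε M φ ω) n X (ofReal q) fun T hT => ?_).trans ?_
  · have h0 : ∀ (c a : V d), c + a - c = a := fun c a => by abel
    have := bLy hd hφ hL (cc U) (fun y y' => by
        rcases Nat.eq_zero_or_pos (dinf y y') with h | h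
        · simp [h]
        · obtain ⟨i, hi⟩ : ∃ i, dinf y y' ≤ (y i - y' i).natAbs := by
            by_contra! hc
            exact lt_irrefl (dinf y y') ((Finset.sup_lt_iff (by simpa using h)).2 fun i _ => hc i)
          refine le_trans ?_ (le_sup (f := fun i => (cc U y i - cc U y' i).natAbs) (Finset.mem_univ i))
          rw [show cc U y i - cc U y' i = (2 * U + 1 : ℕ) * (y i - y' i) by simp [cc]; ring, natAbs_mul,
            natAbs_natCast]
          exact Nat.mul_le_mul_left _ hi) (bx 0 L) (fun y a ha => by
        rw [add_comm]; have := (bSy (z := cc U y)).2 ha; simpa using this)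
      (g := fun a => if a ∈ bx 0 K then -1 / ε else -1 / M) hε (fun a b => by
        split_ifs <;> exact mul_nonneg_of_nonpos_of_nonpos (div_nonpos_of_nonpos_of_nonneg ♣ ♠)
          (div_nonpos_of_nonpos_of_nonneg ♣ ♠)) (fun a => by
        split_ifs
        · rw [abs_div, abs_neg, abs_one, abs_of_pos hε]
        · rw [abs_div, abs_neg, abs_one, abs_of_pos hM]; exact one_div_le_one_div_of_le hε hεM)
      (v := kap d l / ε ^ 2 + kap d 0 / M ^ 2) ♠ (fun y a ha => by
        split_ifs with hc
        · have := aWx hd (D := bx (cc U y) L) (x := cc U y + a) (r := l) (by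
            rw [add_comm]; have := (bSy (z := cc U y)).2 ha; simpa using this) fun x' hx' => by
              rw [bHy] at hx' hc
              have h1 := aBx x' (cc U y + a) (cc U y)
              have h2 := bSx (cc U y) a 0
              rw [zero_add, add_comm a] at h2
              omega
          have h2 : (-1 / ε) ^ 2 = 1 / ε ^ 2 := by ring
          rw [h2]
          have : 1 / ε ^ 2 * Qg d (eta (bx (cc U y) L) (cc U y + a)) (eta (bx (cc U y) L) (cc U y + a)) ≤ 1 / ε ^ 2 * kap d l := by gcongr
          have : 0 ≤ kap d 0 / M ^ 2 := by positivity
          have : 1 / ε ^ 2 * kap d l = kap d l / ε ^ 2 := by ring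
          linarith
        · have h2 : (-1 / M) ^ 2 = 1 / M ^ 2 := by ring
          rw [h2]
          have := aWy hd (bx (cc U y) L) (cc U y + a)
          have : 1 / M ^ 2 * Qg d (eta (bx (cc U y) L) (cc U y + a)) (eta (bx (cc U y) L) (cc U y + a)) ≤ 1 / M ^ 2 * kap d 0 := by gcongr
          have : 0 ≤ kap d l / ε ^ 2 := by positivity
          have : 1 / M ^ 2 * kap d 0 = kap d 0 / M ^ 2 := by ring
          linarith) hT (Finset.Subset.refl T)
    rw [(aGz (fun _ => 0) (fun _ _ _ => le_rfl) hT).1, bI] at this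
    push_cast at this
    refine le_trans (measure_mono fun ω hω => ?_) this
    simp only [mem_ofPred_eq] at hω ⊢
    intro y hy
    have h1 : ¬ En (cc U y) K L ε M (bDz φ (bx (cc U y) L) ω) := hω y hy
    have hz : ∀ z, cc U y + (z - cc U y) = z := fun z => by abel
    have hb : ∀ z N, z - cc U y ∈ bx 0 N ↔ z ∈ bx (cc U y) N := fun z N => by
      rw [← bSy (z := cc U y)]; simp
    have hg : ∀ z s, 0 < s → bDz φ (bx (cc U y) L) ω z < -s → 1 ≤ -1 / s * bDz φ (bx (cc U y) L) ω z := by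
      intro z s hs hlt
      rw [div_mul_eq_mul_div, le_div_iff₀ hs]; linarith
    rw [En, not_and_or] at h1
    push Not at h1
    have key : ∃ z ∈ bx (cc U y) L, (z ∈ bx (cc U y) K ∧ bDz φ (bx (cc U y) L) ω z < -ε) ∨
        (z ∉ bx (cc U y) K ∧ bDz φ (bx (cc U y) L) ω z < -M) := by
      rcases h1 with ⟨z, hz1, hz2⟩ | ⟨z, hz1, hz2⟩
      · exact ⟨z, bHy.2 ((bHy.1 hz1).trans ♥), Or.inl ⟨hz1, hz2⟩⟩
      · by_cases hzK : z ∈ bx (cc U y) K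
        · exact ⟨z, hz1, Or.inl ⟨hzK, by linarith⟩⟩
        · exact ⟨z, hz1, Or.inr ⟨hzK, hz2⟩⟩
    obtain ⟨z, hzL, hh⟩ := key
    refine ⟨z - cc U y, (hb z L).2 hzL, ?_⟩
    simp only [hz, hb]
    rcases hh with ⟨h2, h3⟩ | ⟨h2, h3⟩
    · rw [if_pos h2]; exact hg z ε hε h3
    · rw [if_neg h2]; exact hg z M hM h3
  · gcongr
    rw [show (3000000 ^ (2 * d) : ENNReal) = ofReal (3000000 ^ (2 * d)) by
      rw [ofReal_pow ♣]; norm_num, ← ofReal_mul ♠]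
    refine (ofReal_le_ofReal hq).trans (le_of_eq ?_)
    rw [ofReal_div_of_pos ♣]; simp
lemma bVx (hd : 3 ≤ d) (hφ : IsGFF P φ) {U K L n r ρ : ℕ} {h ε M : ℝ} {p q : ENNReal}
    (hp : P {ω | ¬ GA 0 U (2 * r) h (proc φ ω)} ≤ p) (hq : ∀ X, P {ω | Bad (bb U K L ε M φ ω) n X} ≤ q) :
    P (Gd U K L n r ρ h ε M φ)ᶜ ≤ (2 * r + 1) ^ d * p + (2 * ρ + 1) ^ d * q := by
  have hsub : (Gd U K L n r ρ h ε M φ)ᶜ ⊆ (⋃ c ∈ bx 𝕆 d r, {ω | ¬ GA c U (2 * r) h (proc φ ω)}) ∪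
      ⋃ X ∈ bx 𝕆 d ρ, {ω | Bad (bb U K L ε M φ ω) n X} := by
    intro ω hω
    rw [Gd, mem_compl_iff, mem_ofPred_eq, not_and_or] at hω
    push Not at hω
    simp only [mem_union, mem_iUnion, mem_ofPred_eq, exists_prop]
    rcases hω with ⟨y, h1, h2⟩ | ⟨X, h1, h2⟩
    · have h3 : dinf (cc U y) 0 ≤ r := h1 _ (bHy.2 (by simp [dinf]))
      refine Or.inl ⟨cc U y, bHy.2 h3, ?_⟩
      rintro ⟨v, hv, hm⟩
      exact h2 v hv (bRz.1 (hm.to (fun _ _ h => h) (h1 v hv) (by rw [aB]; omega)))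
    · exact Or.inr ⟨X, bHy.2 h1, h2⟩
  have hb : ∀ (N : ℕ), ((bx 𝕆 d N).card : ENNReal) = (2 * N + 1) ^ d := fun N => by rw [bI]; push_cast; rfl
  refine (measure_mono hsub).trans ((measure_union_le _ _).trans (add_le_add ?_ ?_))
  · refine (measure_biUnion_finset_le _ _).trans ((sum_le_card_nsmul _ _ p fun c _ => ?_).trans ?_)
    · rw [bUx hd hφ]; exact hp
    · rw [nsmul_eq_mul, hb]
  · refine (measure_biUnion_finset_le _ _).trans ((sum_le_card_nsmul _ _ q fun X _ => hq X).trans ?_)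
    rw [nsmul_eq_mul, hb]
lemma bVy (C : ℝ) {i j : ℕ} (h : i < j) : ∀ᶠ b : ℕ in atTop, C * ℜ b ^ i ≤ ℜ b ^ j := by
  filter_upwards [eventually_ge_atTop ⌈|C| + 1⌉₊] with b hb
  have h1 : |C| + 1 ≤ b := (le_ceil _).trans (by exact_mod_cast hb)
  have h2 := le_abs_self C
  have h3 := abs_nonneg C
  calc C * ℜ b ^ i ≤ b * ℜ b ^ i := by gcongr; linarith
    _ = ℜ b ^ (i + 1) := by ring
    _ ≤ ℜ b ^ j := pow_le_pow_right₀ (by linarith) h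
def UU (b : ℕ) : ℕ := 3 ^ ((2 * b) ^ 16)
def LL (b : ℕ) : ℕ := 10 * (2 * UU b + 1)
def Eb (b : ℕ) : ℝ := 2 ^ 18 * ℜ b ^ 16
lemma bVz {b : ℕ} (hb : 1 ≤ b) : ((4 * LL b + 3 : ℕ) : ℝ) ≤ exp (Eb b) := by
  have h0 : (1 : ℕ) ≤ UU b := one_le_pow _ _ ♣
  have h1 : 4 * LL b + 3 ≤ 3 ^ ((2 * b) ^ 16 + 5) := by
    rw [pow_add, LL, ← UU]; omega
  have h2 : ℜ 3 ≤ exp 2 := by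
    have := add_one_le_exp (2 : ℝ); linarith
  calc ((4 * LL b + 3 : ℕ) : ℝ) ≤ (3 ^ ((2 * b) ^ 16 + 5) : ℕ) := by exact_mod_cast h1
    _ = ℜ 3 ^ ((2 * b) ^ 16 + 5) := by push_cast; rfl
    _ ≤ exp 2 ^ ((2 * b) ^ 16 + 5) := by gcongr
    _ = exp (2 * ((2 * b) ^ 16 + 5)) := by rw [← exp_nat_mul]; push_cast; ring_nf
    _ ≤ _ := by
      rw [exp_le_exp, Eb]
      have : ℜ 1 ≤ ℜ b ^ 16 := one_le_pow₀ (by exact_mod_cast hb)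
      rw [mul_pow]; nlinarith
lemma bW {b : ℕ} (hd : 3 ≤ d) (hb : 1 ≤ b) : kap d (b ^ 27) ≤ kap d 0 / ℜ b ^ 18 := by
  have h0 := aJz hd 0
  have hb' : ℜ 0 < b := by exact_mod_cast hb
  have e0 : kap d 0 = (Fs 𝕆 d - Pav Fs 𝕆 d)⁻¹ := by simp [kap]
  rw [e0] at h0 ⊢
  rw [kap, div_eq_mul_inv]
  refine mul_le_mul_of_nonneg_left ?_ h0.le
  rw [rpow_neg ♠]
  refine inv_anti₀ ♠ ?_
  calc ℜ b ^ 18 = ((ℜ b ^ 18) ^ 3) ^ (1 / 3 : ℝ) := by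
        rw [← rpow_natCast ((ℜ b ^ 18)) 3, ← rpow_mul ♠]; norm_num
    _ ≤ _ := by
      refine rpow_le_rpow ♠ ?_ ♣
      push_cast
      rw [← pow_mul, ← pow_mul]; linarith
lemma E1 (hd : 3 ≤ d) {ε : ℝ} (hε : 0 < ε) : ∀ᶠ b : ℕ in atTop,
    ((2 * LL b + 1 : ENNReal) ^ d) * ofReal (exp (-ε ^ 2 / (2 * kap d (b ^ 27)))) ≤ b1 d (UU b) (LL b) / 2 := by
  have κ0 := aJz hd 0
  filter_upwards [bVy ((4 + 3 * d * 2 ^ 18) * (2 * kap d 0 / ε ^ 2)) (show 16 < 18 by norm_num), eventually_ge_atTop 1] with b hb hb1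
  have hbr : ℜ 1 ≤ b := by exact_mod_cast hb1
  have hL := bVz hb1
  push_cast at hL
  have hU : (UU b : ℝ) ≤ LL b := by rw [LL]; push_cast; linarith
  have kl := aJz hd (b ^ 27)
  have k2 := bW hd hb1
  set e := exp (-ε ^ 2 / (2 * kap d (b ^ 27))) with he
  have key : 4 * ((2 * (UU b : ℝ) + 1) ^ d * (2 * LL b + 1) ^ d) * ((2 * LL b + 1) ^ d * e) ≤ 1 := by
    have h1 : e ≤ exp (-(4 + 3 * d * 2 ^ 18) * ℜ b ^ 16) := by
      rw [he, exp_le_exp, neg_div, neg_mul, neg_le_neg_iff, le_div_iff₀ ♠]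
      have : (4 + 3 * d * 2 ^ 18) * ℜ b ^ 16 * (2 * kap d (b ^ 27)) ≤ (4 + 3 * d * 2 ^ 18) * ℜ b ^ 16 * (2 * (kap d 0 / ℜ b ^ 18)) := by gcongr
      refine this.trans ?_
      rw [mul_div, mul_div, div_le_iff₀ ♠]
      have h3 : (4 + 3 * d * 2 ^ 18) * ℜ b ^ 16 * (2 * kap d 0) = ε ^ 2 * ((4 + 3 * d * 2 ^ 18) * (2 * kap d 0 / ε ^ 2) * ℜ b ^ 16) := by
        field_simp
      rw [h3]; gcongr
    have h4 : ℜ 4 ≤ exp (4 * ℜ b ^ 16) := by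
      have := add_one_le_exp (4 * ℜ b ^ 16)
      have : ℜ 1 ≤ ℜ b ^ 16 := one_le_pow₀ hbr
      linarith
    calc _ ≤ exp (4 * ℜ b ^ 16) * (exp (Eb b) ^ d * exp (Eb b) ^ d) * (exp (Eb b) ^ d *
          exp (-(4 + 3 * d * 2 ^ 18) * ℜ b ^ 16)) := by gcongr <;> linarith
      _ = 1 := by
        simp only [← exp_nat_mul, ← exp_add]
        rw [exp_eq_one_iff, Eb]; ring
  have e1 : b1 d (UU b) (LL b) / 2 = ofReal (4 * ((2 * (UU b : ℝ) + 1) ^ d * (2 * LL b + 1) ^ d))⁻¹ := by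
    rw [ofReal_inv_of_pos ♠, b1, div_eq_mul_inv, ← ENNReal.mul_inv (by simp) (by simp)]
    congr 1
    rw [show (4 * ((2 * (UU b : ℝ) + 1) ^ d * (2 * LL b + 1) ^ d)) = ((4 * ((2 * UU b + 1) ^ d * (2 * LL b + 1) ^ d) : ℕ) : ℝ) by push_cast; ring,
      ofReal_natCast]
    push_cast; ring
  rw [e1, show ((2 * LL b + 1 : ENNReal) ^ d) = ofReal ((2 * LL b + 1) ^ d) by
    rw [show ((2 * LL b + 1) ^ d : ℝ) = (((2 * LL b + 1) ^ d : ℕ) : ℝ) by push_cast; ring, ofReal_natCast]; push_cast; ring,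
    ← ofReal_mul ♠]
  refine ofReal_le_ofReal ?_
  rw [← one_div, le_div_iff₀ ♠]; linarith
lemma E2 (hd : 3 ≤ d) {ε : ℝ} (hε : 0 < ε) : ∀ᶠ b : ℕ in atTop,
    3000000 ^ (2 * d) * ((2 * LL b + 1) ^ d * exp (-1 / (2 * ((kap d (b ^ 27) / ε ^ 2 + kap d 0 / (ℜ b ^ 9) ^ 2) +
      4 * kap d (4500 * (2 * UU b + 1)) / ε ^ 2)))) ≤ 1 / 2 := by
  have κ0 := aJz hd 0
  set C : ℝ := 2 * 3000000 ^ (2 * d) with hC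
  set v : ℝ := kap d 0 * (5 / ε ^ 2 + 1) with hv
  have hv0 : 0 < v := by positivity
  filter_upwards [bVy ((C + d * 2 ^ 18) * (2 * v)) (show 16 < 18 by norm_num), eventually_ge_atTop 1] with b hb hb1
  have hbr : ℜ 1 ≤ b := by exact_mod_cast hb1
  have hL := bVz hb1
  push_cast at hL
  have k2 := bW hd hb1
  have k1 := aJz hd (b ^ 27)
  have k3 : kap d (4500 * (2 * UU b + 1)) ≤ kap d (b ^ 27) := by
    refine aJy hd ?_
    have : b ^ 27 ≤ UU b := by
      calc b ^ 27 ≤ (3 ^ b) ^ 27 := pow_le_pow_left (lt_pow_self ♣).le _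
        _ = 3 ^ (27 * b) := by rw [← pow_mul]; ring_nf
        _ ≤ UU b := by
          refine pow_le_pow_right ♣ ?_
          rw [mul_pow]
          have : b ≤ b ^ 16 := Nat.le_self_pow ♣ b
          omega
    omega
  set w := (kap d (b ^ 27) / ε ^ 2 + kap d 0 / (ℜ b ^ 9) ^ 2) + 4 * kap d (4500 * (2 * UU b + 1)) / ε ^ 2 with hw
  have k4 := aJz hd (4500 * (2 * UU b + 1))
  have hw0 : 0 < w := by positivity
  have hwv : w ≤ v / ℜ b ^ 18 := by
    have : 4 * kap d (4500 * (2 * UU b + 1)) / ε ^ 2 ≤ 4 * (kap d 0 / ℜ b ^ 18) / ε ^ 2 := by gcongr; linarith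
    have : kap d (b ^ 27) / ε ^ 2 ≤ (kap d 0 / ℜ b ^ 18) / ε ^ 2 := by gcongr
    have e : v / ℜ b ^ 18 = (kap d 0 / ℜ b ^ 18) / ε ^ 2 + kap d 0 / (ℜ b ^ 9) ^ 2 + 4 * (kap d 0 / ℜ b ^ 18) / ε ^ 2 := by
      rw [hv, ← pow_mul]; field_simp; ring
    rw [e, hw]; linarith
  have h1 : exp (-1 / (2 * w)) ≤ exp (-(C + d * 2 ^ 18) * ℜ b ^ 16) := by
    rw [exp_le_exp, neg_div, neg_mul, neg_le_neg_iff, le_div_iff₀ ♠]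
    calc (C + d * 2 ^ 18) * ℜ b ^ 16 * (2 * w) ≤ (C + d * 2 ^ 18) * ℜ b ^ 16 * (2 * (v / ℜ b ^ 18)) := by gcongr
      _ = ((C + d * 2 ^ 18) * (2 * v) * ℜ b ^ 16) / ℜ b ^ 18 := by ring
      _ ≤ 1 := by rw [div_le_one ♠]; exact hb
  have h4 : C ≤ exp (C * ℜ b ^ 16) := by
    have := add_one_le_exp (C * ℜ b ^ 16)
    have : ℜ 1 ≤ ℜ b ^ 16 := one_le_pow₀ hbr
    have : 0 < C := by positivity
    nlinarith
  have : C * ((2 * LL b + 1) ^ d * exp (-1 / (2 * w))) ≤ 1 := by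
    calc _ ≤ exp (C * ℜ b ^ 16) * (exp (Eb b) ^ d * exp (-(C + d * 2 ^ 18) * ℜ b ^ 16)) := by gcongr; linarith
      _ = 1 := by
        simp only [← exp_nat_mul, ← exp_add]
        rw [exp_eq_one_iff, Eb]; ring
  rw [hC] at this; linarith
def Gb (d : ℕ) (A : ℝ) (b : ℕ) : ℝ :=
  (ℜ b ^ 9 + A + 2) ^ 2 * (d * (ℜ b ^ 27 + 5) + 1) + 2 * (2 + 2 * d * Eb b) * (d * ((2 * b) ^ 16 + 4) + 1)
lemma bWx {A : ℝ} (hA : 0 ≤ A) {b : ℕ} (hb : 1 ≤ b) :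
    Gb d A b ≤ ((A + 3) ^ 2 * (6 * d + 1) + 2 * (2 + 2 * d * 2 ^ 18) * (d * (2 ^ 16 + 4) + 1)) * ℜ b ^ 45 := by
  have hbr : ℜ 1 ≤ b := by exact_mod_cast hb
  have h9 : ℜ 1 ≤ ℜ b ^ 9 := one_le_pow₀ hbr
  have h16 : ℜ 1 ≤ ℜ b ^ 16 := one_le_pow₀ hbr
  have h27 : ℜ 1 ≤ ℜ b ^ 27 := one_le_pow₀ hbr
  have h32 : ℜ b ^ 32 ≤ ℜ b ^ 45 := pow_le_pow_right₀ hbr ♣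
  have d0 : ℜ 0 ≤ d := by positivity
  have a1 : ℜ b ^ 9 + A + 2 ≤ (A + 3) * ℜ b ^ 9 := by nlinarith
  have a2 : d * (ℜ b ^ 27 + 5) + 1 ≤ (6 * d + 1) * ℜ b ^ 27 := by nlinarith
  have a3 : 2 + 2 * d * Eb b ≤ (2 + 2 * d * 2 ^ 18) * ℜ b ^ 16 := by rw [Eb]; nlinarith
  have a4 : d * ((2 * ℜ b) ^ 16 + 4) + 1 ≤ (d * (2 ^ 16 + 4) + 1) * ℜ b ^ 16 := by rw [mul_pow]; nlinarith
  have e0 : 0 ≤ Eb b := by unfold Eb; positivity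
  calc Gb d A b ≤ ((A + 3) * ℜ b ^ 9) ^ 2 * ((6 * d + 1) * ℜ b ^ 27) +
        2 * ((2 + 2 * d * 2 ^ 18) * ℜ b ^ 16) * ((d * (2 ^ 16 + 4) + 1) * ℜ b ^ 16) := by
        unfold Gb; gcongr
    _ = (A + 3) ^ 2 * (6 * d + 1) * ℜ b ^ 45 + 2 * (2 + 2 * d * 2 ^ 18) * (d * (2 ^ 16 + 4) + 1) * ℜ b ^ 32 := by ring
    _ ≤ (A + 3) ^ 2 * (6 * d + 1) * ℜ b ^ 45 + 2 * (2 + 2 * d * 2 ^ 18) * (d * (2 ^ 16 + 4) + 1) * ℜ b ^ 45 := by gcongr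
    _ = _ := by ring
lemma bWy {A : ℝ} (hA : 0 ≤ A) {b : ℕ} (hb : 1 ≤ b) :
    ofReal (exp (-Gb d A b)) ≤ bKy d (UU b) (LL b) (b ^ 27) ((2 * b) ^ 16 + 4) (ℜ b ^ 9 + A) := by
  have hL := bVz hb
  push_cast at hL
  have hU : (UU b : ℝ) ≤ LL b := by rw [LL]; push_cast; linarith
  have g1 := bFx (t := ℜ b ^ 9 + A) ♠
  have g2 : ofReal (exp (-(2 + 2 * d * Eb b))) ≤ b1 d (UU b) (LL b) / 2 := by
    rw [b1, div_eq_mul_inv, ← ENNReal.mul_inv (by simp) (by simp), exp_neg, ofReal_inv_of_pos (exp_pos _)]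
    refine ENNReal.inv_le_inv.2 ?_
    rw [show (2 * ((2 * UU b + 1) ^ d * (2 * LL b + 1) ^ d) * 2 : ENNReal) = ofReal (4 * ((2 * (UU b : ℝ) + 1) ^ d * (2 * LL b + 1) ^ d)) by
      rw [show (4 * ((2 * (UU b : ℝ) + 1) ^ d * (2 * LL b + 1) ^ d)) = ((4 * ((2 * UU b + 1) ^ d * (2 * LL b + 1) ^ d) : ℕ) : ℝ) by push_cast; ring,
        ofReal_natCast]; push_cast; ring]
    refine ofReal_le_ofReal ?_
    calc _ ≤ exp 2 * (exp (Eb b) ^ d * exp (Eb b) ^ d) := by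
          have : ℜ 4 ≤ exp 2 := by
            have h := exp_one_gt_d9
            have : exp 2 = exp 1 * exp 1 := by rw [← exp_add]; norm_num
            rw [this]; nlinarith
          gcongr <;> linarith
      _ = _ := by simp only [← exp_nat_mul, ← exp_add]; ring_nf
  rw [bKy]
  calc _ = ofReal (exp (-(ℜ b ^ 9 + A + 2) ^ 2)) ^ (d * (b ^ 27 + 5) + 1) *
        (ofReal (exp (-(2 + 2 * d * Eb b))) ^ 2) ^ (d * ((2 * b) ^ 16 + 4) + 1) := by
        simp only [← ofReal_pow (exp_pos _).le, ← exp_nat_mul]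
        rw [← ofReal_mul ♠, ← exp_add, Gb]
        congr 2; push_cast; ring
    _ ≤ _ := by gcongr
lemma E3 (c0 A : ℝ) (hc : 0 < c0) (hc1 : c0 ≤ 1) (hA : 0 ≤ A) : ∀ᶠ b : ℕ in atTop,
    (1000 : ENNReal) ^ (b ^ 48) ≤ (1000000 ^ (b ^ 48) : ℕ) * (ofReal (kp (c0 * exp (-(4 * d * Eb b)))) *
      bKy d (UU b) (LL b) (b ^ 27) ((2 * b) ^ 16 + 4) (ℜ b ^ 9 + A) ^ 2) := by
  set CG := (A + 3) ^ 2 * (6 * d + 1) + 2 * (2 + 2 * d * 2 ^ 18) * (d * (2 ^ 16 + 4) + 1) with hCG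
  filter_upwards [bVy (16 / c0 ^ 2 + 8 * d * 2 ^ 18 + 2 * CG) (show 45 < 48 by norm_num), eventually_ge_atTop 1] with b hb hb1
  have hbr : ℜ 1 ≤ b := by exact_mod_cast hb1
  have hG := bWx (d := d) hA hb1
  rw [← hCG] at hG
  have h1645 : ℜ b ^ 16 ≤ ℜ b ^ 45 := pow_le_pow_right₀ hbr ♣
  have h45 : ℜ 1 ≤ ℜ b ^ 45 := one_le_pow₀ hbr
  have e0 : 0 ≤ Eb b := by unfold Eb; positivity
  have hx : 16 / c0 ^ 2 + 8 * d * Eb b + 2 * Gb d A b ≤ ℜ b ^ 48 := by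
    refine le_trans ?_ hb
    have : 16 / c0 ^ 2 ≤ 16 / c0 ^ 2 * ℜ b ^ 45 := le_mul_of_one_le_right ♠ h45
    have : 8 * d * Eb b ≤ 8 * d * (2 ^ 18 * ℜ b ^ 45) := by unfold Eb; gcongr
    nlinarith
  set δ := c0 * exp (-(4 * d * Eb b)) with hδ
  have hδ0 : 0 < δ := by positivity
  have hδ1 : δ ≤ 1 := by
    have h0 : 0 ≤ 4 * d * Eb b := by positivity
    have : exp (-(4 * d * Eb b)) ≤ 1 := Real.exp_le_one_iff.2 (by linarith)
    nlinarith [exp_pos (-(4 * d * Eb b))]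
  have hk : δ ^ 2 / 16 ≤ kp δ := by
    rw [kp]
    have h1 : exp (-(δ ^ 2) / 8) ≤ 1 / (1 + δ ^ 2 / 8) := by
      rw [neg_div, exp_neg, ← one_div]
      refine one_div_le_one_div_of_le ♠ ?_
      have := add_one_le_exp (δ ^ 2 / 8); linarith
    have h2 : 1 / (1 + δ ^ 2 / 8) ≤ 1 - δ ^ 2 / 16 := by
      have y0 := sq_nonneg δ
      have y1 : δ ^ 2 ≤ 1 := pow_le_one₀ hδ0.le hδ1
      rw [div_le_iff₀ ♠]
      generalize δ ^ 2 = y at y0 y1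
      nlinarith
    linarith
  have hb' : ofReal (exp (-Gb d A b)) ≤ _ := bWy (d := d) hA hb1
  have h3 : (1 : ENNReal) ≤ ofReal (exp (ℜ b ^ 48)) * (ofReal (δ ^ 2 / 16) * ofReal (exp (-Gb d A b)) ^ 2) := by
    rw [← ofReal_pow ♠, ← ofReal_mul ♠, ← ofReal_mul ♠, ENNReal.one_le_ofReal]
    have h5 : 16 / c0 ^ 2 ≤ exp (16 / c0 ^ 2) := by have := add_one_le_exp (16 / c0 ^ 2); linarith
    have h6 : 1 ≤ exp (16 / c0 ^ 2) * (c0 ^ 2 / 16) := by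
      calc ℜ 1 = 16 / c0 ^ 2 * (c0 ^ 2 / 16) := by field_simp
        _ ≤ _ := by gcongr
    refine h6.trans ?_
    calc exp (16 / c0 ^ 2) * (c0 ^ 2 / 16) ≤ exp (ℜ b ^ 48 - 8 * d * Eb b - 2 * Gb d A b) * (c0 ^ 2 / 16) := by
          gcongr; linarith
      _ = _ := by
        rw [hδ, mul_pow, ← exp_nat_mul, ← exp_nat_mul, show ℜ b ^ 48 - 8 * d * Eb b - 2 * Gb d A b = ℜ b ^ 48 + (2 : ℕ) * (-(4 * d * Eb b)) + (2 : ℕ) * (-Gb d A b) by push_cast; ring,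
          exp_add, exp_add]; ring
  have h4 : ofReal (exp (ℜ b ^ 48)) ≤ 1000 ^ (b ^ 48) := by
    rw [show ℜ b ^ 48 = ((b ^ 48 : ℕ) : ℝ) * 1 by push_cast; ring, exp_nat_mul, ofReal_pow ♠]
    gcongr
    rw [show (1000 : ENNReal) = ofReal 1000 by simp]
    refine ofReal_le_ofReal ?_
    have := exp_one_lt_d9; linarith
  calc (1000 : ENNReal) ^ (b ^ 48) = 1000 ^ (b ^ 48) * 1 := by rw [mul_one]
    _ ≤ 1000 ^ (b ^ 48) * (1000 ^ (b ^ 48) * (ofReal (kp δ) *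
      bKy d (UU b) (LL b) (b ^ 27) ((2 * b) ^ 16 + 4) (ℜ b ^ 9 + A) ^ 2)) := by
        refine mul_le_mul_right (h3.trans ?_) _
        gcongr
    _ = _ := by
      rw [← mul_assoc, ← mul_pow]; push_cast; norm_num
lemma bWz (b0 : ℕ) : ∃ R0 : ℕ, ∀ R : ℕ, R0 ≤ R → ∃ b, b0 ≤ b ∧ ufn R ≤ UU b ∧ (1000000 ^ (b ^ 48)) ^ 6 ≤ R := by
  refine ⟨⌈exp ((2 * (max b0 4 : ℕ)) ^ 48 + 1)⌉₊, fun R hR => ?_⟩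
  have hR1 : exp ((2 * (max b0 4 : ℕ)) ^ 48 + 1) ≤ R := (le_ceil _).trans (by exact_mod_cast hR)
  have hR0 : ℜ 0 < R := (exp_pos _).trans_le hR1
  have hlog : (2 * (max b0 4 : ℕ) : ℝ) ^ 48 + 1 ≤ log R := by rwa [le_log_iff_exp_le hR0]
  have hex : ∃ b : ℕ, log R ≤ (2 * b : ℝ) ^ 48 := by
    refine ⟨⌈log R⌉₊ + 1, ?_⟩
    have h1 := le_ceil (log R)
    push_cast
    have h2 : ℜ 0 ≤ (⌈log R⌉₊ : ℝ) := by positivity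
    calc log R ≤ 2 * ((⌈log R⌉₊ : ℝ) + 1) := by linarith
      _ ≤ _ := le_self_pow₀ (by linarith) ♣
  classical
  set b := Nat.find hex with hb
  have hs : log R ≤ (2 * b : ℝ) ^ 48 := Nat.find_spec hex
  have hbm : max b0 4 < b := by
    by_contra! hc
    have : (2 * b : ℝ) ^ 48 ≤ (2 * (max b0 4 : ℕ) : ℝ) ^ 48 := by gcongr
    linarith
  have hb4 : 4 < b := lt_of_le_of_lt (le_max_right _ _) hbm
  have hlt : (2 * ((b - 1 : ℕ) : ℝ)) ^ 48 < log R := by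
    have := Nat.find_min hex (m := b - 1) ♥
    push Not at this; exact this
  refine ⟨b, (le_max_left _ _).trans hbm.le, ?_, ?_⟩
  · have h0 : 0 ≤ log R := le_trans (pow_nonneg ♠ 48) hlt.le
    have h1 : log R ^ (ℜ 1 / 3) ≤ (2 * b : ℝ) ^ 16 := by
      calc log R ^ (ℜ 1 / 3) ≤ (((2 * b : ℝ) ^ 16) ^ 3) ^ (ℜ 1 / 3) := by
            refine rpow_le_rpow h0 ?_ ♣
            rw [← pow_mul]; exact hs
        _ = _ := by rw [← rpow_natCast ((2 * b : ℝ) ^ 16) 3, ← rpow_mul ♠]; norm_num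
    rw [ufn, UU]
    refine (Real.exp_le_exp.2 h1).trans ?_
    rw [show (2 * b : ℝ) ^ 16 = (((2 * b) ^ 16 : ℕ) : ℝ) * 1 by push_cast; ring, exp_nat_mul]
    push_cast
    gcongr
    have := exp_one_lt_d9; linarith
  · have h1 : ((1000000 ^ (b ^ 48)) ^ 6 : ℝ) ≤ R := by
      rw [← exp_log hR0]
      have h2 : ℜ 1000000 ≤ exp 1 ^ 14 := by
        have := exp_one_gt_d9
        calc ℜ 1000000 ≤ 2.7182818283 ^ 14 := by norm_num
          _ ≤ _ := by gcongr
      calc ((1000000 ^ (b ^ 48)) ^ 6 : ℝ) ≤ ((exp 1 ^ 14) ^ (b ^ 48)) ^ 6 := by gcongr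
        _ = exp (84 * ℜ b ^ 48) := by
          rw [← pow_mul, ← pow_mul, ← exp_nat_mul]; congr 1; push_cast; ring
        _ ≤ _ := by
          rw [exp_le_exp]
          refine le_trans ?_ hlt.le
          rw [Nat.cast_sub ♥]
          have : ℜ 5 ≤ b := by exact_mod_cast hb4
          calc 84 * ℜ b ^ 48 ≤ (3 / 2 * ℜ b) ^ 48 := by rw [mul_pow]; gcongr; norm_num
            _ ≤ _ := pow_le_pow_left₀ ♠ (by push_cast; linarith) _
    exact_mod_cast h1
lemma E4 (C : ℕ) : ∀ᶠ b : ℕ in atTop, C * (2 * UU b + 1) ≤ 1000000 ^ (b ^ 48) := by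
  filter_upwards [bVy (C + 2 ^ 18) (show 16 < 48 by norm_num), eventually_ge_atTop 1] with b hb hb1
  have hbr : ℜ 1 ≤ b := by exact_mod_cast hb1
  have hL := bVz hb1
  have h0 : 2 * UU b + 1 ≤ 4 * LL b + 3 := by rw [LL]; omega
  have h1 : ((2 * UU b + 1 : ℕ) : ℝ) ≤ exp (Eb b) := le_trans (by exact_mod_cast h0) hL
  have : ((C * (2 * UU b + 1) : ℕ) : ℝ) ≤ (1000000 ^ (b ^ 48) : ℕ) := by
    rw [Nat.cast_mul, Nat.cast_pow]
    calc ℜ C * ((2 * UU b + 1 : ℕ) : ℝ) ≤ exp (C * ℜ b ^ 16) * exp (Eb b) := by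
          gcongr
          have := add_one_le_exp (C * ℜ b ^ 16)
          have : ℜ 1 ≤ ℜ b ^ 16 := one_le_pow₀ hbr
          have : ℜ 0 ≤ C := by positivity
          nlinarith
      _ = exp ((C + 2 ^ 18) * ℜ b ^ 16) := by rw [← exp_add, Eb]; ring_nf
      _ ≤ exp (ℜ b ^ 48) := Real.exp_le_exp.2 hb
      _ = exp 1 ^ (b ^ 48) := by rw [← exp_nat_mul]; push_cast; ring_nf
      _ ≤ _ := by
        gcongr
        have := exp_one_lt_d9; push_cast; linarith
  exact_mod_cast this
lemma bX : Tendsto (fun b : ℕ => b ^ 48) atTop atTop := tendsto_pow_atTop ♣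
lemma E5 (δ : ENNReal) (hδ : 0 < δ) : ∀ᶠ b : ℕ in atTop, 5 * ((1000 : ENNReal) ^ (b ^ 48))⁻¹ ≤ δ := by
  have h1 : Tendsto (fun n : ℕ => 5 * ((1000 : ENNReal)⁻¹) ^ n) atTop (nhds (5 * 0)) :=
    ENNReal.Tendsto.const_mul (ENNReal.tendsto_pow_atTop_nhds_zero_of_lt_one (ENNReal.inv_lt_one.2 ♣)) (by simp)
  rw [mul_zero] at h1
  filter_upwards [(h1.comp bX).eventually_le_const hδ] with b hb
  simpa [ENNReal.inv_pow] using hb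
lemma E6 (k : ℕ) (δ : ENNReal) (hδ : 0 < δ) : ∀ᶠ b : ℕ in atTop, ((1000000 : ENNReal) ^ (b ^ 48)) ^ k * 2⁻¹ ^ 2 ^ (b ^ 48) ≤ δ := by
  suffices h : ∀ᶠ n : ℕ in atTop, ((1000000 : ENNReal) ^ n) ^ k * 2⁻¹ ^ 2 ^ n ≤ δ from bX.eventually h
  have h1 : Tendsto (fun n : ℕ => ((2 : ENNReal)⁻¹) ^ n) atTop (nhds 0) :=
    ENNReal.tendsto_pow_atTop_nhds_zero_of_lt_one (ENNReal.inv_lt_one.2 ♣)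
  have h2 : ∀ᶠ n : ℕ in atTop, (20 * k + 1) * n ≤ 2 ^ n := by
    have := (tendsto_pow_const_div_const_pow_of_one_lt 1 (show ℜ 1 < 2 by norm_num)).eventually_le_const
      (show ℜ 0 < 1 / (20 * k + 1) by positivity)
    filter_upwards [this] with n hn
    rw [div_le_div_iff₀ ♠ ♠] at hn
    have : (((20 * k + 1) * n : ℕ) : ℝ) ≤ ((2 ^ n : ℕ) : ℝ) := by push_cast; linarith
    exact_mod_cast this
  filter_upwards [h1.eventually_le_const hδ, h2] with n hn hn2
  refine le_trans ?_ hn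
  calc ((1000000 : ENNReal) ^ n) ^ k * 2⁻¹ ^ 2 ^ n ≤ ((2 ^ 20) ^ n) ^ k * 2⁻¹ ^ ((20 * k + 1) * n) := by
        refine mul_le_mul' ?_ (pow_le_pow_of_le_one (by simp) (by simp) hn2)
        gcongr; norm_num
    _ = 2⁻¹ ^ n := by
      rw [show (20 * k + 1) * n = 20 * (n * k) + n by ring, pow_add, ← mul_assoc, ← pow_mul, ← pow_mul, ← mul_pow,
        ENNReal.mul_inv_cancel (by simp) (by simp)]; simp
def GB (c : V d) (s : ℕ) (a b : ℝ) (f : V d → ℝ) : Prop :=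
  ∀ v ∈ bx c (4 * s), ∀ v' ∈ bx c (4 * s), MA c (8 * s) a f v → MA c (8 * s) a f v' →
    Cn ({x | b ≤ f x} ∩ (bx c (8 * s) : 𝕊 d)) v v'
lemma bXx (hd : 3 ≤ d) {b : ℕ} (hb : 1 ≤ b) : Vb d (LL b) ≤ (1 + kap d 0) * exp (4 * d * Eb b) := by
  have hL := bVz hb
  push_cast at hL
  have k0 := aJz hd 0
  have e0 : 0 ≤ Eb b := by unfold Eb; positivity
  rw [Vb]
  calc _ ≤ exp (Eb b) ^ (3 * d) * (exp (Eb b) ^ d + kap d 0 * exp (Eb b) ^ d) := by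
        gcongr
        · linarith
        · exact le_mul_of_one_le_right k0.le (one_le_pow₀ (one_le_exp e0))
    _ = _ := by
      rw [show 4 * d * Eb b = ((4 * d : ℕ) : ℝ) * Eb b by push_cast; ring, exp_nat_mul]; ring
theorem bXy (hd : 3 ≤ d) (hφ : IsGFF P φ) {h h' : ℝ} (hh : h ∈ tildeSet d P φ) (hlt : h' < h)
    {δ : ENNReal} (hδ : 0 < δ) (s0 : ℕ) : ∃ s, s0 ≤ s ∧ P {ω | ¬ GA 0 s (16 * s) h (proc φ ω)} ≤ δ ∧
      P {ω | ¬ GB 0 s ((h + h') / 2) h' (proc φ ω)} ≤ δ := by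
  classical
  set ε := (h - h') / 4 with hε
  have hε0 : 0 < ε := by rw [hε]; linarith
  have k0 := aJz hd 0
  set j : ℕ := 6 * d + 1 with hj
  set c0 : ℝ := min 1 (2 * ε / (j * (1 + kap d 0))) with hc0
  have hj0 : ℜ 0 < j := by rw [hj]; positivity
  have hc00 : 0 < c0 := lt_min one_pos ♠
  set δ1 : ENNReal := min (δ / 4) 4⁻¹ with hδ1
  have hδ10 : 0 < δ1 := lt_min (ENNReal.div_pos hδ.ne' (by simp)) (by simp)
  have hδ11 : δ1 ≤ 4⁻¹ := min_le_right _ _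
  have hδ14 : δ1 ≤ δ / 4 := min_le_left _ _
  obtain ⟨b0, hb0⟩ := eventually_atTop.1 ((E1 hd hε0).and ((E2 hd hε0).and ((E3 (d := d) c0 |h| hc00 (min_le_left _ _) (abs_nonneg h)).and
    ((E4 (240 * j)).and ((E5 δ1 hδ10).and ((E6 (6 * d) δ1 hδ10).and (eventually_ge_atTop (max (max 1 s0) ⌈ε⌉₊))))))))
  obtain ⟨R0, hR0⟩ := bWz b0
  obtain ⟨R, hR, hp⟩ := bUz hd hφ hh hδ10 R0
  obtain ⟨b, hb, hu, hMR⟩ := hR0 R hR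
  obtain ⟨e1, e2, e3, e4, e5, e6, e7⟩ := hb0 b hb
  have hb1 : 1 ≤ b := (le_max_left _ _).trans ((le_max_left _ _).trans e7)
  have hbr : ℜ 1 ≤ b := by exact_mod_cast hb1
  have hbs : s0 ≤ b := (le_max_right _ _).trans ((le_max_left _ _).trans e7)
  have hbε : ε ≤ b := (le_ceil _).trans (by exact_mod_cast (le_max_right _ _).trans e7)
  set n := b ^ 48 with hn
  set Mn := 1000000 ^ n with hMn
  set m := 2 * UU b + 1 with hm
  have hn1 : 1 ≤ n := one_le_pow _ _ hb1
  have hMn1 : 1 ≤ Mn := one_le_pow _ _ ♣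
  have hUb : b ≤ UU b := by
    have h1 : b ≤ (2 * b) ^ 16 := (show b ≤ 2 * b by omega).trans (Nat.le_self_pow ♣ _)
    exact h1.trans (lt_pow_self ♣).le
  set W := m * Mn with hW
  have hW0 : m ≤ W := le_mul_of_pos_right _ hMn1
  set s := 5 * j * (Mn + 1) * W with hs
  have hsW : W ≤ s := Nat.le_mul_of_pos_left _ ♠
  set p := P {ω | ¬ ConnIn (lvl φ h ω) (box d (ufn R)) (bdry d R)} with hpd
  have h2r : 2 * (8 * s) + 1 ≤ Mn ^ 3 := by
    calc 2 * (8 * s) + 1 = 80 * j * (Mn + 1) * W + 1 := by rw [hs]; ring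
      _ ≤ 240 * j * m * (Mn * Mn) := by
        have : 1 ≤ j * m * (Mn * Mn) := Nat.one_le_iff_ne_zero.2 ♠
        have h2 : 80 * j * (Mn + 1) * W ≤ 80 * j * (2 * Mn) * W := by gcongr; omega
        have h3 : 80 * j * (2 * Mn) * W = 160 * (j * m * (Mn * Mn)) := by rw [hW]; ring
        have h4 : 240 * j * m * (Mn * Mn) = 240 * (j * m * (Mn * Mn)) := by ring
        omega
      _ ≤ Mn * (Mn * Mn) := by gcongr
      _ = Mn ^ 3 := by ring
  have h3R : Mn ^ 3 ≤ R := (pow_le_pow_right hMn1 ♣).trans hMR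
  have hR1 : 1 ≤ R := le_trans (one_le_pow _ _ hMn1) hMR
  have hpr : p ≤ δ1 := by
    refine le_trans ?_ hp
    exact le_mul_of_one_le_left (by simp) (one_le_pow₀ (Nat.one_le_cast.2 hR1))
  have hGAp : ∀ U r, UU b ≤ U → U ≤ r → r ≤ R → P {ω | ¬ GA 0 U r h (proc φ ω)} ≤ p := by
    intro U r h1 h2 h3
    refine measure_mono fun ω hω hc => hω ?_
    exact bUy (hu.trans (by exact_mod_cast h1)) h3 h2 hc
  have hUs : UU b ≤ s := by omega
  refine ⟨s, by omega, ?_, ?_⟩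
  · refine (hGAp s (16 * s) hUs ♥ ♥).trans (hpr.trans (hδ14.trans ?_))
    exact div_le_of_le_mul (le_mul_of_one_le_right (by simp) ♣)
  · have hconn : 1 / 2 < P {ω | ConnIn (lvl φ h ω) (box d (ufn R)) (bdry d R)} := by
      have h1 : 1 ≤ P {ω | ConnIn (lvl φ h ω) (box d (ufn R)) (bdry d R)} + p := by
        rw [← measure_univ (μ := P)]
        refine (measure_mono ?_).trans (measure_union_le _ _)
        intro ω _; exact em _
      by_contra! hc
      have h2 : (1 : ENNReal) ≤ 1 / 2 + 4⁻¹ := h1.trans (add_le_add hc (hpr.trans hδ11))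
      have h3 : (1 / 2 + 4⁻¹ : ENNReal) < 1 := by
        rw [show (1 / 2 : ENNReal) = ofReal (1 / 2) by rw [ofReal_div_of_pos ♣]; simp,
          show (4⁻¹ : ENNReal) = ofReal (4⁻¹) by rw [ofReal_inv_of_pos ♣]; simp,
          ← ofReal_add ♣ ♣, ENNReal.ofReal_lt_one]; norm_num
      exact absurd h2 (not_le.2 h3)
    have hlU : b ^ 27 ≤ UU b := by
      calc b ^ 27 ≤ (3 ^ b) ^ 27 := pow_le_pow_left (lt_pow_self ♣).le _
        _ = 3 ^ (27 * b) := by rw [← pow_mul]; ring_nf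
        _ ≤ UU b := by
          refine pow_le_pow_right ♣ ?_
          rw [mul_pow]
          have : b ≤ b ^ 16 := Nat.le_self_pow ♣ b
          omega
    have hLm : LL b = 10 * m := by rw [hm, LL]
    have hLW : 11 * m < s := by
      have h1 : 5 * 1 * (2 + 1) * W ≤ s := by
        rw [hs]; gcongr
        · omega
        · have : 2 ≤ 1000000 ^ n := le_trans ♣ (pow_le_pow_right ♣ hn1)
          omega
      omega
    have hloc := bRy (r := 8 * s) hd hφ hu (L := LL b) (R := R) ♥ hconn hε0.le (M := ℜ b ^ 9) ♠
      (K := LL b - b ^ 27) (l := b ^ 27) ♥ ♥ (k := (2 * b) ^ 16 + 4) (by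
        have : (3 : ℕ) ^ ((2 * b) ^ 16 + 4) = UU b * 81 := by rw [pow_add, UU]; norm_num
        have : 1 ≤ UU b := by omega
        omega) e1
    rw [show h - 2 * ε = (h + h') / 2 by rw [hε]; ring] at hloc
    have hbad := fun X => bV hd hφ (U := UU b) (L := LL b) (K := LL b - b ^ 27) (l := b ^ 27) (M := ℜ b ^ 9) hε0
      (hbε.trans (le_self_pow₀ hbr ♣)) ♥ ♥ e2 n X
    set ρ := 40 * j * (Mn + 1) with hρ
    have hρr : 2 * ρ + 1 ≤ 2 * (8 * s) + 1 := by
      have : ρ ≤ 8 * s := by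
        have : ρ * 1 ≤ ρ * W := by gcongr; omega
        have h2 : ρ * W = 8 * s := by rw [hρ, hs]; ring
        omega
      omega
    have hGd := bVx (ρ := ρ) hd hφ (r := 8 * s) (h := (h + h') / 2) (p := p) (q := 2⁻¹ ^ 2 ^ n) (by
      refine le_trans (measure_mono ?_) (hGAp (UU b) (2 * (8 * s)) le_rfl ♥ ♥)
      intro ω hω hc
      refine hω ?_
      obtain ⟨v, hv, hm⟩ := hc
      exact ⟨v, hv, hm.to (fun x _ hx => by linarith) ((bHy.1 hv).trans ♥) (by simp [dinf])⟩) hbad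
    have cast1 : ∀ x : ℕ, (2 * x + 1 : ENNReal) = ((2 * x + 1 : ℕ) : ENNReal) := fun x => by push_cast; rfl
    have c2 : (2 * ((8 * s : ℕ) : ENNReal) + 1) ≤ (Mn : ENNReal) ^ 3 := by rw [cast1]; exact_mod_cast h2r
    have c3 : (2 * (ρ : ENNReal) + 1) ≤ (Mn : ENNReal) ^ 3 := by rw [cast1]; exact_mod_cast hρr.trans h2r
    have hGd2 : (2 * ((8 * s : ℕ) : ENNReal) + 1) ^ d * P (Gd (UU b) (LL b - b ^ 27) (LL b) n (8 * s) ρ ((h + h') / 2) ε (ℜ b ^ 9) φ)ᶜ ≤ δ1 + δ1 := by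
      calc _ ≤ ((Mn : ENNReal) ^ 3) ^ d * (((Mn : ENNReal) ^ 3) ^ d * p + ((Mn : ENNReal) ^ 3) ^ d * 2⁻¹ ^ 2 ^ n) := by
            refine mul_le_mul' (by gcongr) (hGd.trans ?_)
            gcongr
        _ = ((Mn : ENNReal) ^ 6) ^ d * p + ((Mn : ENNReal)) ^ (6 * d) * 2⁻¹ ^ 2 ^ n := by
          rw [← pow_mul, ← pow_mul, mul_add, ← mul_assoc, ← mul_assoc, ← pow_add]
          congr 2 <;> congr 1 <;> ring
        _ ≤ _ := by
          refine add_le_add (le_trans ?_ hp) (le_trans (le_of_eq ?_) e6)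
          · gcongr; exact_mod_cast hMR
          · rw [hMn]; push_cast; rfl
    have hjj : j = 6 * d + 1 := hj
    have h22 : δ1 + δ1 ≤ 1 := by
      refine (add_le_add hδ11 hδ11).trans ?_
      rw [← two_mul, ← div_eq_mul_inv]
      exact div_le_of_le_mul ♣
    set dl := c0 * exp (-(4 * d * Eb b)) with hdl
    obtain ⟨F, hF0, hF1, hF2⟩ := (bRx hd hφ (δ := dl) ♠ hloc ♥ (by
        have : m * 20 ≤ m * 1000000 ^ n := by
          gcongr; exact le_trans ♣ (pow_le_pow_right ♣ hn1)
        rw [← hm, hLm]; omega) (N := Mn) ♥ (Θ := 1000 ^ n) (by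
        rw [add_comm (ℜ b ^ 9)] at *
        exact e3) (by
          refine ENNReal.inv_le_inv.2 ?_
          calc (2 : ENNReal) ≤ 1000 ^ 1 := by norm_num
            _ ≤ 1000 ^ n := pow_le_pow_right₀ ♣ hn1) (by simp) (hGd2.trans h22) j (2 * j * (Mn + 1)) (by
        rw [← hMn, ← hm, ← hW, hs]; apply le_of_eq_of_le _ (show 30 * (j * (Mn + 1) * W) ≤ _ by
          rw [show 8 * (5 * j * (Mn + 1) * W) = 40 * (j * (Mn + 1) * W) by ring]; omega)
        ring) (by
        rw [hρ, show 10 * (2 * j * (Mn + 1) + j * (Mn + 1)) = 30 * (j * (Mn + 1)) by ring, show 40 * j * (Mn + 1) = 40 * (j * (Mn + 1)) by ring]; omega)).2 (6 * d) hj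
    have h4s : 10 * (2 * j * (Mn + 1)) * ((2 * UU b + 1) * 1000000 ^ n) = 4 * s := by
      rw [← hMn, ← hm, ← hW, hs]; ring
    rw [h4s] at hF2
    have hFb : ∀ x, F x ≤ (h - h') / 2 := by
      intro x
      refine (hF1 x).trans ?_
      have hv := bXx hd hb1
      have hc : c0 ≤ 2 * ε / (j * (1 + kap d 0)) := min_le_right _ _
      calc ℜ j * (dl * Vb d (LL b)) ≤ j * (c0 * exp (-(4 * d * Eb b)) * ((1 + kap d 0) * exp (4 * d * Eb b))) := by
            rw [hdl]; gcongr
        _ = c0 * (j * (1 + kap d 0)) := by rw [exp_neg]; field_simp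
        _ ≤ 2 * ε := by rwa [← le_div_iff₀ ♠]
        _ = _ := by rw [hε]; ring
    have hΘ : ((1000 : ENNReal) ^ n)⁻¹ ^ (6 * d) * (2 * ((8 * s : ℕ) : ENNReal) + 1) ^ d ≤ 1 := by
      calc _ ≤ ((1000 : ENNReal) ^ n)⁻¹ ^ (6 * d) * ((Mn : ENNReal) ^ 3) ^ d := by gcongr
        _ = ((1000 : ENNReal) ^ n)⁻¹ ^ (6 * d) * ((1000 : ENNReal) ^ n) ^ (6 * d) := by
          congr 1
          rw [hMn]; push_cast
          rw [show (1000000 : ENNReal) = 1000 ^ 2 by norm_num, ← pow_mul, ← pow_mul, ← pow_mul, ← pow_mul]; congr 1; ring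
        _ = 1 := by rw [← mul_pow, ENNReal.inv_mul_cancel (by simp) (by simp), one_pow]
    have hfin : ((1000 : ENNReal) ^ n)⁻¹ * (4 + ((1000 : ENNReal) ^ n)⁻¹ ^ (6 * d) * (2 * ((8 * s : ℕ) : ENNReal) + 1) ^ d) +
        (2 * ((8 * s : ℕ) : ENNReal) + 1) ^ d * P (Gd (UU b) (LL b - b ^ 27) (LL b) n (8 * s) ρ ((h + h') / 2) ε (ℜ b ^ 9) φ)ᶜ ≤ δ := by
      calc _ ≤ ((1000 : ENNReal) ^ n)⁻¹ * (4 + 1) + (δ1 + δ1) := by gcongr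
        _ ≤ δ1 + (δ1 + δ1) := by
          refine add_le_add (le_trans (le_of_eq ?_) e5) le_rfl
          rw [mul_comm]; norm_num
        _ ≤ δ / 4 + (δ / 4 + δ / 4) := by gcongr
        _ ≤ 4 * (δ / 4) := by
          rw [show (4 : ENNReal) = 1 + (1 + 1 + 1) by norm_num, add_mul, add_mul, add_mul, one_mul, add_assoc (_ / _)]
          refine add_le_add le_rfl (add_le_add le_rfl ?_)
          exact le_self_add
        _ = δ := ENNReal.mul_div_cancel (by simp) (by simp)
    refine le_trans (measure_mono fun ω hω => ?_) (hF2.trans hfin)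
    simp only [mem_ofPred_eq] at hω ⊢
    by_contra! hcard
    refine hω fun v hv v' hv' hmv hmv' => ?_
    have hmem : ∀ v ∈ bx 𝕆 d (4 * s), MA 0 (8 * s) ((h + h') / 2) (proc φ ω) v →
        comp (SF (8 * s) ((h + h') / 2) F (proc φ ω)) v ∈ Kim (8 * s) ((h + h') / 2) (4 * s) F (proc φ ω) := by
      intro v hv hm
      exact Finset.mem_image_of_mem _ (Finset.mem_filter.2 ⟨hv, bRz.1 hm⟩)
    have heq := Finset.card_le_one.1 (by omega : (Kim (8 * s) ((h + h') / 2) (4 * s) F (proc φ ω)).card ≤ 1) _ (hmem v hv hmv) _ (hmem v' hv' hmv')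
    have hin : ∀ v, MA 0 (8 * s) ((h + h') / 2) (proc φ ω) v → v ∈ SF (8 * s) ((h + h') / 2) F (proc φ ω) := by
      rintro v ⟨p, -, hc⟩
      have := hc.left.1
      refine ⟨?_, hc.left.2⟩
      have h0 := hF0 v
      simp only [mem_ofPred_eq, Pi.zero_apply] at *
      linarith
    have hcn : Cn (SF (8 * s) ((h + h') / 2) F (proc φ ω)) v v' := by
      rw [← bCy, heq, bCy]; exact Cn.refl (hin v' hmv')
    refine Cn.mono ?_ hcn
    intro x hx
    have h1 := hx.1
    refine ⟨?_, hx.2⟩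
    simp only [mem_ofPred_eq] at *
    have := hFb x
    linarith
lemma bXz {α : Type*} {r : ℕ} (hr : 0 < r) (T : Finset α) (B : Fin r → α → Ω → Prop) {p : ENNReal} (hp : p ≤ 1)
    (h : ∀ i, ∀ S ⊆ T, P {ω | ∀ y ∈ S, B i y ω} ≤ (p ^ r) ^ S.card) :
    P {ω | ∀ y ∈ T, ∃ i, B i y ω} ≤ (r * p) ^ T.card := by
  classical
  have hsub : {ω | ∀ y ∈ T, ∃ i, B i y ω} ⊆ ⋃ f : T → Fin r, {ω | ∀ y : T, B (f y) y ω} := by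
    intro ω hω
    choose f hf using fun y : T => hω y y.2
    exact mem_iUnion.2 ⟨f, hf⟩
  refine (measure_mono hsub).trans ((measure_iUnion_fintype_le _ _).trans
    ((sum_le_card_nsmul _ _ (p ^ T.card) fun f _ => ?_).trans (le_of_eq ?_)))
  · obtain ⟨i, hi⟩ : ∃ i, T.card ≤ r * (T.attach.filter (f · = i)).card := by
      by_contra! hc
      have h1 := Finset.card_eq_sum_card_fiberwise (s := T.attach) (f := f) (t := Finset.univ) (fun _ _ => Finset.mem_coe.2 (Finset.mem_univ _))
      have h2 : ∑ i : Fin r, r * (T.attach.filter (f · = i)).card < ∑ i : Fin r, T.card :=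
        Finset.sum_lt_sum_of_nonempty ⟨⟨0, hr⟩, Finset.mem_univ _⟩ fun i _ => hc i
      rw [← mul_sum, ← h1] at h2
      simp at h2
    set S := (T.attach.filter (f · = i)).map (Function.Embedding.subtype _)
    have hS : S ⊆ T := fun y hy => by
      obtain ⟨z, -, rfl⟩ := Finset.mem_map.1 hy; exact z.2
    refine (measure_mono fun ω hω => ?_).trans ((h i S hS).trans ?_)
    · intro y hy
      obtain ⟨z, hz, rfl⟩ := Finset.mem_map.1 hy
      rw [← (Finset.mem_filter.1 hz).2]; exact hω z
    · rw [← pow_mul, Finset.card_map]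
      exact pow_le_pow_right_of_le_one' hp hi
  · simp [mul_pow]
variable {ι X : Type*} [Fintype ι] [MeasurableSpace X]
lemma cyl [DecidableEq ι] [Nonempty X] (ν ν' : ι → Measure X) [∀ i, IsFiniteMeasure (ν i)] [∀ i, IsFiniteMeasure (ν' i)] (W : Finset ι)
    (h : ∀ i ∈ W, ν i = ν' i) {F : Set (ι → X)} (hF : MeasurableSet F)
    (hW : ∀ ζ ζ' : ι → X, (∀ i ∈ W, ζ i = ζ' i) → ζ ∈ F → ζ' ∈ F) :
    Measure.pi ν F * ∏ i with i ∉ W, ν' i univ = Measure.pi ν' F * ∏ i with i ∉ W, ν i univ := by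
  classical
  have x0 : X := Classical.arbitrary X
  let e := MeasurableEquiv.piEquivPiSubtypeProd (fun _ : ι => X) (· ∈ W)
  have key : ∀ (η : ι → Measure X) [∀ i, IsFiniteMeasure (η i)], Measure.pi η F =
      Measure.pi (fun i : {i // i ∈ W} => η i) {w | e.symm (w, fun _ => x0) ∈ F} * ∏ i with i ∉ W, η i univ := by
    intro η _
    have h1 := (measurePreserving_piEquivPiSubtypeProd η (· ∈ W)).symm
    have h2 := h1.measure_preimage (s := F) hF.nullMeasurableSet
    rw [← h2]
    have h3 : e.symm ⁻¹' F = {w | e.symm (w, fun _ => x0) ∈ F} ×ˢ univ := by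
      ext ⟨w, w'⟩
      simp only [mem_preimage, mem_prod, mem_univ, and_true, mem_ofPred_eq]
      constructor <;> refine hW _ _ fun i hi => ?_ <;> simp [e, hi, MeasurableEquiv.piEquivPiSubtypeProd, Equiv.piEquivPiSubtypeProd]
    erw [h3]
    rw [Measure.prod_prod]
    rw [Measure.pi_univ, Finset.prod_subtype _ (p := (· ∉ W)) (by simp)]
    congr!
  rw [key ν, key ν', show (fun i : {i // i ∈ W} => ν i) = fun i : {i // i ∈ W} => ν' i from funext fun i => h i i.2]
  ring
lemma bY [Nonempty X] (ν : ι → Measure X) [∀ i, IsFiniteMeasure (ν i)] (G : Finset ι) {A : Set X} (hA : MeasurableSet A)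
    {θ : ENNReal} (hθ : θ ≠ 0) (hθ1 : θ ≤ 1) (hG : ∀ i ∈ G, ν i Aᶜ = θ * ν i univ) (Vf : (ι → X) → Finset ι)
    (hV : ∀ ζ ζ', (∀ i ∈ Vf ζ, ζ i = ζ' i) → Vf ζ' = Vf ζ) (hm : ∀ W, MeasurableSet {ζ | Vf ζ = W}) (k : ℕ) :
    Measure.pi ν {ζ | (∃ S ⊆ Vf ζ, S ⊆ G ∧ k ≤ S.card) ∧ ∀ i ∈ Vf ζ, i ∈ G → ζ i ∉ A} ≤ θ ^ k * ∏ i, ν i univ := by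
  classical
  by_cases h0 : ∏ i, ν i univ = 0
  · refine (measure_mono (subset_univ _)).trans ?_
    rw [Measure.pi_univ, h0]; simp
  have hθt : θ ≠ ⊤ := (hθ1.trans_lt one_lt_top).ne
  let ν' : ι → Measure X := fun i => if i ∈ G then (ν i).restrict Aᶜ else ν i
  let νW : Finset ι → ι → Measure X := fun W i => if i ∈ W then ν' i else ν i
  have f1 : ∀ i, IsFiniteMeasure (ν' i) := fun i => by simp only [ν']; split_ifs <;> infer_instance
  have f2 : ∀ W i, IsFiniteMeasure (νW W i) := fun W i => by simp only [νW]; split_ifs <;> infer_instance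
  let 𝒲 : Finset (Finset ι) := Finset.univ.filter fun W => k ≤ (W ∩ G).card
  have u' : ∀ i, ν' i univ = (if i ∈ G then θ else 1) * ν i univ := fun i => by
    simp only [ν']; split_ifs with h
    · rw [Measure.restrict_apply_univ, hG i h]
    · simp
  have hle : Measure.pi ν {ζ | (∃ S ⊆ Vf ζ, S ⊆ G ∧ k ≤ S.card) ∧ ∀ i ∈ Vf ζ, i ∈ G → ζ i ∉ A} ≤
      ∑ W ∈ 𝒲, Measure.pi (νW W) {ζ | Vf ζ = W} := by
    refine (measure_mono (t := ⋃ W ∈ 𝒲, {ζ | Vf ζ = W} ∩ univ.pi fun i => if i ∈ W ∧ i ∈ G then Aᶜ else univ) ?_).trans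
      ((measure_biUnion_finset_le _ _).trans (sum_le_sum fun W _ => ?_))
    · rintro ζ ⟨⟨S, h1, h2, h3⟩, h4⟩
      refine mem_biUnion (x := Vf ζ) ?_ ⟨rfl, fun i _ => ?_⟩
      · exact Finset.mem_coe.2 (Finset.mem_filter.2 ⟨Finset.mem_univ _, h3.trans (Finset.card_le_card (Finset.subset_inter h1 h2))⟩)
      · dsimp only; split_ifs with h
        · exact h4 i h.1 h.2
        · trivial
    · rw [← Measure.restrict_apply (hm W), Measure.restrict_pi_pi]
      refine le_of_eq ?_
      congr 2
      funext i
      simp only [νW, ν']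
      by_cases h1 : i ∈ W <;> by_cases h2 : i ∈ G <;> simp [h1, h2]
  have hW : ∀ W, Measure.pi (νW W) {ζ | Vf ζ = W} * θ ^ (G \ W).card = Measure.pi ν' {ζ | Vf ζ = W} := by
    intro W
    have := cyl (νW W) ν' W (fun i hi => by simp [νW, hi]) (hm W) (fun ζ ζ' h1 h2 => (hV ζ ζ' (by rw [show Vf ζ = W from h2]; exact h1)).trans h2)
    have e1 : ∏ i with i ∉ W, νW W i univ = ∏ i with i ∉ W, ν i univ :=
      prod_congr rfl fun i hi => by simp [νW, (Finset.mem_filter.1 hi).2]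
    have e2 : ∏ i with i ∉ W, ν' i univ = θ ^ (G \ W).card * ∏ i with i ∉ W, ν i univ := by
      simp_rw [u']
      rw [prod_mul_distrib, ← prod_filter, prod_const]
      congr 3
      ext i; simp [and_comm]
    rw [e1, e2, ← mul_assoc] at this
    have n0 : ∏ i with i ∉ W, ν i univ ≠ 0 := fun h => h0 (by
      obtain ⟨i, -, hi⟩ := Finset.prod_eq_zero_iff.1 h
      exact Finset.prod_eq_zero (Finset.mem_univ i) hi)
    exact (ENNReal.mul_left_inj n0 (ENNReal.prod_ne_top fun i _ => measure_ne_top _ _)).1 this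
  have hsum : ∑ W ∈ 𝒲, Measure.pi ν' {ζ | Vf ζ = W} ≤ θ ^ G.card * ∏ i, ν i univ := by
    rw [← measure_biUnion_finset (fun W _ W' _ h => disjoint_left.2 fun ζ h1 h2 => h (h1.symm.trans h2)) fun W _ => hm W]
    refine (measure_mono (subset_univ _)).trans (le_of_eq ?_)
    rw [Measure.pi_univ]
    simp_rw [u']
    rw [prod_mul_distrib, ← prod_filter, prod_const, Finset.filter_mem_eq_inter, Finset.univ_inter]
  refine hle.trans ?_
  by_cases hk : k ≤ G.card
  · have c0 : θ ^ (G.card - k) ≠ 0 := pow_ne_zero _ hθ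
    have ct : θ ^ (G.card - k) ≠ ⊤ := pow_ne_top hθt
    rw [← ENNReal.mul_le_mul_iff_left c0 ct, sum_mul]
    have e3 : θ ^ k * (∏ i, ν i univ) * θ ^ (G.card - k) = θ ^ G.card * ∏ i, ν i univ := by
      rw [mul_right_comm, ← pow_add, Nat.add_sub_cancel' hk]
    rw [e3]
    refine le_trans (sum_le_sum fun W hW' => ?_) hsum
    rw [← hW W]
    refine mul_le_mul_right (pow_le_pow_right_of_le_one' hθ1 ?_) _
    have h1 := (Finset.mem_filter.1 hW').2
    have h2 := Finset.card_sdiff_add_card_inter G W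
    rw [Finset.inter_comm] at h1
    omega
  · rw [sum_eq_zero]
    · exact zero_le
    · intro W hW
      exact absurd ((Finset.mem_filter.1 hW).2.trans (Finset.card_le_card Finset.inter_subset_right)) hk
lemma bYx [Nonempty X] (μ : Measure X) [IsProbabilityMeasure μ] {A τ : Set X} (hA : MeasurableSet A) (hτ : MeasurableSet τ)
    {θ : ENNReal} (hθ : θ ≠ 0) (hθ1 : θ ≤ 1) (hG : μ (τ \ A) = θ * μ τ) (Vf : (ι → X) → Finset ι)
    (hV : ∀ ζ ζ', (∀ i ∈ Vf ζ, ζ i = ζ' i) → Vf ζ' = Vf ζ) (hm : ∀ W, MeasurableSet {ζ | Vf ζ = W}) (k : ℕ)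
    (G : Set ι → Set ι) (hGT : ∀ T, G T ⊆ T) :
    Measure.pi (fun _ : ι => μ) {ζ | (∃ S ⊆ Vf ζ, (S : Set ι) ⊆ G {i | ζ i ∈ τ} ∧ k ≤ S.card) ∧
      ∀ i ∈ Vf ζ, i ∈ G {i | ζ i ∈ τ} → ζ i ∉ A} ≤ θ ^ k := by
  classical
  let ν : Finset ι → ι → Measure X := fun T i => μ.restrict (if i ∈ T then τ else τᶜ)
  have f1 : ∀ T i, IsFiniteMeasure (ν T i) := fun T i => by simp only [ν]; infer_instance
  let pT : Finset ι → Set (ι → X) := fun T => univ.pi fun i => if i ∈ T then τ else τᶜ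
  have mT : ∀ T, MeasurableSet (pT T) := fun T => MeasurableSet.univ_pi fun i => by split_ifs; exacts [hτ, hτ.compl]
  have hT : ∀ T ζ, ζ ∈ pT T → {i | ζ i ∈ τ} = (T : Set ι) := fun T ζ h => by
    ext i
    have := h i (mem_univ i)
    dsimp only at this
    split_ifs at this with hi <;> simp [hi, this] <;> simpa using this
  set E := {ζ : ι → X | (∃ S ⊆ Vf ζ, (S : Set ι) ⊆ G {i | ζ i ∈ τ} ∧ k ≤ S.card) ∧
      ∀ i ∈ Vf ζ, i ∈ G {i | ζ i ∈ τ} → ζ i ∉ A}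
  have hb : ∀ T : Finset ι, Measure.pi (fun _ : ι => μ) (E ∩ pT T) ≤ θ ^ k * ∏ i, ν T i univ := by
    intro T
    rw [← Measure.restrict_apply' (mT T), Measure.restrict_pi_pi]
    refine (measure_mono_ae ?_).trans (bY (ν T) (Finset.univ.filter (· ∈ G T)) hA hθ hθ1 (fun i hi => ?_) Vf hV hm k)
    · have : ∀ᵐ ζ ∂(Measure.pi (ν T)), ζ ∈ pT T := by
        simp only [ν]
        rw [← Measure.restrict_pi_pi]; exact ae_restrict_mem (mT T)
      filter_upwards [this] with ζ hζ hE
      have e := hT T ζ hζ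
      simp only [E, mem_ofPred_eq] at hE
      change (∃ S ⊆ Vf ζ, _ ∧ _) ∧ _ at hE
      simp only [e] at hE
      obtain ⟨⟨S, h1, h2, h3⟩, h4⟩ := hE
      exact ⟨⟨S, h1, fun i hi => by simpa using h2 hi, h3⟩, fun i h5 h6 => h4 i h5 (by simpa using h6)⟩
    · have hi' := hGT T (Finset.mem_filter.1 hi).2
      simp only [ν, if_pos (Finset.mem_coe.1 hi'), Measure.restrict_apply hA.compl, Measure.restrict_apply_univ]
      rw [← hG, sdiff_eq, inter_comm]
  have hc : E ⊆ ⋃ T : Finset ι, E ∩ pT T := fun ζ hζ => mem_iUnion.2 ⟨Finset.univ.filter (ζ · ∈ τ), hζ, fun i _ => by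
    dsimp only; split_ifs with h
    · simpa using h
    · simpa using h⟩
  refine (measure_mono hc).trans ((measure_iUnion_fintype_le _ _).trans ((sum_le_sum fun T _ => hb T).trans ?_))
  rw [← mul_sum]
  have : ∑ T : Finset ι, ∏ i, ν T i univ = ∏ i : ι, (μ τ + μ τᶜ) := by
    rw [Finset.prod_add, Finset.powerset_univ]
    refine sum_congr rfl fun T _ => ?_
    simp only [ν, Measure.restrict_apply_univ]
    rw [← Finset.prod_mul_prod_compl T]
    congr 1
    · exact prod_congr rfl fun i hi => by rw [if_pos hi]
    · rw [Finset.compl_eq_univ_sdiff]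
      exact prod_congr rfl fun i hi => by rw [if_neg (Finset.mem_sdiff.1 hi).2]
  rw [this, prob_add_prob_compl hτ]; simp
lemma bYy (hd : 3 ≤ d) {c : ℝ} (hc : 0 < c) :
    Tendsto (fun s : ℕ => (2 * (16 * s) + 1 : ℝ) ^ d * exp (-c / kap d s)) atTop (nhds 0) := by
  have k0 := aJz hd 0
  set t : ℕ → ℝ := fun s => (ℜ s ^ 2 + 1) ^ (1 / 3 : ℝ)
  have ht : Tendsto t atTop atTop := (tendsto_rpow_atTop ♣).comp
    (tendsto_atTop_add_const_right _ _ ((tendsto_pow_atTop ♣).comp tendsto_natCast_atTop_atTop))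
  have hk : ∀ s, kap d s = kap d 0 / t s := fun s => by
    have e0 : kap d 0 = (Fs 𝕆 d - Pav Fs 𝕆 d)⁻¹ := by simp [kap]
    rw [e0, kap, rpow_neg ♠]; rfl
  set b := c / kap d 0
  have hb : 0 < b := by positivity
  have h1 := ((Real.tendsto_pow_mul_exp_neg_atTop_nhds_zero (2 * d)).comp (ht.const_mul_atTop hb)).const_mul ((33 / b ^ 2) ^ d)
  rw [mul_zero] at h1
  refine squeeze_zero (fun s => by positivity) (fun s => ?_) h1
  have t1 : 1 ≤ t s := Real.one_le_rpow (by nlinarith [sq_nonneg (s : ℝ)]) ♣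
  have t3 : t s ^ 3 = ℜ s ^ 2 + 1 := by
    rw [← rpow_natCast, ← rpow_mul ♠]; norm_num
  have hs : ℜ s ≤ t s ^ 2 := by
    refine le_of_sq_le_sq ?_ ♠
    nlinarith [pow_pos (zero_lt_one.trans_le t1) 3]
  simp only [Function.comp]
  have e1 : -c / kap d s = -(b * t s) := by rw [hk]; simp only [b]; field_simp
  have e2 : (33 / b ^ 2) ^ d * ((b * t s) ^ (2 * d) * exp (-(b * t s))) = (33 * t s ^ 2) ^ d * exp (-(b * t s)) := by
    rw [pow_mul, ← mul_assoc, ← mul_pow]; congr 2; field_simp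
  rw [e1, e2]
  gcongr
  nlinarith
def Sd (c : V d) (s : ℕ) (a a' b : ℝ) (f : V d → ℝ) : Prop := GA c s (16 * s) a f ∧ GB c s a' b f
lemma Sd.pert {c : V d} {s : ℕ} {a a' b ε : ℝ} {f g : V d → ℝ} (h : Sd c s a a' b f)
    (hfg : ∀ x ∈ bx c (16 * s), |f x - g x| ≤ ε) : Sd c s (a - ε) (a' + ε) (b - ε) g := by
  obtain ⟨⟨v, hv, hm⟩, hB⟩ := h
  have h8 : ∀ x ∈ bx c (8 * s), x ∈ bx c (16 * s) := fun x hx => bHy.2 ((bHy.1 hx).trans ♥)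
  have h0 : dinf c c = 0 := by simp [dinf]
  refine ⟨⟨v, hv, hm.to (fun x hx h => ?_) ((bHy.1 hv).trans ♥) ♥⟩, fun v hv v' hv' h1 h2 => ?_⟩
  · have := abs_le.1 (hfg x hx); linarith
  · have key : ∀ v ∈ bx c (4 * s), MA c (8 * s) (a' + ε) g v → MA c (8 * s) a' f v := fun v hv h =>
      h.to (fun x hx h => by have := abs_le.1 (hfg x (h8 x hx)); linarith) ((bHy.1 hv).trans ♥) ♥
    refine Cn.mono ?_ (hB v hv v' hv' (key v hv h1) (key v' hv' h2))
    intro x hx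
    have := abs_le.1 (hfg x (h8 x hx.2))
    have h3 : b ≤ f x := hx.1
    exact ⟨show b - ε ≤ g x by linarith, hx.2⟩
lemma bYz (c : V d) (s : ℕ) (a a' b : ℝ) : MeasurableSet {f : V d → ℝ | Sd c s a a' b f} := by
  have e1 : {f : V d → ℝ | Sd c s a a' b f} = {f | GA c s (16 * s) a f} ∩ {f | GB c s a' b f} := rfl
  have hi : ∀ (t : ℝ) (f : V d → ℝ), {x | t ≤ f x} ∩ (bx c (8 * s) : 𝕊 d) ∩ (bx c (8 * s) : 𝕊 d) =
    {x | t ≤ f x} ∩ (bx c (8 * s) : 𝕊 d) := fun t f => by rw [inter_assoc, inter_self]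
  rw [e1]
  refine (aS (Ω := V d → ℝ) (Λ := (bx c (16 * s) : 𝕊 d)) (finite_toSet _) (fun x f => f x) (fun x => measurable_pi_apply x) (fun _ => a) fun K =>
    ∃ v ∈ bx c s, ∃ p, dinf p c = 16 * s ∧ Cn K v p).inter ?_
  exact bMz (finite_toSet (bx c (8 * s))) (fun _ => a') (fun _ => b) fun K K' => ∀ v ∈ bx c (4 * s), ∀ v' ∈ bx c (4 * s),
    (∃ p, dinf p c = 8 * s ∧ Cn K v p) → (∃ p, dinf p c = 8 * s ∧ Cn K v' p) → Cn K' v v'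
lemma bZ {z : V d} {s : ℕ} {a a' b : ℝ} {f : V d → ℝ} : Sd z s a a' b f ↔ Sd 0 s a a' b fun x => f (x + z) := by
  rw [Sd, Sd, bTz]
  refine and_congr_right fun _ => ?_
  have e := fun v => @bT d f a' 0 v (8 * s) z
  have e2 := fun v w => @bSz d f b 0 v w (8 * s) z
  simp only [zero_add] at e e2
  have hb : ∀ v, v + z ∈ bx z (4 * s) ↔ v ∈ bx 0 (4 * s) := fun v => by
    have := @bSy d 0 z v (4 * s); rwa [zero_add] at this
  refine ⟨fun h v hv v' hv' h1 h2 => (e2 v v').1 (h _ ((hb v).2 hv) _ ((hb v').2 hv') ((e v).2 h1) ((e v').2 h2)),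
    fun h v hv v' hv' h1 h2 => ?_⟩
  have hz : ∀ v, v - z + z = v := fun v => by abel
  have := (e2 (v - z) (v' - z)).2 (h _ ((hb _).1 (by rwa [hz])) _ ((hb _).1 (by rwa [hz])) ((e _).1 (by rwa [hz])) ((e _).1 (by rwa [hz])))
  rwa [hz, hz] at this
lemma bZx (U : ℕ) (y y' : V d) : (2 * U + 1) * dinf y y' ≤ dinf (cc U y) (cc U y') := by
  rcases Nat.eq_zero_or_pos (dinf y y') with h | h
  · simp [h]
  · obtain ⟨i, hi⟩ := (aDz h).1 le_rfl
    refine le_trans ?_ (le_sup (f := fun i => (cc U y i - cc U y' i).natAbs) (Finset.mem_univ i))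
    rw [show cc U y i - cc U y' i = (2 * U + 1 : ℕ) * (y i - y' i) by simp [cc]; ring, natAbs_mul, natAbs_natCast]
    exact Nat.mul_le_mul_left _ hi
lemma bZy (hd : 3 ≤ d) (hφ : IsGFF P φ) {s : ℕ} (B : V d → Set (V d → ℝ)) (hB : ∀ y, MeasurableSet (B y)) {p : ENNReal}
    (hp : ∀ y, P {ω | (fun x => Wg φ (psi (bx (cc s y) (24 * s)) x) ω) ∈ B y} ≤ p) (S : 𝔽 d)
    (hS : ∀ y ∈ S, ∀ y' ∈ S, y ≠ y' → 9000 ≤ dinf y y') :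
    P {ω | ∀ y ∈ S, (fun x => Wg φ (psi (bx (cc s y) (24 * s)) x) ω) ∈ B y} ≤ p ^ S.card := by
  classical
  have iso := aTx hd hφ
  let D : V d → 𝔽 d := fun y => bx (cc s y) (24 * s)
  have h1 := iso.prob_eq (iso.pi (ι := S)) (J := S × V d) (fun j => psi (D j.1) j.2) (fun j => Pi.single j.1 (psi (D j.1) j.2))
    (fun i j => by
      rw [aRx]
      by_cases hij : i.1 = j.1
      · rw [sum_eq_single i.1]
        · simp [hij]
        · intro k _ hk; simp [hk]
        · simp
      · rw [sum_eq_zero, aUz hd]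
        · intro x hx x' hx'
          have a1 := hS i.1 i.1.2 j.1 j.1.2 (fun h => hij (Subtype.ext h))
          have a2 := bZx s i.1.1 j.1.1
          have a3 := Nat.mul_le_mul_left (2 * s + 1) a1
          have a4 := bHy.1 hx
          have a5 := bHy.1 hx'
          have a6 := aBx (cc s i.1) x (cc s j.1)
          have a7 := aBx x x' (cc s j.1)
          rw [aB _ x] at a6
          omega
        · intro k _
          by_cases hk : k = i.1
          · rw [Pi.single_eq_of_ne (i := j.1) (by rw [hk]; exact hij)]; simp
          · simp [hk])
    (A := ⋂ y : S, {f | (fun x => f (y, x)) ∈ B y}) (MeasurableSet.iInter fun y => by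
      have : Measurable fun f : S × V d → ℝ => fun x => f (y, x) := measurable_pi_lambda _ fun x => measurable_pi_apply _
      exact this (hB y))
  have e1 : {ω | ∀ y ∈ S, (fun x => Wg φ (psi (bx (cc s y) (24 * s)) x) ω) ∈ B y} =
    {ω | (fun j : S × V d => Wg φ (psi (D j.1) j.2) ω) ∈ ⋂ y : S, {f | (fun x => f (y, x)) ∈ B y}} := by
    ext ω; simp [D]
  rw [e1, h1]
  have e2 : {ω : S → Ω | (fun j : S × V d => piW (Wg φ) S (Pi.single j.1 (psi (D j.1) j.2)) ω) ∈ ⋂ y : S, {f | (fun x => f (y, x)) ∈ B y}}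
      = univ.pi fun y : S => {ω | (fun x => Wg φ (psi (D y) x) ω) ∈ B y} := by
    ext ω
    have e3 : ∀ (y : S) x, piW (Wg φ) S (Pi.single y (psi (D y) x)) ω = Wg φ (psi (D y) x) (ω y) := fun y x => by
      rw [aR, sum_eq_single y]
      · simp
      · intro k _ hk; simp [hk]
      · simp
    simp only [mem_ofPred_eq, mem_iInter, Set.mem_pi, mem_univ, forall_const]
    simp_rw [e3]
  rw [e2, Measure.pi_pi]
  refine (Finset.prod_le_prod' (g := fun _ => p) fun (y : S) _ => hp y.1).trans ?_
  simp
lemma bZz (hd : 3 ≤ d) (hφ : IsGFF P φ) {h h' ε : ℝ} (hh : h ∈ tildeSet d P φ) (hlt : h' < h) (hε : ε = (h - h') / 8)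
    {q : ENNReal} (hq : 0 < q) (s0 : ℕ) : ∃ s, s0 ≤ s ∧ ∀ n (x : V d), ∀ T ∈ Tr n x, ∀ S ⊆ T,
      P {ω | ∀ y ∈ S, ¬ Sd (cc s y) s (h - 2 * ε) (h - 2 * ε) (h' - 2 * ε) (proc φ ω)} ≤ q ^ S.card := by
  classical
  have hε0 : 0 < ε := by rw [hε]; linarith
  set p : ENNReal := min 1 (q / 3)
  have hp0 : 0 < p := lt_min one_pos (ENNReal.div_pos hq.ne' (by simp))
  have hp1 : p ≤ 1 := min_le_left _ _
  have hp3 : 0 < p ^ 3 := ENNReal.pow_pos hp0 3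
  set δ := p ^ 3 / 4
  have hδ : 0 < δ := ENNReal.div_pos hp3.ne' (by simp)
  have h4 : δ + δ + δ + δ = p ^ 3 := by
    rw [show δ + δ + δ + δ = δ * 4 by ring]
    exact ENNReal.div_mul_cancel (by simp) (by simp)
  have hδt : δ ≠ ⊤ := ENNReal.div_ne_top (pow_ne_top (hp1.trans_lt one_lt_top).ne) (by simp)
  obtain ⟨s1, hs1⟩ := eventually_atTop.1 ((bYy hd (c := ε ^ 2 / 10) ♠).eventually
    (gt_mem_nhds (toReal_pos hδ.ne' hδt)))
  obtain ⟨s, hs, hA, hB⟩ := bXy hd hφ hh hlt hδ (max s0 (max 1 s1))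
  have hss : 1 ≤ s := (le_max_left _ _).trans ((le_max_right _ _).trans hs)
  refine ⟨s, (le_max_left _ _).trans hs, fun n X T hT S hS => ?_⟩
  have hnum := hs1 s ((le_max_right _ _).trans ((le_max_right _ _).trans hs))
  have ks := aJz hd s
  have k8 := aJz hd (8 * s)
  have k8s := aJy hd (show s ≤ 8 * s by omega)
  have k45 := aJy hd (show s ≤ 4500 * (2 * s + 1) by omega)
  have k45' := aJz hd (4500 * (2 * s + 1))
  have hnum' : ∀ w, 0 < w → w ≤ 5 * kap d s → ofReal ((2 * (16 * s) + 1 : ℝ) ^ d * exp (-ε ^ 2 / (2 * w))) ≤ δ := by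
    intro w hw hw5
    refine (ofReal_le_ofReal (le_trans ?_ hnum.le)).trans (ofReal_toReal hδt).le
    gcongr (2 * (16 * s) + 1 : ℝ) ^ d * exp ?_
    rw [show -(ε ^ 2 / 10) / kap d s = -ε ^ 2 / (2 * (5 * kap d s)) by field_simp; ring, neg_div, neg_div]
    gcongr
  let D : V d → 𝔽 d := fun y => bx (cc s y) (24 * s)
  have hvar : ∀ y, ∀ x ∈ bx (cc s y) (16 * s), Qg d (eta (D y) x) (eta (D y) x) ≤ kap d (8 * s) := fun y x hx =>
    aWx hd (bHy.2 ((bHy.1 hx).trans ♥)) fun x' hx' => by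
      rw [bHy] at hx hx'
      have h1 := aBx x' x (cc s y)
      omega
  have hsplit : ∀ y ω x, φ x ω = Wg φ (psi (D y) x) ω + bDz φ (D y) ω x := fun y ω x => by
    simp [bDz, eta, map_sub]
  have hsup : ∀ (ψ : V d → Ω → ℝ), IsGFF P ψ → ∀ y, P {ω | ∃ x ∈ bx (cc s y) (16 * s), ε ≤ bDz ψ (D y) ω x} ≤ δ := fun ψ hψ y => by
    refine (bJx hd hψ (D y) _ hε0.le k8 (hvar y)).trans (le_trans (le_of_eq ?_) (hnum' _ k8 (by linarith)))
    rw [ofReal_mul ♠, ofReal_pow ♠, bI]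
    congr 1
    rw [show (2 * (16 * ℜ s) + 1) = ((2 * (16 * s) + 1 : ℕ) : ℝ) by push_cast; ring, ofReal_natCast]
    push_cast; ring
  have hneg : ∀ y ω x, bDz (fun x ω => -φ x ω) (D y) ω x = -bDz φ (D y) ω x := fun y ω x => by
    simp [bDz, Finsupp.linearCombination_apply, Finsupp.sum]
  have hloc : ∀ y, P {ω | ¬ Sd (cc s y) s (h - ε) ((h + h') / 2 + ε) (h' - ε) (fun x => Wg φ (psi (D y) x) ω)} ≤ p ^ 3 := by
    intro y
    rw [← h4]
    have hSd : P {ω | ¬ Sd (cc s y) s h ((h + h') / 2) h' (proc φ ω)} ≤ δ + δ := by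
      have := bTx hd hφ (cc s y) (bYz 0 s h ((h + h') / 2) h').compl
      simp only [mem_compl_iff, mem_ofPred_eq] at this
      simp_rw [bZ (z := cc s y)]
      refine (le_of_eq this).trans ((measure_mono ?_).trans ((measure_union_le _ _).trans (add_le_add hA hB)))
      intro ω hω
      rw [mem_ofPred_eq, Sd, not_and_or] at hω
      exact hω
    refine (measure_mono (t := ({ω | ¬ Sd (cc s y) s h ((h + h') / 2) h' (proc φ ω)} ∪
      {ω | ∃ x ∈ bx (cc s y) (16 * s), ε ≤ bDz φ (D y) ω x}) ∪
      {ω | ∃ x ∈ bx (cc s y) (16 * s), ε ≤ bDz (fun x ω => -φ x ω) (D y) ω x}) ?_).trans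
      ((measure_union_le _ _).trans (add_le_add ((measure_union_le _ _).trans (add_le_add hSd (hsup φ hφ y))) (hsup _ (bGy hφ) y)))
    intro ω hω
    by_contra hc
    simp only [mem_union, mem_ofPred_eq, not_or, not_not, not_exists, not_and, not_le, hneg] at hc
    refine hω (hc.1.1.pert fun x hx => ?_)
    have h1 := hc.1.2 x hx
    have h2 := hc.2 x hx
    rw [proc, hsplit y ω x, abs_le]; constructor <;> linarith
  have henv : ∀ σ : ℝ, σ ^ 2 = 1 → ∀ S ⊆ T, P {ω | ∀ y ∈ S, ∃ a ∈ bx 𝕆 d (16 * s), 1 ≤ σ / ε * bDz φ (D y) ω (cc s y + a)} ≤ (p ^ 3) ^ S.card := by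
    intro σ hσ S hS
    have hab : ∀ y, ∀ a ∈ bx 𝕆 d (16 * s), cc s y + a ∈ bx (cc s y) (16 * s) := fun y a ha => by
      rw [add_comm]; have := (bSy (z := cc s y)).2 ha; simpa using this
    refine (bLy hd hφ (m := 2 * s + 1) (L := 24 * s) ♥ (cc s) (bZx s) (bx 0 (16 * s))
      (fun y a ha => bHy.2 ((bHy.1 (hab y a ha)).trans ♥)) (g := fun _ => σ / ε) hε0
      (fun _ _ => mul_self_nonneg _) (fun _ => ?_) (v := kap d (8 * s) / ε ^ 2) ♠ (fun y a ha => ?_) hT hS).trans ?_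
    · rw [abs_div, abs_of_pos hε0, show |σ| = 1 from (pow_eq_one_iff_of_nonneg (abs_nonneg σ) two_ne_zero).1 (by rw [sq_abs, hσ])]
    · rw [div_pow, hσ, one_div, inv_mul_eq_div]
      gcongr
      exact hvar y _ (hab y a ha)
    · gcongr
      rw [bI]
      push_cast
      refine le_trans (le_of_eq ?_) ((hnum' (kap d (8 * s) + 4 * kap d (4500 * (2 * s + 1))) ♠ (by linarith)).trans
        (by rw [← h4]; exact le_add_self))
      congr 3
      field_simp
  have hbig := bXz (P := P) (r := 3) ♣ S (fun i y ω => if i = 0 then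
      ¬ Sd (cc s y) s (h - ε) ((h + h') / 2 + ε) (h' - ε) (fun x => Wg φ (psi (D y) x) ω) else
      ∃ a ∈ bx 𝕆 d (16 * s), 1 ≤ (if i = 1 then (1 : ℝ) else -1) / ε * bDz φ (D y) ω (cc s y + a)) hp1 (fun i S' hS' => by
    by_cases h0 : i = 0
    · simp only [h0, if_true]
      exact bZy hd hφ (fun y => {f | ¬ Sd (cc s y) s (h - ε) ((h + h') / 2 + ε) (h' - ε) f}) (fun y => (bYz _ _ _ _ _).compl) hloc S'
        fun y hy y' hy' hne => (aGz (fun _ => 0) (fun _ _ _ => le_rfl) hT).2.1 y (hS (hS' hy)) y' (hS (hS' hy')) hne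
    · simp only [h0, if_false]
      exact henv _ (by split_ifs <;> norm_num) S' (hS'.trans hS))
  refine (measure_mono ?_).trans (hbig.trans ?_)
  · intro ω hω y hy
    by_contra! hc
    have c0 := hc 0
    have c1 := hc 1
    have c2 := hc 2
    simp only [if_true, not_not] at c0
    simp only [if_true, one_ne_zero, if_false, not_exists, not_and, not_le] at c1
    rw [if_neg (by decide), if_neg (by decide)] at c2
    simp only [not_exists, not_and, not_le] at c2
    refine hω y hy ?_
    have := c0.pert (ε := ε) (g := proc φ ω) fun x hx => ?_
    · convert this using 1 <;> rw [hε] <;> ring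
    · have ha : x - cc s y ∈ bx 𝕆 d (16 * s) := by rw [← bSy (z := cc s y)]; simpa using hx
      have a1 := c1 _ ha
      have a2 := c2 _ ha
      rw [show cc s y + (x - cc s y) = x by abel, div_mul_eq_mul_div, div_lt_one hε0] at a1 a2
      rw [proc, hsplit y ω x, abs_le]; constructor <;> linarith
  · gcongr
    calc ((3 : ℕ) : ENNReal) * p ≤ 3 * (q / 3) := by push_cast; gcongr; exact min_le_right _ _
      _ = q := ENNReal.mul_div_cancel (by simp) (by simp)
abbrev Of (d s : ℕ) := ↥(bx 𝕆 d s)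
abbrev mu (d s : ℕ) : Measure (Of d s → ℝ) := Measure.pi fun _ => ga
abbrev PB (P : Measure Ω) (s : ℕ) (I : 𝔽 d) : Measure ((Ω × Ω) × (I → Of d s → ℝ)) :=
  (P.prod P).prod (Measure.pi fun _ : I => mu d s)
def Nz (s : ℕ) (I : 𝔽 d) (ζ : I → Of d s → ℝ) (x : V d) : ℝ :=
  ∑ i, ∑ a, if cc s i.1 + a.1 = x then ζ i a else 0
def nzv (s : ℕ) (I : 𝔽 d) (x : V d) : I → Of d s → ℝ := fun i a => if cc s i.1 + a.1 = x then 1 else 0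
def fb (x : V d) : Es d × Es d := (√2)⁻¹ • (ev x, ev x)
def yb (t : ℝ) (x : V d) : Es d × Es d := if Even (∑ i, x i) then (t • yv x, 0) else (0, t • yv x)
abbrev W2 (φ : V d → Ω → ℝ) := aQ (Wg φ) (Wg φ)
abbrev Q2 (d : ℕ) := aQx (Qg d) (Qg d)
abbrev W3 (φ : V d → Ω → ℝ) (s : ℕ) (I : 𝔽 d) := aQ (W2 φ) (piW (piW aRy (Of d s)) I)
abbrev Q3 (s : ℕ) (I : 𝔽 d) := aQx (Q2 d) (piQ (piQ (aRz 1) (Of d s)) I)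
lemma cA {c a : V d} {N : ℕ} : c + a ∈ bx c N ↔ a ∈ bx 0 N := by
  rw [add_comm]; have := @bSy d 0 c a N; rwa [zero_add] at this
lemma cAx {s : ℕ} {i j : V d} {a b : Of d s} (h : cc s i + a.1 = cc s j + b.1) : i = j ∧ a = b := by
  have h1 : idx (2 * s + 1) (cc s i + a.1) = i := bOy.2 (cA.2 a.2)
  rw [h, bOy.2 (cA.2 b.2)] at h1
  subst h1
  exact ⟨rfl, Subtype.ext (add_left_cancel h)⟩
lemma cAy {s : ℕ} {I : 𝔽 d} (ζ : I → Of d s → ℝ) (i : I) (a : Of d s) : Nz s I ζ (cc s i.1 + a.1) = ζ i a := by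
  rw [Nz, sum_eq_single i, sum_eq_single a]
  · simp
  · intro b _ hb; exact if_neg fun h => hb (cAx h).2
  · simp
  · intro j _ hj; exact sum_eq_zero fun b _ => if_neg fun h => hj (Subtype.ext (cAx h).1)
  · simp
lemma cAz {s : ℕ} {I : 𝔽 d} (ζ : I → Of d s → ℝ) (x : V d) (h : idx (2 * s + 1) x ∈ I) :
    ∃ a : Of d s, Nz s I ζ x = ζ ⟨_, h⟩ a ∧ x = cc s (idx (2 * s + 1) x) + a.1 := by
  have h1 : x ∈ bx (cc s (idx (2 * s + 1) x)) s := bOy.1 rfl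
  have h2 : cc s (idx (2 * s + 1) x) + (x - cc s (idx (2 * s + 1) x)) = x := by abel
  refine ⟨⟨x - cc s (idx (2 * s + 1) x), cA.1 (by rwa [h2])⟩, ?_, h2.symm⟩
  rw [← cAy ζ ⟨_, h⟩]
  exact congrArg _ h2.symm
lemma cB (hd : 3 ≤ d) (hφ : IsGFF P φ) (s : ℕ) (I : 𝔽 d) : IsoG (PB P s I) (W3 φ s I) (Q3 s I) := by
  have h1 : IsoG ga aRy (aRz 1) := by simpa using IsoG.one (v := 1) zero_le_one
  exact ((aTx hd hφ).prod (aTx hd hφ)).prod (h1.pi.pi)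
lemma cBx (s : ℕ) (I : 𝔽 d) (e : Es d × Es d) (r : ℝ) (x : V d) (ω : (Ω × Ω) × (I → Of d s → ℝ)) :
    W3 φ s I (e, r • nzv s I x) ω = W2 φ e ω.1 + r * Nz s I ω.2 x := by
  rw [aQy, aR, Nz, mul_sum]
  congr 1
  refine sum_congr rfl fun i _ => ?_
  rw [aR, mul_sum]
  refine sum_congr rfl fun a _ => ?_
  simp only [Pi.smul_apply, nzv, aRy, LinearMap.toSpanSingleton_apply, smul_eq_mul]
  split_ifs <;> simp
lemma cBy (s : ℕ) (I : 𝔽 d) (e e' : Es d × Es d) (r r' : ℝ) (x x' : V d) :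
    Q3 s I (e, r • nzv s I x) (e', r' • nzv s I x') = Q2 d e e' + r * r' * if x = x' ∧ idx (2 * s + 1) x ∈ I then 1 else 0 := by
  have h0 : Q3 s I (e, r • nzv s I x) (e', r' • nzv s I x') = Q2 d e e' + r * r' * Nz s I (nzv s I x') x := by
    rw [aQz, aRx, Nz, mul_sum]
    congr 1
    refine sum_congr rfl fun i _ => ?_
    rw [aRx, mul_sum]
    refine sum_congr rfl fun a _ => ?_
    simp only [Pi.smul_apply, nzv, aRz, LinearMap.smul_apply, mul_apply', smul_eq_mul]
    split_ifs <;> ring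
  rw [h0]
  congr 2
  by_cases hI : idx (2 * s + 1) x ∈ I
  · obtain ⟨a, h1, h2⟩ := cAz (nzv s I x') x hI
    rw [h1, nzv, ← h2]
    simp [hI]
  · rw [if_neg fun h => hI h.2]
    refine sum_eq_zero fun i _ => sum_eq_zero fun a _ => if_neg fun h => hI ?_
    rw [← h, bOy.2 (cA.2 a.2)]; exact i.2
lemma cBz (x y : V d) : Q2 d (fb x) (fb y) = green d x y := by
  have h2 : (√2)⁻¹ * (√2)⁻¹ = ℜ 2⁻¹ := by rw [← mul_inv, mul_self_sqrt ♣]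
  rw [aQz]
  simp only [fb, Prod.smul_fst, Prod.smul_snd, map_smul, LinearMap.smul_apply, aSx, smul_eq_mul]
  linear_combination (2 * green d x y) * h2
lemma cC (hd : 3 ≤ d) (t : ℝ) (x y : V d) : Q2 d (fb x) (yb t y) = (√2)⁻¹ * t * if x = y then 1 else 0 := by
  rw [aQz]
  simp only [fb, yb, eq_comm (a := x)]
  split_ifs with h1 h2 h2 <;> simp only [Prod.smul_fst, Prod.smul_snd, map_smul, LinearMap.smul_apply, aU hd, h2, if_true, if_false, smul_eq_mul, map_zero] <;> ring
lemma cCx (e f : Es d × Es d) : Q2 d e f = Q2 d f e := by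
  rw [aQz, aQz, aSz, aSz f.2]
lemma cCy (x : V d) (i : Fin d) : ∑ j, unitV d i j = 1 := by simp [unitV]
lemma cCz (hd : 3 ≤ d) (t : ℝ) (x y : V d) : Q2 d (yb t x) (yb t y) = t ^ 2 * if x = y then 1 else 0 := by
  have key : (Even (∑ i, x i) ↔ Even (∑ i, y i)) → Qg d (yv x) (yv y) = if x = y then 1 else 0 := fun h => by
    have hz : Pav (fun z => if y = z then (1 : ℝ) else 0) x = 0 := by
      rw [Pav, sum_eq_zero, mul_zero]
      intro i _
      have u := cCy x i
      rw [if_neg, if_neg, add_zero]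
      · rintro rfl
        simp only [Pi.sub_apply, sum_sub_distrib, u] at h
        rw [Int.even_sub_one, iff_not_comm] at h
        tauto
      · rintro rfl
        simp only [Pi.add_apply, sum_add_distrib, u] at h
        rw [Int.even_add_one] at h
        tauto
    rw [aSz]
    change Qg d (yv y) (ev x - aTy ev x) = _
    rw [map_sub, aTz, aSz, aU hd]
    simp_rw [fun z => aSz (yv y) (ev z), aU hd, hz]
    simp [eq_comm]
  rw [aQz]
  unfold yb
  split_ifs with h1 h2 h3 h3 h2 h3 h3
  all_goals first | (subst h3; contradiction) | skip
  all_goals simp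
  all_goals first | (rw [key (by tauto), if_pos h3]; ring) | (right; rw [key (by tauto), if_neg h3]) | skip
lemma cD (hd : 3 ≤ d) (hφ : IsGFF P φ) {s : ℕ} {I : 𝔽 d} (e : V d → (Es d × Es d) × (I → Of d s → ℝ)) {M : ℝ} (hM : 0 < M)
    (H : ∀ z z', Q3 s I (e z) (e z') ≤ green d z z' / M ^ 2) {p : ENNReal}
    (hp : ofReal ((bx 𝕆 d (16 * s)).card * exp (-1 / (2 * (kap d 0 / M ^ 2 + 4 * kap d (4500 * (2 * s + 1)) / M ^ 2)))) ≤ p)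
    {n : ℕ} {x : V d} {T S : 𝔽 d} (hT : T ∈ Tr n x) (hS : S ⊆ T) :
    PB P s I {ω | ∀ y ∈ S, ∃ a ∈ bx 𝕆 d (16 * s), 1 ≤ W3 φ s I (e (cc s y + a)) ω} ≤ p ^ S.card := by
  have k0 := aJz hd 0
  have hg : ∀ z z' : V d, ∀ r ≤ dinf z z', green d z z' / M ^ 2 ≤ kap d r / M ^ 2 := fun z z' r hr => by
    gcongr; exact (aKx hd z z').trans (aJy hd hr)
  refine (bLx hd (cB hd hφ s I) (fun e f => ?_) (m := 2 * s + 1) ♥ _ (fun y a => e (cc s y + a)) hM (v := kap d 0 / M ^ 2)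
    ♠ (fun y a _ => (H _ _).trans (hg _ _ _ (Nat.zero_le _))) (fun i j hij a ha b hb => (H _ _).trans (hg _ _ _ ?_)) hT hS).trans
    (by gcongr)
  · rw [aQz (Q := Q2 d), aQz (Q := Q2 d), cCx, aRx, aRx]
    congr 1
    refine sum_congr rfl fun i _ => ?_
    rw [aRx, aRx]
    exact sum_congr rfl fun i _ => by simp [aRz, mul_comm]
  · have h1 := bZx s i j
    have h2 := aBx (cc s i) (cc s i + a) (cc s j)
    have h3 := aBx (cc s i + a) (cc s j + b) (cc s j)
    have h4 := bHy.1 ((cA (c := cc s i)).2 ha)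
    have h5 := bHy.1 ((cA (c := cc s j)).2 hb)
    have h6 := Nat.mul_le_mul_left (2 * s + 1) hij
    rw [aB] at h4
    omega
def bs (s : ℕ) (I : 𝔽 d) (h h' ε M : ℝ) (f g : V d → ℝ) (T : Set I) : 𝕊 d :=
  {y | y ∈ I ∧ (¬ Sd (cc s y) s (h - 2 * ε) (h - 2 * ε) (h' - 2 * ε) f ∨ (∃ z ∈ bx (cc s y) (8 * s), ε ≤ g z) ∨
    (∃ z ∈ bx (cc s y) (8 * s), f z ≤ -M) ∨ ∃ i : I, dinf i.1 y ≤ 4 ∧ i ∉ T)}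
def tau (d s : ℕ) (ε σ : ℝ) : Set (Of d s → ℝ) := {z | ∀ a, -ε < σ * z a}
theorem cDx (hd : 3 ≤ d) (hφ : IsGFF P φ) {h h' ε : ℝ} (hh : h ∈ tildeSet d P φ) (hlt : h' < h) (hε : ε = (h - h') / 8)
    {q : ENNReal} (hq : 0 < q) : ∃ s, 1 ≤ s ∧ ∃ σ M : ℝ, 0 < σ ∧ 0 < M ∧ ∃ f g : V d → Ω × Ω → ℝ, (∀ x, Measurable (f x)) ∧ (∀ x, Measurable (g x)) ∧
      ∀ I : 𝔽 d, (∀ Λ : 𝔽 d, (∀ x ∈ Λ, idx (2 * s + 1) x ∈ I) → ∀ (a : ℝ) (p : 𝕊 d → Prop),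
        P {ω | p ({x | a ≤ φ x ω} ∩ (Λ : 𝕊 d))} =
        PB P s I {ω | p ({x | a ≤ f x ω.1 - g x ω.1 + σ * Nz s I ω.2 x} ∩ (Λ : 𝕊 d))}) ∧
      ∀ n X, PB P s I {ω | Bad (bs s I h h' ε M (fun x => f x ω.1) (fun x => g x ω.1) {i | ω.2 i ∈ tau d s ε σ}) n X} ≤ q ^ (2 ^ n) := by
  classical
  have hε0 : 0 < ε := by rw [hε]; linarith
  set C : ENNReal := 3000000 ^ (2 * d) * 4
  have hC : C ≠ 0 := by simp [C]
  have hCt : C ≠ ⊤ := mul_ne_top (pow_ne_top (by simp)) (by simp)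
  set p : ENNReal := min 1 (q / C)
  have hp0 : 0 < p := lt_min one_pos (ENNReal.div_pos hq.ne' hCt)
  have hp1 : p ≤ 1 := min_le_left _ _
  have hpq : 3000000 ^ (2 * d) * (((4 : ℕ) : ENNReal) * p) ≤ q := by
    rw [← mul_assoc]
    exact (mul_le_mul_right (min_le_right _ _) C).trans (ENNReal.mul_div_cancel hC hCt).le
  have hp4 : 0 < p ^ 4 := ENNReal.pow_pos hp0 4
  have hp4t : p ^ 4 ≠ ⊤ := pow_ne_top (hp1.trans_lt one_lt_top).ne
  obtain ⟨s, hs, hseed⟩ := bZz hd hφ hh hlt hε hp4 1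
  have k0 := aJz hd 0
  have k1 := aJz hd (4500 * (2 * s + 1))
  set K := kap d 0 + 4 * kap d (4500 * (2 * s + 1))
  have hK : 0 < K := by positivity
  have hl := (Real.tendsto_exp_neg_atTop_nhds_zero.const_mul ((bx 𝕆 d (16 * s)).card : ℝ)).eventually
    (gt_mem_nhds (by rw [mul_zero]; exact toReal_pos hp4.ne' hp4t))
  obtain ⟨r, hr, hr0⟩ := (hl.and (eventually_gt_atTop 0)).exists
  set M := √(2 * K * r)
  have hM : 0 < M := Real.sqrt_pos.2 ♠
  have hM2 : M ^ 2 = 2 * K * r := sq_sqrt ♠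
  have hMp : ofReal ((bx 𝕆 d (16 * s)).card * exp (-1 / (2 * (kap d 0 / M ^ 2 + 4 * kap d (4500 * (2 * s + 1)) / M ^ 2)))) ≤ p ^ 4 := by
    rw [← add_div, show -1 / (2 * (K / M ^ 2)) = -r by rw [hM2]; field_simp]
    exact (ofReal_le_ofReal hr.le).trans (ofReal_toReal hp4t).le
  have u2 : (√2)⁻¹ ^ 2 = ℜ 2⁻¹ := by rw [inv_pow, sq_sqrt ♣]
  set u : ℝ := (√2)⁻¹
  have hu : 0 < u := by positivity
  have hx0 : 0 < ε / M := by positivity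
  obtain ⟨t, ht0, ht1, ht2, ht3⟩ : ∃ t : ℝ, 0 < t ∧ t ≤ 1 ∧ t ≤ ε / M ∧ 2 * t ≤ (ε / M) ^ 2 :=
    ⟨min 1 (min (ε / M) ((ε / M) ^ 2 / 2)), by positivity, min_le_left _ _, (min_le_right _ _).trans (min_le_left _ _), by
      have := (min_le_right 1 (min (ε / M) ((ε / M) ^ 2 / 2))).trans (min_le_right _ _); linarith⟩
  have hv : 0 < 2 * u * t - t ^ 2 := by nlinarith [mul_pos hu ht0]
  set σ := √(2 * u * t - t ^ 2)
  have hσ : 0 < σ := Real.sqrt_pos.2 hv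
  have hσ2 : σ ^ 2 = 2 * u * t - t ^ 2 := sq_sqrt hv.le
  have hσ3 : σ ^ 2 ≤ (ε / M) ^ 2 := by nlinarith [mul_pos hu ht0]
  have iso2 := (aTx hd hφ).prod (aTx hd hφ)
  refine ⟨s, hs, σ, M, hσ, hM, fun x => W2 φ (fb x), fun x => W2 φ (yb t x), fun x => iso2.meas _, fun x => iso2.meas _, fun I => ⟨fun Λ hΛ a p => ?_, fun n X => ?_⟩⟩
  · have h1 := (aTx hd hφ).prob_eq (cB hd hφ s I) (fun x => if x ∈ Λ then ev x else 0)
      (fun x => if x ∈ Λ then (fb x - yb t x, σ • nzv s I x) else 0) (fun x y => by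
        by_cases hx : x ∈ Λ
        · by_cases hy : y ∈ Λ
          · simp only [hx, hy, if_true]
            rw [cBy, LinearMap.map_sub₂, map_sub, map_sub, cBz, cC hd, cCx (yb t x), cC hd, cCz hd, aSx]
            by_cases hxy : x = y
            · simp [hxy, hΛ y hy]; linear_combination -hσ2
            · simp [hxy, Ne.symm hxy]
          · simp [hy]
        · simp [hx]) (aS (Ω := V d → ℝ) Λ.finite_toSet (fun x f => f x) (fun x => measurable_pi_apply x) (fun _ => a) p)
    refine Eq.trans ?_ (h1.trans ?_)
    all_goals
      congr 1; ext ω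
      simp only [mem_ofPred_eq]
      rw [iff_eq_eq]
      congr 1; ext x
      simp only [mem_inter_iff, mem_ofPred_eq, SetLike.mem_coe]
      refine and_congr_left fun hx => ?_
      simp only [hx, if_true]
    · rw [aSy]
    · rw [cBx, map_sub, Pi.sub_apply]
  · let e : Fin 3 → V d → (Es d × Es d) × (I → Of d s → ℝ) := fun k z => if k = 0 then (ε⁻¹ • yb t z, (0 : ℝ) • nzv s I z) else
      if k = 1 then ((-M⁻¹) • fb z, (0 : ℝ) • nzv s I z) else (0, (-σ / ε) • nzv s I z)
    have hδ : ∀ (c : ℝ) (z z' : V d), 0 ≤ c → c ≤ 1 / M ^ 2 → (c * if z = z' then (1 : ℝ) else 0) ≤ green d z z' / M ^ 2 := fun c z z' c0 hc => by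
      split_ifs with hz
      · subst hz
        rw [mul_one]
        exact hc.trans (by gcongr; exact aT hd z)
      · rw [mul_zero]; exact div_nonneg (aK _ _) ♠
    have He : ∀ k z z', Q3 s I (e k z) (e k z') ≤ green d z z' / M ^ 2 := fun k z z' => by
      fin_cases k
      · simp only [e]
        simp only [Fin.zero_eta, if_true]
        rw [cBy, map_smul, map_smul, LinearMap.smul_apply, cCz hd, zero_mul, zero_mul, add_zero, smul_eq_mul, smul_eq_mul, ← mul_assoc, ← mul_assoc]
        refine hδ _ z z' ♠ ?_
        rw [show ε⁻¹ * ε⁻¹ * t ^ 2 = t ^ 2 / ε ^ 2 by field_simp, div_le_div_iff₀ ♠ ♠]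
        rw [le_div_iff₀ hM] at ht2
        have := pow_le_pow_left₀ ♠ ht2 2
        rw [mul_pow] at this; linarith
      · simp only [e]
        rw [if_neg (by decide), if_pos (by decide), if_neg (by decide), if_pos (by decide)]
        rw [cBy, map_smul, map_smul, LinearMap.smul_apply, cBz]
        refine le_of_eq ?_
        simp; field_simp
      · simp only [e]
        rw [if_neg (by decide), if_neg (by decide), if_neg (by decide), if_neg (by decide), cBy, map_zero, zero_add]
        refine le_trans ?_ (hδ (-σ / ε * (-σ / ε)) z z' (mul_self_nonneg _) ?_)
        · refine mul_le_mul_of_nonneg_left ?_ (mul_self_nonneg _)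
          split_ifs <;> first | tauto | norm_num
        · rw [show -σ / ε * (-σ / ε) = σ ^ 2 / ε ^ 2 by field_simp, div_le_div_iff₀ ♠ ♠]
          rw [div_pow, le_div_iff₀ ♠] at hσ3
          linarith
    have hoff : ∀ y : V d, ∀ z N, N ≤ 16 * s → z ∈ bx (cc s y) N → ∃ a ∈ bx 𝕆 d (16 * s), cc s y + a = z := fun y z N hN hz =>
      ⟨z - cc s y, cA (c := cc s y).1 (by rw [add_sub_cancel]; exact bHy.2 ((bHy.1 hz).trans hN)), by abel⟩
    refine (bAz _ n X (((4 : ℕ) : ENNReal) * p) fun T hT => ?_).trans (pow_le_pow_left' hpq _)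
    rw [← (aGz (fun _ => 0) (fun _ _ _ => le_rfl) hT).1]
    refine (measure_mono ?_).trans (bXz (P := PB P s I) (r := 4) ♣ T (Fin.cons (fun y ω => ¬ Sd (cc s y) s (h - 2 * ε) (h - 2 * ε) (h' - 2 * ε) (fun x => W2 φ (fb x) ω.1))
      fun k y ω => ∃ a ∈ bx 𝕆 d (16 * s), 1 ≤ W3 φ s I (e k (cc s y + a)) ω) hp1 fun i S hS => ?_)
    · intro ω hω y hy
      obtain ⟨-, h0 | ⟨z, hz, h1⟩ | ⟨z, hz, h1⟩ | ⟨i, hi, h1⟩⟩ := hω y hy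
      · exact ⟨0, h0⟩
      · obtain ⟨a, ha, rfl⟩ := hoff y z _ ♥ hz
        refine ⟨1, a, ha, ?_⟩
        change 1 ≤ W3 φ s I (e 0 _) ω
        simp only [e, if_true]
        rw [cBx, zero_mul, add_zero, map_smul, Pi.smul_apply, smul_eq_mul, inv_mul_eq_div, le_div_iff₀ hε0, one_mul]
        exact h1
      · obtain ⟨a, ha, rfl⟩ := hoff y z _ ♥ hz
        refine ⟨2, a, ha, ?_⟩
        change 1 ≤ W3 φ s I (e 1 _) ω
        simp only [e]
        rw [if_neg (by decide), if_pos trivial, cBx, zero_mul, add_zero, map_smul, Pi.smul_apply, smul_eq_mul, neg_mul, inv_mul_eq_div, le_neg, div_le_iff₀ hM]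
        linarith
      · have h2 : ∃ a, σ * ω.2 i a ≤ -ε := by
          by_contra! hc; exact h1 hc
        obtain ⟨b, hb⟩ := h2
        have hz : cc s i.1 + b.1 ∈ bx (cc s y) (16 * s) := by
          have h3 := bHy.1 (cA (c := cc s i.1).2 b.2)
          rw [bHz]
          intro j
          have h4 := (bHz.1 (bHy.2 h3)) j
          have h5 := (bHz.1 (bHy.2 hi)) j
          have h6 : cc s i.1 j - cc s y j = (2 * s + 1) * (i.1 j - y j) := by simp only [cc]; ring
          have h7 : ((2 * s + 1 : ℤ) * (i.1 j - y j)).natAbs ≤ (2 * s + 1) * 4 := by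
            rw [natAbs_mul]; exact Nat.mul_le_mul ♥ h5
          rw [← h6] at h7
          omega
        obtain ⟨a, ha, hab⟩ := hoff y _ _ le_rfl hz
        refine ⟨3, a, ha, ?_⟩
        change 1 ≤ W3 φ s I (e 2 _) ω
        simp only [e]
        rw [if_neg (by decide), if_neg (by decide), hab, cBx, cAy, map_zero, Pi.zero_apply, zero_add, div_mul_eq_mul_div, le_div_iff₀ hε0]
        linarith
    · refine Fin.cases ?_ (fun k => ?_) i
      · simp only [Fin.cons_zero]
        have h1 := (aTx hd hφ).prob_eq (cB hd hφ s I) ev (fun x => (fb x, (0 : ℝ) • nzv s I x)) (fun x y => by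
          rw [cBy, cBz, aSx]; simp)
          (A := ⋂ y ∈ S, {f | Sd (cc s y) s (h - 2 * ε) (h - 2 * ε) (h' - 2 * ε) f}ᶜ) (measurableSet_biInter _ fun y _ => (bYz _ _ _ _ _).compl)
        simp only [cBx, zero_mul, add_zero, aSy, mem_iInter, mem_compl_iff, mem_ofPred_eq] at h1
        rw [← h1]
        exact hseed n X T hT S hS
      · simp only [Fin.cons_succ]
        exact cD hd hφ (e k) hM (He k) hMp hT hS
end
section
variable {d : ℕ}
lemma cDy (hd : 2 ≤ d) (c : V d) (N : ℕ) : Cd (bx c N : 𝕊 d) := by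
  have h := aCz hd (fun i => c i - N) (fun i => c i + N) c (fun _ _ => True) (fun j => ⟨by simp, by simp, trivial⟩)
  convert h using 1
  ext y
  simp only [SetLike.mem_coe, bHz, mem_ofPred_eq, exists_const_iff, and_true]
  exact ⟨fun h => ⟨fun j => by have := h j; omega, ⟨⟨0, by omega⟩⟩⟩, fun h j => by have := h.1 j; omega⟩
lemma cDz {s : ℕ} {z y : V d} (h : z ∈ bx (cc s y) (8 * s)) : dinf (idx (2 * s + 1) z) y ≤ 4 := by
  refine aAy.2 fun i => ?_
  have h1 := bHz.1 (bOy.1 (rfl : idx (2 * s + 1) z = _)) i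
  have h2 := bHz.1 h i
  simp only [cc] at h1 h2
  by_contra! hc
  have h3 := Nat.mul_le_mul_left (2 * s + 1) hc
  have h4 : ((2 * s + 1 : ℤ) * (idx (2 * s + 1) z i - y i)).natAbs = (2 * s + 1) * (idx (2 * s + 1) z i - y i).natAbs := by
    rw [natAbs_mul]; rfl
  rw [← h4, mul_sub] at h3
  omega
variable {s : ℕ} {I : 𝔽 d} {h h' ε M σ α A0 : ℝ} {f g : V d → ℝ} {ζ : I → Of d s → ℝ}
abbrev TT (ε σ : ℝ) (ζ : I → Of d s → ℝ) : Set I := {i | ζ i ∈ tau d s ε σ}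
abbrev KK (α σ : ℝ) (f g : V d → ℝ) (ζ : I → Of d s → ℝ) (ρ : ℕ) : 𝕊 d :=
  {x | α ≤ f x - g x + σ * Nz s I ζ x} ∩ (bx 𝕆 d ρ : 𝕊 d)
lemma cE {y z : V d} (hy : y ∈ I) (hb : y ∉ bs s I h h' ε M f g (TT ε σ ζ)) (hz : z ∈ bx (cc s y) (8 * s)) (hI : idx (2 * s + 1) z ∈ I) :
    f z - 2 * ε ≤ f z - g z + σ * Nz s I ζ z ∧ -M < f z ∧ g z < ε := by
  simp only [bs, mem_ofPred_eq, not_and, not_or, not_exists, not_le, not_not] at hb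
  obtain ⟨-, h2, h3, h4⟩ := hb hy
  obtain ⟨a, ha, -⟩ := cAz ζ z hI
  have h5 := h4 ⟨_, hI⟩ (cDz hz) a
  rw [← ha] at h5
  exact ⟨by linarith [h2 z hz], h3 z hz, h2 z hz⟩
lemma cEx (hs : 1 ≤ s) (hα : α ≤ h' - 4 * ε) {Γ : 𝕊 d} (hΓ : Cd Γ) (hb : ∀ y ∈ Γ, y ∈ I ∧ y ∉ bs s I h h' ε M f g (TT ε σ ζ)) {ρ : ℕ}
    (hρ : ∀ y ∈ Γ, bx (cc s y) (8 * s) ⊆ bx 0 ρ) (hI : ∀ x ∈ bx 𝕆 d ρ, idx (2 * s + 1) x ∈ I) :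
    ∃ v : V d → V d, (∀ y ∈ Γ, v y ∈ bx (cc s y) s) ∧ ∀ y ∈ Γ, ∀ y' ∈ Γ, Cn (KK α σ f g ζ ρ) (v y) (v y') := by
  have hSd : ∀ y ∈ Γ, Sd (cc s y) s (h - 2 * ε) (h - 2 * ε) (h' - 2 * ε) f := fun y hy => by
    by_contra hc; exact (hb y hy).2 ⟨(hb y hy).1, Or.inl hc⟩
  choose! v hv hm using fun y hy => (hSd y hy).1
  have h00 : ∀ y : V d, dinf y y = 0 := fun y => by simp [dinf]
  have key : ∀ y ∈ Γ, ∀ y' ∈ Γ, dinf (cc s y) (cc s y') ≤ 2 * s + 1 → Cn (KK α σ f g ζ ρ) (v y) (v y') := fun y hy y' hy' hyy => by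
    have h1 := bHy.1 (hv y hy)
    have h2 := bHy.1 (hv y' hy')
    have h3 := aBx (v y') (cc s y') (cc s y)
    rw [aB (cc s y')] at h3
    refine Cn.mono ?_ ((hSd y hy).2 (v y) (bHy.2 ♥) (v y') (bHy.2 ♥)
      ((hm y hy).to (fun _ _ h => h) ♥ (by rw [h00]; omega)) ((hm y' hy').to (fun _ _ h => h) ♥ ♥))
    intro z hz
    have hz8 := hρ y hy hz.2
    have h5 : h' - 2 * ε ≤ f z := hz.1
    have h4 := (cE (hb y hy).1 (hb y hy).2 hz.2 (hI z hz8)).1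
    exact ⟨show α ≤ _ by linarith, hz8⟩
  refine ⟨v, hv, fun y hy y' hy' => ?_⟩
  refine ((hΓ y hy y' hy').ind (fun w => Cn (KK α σ f g ζ ρ) (v y) (v w)) (key y hy y hy (by rw [h00]; omega)) fun a b ha hb' hab hp => hp.trans (key a ha b hb' ?_))
  refine aAy.2 fun i => ?_
  have h1 := bHz.1 (bHy.2 (aC hab)) i
  rw [show cc s a i - cc s b i = (2 * s + 1 : ℕ) * (a i - b i) by simp only [cc]; push_cast; ring, natAbs_mul, natAbs_natCast]
  nlinarith
lemma cEy (hd : 2 ≤ d) (hs : 1 ≤ s) {i : I} (hb : i.1 ∉ bs s I h h' ε M f g (TT ε σ ζ)) {ρ : ℕ} (hρ : bx (cc s i.1) (8 * s) ⊆ bx 0 ρ)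
    (hσ : 0 < σ) (hA0 : α + M + ε ≤ σ * A0) (hA : ∀ a, A0 ≤ ζ i a) {z z' : V d} (hz : z ∈ bx (cc s i.1) s) (hz' : z' ∈ bx (cc s i.1) s) :
    Cn (KK α σ f g ζ ρ) z z' := by
  refine Cn.mono ?_ (cDy hd (cc s i.1) s z hz z' hz')
  intro w hw
  have h8 : w ∈ bx (cc s i.1) (8 * s) := bHy.2 ((bHy.1 hw).trans ♥)
  have hi : idx (2 * s + 1) w = i := bOy.2 hw
  have hI : idx (2 * s + 1) w ∈ I := by rw [hi]; exact i.2
  obtain ⟨-, h1, h2⟩ := cE i.2 hb h8 hI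
  obtain ⟨a, ha, -⟩ := cAz ζ w hI
  rw [show (⟨_, hI⟩ : I) = i from Subtype.ext hi] at ha
  have h3 := mul_le_mul_of_nonneg_left (hA a) hσ.le
  rw [← ha] at h3
  exact ⟨show α ≤ _ by linarith, hρ h8⟩
def GG' (b : 𝕊 d) (n k : ℕ) : 𝕊 d := ⋃ X ∈ (bx 𝕆 d k : 𝕊 d), CC b n X
lemma cEz (hd : 2 ≤ d) (b : 𝕊 d) (n k : ℕ) : Cd (GG' b n k) :=
  (cDy hd 0 k).biUnion _ (fun x _ => (aFx hd b n).1 x) (fun x _ => (aFx hd b n).2.1 x) fun x _ y _ h => (aFx hd b n).2.2 x y h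
lemma cF {b : 𝕊 d} {n k : ℕ} {y : V d} (hy : y ∈ GG' b n k) : bx (cc s y) (8 * s) ⊆ bx 0 ((2 * s + 1) * 1000000 ^ n * (k + 8)) := by
  simp only [GG', mem_iUnion] at hy
  obtain ⟨X, hX, hy⟩ := hy
  intro z hz
  rw [bHz]
  intro i
  have h1 := aEy b n X y hy i
  have h2 := bHz.1 hX i
  have h3 := bHz.1 hz i
  generalize hN : 1000000 ^ n = N at *
  have hN' : (1000000 : ℤ) ^ n = N := by rw [← hN]; push_cast; ring
  have hN1 : 1 ≤ N := by rw [← hN]; exact one_le_pow _ _ ♣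
  rw [hN'] at h1
  simp only [Pi.zero_apply, sub_zero, cc] at h2 h3 ⊢
  have h4 : (N * X i : ℤ).natAbs ≤ N * k := by rw [natAbs_mul, natAbs_natCast]; exact Nat.mul_le_mul_left _ h2
  have h5 : (y i).natAbs ≤ N * k + 3 * N := by omega
  have h6 : ((2 * s + 1 : ℕ) * y i : ℤ).natAbs ≤ (2 * s + 1) * (N * k + 3 * N) := by
    rw [natAbs_mul, natAbs_natCast]; exact Nat.mul_le_mul_left _ h5
  have h7 : (2 * s + 1) * N * (k + 8) = (2 * s + 1) * (N * k + 3 * N) + 5 * ((2 * s + 1) * N) := by ring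
  have h8 := Nat.mul_le_mul_left (2 * s + 1) hN1
  rw [h7]
  push_cast at h6
  omega
end
section
variable {d : ℕ}
def Far (K : 𝕊 d) (R : ℕ) (x : V d) : Prop :=
  ∃ p q, Cn (K ∩ (bx 𝕆 d R : 𝕊 d)) x p ∧ Cn (K ∩ (bx 𝕆 d R : 𝕊 d)) x q ∧ R ≤ 10 * dinf p q
def Gev (K : 𝕊 d) (R : ℕ) : Prop :=
  (∃ p q, Cn (K ∩ (bx 𝕆 d R : 𝕊 d)) p q ∧ R ≤ 5 * dinf p q) ∧ ∃ w, ∀ x, Far K R x → Cn K x w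
lemma cFx (N : ℕ) : box d ℜ N = (bx 𝕆 d N : 𝕊 d) := by
  ext x; rw [box, bC]; exact bHy.symm
lemma cFy {Ω : Type*} {φ : V d → Ω → ℝ} {α : ℝ} {R : ℕ} {ω : Ω} (hG : Gev ({x | α ≤ φ x ω} ∩ (bx 𝕆 d (2 * R) : 𝕊 d)) R) :
    ω ∈ ExistEv d φ R α ∧ ω ∈ UniqueEv d φ R α := by
  have hs : {x | α ≤ φ x ω} ∩ (bx 𝕆 d (2 * R) : 𝕊 d) ∩ (bx 𝕆 d R : 𝕊 d) = lvl φ α ω ∩ box d (R : ℝ) := by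
    rw [cFx, inter_assoc, inter_eq_right.2 (fun x hx => bHy.2 ((bHy.1 hx).trans ♥) : (bx 𝕆 d R : 𝕊 d) ⊆ bx 𝕆 d (2 * R))]; rfl
  obtain ⟨⟨p, q, h1, h2⟩, w, hw⟩ := hG
  rw [hs] at h1
  refine ⟨⟨p, h1.left, p, bCy.2 (Cn.refl h1.left), q, bCy.2 h1, ?_⟩, ?_⟩
  · rw [div_le_iff₀ ♣]; exact_mod_cast (by omega : R ≤ dinf p q * 5)
  intro x hx y hy hdx hdy
  have key : ∀ x, diamGE (comp (lvl φ α ω ∩ box d ℜ R) x) (ℜ R / 10) → Cn ({x | α ≤ φ x ω} ∩ (bx 𝕆 d (2 * R) : 𝕊 d)) x w := by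
    rintro x ⟨p, hp, q, hq, hpq⟩
    refine hw x ⟨p, q, by rw [hs]; exact bCy.1 hp, by rw [hs]; exact bCy.1 hq, ?_⟩
    rw [div_le_iff₀ ♣] at hpq
    have : R ≤ dinf p q * 10 := by exact_mod_cast hpq
    omega
  rw [show (2 * ℜ R) = ((2 * R : ℕ) : ℝ) by push_cast; ring, cFx]
  exact aAx.2 ⟨x, rfl, y, rfl, (key x hdx).trans (key y hdy).symm⟩
open Classical in
def Vis (s : ℕ) (I : 𝔽 d) (S : 𝕊 d) (x : V d) : Finset I :=
  Finset.univ.filter fun i => ∃ z, idx (2 * s + 1) z = i.1 ∧ (z = x ∨ ∃ w, Cn S x w ∧ (w = z ∨ adj w z))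
lemma cFz {s : ℕ} {I : 𝔽 d} {S : 𝕊 d} {x : V d} {i : I} :
    i ∈ Vis s I S x ↔ ∃ z, idx (2 * s + 1) z = i.1 ∧ (z = x ∨ ∃ w, Cn S x w ∧ (w = z ∨ adj w z)) := by simp [Vis]
variable {s : ℕ} {I : 𝔽 d} {h h' ε M σ α A0 : ℝ} {f g : V d → ℝ} {ζ ζ' : I → Of d s → ℝ}
lemma cG {z : V d} (hz : ∀ i : I, idx (2 * s + 1) z = i.1 → ζ i = ζ' i) : Nz s I ζ z = Nz s I ζ' z := by
  refine sum_congr rfl fun i _ => sum_congr rfl fun a _ => ?_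
  split_ifs with h
  · rw [hz i (bOy.2 (by rw [← h]; exact cA.2 a.2))]
  · rfl
lemma cGx (ρ : ℕ) (x : V d) (Λ : 𝕊 d) (hx : ∀ i ∈ Vis s I (KK α σ f g ζ ρ ∩ Λ) x, ζ i = ζ' i) :
    Vis s I (KK α σ f g ζ' ρ ∩ Λ) x = Vis s I (KK α σ f g ζ ρ ∩ Λ) x := by
  have hz : ∀ z, (z = x ∨ ∃ w, Cn (KK α σ f g ζ ρ ∩ Λ) x w ∧ (w = z ∨ adj w z)) →
      (z ∈ KK α σ f g ζ ρ ∩ Λ ↔ z ∈ KK α σ f g ζ' ρ ∩ Λ) := fun z hz => by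
    have := cG (s := s) (ζ := ζ) (ζ' := ζ') (z := z) fun i hi => hx i (cFz.2 ⟨z, hi, hz⟩)
    simp only [KK, mem_inter_iff, mem_ofPred_eq, this]
  have key : ∀ w, Cn (KK α σ f g ζ ρ ∩ Λ) x w ↔ Cn (KK α σ f g ζ' ρ ∩ Λ) x w := fun w => by
    constructor
    · intro hc
      refine (hc.ind (fun a => Cn (KK α σ f g ζ ρ ∩ Λ) x a ∧ Cn (KK α σ f g ζ' ρ ∩ Λ) x a) ⟨Cn.refl hc.left, Cn.refl ((hz x (Or.inl rfl)).1 hc.left)⟩ ?_).2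
      rintro a b ha hb hab ⟨h1, h2⟩
      exact ⟨h1.trans (Cn.step ha hb hab), h2.trans (Cn.step h2.right ((hz b (Or.inr ⟨a, h1, Or.inr hab⟩)).1 hb) hab)⟩
    · intro hc
      refine hc.ind (fun a => Cn (KK α σ f g ζ ρ ∩ Λ) x a) (Cn.refl ((hz x (Or.inl rfl)).2 hc.left)) ?_
      intro a b ha hb hab h1
      exact h1.trans (Cn.step h1.right ((hz b (Or.inr ⟨a, h1, Or.inr hab⟩)).2 hb) hab)
  ext i
  simp only [cFz, key]
def Gt (I : 𝔽 d) (B : 𝕊 d) (n k : ℕ) (T : Set I) : Set I := {i | i ∈ T ∧ i.1 ∈ GG' B n k}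
def EE (s : ℕ) (I : 𝔽 d) (n k : ℕ) (x : V d) (S B : 𝕊 d) (T A : Set I) : Prop :=
  (∃ S' ⊆ Vis s I S x, (S' : Set I) ⊆ Gt I B n k T ∧ 2 ^ n ≤ S'.card) ∧ ∀ i ∈ Vis s I S x, i ∈ Gt I B n k T → i ∉ A
lemma cGy {b : 𝕊 d} {n k R : ℕ} (hk : k ≤ R) (hB : ∀ X ∈ bx 𝕆 d R, ¬ Bad b n X) : GG' b n k ⊆ bᶜ := by
  intro y hy
  simp only [GG', mem_iUnion] at hy
  obtain ⟨X, hX, hy⟩ := hy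
  exact aEz (hB X (bHy.2 ((bHy.1 hX).trans hk))) hy
lemma cGz {b : 𝕊 d} {n k R : ℕ} (hk : (2 * s + 1) * 1000000 ^ n * (k + 8) ≤ R) (hI : ∀ x ∈ bx 𝕆 d R, idx (2 * s + 1) x ∈ I)
    {y : V d} (hy : y ∈ GG' b n k) : y ∈ I ∧ bx (cc s y) (8 * s) ⊆ bx 0 R := by
  have h1 : bx (cc s y) (8 * s) ⊆ bx 0 R := fun z hz => bHy.2 ((bHy.1 (cF hy hz)).trans hk)
  have h2 : ∀ N, cc s y ∈ bx (cc s y) N := fun N => bHz.2 fun i => by simp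
  refine ⟨?_, h1⟩
  have := hI _ (h1 (h2 _))
  rwa [bOy.2 (h2 s)] at this
section
variable {n R : ℕ} (hd : 2 ≤ d) (hs : 1 ≤ s) (hα : α ≤ h' - 4 * ε) (hR : 100 * ((2 * s + 1) * 1000000 ^ n) ≤ R)
  (hI : ∀ x ∈ bx 𝕆 d (2 * R), idx (2 * s + 1) x ∈ I)
  (hB : ∀ X ∈ bx 𝕆 d R, ¬ Bad (bs s I h h' ε M f g (TT ε σ ζ)) n X)
include hd hs hα hR hI hB
lemma cH : ∃ p q, Cn (KK α σ f g ζ (2 * R) ∩ (bx 𝕆 d R : 𝕊 d)) p q ∧ R ≤ 5 * dinf p q := by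
  set L := (2 * s + 1) * 1000000 ^ n with hL
  have hL1 : 1 ≤ L := by rw [hL]; exact succ_le_of_lt ♠
  have hk := div_mul_le_self R L
  have hk' := lt_div_mul_add (a := R) hL1
  have hk100 : 100 ≤ R / L := (Nat.le_div_iff_mul_le hL1).2 hR
  obtain ⟨k, hkk⟩ : ∃ k, R / L = k + 8 := ⟨R / L - 8, by omega⟩
  rw [hkk] at hk hk' hk100
  have hkR : k ≤ R := by nlinarith
  have hsub : ∀ x ∈ bx 𝕆 d R, x ∈ bx 𝕆 d (2 * R) := fun x hx => bHy.2 ((bHy.1 hx).trans ♥)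
  have hGI := fun y (hy : y ∈ GG' (bs s I h h' ε M f g (TT ε σ ζ)) n k) => cGz (s := s) (I := I) (R := R) (by rw [← hL]; linarith) (fun x hx => hI x (hsub x hx)) hy
  obtain ⟨v, hv, hc⟩ := cEx hs hα (cEz hd (bs s I h h' ε M f g (TT ε σ ζ)) n k) (fun y hy => ⟨(hGI y hy).1, cGy hkR hB hy⟩)
    (ρ := R) (fun y hy => (hGI y hy).2) (fun x hx => hI x (hsub x hx))
  have hy : ∀ e : ℤ, e.natAbs ≤ k → ∃ y ∈ GG' (bs s I h h' ε M f g (TT ε σ ζ)) n k, ∀ i, 1000000 ^ n * e - 2 * 1000000 ^ n ≤ y i ∧ y i < 1000000 ^ n * e + 3 * 1000000 ^ n := fun e he => by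
    obtain ⟨y, hy⟩ := (aFx hd (bs s I h h' ε M f g (TT ε σ ζ)) n).1 (fun _ => e)
    exact ⟨y, mem_iUnion₂.2 ⟨_, bHz.2 fun i => by simpa using he, hy⟩, fun i => aEy _ _ _ y hy i⟩
  obtain ⟨y, hy1, hy2⟩ := hy k (by simp)
  obtain ⟨y', hy1', hy2'⟩ := hy (-k) (by simp)
  refine ⟨v y, v y', Cn.mono ?_ (hc y hy1 y' hy1'), ?_⟩
  · intro z hz
    exact ⟨⟨hz.1, hsub z hz.2⟩, hz.2⟩
  let i : Fin d := ⟨0, by omega⟩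
  have h1 := bHz.1 (hv y hy1) i
  have h2 := bHz.1 (hv y' hy1') i
  have h3 := aAy.1 (le_refl (dinf (v y) (v y'))) i
  have h4 := (hy2 i).1
  have h5 := (hy2' i).2
  simp only [cc] at h1 h2
  have hN : ((1000000 : ℤ) ^ n) = ((1000000 ^ n : ℕ) : ℤ) := by push_cast; ring
  rw [hN] at h4 h5
  generalize (1000000 ^ n : ℕ) = N at *
  have hLc : (L : ℤ) = (2 * s + 1) * N := by rw [hL]; push_cast; ring
  have h6 : (L : ℤ) * (2 * k - 5) ≤ (2 * s + 1) * (y i) - (2 * s + 1) * (y' i + 1) := by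
    rw [hLc]; nlinarith
  have h7 : (R : ℤ) < (k + 8) * L + L := by exact_mod_cast hk'
  have h8 : (L : ℤ) * (2 * k - 5) ≤ dinf (v y) (v y') := by rw [mul_add] at h6; omega
  have h9 : (92 : ℤ) ≤ k := by omega
  have : (R : ℤ) ≤ 5 * dinf (v y) (v y') := by nlinarith
  exact_mod_cast this
lemma cHx (hσ : 0 < σ) (hA0 : α + M + ε ≤ σ * A0)
    (hE : ∀ x ∈ bx 𝕆 d R, ¬ EE s I n (R / ((2 * s + 1) * 1000000 ^ n) + 1) x (KK α σ f g ζ (2 * R) ∩ (bx 𝕆 d R : 𝕊 d))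
      (bs s I h h' ε M f g (TT ε σ ζ)) (TT ε σ ζ) {i | ∀ a, A0 ≤ ζ i a}) :
    ∃ w, ∀ x, Far (KK α σ f g ζ (2 * R)) R x → Cn (KK α σ f g ζ (2 * R)) x w := by
  set L := (2 * s + 1) * 1000000 ^ n with hL
  have hL1 : 1 ≤ L := by rw [hL]; exact succ_le_of_lt ♠
  have hk := div_mul_le_self R L
  have hk' := lt_div_mul_add (a := R) hL1
  have hk100 : 100 ≤ R / L := (Nat.le_div_iff_mul_le hL1).2 hR
  set k := R / L + 1 with hkd
  have hkR : k ≤ R := by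
    rcases Nat.lt_or_ge L 2 with h | h
    · exfalso
      have : 3 * 1 ≤ L := by rw [hL]; exact Nat.mul_le_mul ♥ (one_le_pow _ _ ♣)
      omega
    · nlinarith
  have hk2 : L * (k + 8) ≤ 2 * R := by rw [hkd]; nlinarith
  set b := bs s I h h' ε M f g (TT ε σ ζ) with hb
  have hGI := fun y (hy : y ∈ GG' b n k) => cGz (s := s) (I := I) (R := 2 * R) hk2 hI hy
  have hgood : GG' b n k ⊆ bᶜ := cGy hkR hB
  obtain ⟨v, hv, hc⟩ := cEx hs hα (cEz hd b n k) (fun y hy => ⟨(hGI y hy).1, hgood hy⟩) (ρ := 2 * R) (fun y hy => (hGI y hy).2) hI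
  obtain ⟨y0, hy0⟩ : (GG' b n k).Nonempty := by
    obtain ⟨y, hy⟩ := (aFx hd b n).1 0
    exact ⟨y, mem_iUnion₂.2 ⟨0, bHz.2 fun i => by simp, hy⟩⟩
  refine ⟨v y0, ?_⟩
  rintro x ⟨p, q, hp, hq, hpq⟩
  set S := KK α σ f g ζ (2 * R) ∩ (bx 𝕆 d R : 𝕊 d) with hS
  have hxR : x ∈ bx 𝕆 d R := hp.left.2
  have hnE := hE x hxR
  have hm : 0 < 2 * s + 1 := by omega
  have hC : Cd (idx (2 * s + 1) '' comp S x) := by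
    rintro _ ⟨a, ha, rfl⟩ _ ⟨c, hc', rfl⟩
    exact Cn.idx hm (bCx x a ha c hc')
  have hX : idx (1000000 ^ n) (idx (2 * s + 1) p) ∈ bx 𝕆 d k := bHz.2 fun i => by
    have h1 := bHz.1 (hp.right.2) i
    have h2 := aFy n (idx (2 * s + 1) p) i
    have h3 := bHz.1 (bOy.1 (rfl : idx (2 * s + 1) p = _)) i
    simp only [cc, Pi.zero_apply, sub_zero] at h1 h3 ⊢
    have hN : ((1000000 : ℤ) ^ n) = ((1000000 ^ n : ℕ) : ℤ) := by push_cast; ring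
    rw [hN] at h2
    generalize (idx (1000000 ^ n) (idx (2 * s + 1) p)) i = X at *
    generalize (1000000 ^ n : ℕ) = N at *
    have hLc : (L : ℤ) = (2 * s + 1) * N := by rw [hL]; push_cast; ring
    have hs0 : (0 : ℤ) < 2 * s + 1 := by omega
    have h4 : (L : ℤ) * X ≤ p i := by have := mul_le_mul_of_nonneg_left h2.1 hs0.le; rw [hLc, mul_assoc]; omega
    have h5 : p i < (L : ℤ) * X + L := by
      have := mul_le_mul_of_nonneg_left (Int.add_one_le_of_lt h2.2) hs0.le
      rw [hLc]
      have e : (2 * (s : ℤ) + 1) * (idx (2 * s + 1) p i + 1) = (2 * s + 1) * idx (2 * s + 1) p i + (2 * s + 1) := by ring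
      have e2 : (2 * (s : ℤ) + 1) * (N * X + N) = (2 * s + 1) * N * X + (2 * s + 1) * N := by ring
      omega
    have h6 : (R : ℤ) < L * k := by
      have : R < L * k := by rw [hkd]; nlinarith
      exact_mod_cast this
    have h7 : (0 : ℤ) < L := by exact_mod_cast hL1
    have h8 : X < k := lt_of_mul_lt_mul_left (a := (L : ℤ)) ♥ h7.le
    have h9 : -(k : ℤ) < X + 1 := lt_of_mul_lt_mul_left (a := (L : ℤ)) (by rw [mul_add, mul_neg]; omega) h7.le
    omega
  have hdist : 1000000 ^ n ≤ dinf (idx (2 * s + 1) p) (idx (2 * s + 1) q) := by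
    have hN1 : 1 ≤ 1000000 ^ n := one_le_pow _ _ ♣
    obtain ⟨i, hi⟩ := (aDz (r := 10 * L) (x := p) (y := q) ♥).1 ♥
    refine (aDz hN1).2 ⟨i, ?_⟩
    have h3 := bHz.1 (bOy.1 (rfl : idx (2 * s + 1) p = _)) i
    have h4 := bHz.1 (bOy.1 (rfl : idx (2 * s + 1) q = _)) i
    simp only [cc] at h3 h4
    by_contra! hc
    have h5 : ((2 * s + 1 : ℕ) * (idx (2 * s + 1) p i - idx (2 * s + 1) q i) : ℤ).natAbs ≤ L := by
      rw [natAbs_mul, natAbs_natCast, hL]; exact Nat.mul_le_mul_left _ hc.le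
    have h6 := Nat.mul_le_mul_left (2 * s + 1) hN1
    rw [← hL] at h6
    push_cast at h5
    rw [mul_sub] at h5
    omega
  have hhit := aFz b n _ hC _ _ (mem_image_of_mem _ (bCy.2 hp)) (mem_image_of_mem _ (bCy.2 hq)) hdist
  set Y := idx (2 * s + 1) '' comp S x ∩ CC b n (idx (1000000 ^ n) (idx (2 * s + 1) p)) with hY
  have hYG : ∀ y ∈ Y, y ∈ GG' b n k := fun y hy => mem_iUnion₂.2 ⟨_, hX, hy.2⟩
  have hYT : ∀ y (hy : y ∈ Y), (⟨y, (hGI y (hYG y hy)).1⟩ : I) ∈ TT ε σ ζ := fun y hy => by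
    by_contra hc
    exact hgood (hYG y hy) ⟨(hGI y (hYG y hy)).1, Or.inr (Or.inr (Or.inr ⟨⟨y, (hGI y (hYG y hy)).1⟩, by simp [dinf], hc⟩))⟩
  have hex : ∃ S' ⊆ Vis s I S x, (S' : Set I) ⊆ Gt I b n k (TT ε σ ζ) ∧ 2 ^ n ≤ S'.card := by
    classical
    refine ⟨Finset.univ.filter fun i : I => i.1 ∈ Y, ?_, ?_, ?_⟩
    · intro i hi
      obtain ⟨z, hz, hzi⟩ := (Finset.mem_filter.1 hi).2.1
      exact cFz.2 ⟨z, hzi, Or.inr ⟨z, bCy.1 hz, Or.inl rfl⟩⟩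
    · intro i hi
      have := (Finset.mem_filter.1 (Finset.mem_coe.1 hi)).2
      exact ⟨hYT i.1 this, hYG _ this⟩
    · have : ((Finset.univ.filter fun i : I => i.1 ∈ Y).image Subtype.val : 𝕊 d) = Y := by
        ext y
        simp only [Finset.coe_image, Finset.coe_filter, Finset.mem_univ, true_and, mem_image, mem_ofPred_eq]
        exact ⟨by rintro ⟨i, hi, rfl⟩; exact hi, fun hy => ⟨⟨y, (hGI y (hYG y hy)).1⟩, hy, rfl⟩⟩
      rw [← this, Set.encard_coe_eq_coe_finsetCard, Finset.card_image_of_injective _ Subtype.val_injective] at hhit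
      exact_mod_cast hhit
  have hnE' : ∃ i ∈ Vis s I S x, i ∈ Gt I b n k (TT ε σ ζ) ∧ ∀ a, A0 ≤ ζ i a := by
    by_contra hc
    push Not at hc
    refine hnE ⟨hex, fun i h1 h2 h3 => ?_⟩
    obtain ⟨a, ha⟩ := hc i h1 h2
    exact absurd (h3 a) (not_le.2 ha)
  obtain ⟨i, hi1, hi2, hi3⟩ := hnE'
  obtain ⟨z, hz1, hz2⟩ := cFz.1 hi1
  have h1 := cEy hd hs (hgood hi2.2) (hGI _ hi2.2).2 hσ hA0 hi3 (bOy.1 hz1) (hv _ hi2.2)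
  have h2 : Cn (KK α σ f g ζ (2 * R)) x z := by
    rcases hz2 with rfl | ⟨w, hw, rfl | hw'⟩
    · exact Cn.refl h1.left
    · exact hw.mono inter_subset_left
    · exact (hw.mono inter_subset_left).trans (Cn.step hw.right.1 h1.left hw')
  exact (h2.trans h1).trans (hc _ hi2.2 _ hy0)
end
end
section
variable {d : ℕ} {Ω : Type*} [MeasurableSpace Ω] {P : Measure Ω} [IsProbabilityMeasure P]
lemma cHy (s : ℕ) {ε σ A0 : ℝ} (hε : 0 < ε) (hσ : 0 < σ) (hA0 : 0 < A0) : ∃ θ : ENNReal, θ ≠ 0 ∧ θ < 1 ∧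
    mu d s (tau d s ε σ \ {z | ∀ a, A0 ≤ z a}) = θ * mu d s (tau d s ε σ) := by
  haveI : Measure.IsOpenPosMeasure (ga : Measure ℝ) := (gaussianReal_absolutelyContinuous' 0 ♣).isOpenPosMeasure
  haveI : Measure.IsOpenPosMeasure (mu d s) := Measure.pi.isOpenPosMeasure _
  have a0 : Of d s := ⟨0, bHz.2 fun i => by simp⟩
  have ho : IsOpen (tau d s ε σ) := by
    rw [tau, ofPred_forall]; exact isOpen_iInter_of_finite fun a => isOpen_lt (by fun_prop) (by fun_prop)
  have hcl : IsClosed {z : Of d s → ℝ | ∀ a, A0 ≤ z a} := by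
    rw [ofPred_forall]; exact isClosed_iInter fun a => isClosed_le (by fun_prop) (by fun_prop)
  have h0 : (0 : Of d s → ℝ) ∈ tau d s ε σ := fun a => by simp [hε]
  have h1 : 0 < mu d s (tau d s ε σ) := ho.measure_pos _ ⟨0, h0⟩
  have h2 : 0 < mu d s (tau d s ε σ \ {z | ∀ a, A0 ≤ z a}) :=
    (ho.sdiff hcl).measure_pos _ ⟨0, h0, fun h => absurd (h a0) (by simpa using hA0)⟩
  have h3 : 0 < mu d s {z | ∀ a, A0 ≤ z a} := by
    have hO : IsOpen {z : Of d s → ℝ | ∀ a, A0 < z a} := by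
      rw [ofPred_forall]; exact isOpen_iInter_of_finite fun a => isOpen_lt (by fun_prop) (by fun_prop)
    refine (hO.measure_pos _ ⟨fun _ => A0 + 1, fun a => by simp⟩).trans_le (measure_mono ?_)
    intro z hz a; exact (hz a).le
  have hsub : {z : Of d s → ℝ | ∀ a, A0 ≤ z a} ⊆ tau d s ε σ := fun z hz a => by
    have := mul_pos hσ (hA0.trans_le (hz a)); linarith
  refine ⟨_, (ENNReal.div_pos h2.ne' (measure_ne_top (mu d s) (tau d s ε σ))).ne', ?_, (ENNReal.div_mul_cancel h1.ne' (measure_ne_top _ _)).symm⟩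
  refine ENNReal.div_lt_of_lt_mul ?_
  rw [one_mul, measure_sdiff hsub hcl.measurableSet.nullMeasurableSet (measure_ne_top _ _)]
  exact ENNReal.sub_lt_self (measure_ne_top _ _) h1.ne' h3.ne'
lemma cHz {κ Ω' : Type*} [MeasurableSpace Ω'] [Finite κ] (m : κ → Ω' → Prop) (hm : ∀ i, MeasurableSet {ω | m i ω}) (p : Set κ → Prop) :
    MeasurableSet {ω | p {i | m i ω}} := by
  have h : Measurable fun ω => {i | m i ω} := measurable_set_iff.2 fun i => measurableSet_setOfPred.1 (hm i)
  exact h (MeasurableSet.of_discrete (s := {U | p U}))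
variable {s : ℕ} {I : 𝔽 d} {h h' ε M σ α A0 : ℝ} {f g : V d → Ω × Ω → ℝ}
lemma cI (x : V d) : Measurable fun ζ : I → Of d s → ℝ => Nz s I ζ x := by
  unfold Nz
  refine measurable_sum _ fun i _ => measurable_sum _ fun a _ => ?_
  split_ifs <;> fun_prop
lemma cIx : MeasurableSet (tau d s ε σ) := by
  rw [tau, ofPred_forall]; exact MeasurableSet.iInter fun a => measurableSet_lt (by fun_prop) (by fun_prop)
lemma cIy : MeasurableSet {z : Of d s → ℝ | ∀ a, A0 ≤ z a} := by
  rw [ofPred_forall]; exact MeasurableSet.iInter fun a => measurableSet_le (by fun_prop) (by fun_prop)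
lemma cIz (hf : ∀ x, Measurable (f x)) (hg : ∀ x, Measurable (g x)) (n k ρ R : ℕ) (x : V d) :
    MeasurableSet {ω : (Ω × Ω) × (I → Of d s → ℝ) | EE s I n k x
      (KK α σ (fun x => f x ω.1) (fun x => g x ω.1) ω.2 ρ ∩ (bx 𝕆 d R : 𝕊 d))
      (bs s I h h' ε M (fun x => f x ω.1) (fun x => g x ω.1) (TT ε σ ω.2)) (TT ε σ ω.2) {i | ∀ a, A0 ≤ ω.2 i a}} := by
  have mT : ∀ i : I, MeasurableSet {ω : (Ω × Ω) × (I → Of d s → ℝ) | ω.2 i ∈ tau d s ε σ} := fun i =>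
    (measurable_pi_apply i |>.comp measurable_snd) cIx
  have mA : ∀ i : I, MeasurableSet {ω : (Ω × Ω) × (I → Of d s → ℝ) | ∀ a, A0 ≤ ω.2 i a} := fun i =>
    ((measurable_pi_apply (X := fun _ : I => Of d s → ℝ) i).comp measurable_snd) (cIy (A0 := A0))
  have mf : ∀ x, Measurable fun ω : (Ω × Ω) × (I → Of d s → ℝ) => f x ω.1 := fun x => (hf x).comp measurable_fst
  have mg : ∀ x, Measurable fun ω : (Ω × Ω) × (I → Of d s → ℝ) => g x ω.1 := fun x => (hg x).comp measurable_fst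
  have mN : ∀ x, Measurable fun ω : (Ω × Ω) × (I → Of d s → ℝ) => Nz s I ω.2 x := fun x => (cI x).comp measurable_snd
  have mK : ∀ x, MeasurableSet {ω : (Ω × Ω) × (I → Of d s → ℝ) | α ≤ f x ω.1 - g x ω.1 + σ * Nz s I ω.2 x} := fun x =>
    measurableSet_le measurable_const (((mf x).sub (mg x)).add ((mN x).const_mul σ))
  have mB : ∀ y, MeasurableSet {ω : (Ω × Ω) × (I → Of d s → ℝ) | y ∈ bs s I h h' ε M (fun x => f x ω.1) (fun x => g x ω.1) (TT ε σ ω.2)} := fun y => by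
    simp only [bs, mem_ofPred_eq]
    have e1 := ((measurable_pi_lambda _ mf) (bYz (cc s y) s (h - 2 * ε) (h - 2 * ε) (h' - 2 * ε))).compl
    have e2 : MeasurableSet {ω : (Ω × Ω) × (I → Of d s → ℝ) | ∃ z ∈ bx (cc s y) (8 * s), ε ≤ g z ω.1} := by
      simp only [ofPred_exists]
      exact MeasurableSet.iUnion fun z => (MeasurableSet.const _).inter (measurableSet_le measurable_const (mg z))
    have e3 : MeasurableSet {ω : (Ω × Ω) × (I → Of d s → ℝ) | ∃ z ∈ bx (cc s y) (8 * s), f z ω.1 ≤ -M} := by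
      simp only [ofPred_exists]
      exact MeasurableSet.iUnion fun z => (MeasurableSet.const _).inter (measurableSet_le (mf z) measurable_const)
    have e4 : MeasurableSet {ω : (Ω × Ω) × (I → Of d s → ℝ) | ∃ i : I, dinf i.1 y ≤ 4 ∧ i ∉ TT ε σ ω.2} := by
      simp only [ofPred_exists]
      exact MeasurableSet.iUnion fun i => (MeasurableSet.const _).inter (mT i).compl
    exact (MeasurableSet.const _).inter (e1.union (e2.union (e3.union e4)))
  have key := cHz (κ := (bx 𝕆 d ρ) ⊕ I ⊕ I ⊕ I) (Ω' := (Ω × Ω) × (I → Of d s → ℝ))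
    (Sum.elim (fun z ω => α ≤ f z.1 ω.1 - g z.1 ω.1 + σ * Nz s I ω.2 z.1) (Sum.elim
      (fun y ω => y.1 ∈ bs s I h h' ε M (fun x => f x ω.1) (fun x => g x ω.1) (TT ε σ ω.2)) (Sum.elim (fun i ω => ω.2 i ∈ tau d s ε σ) fun i ω => ∀ a, A0 ≤ ω.2 i a)))
    (by rintro (z | y | i | i); exacts [mK z.1, mB y.1, mT i, mA i])
    (fun U => EE s I n k x ((Subtype.val '' {z | Sum.inl z ∈ U}) ∩ (bx 𝕆 d R : 𝕊 d)) (Subtype.val '' {y | Sum.inr (Sum.inl y) ∈ U})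
      {i | Sum.inr (Sum.inr (Sum.inl i)) ∈ U} {i | Sum.inr (Sum.inr (Sum.inr i)) ∈ U})
  convert key using 4 with ω
  · congr 1
    ext z
    simp only [KK, mem_inter_iff, mem_ofPred_eq, mem_image, Subtype.exists, exists_and_right, exists_eq_right, Sum.elim_inl]
    exact ⟨fun h => ⟨h.2, h.1⟩, fun ⟨h1, h2⟩ => ⟨h2, h1⟩⟩
  · ext y
    simp only [mem_ofPred_eq, mem_image, Subtype.exists, exists_and_right, exists_eq_right, Sum.elim_inl, Sum.elim_inr]
    exact ⟨fun h => ⟨h.1, h⟩, fun ⟨_, h2⟩ => h2⟩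
  all_goals rfl
lemma cJ (hf : ∀ x, Measurable (f x)) (hg : ∀ x, Measurable (g x)) {θ : ENNReal} (hθ : θ ≠ 0) (hθ1 : θ < 1)
    (hG : mu d s (tau d s ε σ \ {z | ∀ a, A0 ≤ z a}) = θ * mu d s (tau d s ε σ)) (n k ρ R : ℕ) (x : V d) :
    PB P s I {ω : (Ω × Ω) × (I → Of d s → ℝ) | EE s I n k x
      (KK α σ (fun x => f x ω.1) (fun x => g x ω.1) ω.2 ρ ∩ (bx 𝕆 d R : 𝕊 d))
      (bs s I h h' ε M (fun x => f x ω.1) (fun x => g x ω.1) (TT ε σ ω.2)) (TT ε σ ω.2) {i | ∀ a, A0 ≤ ω.2 i a}} ≤ θ ^ 2 ^ n := by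
  rw [Measure.prod_apply (cIz hf hg n k ρ R x)]
  refine (lintegral_mono (g := fun _ => θ ^ 2 ^ n) fun ω => ?_).trans (by simp)
  refine (bYx (mu d s) cIy cIx hθ hθ1.le hG (fun ζ => Vis s I (KK α σ (fun x => f x ω) (fun x => g x ω) ζ ρ ∩ (bx 𝕆 d R : 𝕊 d)) x)
    (fun ζ ζ' hz => cGx ρ x _ hz) (fun W => ?_) (2 ^ n) (fun T => Gt I (bs s I h h' ε M (fun x => f x ω) (fun x => g x ω) T) n k T) fun T i hi => hi.1)
  exact aS (Λ := (bx 𝕆 d ρ : 𝕊 d)) (finite_toSet _) (fun x ζ => f x ω - g x ω + σ * Nz s I ζ x) (fun x => ((cI x).const_mul σ).const_add _)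
    (fun _ => α) fun S => Vis s I (S ∩ (bx 𝕆 d R : 𝕊 d)) x = W
end
section
variable {d : ℕ} {Ω : Type*} [MeasurableSpace Ω] {P : Measure Ω} [IsProbabilityMeasure P] {φ : V d → Ω → ℝ}
lemma cJx (hd : 3 ≤ d) (hφ : IsGFF P φ) {h ht : ℝ} (hh : h ∈ tildeSet d P φ) (hlt : ht < h) :
    ∃ m : ℕ, 1 ≤ m ∧ ∃ θ : ENNReal, θ < 1 ∧ θ ≠ 0 ∧ ∀ R n : ℕ, 100 * (m * 1000000 ^ n) ≤ R → ∀ α ≤ ht,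
      P {ω | ¬ Gev ({x | α ≤ φ x ω} ∩ (bx 𝕆 d (2 * R) : 𝕊 d)) R} ≤ 2 * (2 * R + 1) ^ d * θ ^ 2 ^ n := by
  obtain ⟨h', hh'⟩ : ∃ h', h' = (h + ht) / 2 := ⟨_, rfl⟩
  obtain ⟨ε, hε⟩ : ∃ ε, ε = (h - h') / 8 := ⟨_, rfl⟩
  have hε0 : 0 < ε := by linarith
  obtain ⟨s, hs, σ, M, hσ, hM, f, g, hf, hg, H⟩ := cDx hd hφ hh (by linarith) hε (q := 2⁻¹) (by simp)
  obtain ⟨A0, hA0, hA1⟩ : ∃ A0 : ℝ, 0 < A0 ∧ ht + M + ε ≤ σ * A0 :=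
    ⟨max 1 ((ht + M + ε) / σ), by positivity, by rw [mul_comm, ← div_le_iff₀ hσ]; exact le_max_right _ _⟩
  obtain ⟨θ, hθ0, hθ1, hθ⟩ := cHy (d := d) s hε0 hσ hA0
  refine ⟨2 * s + 1, by omega, max 2⁻¹ θ, max_lt (by simp) hθ1, ((pos_iff_ne_zero.2 hθ0).trans_le (le_max_right _ _)).ne', fun R n hR α hα => ?_⟩
  classical
  set I := (bx 𝕆 d (2 * R)).image (idx (2 * s + 1)) with hI
  have hI' : ∀ x ∈ bx 𝕆 d (2 * R), idx (2 * s + 1) x ∈ I := fun x hx => Finset.mem_image_of_mem _ hx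
  obtain ⟨H1, H2⟩ := H I
  rw [H1 (bx 0 (2 * R)) hI' α fun S => ¬ Gev S R]
  refine (measure_mono (t := (⋃ X ∈ bx 𝕆 d R, {ω | Bad (bs s I h h' ε M (fun x => f x ω.1) (fun x => g x ω.1) {i | ω.2 i ∈ tau d s ε σ}) n X}) ∪
    ⋃ x ∈ bx 𝕆 d R, {ω | EE s I n (R / ((2 * s + 1) * 1000000 ^ n) + 1) x
      (KK α σ (fun x => f x ω.1) (fun x => g x ω.1) ω.2 (2 * R) ∩ (bx 𝕆 d R : 𝕊 d))
      (bs s I h h' ε M (fun x => f x ω.1) (fun x => g x ω.1) (TT ε σ ω.2)) (TT ε σ ω.2) {i | ∀ a, A0 ≤ ω.2 i a}}) ?_).trans ?_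
  · intro ω hω
    by_contra hc
    simp only [mem_union, mem_iUnion, not_or, not_exists] at hc
    exact hω ⟨cH ♥ hs (by linarith) hR hI' fun X hX => hc.1 X hX,
      cHx ♥ hs (by linarith) hR hI' (fun X hX => hc.1 X hX) hσ (by linarith) fun x hx => hc.2 x hx⟩
  refine (measure_union_le _ _).trans ((add_le_add (measure_biUnion_finset_le _ _) (measure_biUnion_finset_le _ _)).trans
    ((add_le_add (sum_le_sum fun X _ => H2 n X) (sum_le_sum fun x _ => cJ hf hg hθ0 hθ1 hθ n _ _ _ x)).trans ?_))
  simp only [sum_const, bI, nsmul_eq_mul]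
  push_cast
  rw [mul_assoc, two_mul (_ * _)]
  gcongr
  exacts [le_max_left _ _, le_max_right _ _]
lemma tail (d : ℕ) {m : ℕ} (hm : 1 ≤ m) {t : ℝ} (ht0 : 0 < t) (ht1 : t < 1) : ∃ c : ℝ, 0 < c ∧ ∃ ρ ∈ Ioc (0 : ℝ) 1, ∃ R0 : ℕ, 1 ≤ R0 ∧ ∀ R : ℕ, R0 ≤ R →
    ∃ n, 100 * (m * 1000000 ^ n) ≤ R ∧ 2 * (2 * ℜ R + 1) ^ d * t ^ 2 ^ n ≤ exp (-c * ℜ R ^ ρ) := by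
  obtain ⟨ρ, hρ⟩ : ∃ ρ, ρ = log 2 / log 1000000 := ⟨_, rfl⟩
  have hl2 : 0 < log 2 := log_pos ♣
  have hl : 0 < log 1000000 := log_pos ♣
  have hρ0 : 0 < ρ := by rw [hρ]; positivity
  have hρ1 : ρ ≤ 1 := by rw [hρ, div_le_one hl]; exact Real.log_le_log ♣ ♣
  have h2 : ℜ 1000000 ^ ρ = 2 := by
    rw [Real.rpow_def_of_pos ♣, hρ, mul_div_cancel₀ _ hl.ne', exp_log ♣]
  have hm0 : ℜ 1 ≤ m := by exact_mod_cast hm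
  have hlt : 0 < -log t := neg_pos.2 (Real.log_neg ht0 ht1)
  set C := (100 * ℜ m) ^ ρ with hC
  have hC0 : 0 < C := by positivity
  set c := -log t / (2 * C) with hc
  have hc0 : 0 < c := by positivity
  have hlim := ((isLittleO_rpow_exp_pos_mul_atTop (d / ρ) (half_pos hc0)).comp_tendsto ((tendsto_rpow_atTop hρ0).comp tendsto_natCast_atTop_atTop)).def
    (c := (2 * 3 ^ d)⁻¹) ♠
  obtain ⟨R1, hR1⟩ := eventually_atTop.1 hlim
  refine ⟨c / 2, half_pos hc0, ρ, ⟨hρ0, hρ1⟩, max R1 (100 * m), by omega, fun R hR => ?_⟩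
  have hR' : 100 * ℜ m ≤ R := by exact_mod_cast (le_max_right _ _).trans hR
  have hRp : ℜ 1 ≤ R := by linarith
  obtain ⟨n, hn1, hn2⟩ := exists_nat_pow_near (x := ℜ R / (100 * m)) (y := 1000000) (by rw [one_le_div ♠]; exact hR') ♣
  rw [le_div_iff₀ ♠] at hn1
  rw [div_lt_iff₀ ♠] at hn2
  refine ⟨n, by have : (100 * (m * 1000000 ^ n) : ℝ) ≤ R := by linarith
                exact_mod_cast this, ?_⟩
  have h3 : ℜ R ^ ρ ≤ 2 * 2 ^ n * C := by
    refine (rpow_le_rpow ♠ hn2.le hρ0.le).trans (le_of_eq ?_)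
    rw [mul_rpow ♠ ♠, ← rpow_natCast, ← rpow_mul ♣, mul_comm _ ρ, rpow_mul ♣, h2, rpow_natCast]
    ring
  have h4 : t ^ 2 ^ n ≤ exp (-c * ℜ R ^ ρ) := by
    rw [← exp_log ht0, ← exp_nat_mul]
    refine Real.exp_le_exp.2 ?_
    have : c * ℜ R ^ ρ ≤ c * (2 * 2 ^ n * C) := by gcongr
    have e : c * (2 * 2 ^ n * C) = -log t * 2 ^ n := by rw [hc]; field_simp
    push_cast
    linarith
  have h5 := hR1 R ((le_max_left _ _).trans hR)
  simp only [Function.comp_apply, Real.norm_eq_abs, Real.abs_exp] at h5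
  rw [abs_of_nonneg ♠, ← rpow_mul ♠, mul_div_cancel₀ _ hρ0.ne', rpow_natCast] at h5
  have h6 : 2 * (2 * ℜ R + 1) ^ d ≤ exp (c / 2 * ℜ R ^ ρ) := by
    calc 2 * (2 * ℜ R + 1) ^ d ≤ 2 * (3 * R) ^ d := by gcongr; linarith
      _ = 2 * 3 ^ d * ℜ R ^ d := by rw [mul_pow]; ring
      _ ≤ 2 * 3 ^ d * ((2 * 3 ^ d)⁻¹ * exp (c / 2 * ℜ R ^ ρ)) := by gcongr
      _ = _ := by field_simp
  refine (mul_le_mul h6 h4 ♠ ♠).trans (le_of_eq ?_)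
  rw [← exp_add]; congr 1; ring
lemma cJy (hd : 3 ≤ d) (R : ℕ) : Gev (bx 𝕆 d (2 * R) : 𝕊 d) R := by
  have hsub : (bx 𝕆 d R : 𝕊 d) ⊆ bx 𝕆 d (2 * R) := fun x hx => bHy.2 ((bHy.1 hx).trans ♥)
  refine ⟨⟨fun _ => R, fun _ => -R, ?_, ?_⟩, 0, fun x hx => ?_⟩
  · rw [inter_eq_right.2 hsub]
    exact cDy ♥ _ _ _ (bHz.2 fun i => by simp) _ (bHz.2 fun i => by simp)
  · have := aAy.1 (le_refl (dinf (fun _ => (R : ℤ) : V d) fun _ => -(R : ℤ))) ⟨0, by omega⟩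
    omega
  · obtain ⟨p, q, hp, -⟩ := hx
    exact cDy ♥ _ _ _ hp.left.1 _ (bHz.2 fun i => by simp)
lemma cJz (hd : 3 ≤ d) (hφ : IsGFF P φ) {h ht : ℝ} (hh : h ∈ tildeSet d P φ) (hlt : ht < h) : StronglyPerc d P φ ht := by
  obtain ⟨m, hm, θ, hθ1, hθ0, H⟩ := cJx hd hφ hh hlt
  have hθt : θ ≠ ⊤ := (hθ1.trans one_lt_top).ne
  have ht0 : 0 < θ.toReal := toReal_pos hθ0 hθt
  have ht1 : θ.toReal < 1 := by rw [← ENNReal.toReal_one]; exact (ENNReal.toReal_lt_toReal hθt ENNReal.one_ne_top).2 hθ1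
  obtain ⟨c, hc, ρ, hρ, R0, hR0, hT⟩ := tail d hm ht0 ht1
  set p0 := P {ω | ∀ x ∈ bx 𝕆 d (2 * R0), ht ≤ φ x ω} with hp0
  have hp := bGx hd hφ (bx 𝕆 d (2 * R0)) ht
  have hpr : 0 < p0.toReal := toReal_pos hp.ne' (measure_ne_top _ _)
  have hRR : ℜ 0 < ℜ R0 ^ ρ := Real.rpow_pos_of_pos (by exact_mod_cast hR0) _
  refine ⟨min c (p0.toReal / ℜ R0 ^ ρ), lt_min hc ♠, ρ, hρ, fun α hα R hR => ?_⟩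
  set G := {ω | Gev ({x | α ≤ φ x ω} ∩ (bx 𝕆 d (2 * R) : 𝕊 d)) R} with hG
  have hRρ : 0 ≤ ℜ R ^ ρ := by positivity
  suffices hs : ofReal (1 - exp (-min c (p0.toReal / ℜ R0 ^ ρ) * ℜ R ^ ρ)) ≤ P G by
    refine ⟨hs.trans (measure_mono ?_), hs.trans (measure_mono ?_)⟩
    · intro ω hω; exact (cFy hω).1
    · intro ω hω; exact (cFy hω).2
  rcases le_total R0 R with h1 | h1
  · obtain ⟨n, hn1, hn2⟩ := hT R h1
    have hb := H R n hn1 α hα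
    have e : (2 * (2 * (R : ENNReal) + 1) ^ d * θ ^ 2 ^ n) = ofReal (2 * (2 * ℜ R + 1) ^ d * θ.toReal ^ 2 ^ n) := by
      rw [ofReal_mul ♠, ofReal_mul ♠, ofReal_pow ♠, ofReal_pow ♠,
        ofReal_add ♠ ♠, ofReal_mul ♠, ofReal_toReal hθt]
      simp
    rw [e] at hb
    have hu : (1 : ENNReal) ≤ P G + P Gᶜ := by
      rw [← measure_univ (μ := P), ← union_compl_self G]; exact measure_union_le _ _
    have hle : exp (-c * ℜ R ^ ρ) ≤ exp (-min c (p0.toReal / ℜ R0 ^ ρ) * ℜ R ^ ρ) := by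
      refine Real.exp_le_exp.2 (mul_le_mul_of_nonneg_right (neg_le_neg (min_le_left _ _)) hRρ)
    rw [ofReal_sub _ ♠, ENNReal.ofReal_one]
    refine tsub_le_iff_right.2 (hu.trans (add_le_add le_rfl (hb.trans (ofReal_le_ofReal (hn2.trans hle)))))
  · refine (ofReal_le_ofReal (q := p0.toReal) ?_).trans ?_
    · have a1 := add_one_le_exp (-min c (p0.toReal / ℜ R0 ^ ρ) * ℜ R ^ ρ)
      have a2 : min c (p0.toReal / ℜ R0 ^ ρ) * ℜ R ^ ρ ≤ p0.toReal / ℜ R0 ^ ρ * ℜ R0 ^ ρ := by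
        gcongr
        exacts [min_le_right _ _, hρ.1.le]
      rw [div_mul_cancel₀ _ hRR.ne'] at a2
      linarith
    · rw [ofReal_toReal (measure_ne_top _ _)]
      refine measure_mono ?_
      intro ω hω
      have : {x | α ≤ φ x ω} ∩ (bx 𝕆 d (2 * R) : 𝕊 d) = bx 𝕆 d (2 * R) :=
        inter_eq_right.2 fun x hx => hα.trans (hω x (bHy.2 ((bHy.1 hx).trans ♥)))
      rw [hG, mem_ofPred_eq, this]
      exact cJy hd R
theorem cK (hd : 3 ≤ d) (hφ : IsGFF P φ) : hTilde d P φ ≤ hBar d P φ :=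
  csSup_le (bDy hd hφ) fun _ hh => le_of_forall_lt fun _ hlt => by
    obtain ⟨z, hz1, hz2⟩ := exists_between hlt
    exact hz1.trans_le (le_csSup (bD hd hφ) (cJz hd hφ hh hz2))
end
end

/-- Proposition 1.4: `h̃(d) ≤ h̄(d)` for all `d ≥ 3`. -/
theorem hTilde_le_hBar (d : ℕ) (hd : 3 ≤ d) {Ω : Type*} [MeasurableSpace Ω]
    (P : Measure Ω) [IsProbabilityMeasure P] (φ : V d → Ω → ℝ) (hφ : IsGFF P φ) :
    hTilde d P φ ≤ hBar d P φ := by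
  exact cK hd hφ

end
end GFFperc
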